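/- For every strictly increasing sequence (N_n) of positive integers there exists a subsequence (N_{n_k}) such that for every j ≥ 1 there exists η > 0 (depending on the subsequence and on j) with the following property: for every positive integer h ∈ D_j, the limit lim_{k→∞} (1/N_{n_k}) Σ_{n=1}^{N_{n_k}} λ(n) λ(n+h) exists and is strictly less than 1 − η. -/

import Mathlib

open Filter Topology

noncomputable def primeVol (q : ℕ) : ℝ := ∑ p ∈ q.primeFactors, (1 : ℝ) / p

/-- The Liouville function `λ(n) = (-1)^{Ω(n)}`. -/
noncomputable def liouville (n : ℕ) : ℝ := (-1 : ℝ) ^ (ArithmeticFunction.cardFactors n)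

set_option linter.unusedVariables false
set_option maxHeartbeats 1000000
open scoped Real
open Real (log log_mul norm_eq_abs sin pi_pos norm_of_nonneg exp exp_le_exp exp_nat_mul exp_pos add_one_le_exp exp_sub exp_log log_exp exp_add one_le_exp pi_gt_three log_nonneg log_le_log log_div log_pow rpow_neg sqrt_sq rpow_zero mul_self_sqrt log_pos log_two_lt_d9 log_le_sub_one_of_pos exp_neg exp_le_one_iff tendsto_log_atTop rpow_def_of_pos cos sqrt sq_sqrt sqrt_pos rpow_add rpow_pos_of_pos rpow_one one_le_rpow le_sqrt_of_sq_le rpow_le_rpow div_rpow rpow_natCast rpow_mul fourierChar log_one)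
open Finset (range Icc mem_Icc mem_insert sum_insert sum_range_succ sum_add_distrib sum_congr sum_range_reflect mem_range sum_mul_sum mul_sum card_le_card mem_union mem_filter sum_le_sum sum_const univ sum_eq_zero sum_product sum_comm sum_mul mem_image sum_filter sum_ite_eq' sum_ite_eq mem_product sum_le_sum_of_subset_of_nonneg Ioc mem_Ioc sum_neg_distrib sum_union filter_union disjoint_left sum_nonneg Ico sum_subset card_eq_sum_ones sum_sub_distrib filter_subset mem_Ico sdiff_subset range_eq_Ico card_range sum_bij mem_univ sum_Ioc_succ_top abs_sum_le_sum_abs Ioo card_filter_le sum_div coe_filter sum_sdiff)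
open Complex (I norm_exp_ofReal_mul_I mul_conj' exp_conj ofReal_mul conj_mul' conj_ofReal conj_I norm_real I_sq norm_I re ofRealCLM ofReal_one norm_conj normSq_eq_norm_sq normSq_apply cpow_def_of_ne_zero ofReal_exp)

lemma lio_mul {m n : ℕ} (hm : m ≠ 0) (hn : n ≠ 0) :
    liouville (m*n) = liouville m*liouville n := by
  simp [liouville, ArithmeticFunction.cardFactors_mul hm hn, pow_add]

lemma lio_prime {p : ℕ} (hp : p.Prime) : liouville p = -1 := by
  simp [liouville, ArithmeticFunction.cardFactors_apply_prime hp]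

lemma lio_eq (n : ℕ) : liouville n = 1 ∨ liouville n = -1 := by
  unfold liouville; exact neg_one_pow_eq_or ℝ _

lemma lio_abs (n : ℕ) : |liouville n| = 1 := by
  rcases lio_eq n with h | h <;> simp [h]

lemma lio_sq (n : ℕ) : liouville n*liouville n = 1 := by
  rcases lio_eq n with h | h <;> simp [h]

/-- Frequencies: a Dirichlet character together with an integer frequency. -/
abbrev Freq (h : ℕ) := DirichletCharacter ℂ h × ℤ

noncomputable def ch {h : ℕ} (ξ : Freq h) (n : ℕ) : ℂ :=
  ξ.1 (n : ZMod h)*Complex.exp (((ξ.2 : ℝ)*log n : ℝ)*I)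

lemma ch_mul {h : ℕ} (ξ : Freq h) {m n : ℕ} (hm : m ≠ 0) (hn : n ≠ 0) :
    ch ξ (m*n) = ch ξ m*ch ξ n := by
  unfold ch
  have hm' : (m : ℝ) ≠ 0 := by exact_mod_cast hm
  have hn' : (n : ℝ) ≠ 0 := by exact_mod_cast hn
  have : (((ξ.2 : ℝ)*log ((m*n : ℕ) : ℝ) : ℝ)*I)
      = (((ξ.2 : ℝ)*log m : ℝ)*I)+(((ξ.2 : ℝ)*log n : ℝ)*I) := by
    push_cast
    rw [log_mul hm' hn']
    push_cast; ring
  rw [this, Complex.exp_add]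
  push_cast
  rw [map_mul]; ring

lemma ch_norm_le {h : ℕ} (ξ : Freq h) (n : ℕ) : ‖ch ξ n‖ ≤ 1 := by
  unfold ch
  rw [norm_mul, norm_exp_ofReal_mul_I, mul_one]
  exact DirichletCharacter.norm_le_one _ _

lemma ch_norm_one {h : ℕ} (ξ : Freq h) (n : ℕ) (hn : n.Coprime h) : ‖ch ξ n‖ = 1 := by
  unfold ch
  rw [norm_mul, norm_exp_ofReal_mul_I, mul_one]
  have := (ZMod.unitOfCoprime n hn)
  rw [← ZMod.coe_unitOfCoprime n hn]
  exact DirichletCharacter.unit_norm_eq_one _ _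

lemma ch_eq_zero {h : ℕ} (ξ : Freq h) (n : ℕ) (hn : ¬ n.Coprime h) : ch ξ n = 0 := by
  unfold ch
  rw [MulChar.map_nonunit, zero_mul]
  rwa [ZMod.isUnit_iff_coprime]

noncomputable def pol {h : ℕ} (s : Finset ℕ) (a : ℕ → ℂ) (ξ : Freq h) : ℂ := ∑ n ∈ s, a n*ch ξ n

/-- Fejér kernel. -/
noncomputable def fj (K : ℕ) (x : ℝ) : ℝ :=
  (1/((K : ℝ)+1)) * ‖∑ k ∈ range (K+1), Complex.exp (((k : ℝ)*x : ℝ)*I)‖ ^ 2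

noncomputable def wt (K : ℕ) (k : ℤ) : ℝ := 1 - |(k : ℝ)| / ((K : ℝ)+1)

lemma Icc_succ_int (K : ℕ) : Icc (-((K+1 : ℕ) : ℤ)) ((K+1 : ℕ) : ℤ) =
    insert ((K+1 : ℕ) : ℤ) (insert (-((K+1 : ℕ) : ℤ)) (Icc (-(K : ℤ)) K)) := by
  ext x; simp only [mem_Icc, mem_insert]; push_cast; omega

lemma sum_Icc_int {M : Type*} [AddCommMonoid M] (g : ℤ → M) (K : ℕ) :
    ∑ k ∈ Icc (-(K : ℤ)) K, g k
      = g 0 + ∑ m ∈ range K, (g (m+1)+g (-(m+1))) := by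
  induction K with
  | zero => simp
  | succ K ih =>
    rw [Icc_succ_int, sum_insert, sum_insert, ih, sum_range_succ]
    · push_cast
      abel
    · simp
    · simp only [mem_insert, mem_Icc]; push_cast; omega

lemma sum_pairs_int (g : ℤ → ℂ) (K : ℕ) :
    ∑ i ∈ range (K+1), ∑ j ∈ range (K+1), g ((i : ℤ) - j)
      = ∑ k ∈ Icc (-(K : ℤ)) K, (((K : ℝ)+1 - |(k : ℝ)| : ℝ) : ℂ)*g k := by
  induction K with
  | zero => simp
  | succ K ih =>
    have e1 : ∑ k ∈ Icc (-((K+1 : ℕ) : ℤ)) ((K+1 : ℕ) : ℤ),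
        (((((K+1 : ℕ) : ℝ))+1 - |(k : ℝ)| : ℝ) : ℂ)*g k
        = ∑ k ∈ Icc (-(K : ℤ)) K, (((K : ℝ)+1 - |(k : ℝ)| : ℝ) : ℂ)*g k
          + ∑ k ∈ Icc (-((K+1 : ℕ) : ℤ)) ((K+1 : ℕ) : ℤ), g k := by
      rw [Icc_succ_int, sum_insert, sum_insert, sum_insert, sum_insert]
      · have : |((-((K+1 : ℕ) : ℤ) : ℤ) : ℝ)| = (K : ℝ)+1 := by
          push_cast; rw [abs_neg, abs_of_nonneg (by positivity)]
        have h2 : |((((K+1 : ℕ) : ℤ) : ℤ) : ℝ)| = (K : ℝ)+1 := by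
          push_cast; rw [abs_of_nonneg (by positivity)]
        rw [this, h2]
        have : ∑ x ∈ Icc (-(K : ℤ)) K, (((((K+1 : ℕ) : ℝ))+1 - |(x : ℝ)| : ℝ) : ℂ)*g x
          = ∑ x ∈ Icc (-(K : ℤ)) K, (((K : ℝ)+1 - |(x : ℝ)| : ℝ) : ℂ)*g x
            + ∑ x ∈ Icc (-(K : ℤ)) K, g x := by
          rw [← sum_add_distrib]
          refine sum_congr rfl fun x _ => ?_
          push_cast; ring
        rw [this]; push_cast; ring
      all_goals first
        | simp; done
        | (simp only [mem_insert, mem_Icc]; push_cast; omega)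
    rw [e1, ← ih, sum_Icc_int]
    rw [sum_range_succ]
    simp_rw [sum_range_succ _ (K+1)]
    rw [sum_add_distrib, add_assoc]
    congr 1
    rw [sub_self]
    have e3 : ∑ x ∈ range (K+1), g ((x : ℤ) - ((K+1 : ℕ) : ℤ))
        = ∑ m ∈ range (K+1), g (-(m+1)) := by
      rw [← sum_range_reflect]
      refine sum_congr rfl fun x hx => ?_
      have := mem_range.1 hx
      congr 1
      have : ((K+1 - 1 - x : ℕ) : ℤ) = K - x := by omega
      rw [this]; push_cast; ring
    have e4 : ∑ x ∈ range (K+1), g (((K+1 : ℕ) : ℤ) - (x : ℤ))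
        = ∑ m ∈ range (K+1), g (m+1) := by
      rw [← sum_range_reflect]
      refine sum_congr rfl fun x hx => ?_
      have := mem_range.1 hx
      congr 1
      have : ((K+1 - 1 - x : ℕ) : ℤ) = K - x := by omega
      rw [this]; push_cast; ring
    rw [e3, e4, sum_add_distrib]; ring

lemma fj_eq (K : ℕ) (x : ℝ) :
    ∑ k ∈ Icc (-(K : ℤ)) K, (wt K k : ℂ)*Complex.exp (((k : ℝ)*x : ℝ)*I)
      = (fj K x : ℂ) := by
  have hK : ((K : ℂ)+1) ≠ 0 := by exact_mod_cast Nat.succ_ne_zero K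
  have h1 := sum_pairs_int (fun k : ℤ => Complex.exp (((k : ℝ)*x : ℝ)*I)) K
  have h2 : ∑ i ∈ range (K+1), ∑ j ∈ range (K+1),
      Complex.exp (((((i : ℤ) - j : ℤ) : ℝ)*x : ℝ)*I)
      = ((‖∑ k ∈ range (K+1), Complex.exp (((k : ℝ)*x : ℝ)*I)‖ ^ 2 : ℝ) : ℂ) := by
    push_cast
    rw [← mul_conj', map_sum, sum_mul_sum]
    refine sum_congr rfl fun i _ => sum_congr rfl fun j _ => ?_
    rw [← exp_conj, ← Complex.exp_add]
    congr 1
    simp; ring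
  rw [h2] at h1
  unfold fj
  rw [ofReal_mul, h1, mul_sum]
  refine sum_congr rfl fun k _ => ?_
  unfold wt
  push_cast
  field_simp

lemma fj_nonneg (K : ℕ) (x : ℝ) : 0 ≤ fj K x := by unfold fj; positivity

lemma fj_le (K : ℕ) (x : ℝ) : fj K x ≤ K+1 := by
  unfold fj
  have : ‖∑ k ∈ range (K+1), Complex.exp (((k : ℝ)*x : ℝ)*I)‖ ≤ K+1 := by
    refine (norm_sum_le _ _).trans ?_
    simp [norm_exp_ofReal_mul_I, -ofReal_mul]
  have hK : (0:ℝ) < K+1 := by positivity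
  calc _ ≤ 1/((K:ℝ)+1)*(K+1)^2 := by gcongr
    _ = _ := by field_simp

lemma exp_sub_one_norm (x : ℝ) (hx : |x| ≤ π) :
    2 / π * |x| ≤ ‖Complex.exp ((x:ℝ)*I) - 1‖ := by
  have h := Complex.norm_exp_I_mul_ofReal_sub_one x
  rw [mul_comm] at h
  rw [h, norm_mul]
  simp only [norm_eq_abs]
  have h2 : 2 / π * |x/2| ≤ |sin (x/2)| := Real.mul_abs_le_abs_sin (by
    rw [abs_div]; norm_num; linarith)
  rw [abs_div] at h2
  norm_num at h2 ⊢
  calc 2 / π * |x| = 2*(|x| / π) := by ring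
    _ ≤ _ := by linarith

lemma geom_norm_le (K : ℕ) (x : ℝ) (hx : |x| ≤ π) (h0 : x ≠ 0) :
    ‖∑ k ∈ range K, Complex.exp (((k : ℝ)*x : ℝ)*I)‖ ≤ π / |x| := by
  have h1 := exp_sub_one_norm x hx
  have hx0 : 0 < |x| := abs_pos.2 h0
  have hpi := pi_pos
  have hpos : 0 < ‖Complex.exp ((x:ℝ)*I) - 1‖ := lt_of_lt_of_le (by positivity) h1
  have hne : Complex.exp ((x:ℝ)*I) ≠ 1 := by
    intro h; rw [h] at hpos; simp at hpos
  have : ∀ k : ℕ, Complex.exp (((k : ℝ)*x : ℝ)*I) = Complex.exp ((x:ℝ)*I) ^ k := by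
    intro k; rw [← Complex.exp_nat_mul]; push_cast; ring_nf
  simp_rw [this]
  rw [geom_sum_eq hne, norm_div]
  have h3 : ‖Complex.exp ((x:ℝ)*I) ^ K - 1‖ ≤ 2 := by
    refine (norm_sub_le _ _).trans ?_
    rw [norm_pow, norm_exp_ofReal_mul_I]; norm_num
  calc _ ≤ 2/(2 / π * |x|) := by gcongr
    _ = _ := by field_simp

lemma fj_le' (K : ℕ) (x : ℝ) (hx : |x| ≤ π) (h0 : x ≠ 0) :
    fj K x ≤ π ^ 2/((K+1)*x ^ 2) := by
  unfold fj
  have := geom_norm_le (K+1) x hx h0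
  have hx0 : 0 < |x| := abs_pos.2 h0
  calc _ ≤ 1/((K:ℝ)+1)*(π / |x|)^2 := by gcongr
    _ = _ := by rw [div_pow, sq_abs]; field_simp

lemma fj_periodic (K : ℕ) (x : ℝ) (m : ℤ) : fj K (x+m*(2 * π)) = fj K x := by
  unfold fj
  congr 3
  refine sum_congr rfl fun k _ => ?_
  have : (((k : ℝ)*(x+m*(2 * π)) : ℝ)*I) = (((k : ℝ)*x : ℝ)*I)
    + ((k*m : ℤ) : ℂ)*(2 * π * I) := by push_cast; ring
  rw [this, Complex.exp_add, Complex.exp_int_mul_two_pi_mul_I, mul_one]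

lemma wt_nonneg (K : ℕ) (k : ℤ) (hk : k ∈ Icc (-(K : ℤ)) K) : 0 ≤ wt K k := by
  unfold wt
  rw [mem_Icc] at hk
  have : |(k : ℝ)| ≤ K := by rw [abs_le]; constructor <;> exact_mod_cast (by omega)
  rw [sub_nonneg, div_le_one (by positivity)]; linarith

lemma card_int_interval (T : Finset ℤ) (x y : ℝ) (hxy : x ≤ y) (hT : ∀ u ∈ T, x ≤ u ∧ (u:ℝ) ≤ y) :
    (T.card : ℝ) ≤ y - x+1 := by
  have h1 : T ⊆ Icc ⌈x⌉ ⌊y⌋ := by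
    intro u hu
    rw [mem_Icc]
    exact ⟨Int.ceil_le.2 (hT u hu).1, Int.le_floor.2 (hT u hu).2⟩
  have h2 := card_le_card h1
  rw [Int.card_Icc] at h2
  have h3 : (T.card : ℝ) ≤ ((⌊y⌋ + 1 - ⌈x⌉).toNat : ℝ) := by exact_mod_cast h2
  have h4 : (((⌊y⌋ + 1 - ⌈x⌉).toNat : ℤ) : ℝ) = ((max (⌊y⌋ + 1 - ⌈x⌉) 0 : ℤ) : ℝ) := by
    rw [Int.toNat_eq_max]
  have h5 : (((⌊y⌋ + 1 - ⌈x⌉).toNat : ℤ) : ℝ) = ((⌊y⌋ + 1 - ⌈x⌉).toNat : ℝ) := by norm_cast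
  rw [← h5, h4] at h3
  refine h3.trans ?_
  push_cast
  refine max_le ?_ (by linarith)
  have := Int.floor_le y
  have := Int.le_ceil x
  linarith

lemma sum_inv_sq_le (M : ℕ) : ∑ i ∈ range M, (1:ℝ)/((i:ℝ)+1)^2 ≤ 2 := by
  have : ∀ M : ℕ, ∑ i ∈ range (M+1), (1:ℝ)/((i:ℝ)+1)^2 ≤ 2 - 1/((M:ℝ)+1) := by
    intro M
    induction M with
    | zero => norm_num
    | succ M ih =>
      rw [sum_range_succ]
      push_cast
      have : (1:ℝ)/((M:ℝ)+1+1)^2 ≤ 1/((M:ℝ)+1) - 1/((M:ℝ)+1+1) := by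
        rw [div_sub_div _ _ (by positivity) (by positivity), div_le_div_iff₀ (by positivity) (by positivity)]
        have : (0:ℝ) ≤ M := by positivity
        nlinarith
      linarith
  cases M with
  | zero => simp
  | succ M => exact (this M).trans (by simp; positivity)

lemma sum_spaced (T : Finset ℤ) (f : ℤ → ℝ) (u0 B q : ℝ) (hB : 0 ≤ B) (hq : 0 ≤ q)
    (h1 : ∀ u ∈ T, f u ≤ B) (h2 : ∀ u ∈ T, (u:ℝ) ≠ u0 → f u ≤ B*q^2/((u:ℝ) - u0)^2) :
    ∑ u ∈ T, f u ≤ (12+6*q)*B := by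
  set i : ℤ → ℕ := fun u => ⌊|(u:ℝ) - u0| / (q+1)⌋₊ with hi
  obtain ⟨M, hM⟩ : ∃ M : ℕ, ∀ u ∈ T, i u < M+1 := by
    refine ⟨T.sup i, fun u hu => Nat.lt_succ_of_le (Finset.le_sup hu)⟩
  set g : ℕ → ℝ := fun m => if m = 0 then B else B/(m:ℝ)^2 with hg
  have hg0 : ∀ m, 0 ≤ g m := by intro m; simp only [hg]; split_ifs <;> positivity
  have hfg : ∀ u ∈ T, f u ≤ g (i u) := by
    intro u hu
    simp only [hg]
    split_ifs with h
    · exact h1 u hu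
    · have hfl : (i u : ℝ) ≤ |(u:ℝ) - u0| / (q+1) := Nat.floor_le (by positivity)
      have hi1 : (0:ℝ) < i u := by exact_mod_cast Nat.pos_of_ne_zero h
      rw [le_div_iff₀ (by positivity)] at hfl
      have hne : (u:ℝ) ≠ u0 := by
        intro h'; rw [h'] at hfl; simp at hfl; nlinarith
      refine (h2 u hu hne).trans ?_
      have hpos : 0 < ((u:ℝ) - u0)^2 := by
        have := sub_ne_zero.2 hne
        positivity
      rw [div_le_div_iff₀ hpos (by positivity)]
      have : ((i u : ℝ)*q)^2 ≤ ((u:ℝ) - u0)^2 := by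
        rw [← sq_abs ((u:ℝ) - u0)]
        refine pow_le_pow_left₀ (by positivity) ?_ 2
        nlinarith
      calc B*q^2*(i u : ℝ)^2 = B*((i u : ℝ)*q)^2 := by ring
        _ ≤ _ := by gcongr
  have hcard : ∀ m, (((T.filter (fun u => i u = m)).card : ℕ) : ℝ) ≤ 2*q+4 := by
    intro m
    have hsub : T.filter (fun u => i u = m) ⊆
        ((T.filter (fun u => i u = m)).filter (fun u => u0 ≤ (u:ℝ))) ∪
        ((T.filter (fun u => i u = m)).filter (fun u => (u:ℝ) ≤ u0)) := by
      intro u hu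
      rw [mem_union]
      rcases le_total u0 (u:ℝ) with h | h
      · exact Or.inl (mem_filter.2 ⟨hu, h⟩)
      · exact Or.inr (mem_filter.2 ⟨hu, h⟩)
    have hc := (card_le_card hsub).trans (Finset.card_union_le _ _)
    have key : ∀ u, i u = m → (m:ℝ)*(q+1) ≤ |(u:ℝ) - u0| ∧ |(u:ℝ) - u0| ≤ (m+1)*(q+1) := by
      intro u hu
      have a1 : (i u : ℝ) ≤ |(u:ℝ) - u0| / (q+1) := Nat.floor_le (by positivity)
      have a2 : |(u:ℝ) - u0| / (q+1) < i u+1 := Nat.lt_floor_add_one _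
      rw [hu] at a1 a2
      rw [le_div_iff₀ (by positivity)] at a1
      rw [div_lt_iff₀ (by positivity)] at a2
      exact ⟨a1, a2.le⟩
    have c1 := card_int_interval ((T.filter (fun u => i u = m)).filter (fun u => u0 ≤ (u:ℝ)))
      (u0+m*(q+1)) (u0+(m+1)*(q+1)) (by nlinarith) (by
        intro u hu
        rw [mem_filter, mem_filter] at hu
        have := key u hu.1.2
        rw [abs_of_nonneg (by linarith [hu.2])] at this
        constructor <;> linarith [this.1, this.2])
    have c2 := card_int_interval ((T.filter (fun u => i u = m)).filter (fun u => (u:ℝ) ≤ u0))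
      (u0 - (m+1)*(q+1)) (u0 - m*(q+1)) (by nlinarith) (by
        intro u hu
        rw [mem_filter, mem_filter] at hu
        have := key u hu.1.2
        rw [abs_of_nonpos (by linarith [hu.2])] at this
        constructor <;> linarith [this.1, this.2])
    have hc2 := (Nat.cast_le (α := ℝ)).2 hc
    push_cast at hc2
    nlinarith
  calc ∑ u ∈ T, f u ≤ ∑ u ∈ T, g (i u) := sum_le_sum hfg
    _ = ∑ m ∈ range (M+1), ∑ u ∈ T with i u = m, g (i u) := by
        rw [Finset.sum_fiberwise_of_maps_to]
        intro u hu; exact mem_range.2 (hM u hu)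
    _ = ∑ m ∈ range (M+1), ((T.filter (fun u => i u = m)).card : ℝ)*g m := by
        refine sum_congr rfl fun m _ => ?_
        rw [← nsmul_eq_mul, ← sum_const]
        refine sum_congr rfl fun u hu => ?_
        rw [(mem_filter.1 hu).2]
    _ ≤ ∑ m ∈ range (M+1), (2*q+4)*g m := by
        refine sum_le_sum fun m _ => ?_
        exact mul_le_mul_of_nonneg_right (hcard m) (hg0 m)
    _ = (2*q+4) * ∑ m ∈ range (M+1), g m := by rw [mul_sum]
    _ ≤ (2*q+4)*(3*B) := by
        gcongr
        rw [Finset.sum_range_succ']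
        have : ∑ k ∈ range M, g (k+1) = B * ∑ k ∈ range M, 1/((k:ℝ)+1)^2 := by
          rw [mul_sum]
          refine sum_congr rfl fun k _ => ?_
          simp [hg, div_eq_mul_inv]
        rw [this]
        have h0 : g 0 = B := by simp [hg]
        rw [h0]
        have := sum_inv_sq_le M
        nlinarith
    _ = _ := by ring

noncomputable def Xi (h K : ℕ) [NeZero h] : Finset (Freq h) := univ ×ˢ Icc (-(K:ℤ)) K

noncomputable def En (h K : ℕ) [NeZero h] (s : Finset ℕ) (a : ℕ → ℂ) : ℝ :=
  ∑ ξ ∈ Xi h K, wt K ξ.2 * ‖pol s a ξ‖ ^ 2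

/-- congruent and coprime to the modulus -/
def CRel (h n m : ℕ) : Prop := n.Coprime h ∧ (n : ZMod h) = (m : ZMod h)

lemma CRel.symm {h n m : ℕ} (H : CRel h n m) : CRel h m n := by
  refine ⟨?_, H.2.symm⟩
  have := (ZMod.isUnit_iff_coprime n h).2 H.1
  rw [H.2] at this
  exact (ZMod.isUnit_iff_coprime m h).1 this

lemma CRel_comm {h n m : ℕ} : CRel h n m ↔ CRel h m n := ⟨CRel.symm, CRel.symm⟩

lemma char_orth (h : ℕ) [NeZero h] (n m : ℕ) [Decidable (CRel h n m)] :
    ∑ χ : DirichletCharacter ℂ h, χ (n : ZMod h)*(starRingEnd ℂ) (χ (m : ZMod h))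
      = if CRel h n m then (h.totient : ℂ) else 0 := by
  by_cases hm : IsUnit (m : ZMod h)
  · have := DirichletCharacter.sum_char_inv_mul_char_eq ℂ hm (n : ZMod h)
    have h2 : ∀ χ : DirichletCharacter ℂ h, χ ((m : ZMod h)⁻¹) = (starRingEnd ℂ) (χ (m : ZMod h)) := by
      intro χ
      have e1 : χ ((m : ZMod h)⁻¹) * χ (m : ZMod h) = 1 := by
        rw [← map_mul, ZMod.inv_mul_of_unit _ hm, map_one]
      have e2 : ‖χ (m : ZMod h)‖ = 1 := by
        obtain ⟨u, hu⟩ := hm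
        rw [← hu]; exact DirichletCharacter.unit_norm_eq_one _ _
      have e3 : (starRingEnd ℂ) (χ (m : ZMod h)) * χ (m : ZMod h) = 1 := by
        rw [conj_mul', e2]; norm_num
      have e4 : χ (m : ZMod h) ≠ 0 := by
        intro h0; rw [h0] at e2; simp at e2
      exact mul_right_cancel₀ e4 (e1.trans e3.symm)
    simp_rw [h2] at this
    rw [sum_congr rfl fun χ _ => mul_comm _ _, this]
    congr 1
    rw [eq_iff_iff]
    constructor
    · intro h'
      refine ⟨?_, h'.symm⟩
      rw [h'] at hm
      exact (ZMod.isUnit_iff_coprime n h).1 hm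
    · exact fun h' => h'.2.symm
  · have : ¬ CRel h n m := fun H => hm ((ZMod.isUnit_iff_coprime m h).2 H.symm.1)
    rw [if_neg this]
    refine sum_eq_zero fun χ _ => ?_
    rw [MulChar.map_nonunit χ hm]; simp

open Classical in
lemma En_eq (h K : ℕ) [NeZero h] (s : Finset ℕ) (a : ℕ → ℂ) :
    (En h K s a : ℂ) = h.totient * ∑ n ∈ s, ∑ m ∈ s, if CRel h n m then
      a n*(starRingEnd ℂ) (a m)*(fj K (log n - log m) : ℂ) else 0 := by
  unfold En Xi
  rw [sum_product]
  push_cast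
  have e1 : ∀ (χ : DirichletCharacter ℂ h) (k : ℤ), (wt K k : ℂ)*(‖pol s a (χ, k)‖ : ℂ)^2
      = ∑ n ∈ s, ∑ m ∈ s, a n*(starRingEnd ℂ) (a m) *
        (χ (n : ZMod h)*(starRingEnd ℂ) (χ (m : ZMod h))) *
        ((wt K k : ℂ)*Complex.exp (((k : ℝ)*(log n - log m) : ℝ)*I)) := by
    intro χ k
    rw [← mul_conj']
    unfold pol ch
    rw [map_sum, sum_mul_sum, mul_sum]
    refine sum_congr rfl fun n _ => ?_
    rw [mul_sum]
    refine sum_congr rfl fun m _ => ?_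
    have : Complex.exp (((k : ℝ)*(log n - log m) : ℝ)*I)
      = Complex.exp (((k:ℝ)*log n : ℝ)*I) *
        (starRingEnd ℂ) (Complex.exp (((k:ℝ)*log m : ℝ)*I)) := by
      rw [← exp_conj, ← Complex.exp_add]
      congr 1; rw [map_mul, conj_ofReal, conj_I]; push_cast; ring
    rw [this]
    simp only [map_mul]; ring
  simp_rw [e1]
  have e2 : ∀ χ : DirichletCharacter ℂ h, ∑ k ∈ Icc (-(K:ℤ)) K, ∑ n ∈ s, ∑ m ∈ s, a n*(starRingEnd ℂ) (a m) *
        (χ (n : ZMod h)*(starRingEnd ℂ) (χ (m : ZMod h))) *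
        ((wt K k : ℂ)*Complex.exp (((k : ℝ)*(log n - log m) : ℝ)*I))
      = ∑ n ∈ s, ∑ m ∈ s, a n*(starRingEnd ℂ) (a m)*(fj K (log n - log m) : ℂ) *
        (χ (n : ZMod h)*(starRingEnd ℂ) (χ (m : ZMod h))) := by
    intro χ
    rw [sum_comm]
    refine sum_congr rfl fun n _ => ?_
    rw [sum_comm]
    refine sum_congr rfl fun m _ => ?_
    rw [← mul_sum, fj_eq]; ring
  simp_rw [e2]
  rw [sum_comm, mul_sum]
  refine sum_congr rfl fun n _ => ?_
  rw [sum_comm, mul_sum]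
  refine sum_congr rfl fun m _ => ?_
  rw [← mul_sum, char_orth]
  split_ifs <;> ring

lemma fj_neg (K : ℕ) (x : ℝ) : fj K (-x) = fj K x := by
  unfold fj
  congr 2
  have : ∑ k ∈ range (K+1), Complex.exp (((k : ℝ)*(-x) : ℝ)*I)
    = (starRingEnd ℂ) (∑ k ∈ range (K+1), Complex.exp (((k : ℝ)*x : ℝ)*I)) := by
    rw [map_sum]
    refine sum_congr rfl fun k _ => ?_
    rw [← exp_conj]; congr 1; simp
  rw [this, RCLike.norm_conj]

open Classical in
lemma En_le_rows (h K : ℕ) [NeZero h] (s : Finset ℕ) (a : ℕ → ℂ) (R : ℝ)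
    (hR : ∀ n ∈ s, ∑ m ∈ s, (if CRel h n m then fj K (log n - log m) else 0) ≤ R) :
    En h K s a ≤ h.totient*(R * ∑ n ∈ s, ‖a n‖^2) := by
  have h1 : En h K s a ≤ h.totient * ∑ n ∈ s, ∑ m ∈ s,
      (if CRel h n m then fj K (log n - log m) else 0)*(‖a n‖^2/2 + ‖a m‖^2/2) := by
    have := congrArg norm (En_eq h K s a)
    rw [norm_real, norm_mul, Complex.norm_natCast] at this
    refine (le_abs_self _).trans (this.le.trans ?_)
    gcongr
    refine (norm_sum_le _ _).trans (sum_le_sum fun n _ => ?_)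
    refine (norm_sum_le _ _).trans (sum_le_sum fun m _ => ?_)
    split_ifs
    · rw [norm_mul, norm_mul, RCLike.norm_conj, norm_real, norm_of_nonneg (fj_nonneg _ _)]
      rw [mul_comm]
      refine mul_le_mul_of_nonneg_left ?_ (fj_nonneg _ _)
      nlinarith [sq_nonneg (‖a n‖ - ‖a m‖)]
    · simp
  refine h1.trans ?_
  gcongr
  have h2 : ∑ n ∈ s, ∑ m ∈ s,
      (if CRel h n m then fj K (log n - log m) else 0)*(‖a n‖^2/2 + ‖a m‖^2/2)
      = ∑ n ∈ s, (∑ m ∈ s, (if CRel h n m then fj K (log n - log m) else 0)) * ‖a n‖^2 := by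
    simp_rw [mul_add, sum_add_distrib]
    rw [sum_comm (f := fun n m => (if CRel h n m then fj K (log n - log m) else 0)*(‖a m‖^2/2)),
      ← sum_add_distrib]
    refine sum_congr rfl fun n _ => ?_
    rw [← sum_add_distrib, sum_mul]
    refine sum_congr rfl fun m _ => ?_
    have : (if CRel h m n then fj K (log m - log n) else 0)
       = (if CRel h n m then fj K (log n - log m) else 0) := by
      rw [← fj_neg, neg_sub, CRel_comm]
    rw [this]; ring
  rw [h2, mul_sum]
  exact sum_le_sum fun n hn => mul_le_mul_of_nonneg_right (hR n hn) (by positivity)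

lemma exp_pi_le : exp π ≤ 55 := by
  have h1 : exp π ≤ exp 4 := exp_le_exp.2 Real.pi_le_four
  have h2 : exp 4 = (exp 1)^4 := by rw [← exp_nat_mul]; norm_num
  have h3 := Real.exp_one_lt_d9
  have h4 : (exp 1)^4 ≤ 2.7182818286^4 := pow_le_pow_left₀ (exp_pos 1).le h3.le 4
  rw [h2] at h1
  refine h1.trans (h4.trans (by norm_num))

lemma log_sub_log_ge {a b : ℝ} (ha : 0 < a) (hab : a ≤ b) : (b - a)/b ≤ log b - log a := by
  have hb := lt_of_lt_of_le ha hab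
  have := add_one_le_exp (log a - log b)
  rw [exp_sub, exp_log ha, exp_log hb] at this
  have h2 : (b - a)/b = 1 - a/b := by field_simp
  rw [h2]; linarith

lemma abs_log_sub_ge {a b M : ℝ} (ha : 0 < a) (hb : 0 < b) (haM : a ≤ M) (hbM : b ≤ M) :
    |a - b| / M ≤ |log a - log b| := by
  rcases le_total a b with h | h
  · have := log_sub_log_ge ha h
    rw [abs_sub_comm, abs_of_nonneg (sub_nonneg.2 h), abs_sub_comm]
    refine le_trans ?_ (this.trans (le_abs_self _))
    exact div_le_div_of_nonneg_left (sub_nonneg.2 h) hb hbM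
  · have := log_sub_log_ge hb h
    rw [abs_of_nonneg (sub_nonneg.2 h)]
    refine le_trans ?_ (this.trans (le_abs_self _))
    exact div_le_div_of_nonneg_left (sub_nonneg.2 h) ha haM

lemma CRel.mod {h n m : ℕ} (H : CRel h n m) : n % h = m % h :=
  (ZMod.natCast_eq_natCast_iff' n m h).1 H.2

lemma period_bound (h K : ℕ) [NeZero h] (s : Finset ℕ) (N2 : ℝ) (n : ℕ) (hn : 0 < n) (p : ℤ) (hN0 : 0 ≤ N2)
    (hs : ∀ m ∈ s, 0 < m ∧ (m:ℝ) ≤ N2 ∧ CRel h n m ∧ |log m - log n - p*(2 * π)| ≤ π) :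
    ∑ m ∈ s, fj K (log n - log m) ≤ 1100*(K+1+N2/h) := by
  rcases s.eq_empty_or_nonempty with rfl | ⟨m0, hm0⟩
  · simp only [Finset.sum_empty]; positivity
  have hh : (0:ℝ) < h := by exact_mod_cast Nat.pos_of_ne_zero (NeZero.ne h)
  have hN2 : 0 < N2 := lt_of_lt_of_le (by exact_mod_cast (hs m0 hm0).1) (hs m0 hm0).2.1
  set t : ℝ := n*exp (p*(2 * π)) with ht
  have htpos : 0 < t := by have : (0:ℝ) < n := by exact_mod_cast hn
                           positivity
  have hlogt : log t = log n+p*(2 * π) := by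
    rw [ht, log_mul (by positivity) (by positivity), log_exp]
  have htN : t ≤ exp π * N2 := by
    have hm := hs m0 hm0
    have h1 : log t ≤ π + log m0 := by
      rw [hlogt]; have := (abs_le.1 hm.2.2.2).1; linarith
    have h2 : t ≤ exp (π + log m0) := by
      rw [← exp_log htpos]; exact exp_le_exp.2 h1
    rw [exp_add, exp_log (by exact_mod_cast hm.1)] at h2
    refine h2.trans ?_
    have := hm.2.1
    gcongr
  have hNe : N2 ≤ exp π * N2 := by
    have : 1 ≤ exp π := one_le_exp pi_pos.le
    nlinarith
  set r : ℕ := n % h with hr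
  set ι : ℕ → ℤ := fun m => ((m/h : ℕ) : ℤ) with hι
  have hmr : ∀ m ∈ s, (m:ℝ) = h*((ι m : ℤ) : ℝ)+r := by
    intro m hm
    have h1 := (hs m hm).2.2.1.mod
    have h2 := Nat.div_add_mod m h
    rw [← h1] at h2
    simp only [hι]
    have h3 : ((h*(m/h)+n % h : ℕ) : ℝ) = m := by rw [h2]
    push_cast at h3
    rw [← h3, Int.cast_natCast]
  have hinj : Set.InjOn ι s := by
    intro m hm m' hm' he
    have h1 := hmr m hm
    have h2 := hmr m' hm'
    rw [he, ← h2] at h1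
    exact_mod_cast h1
  set F : ℤ → ℝ := fun u => fj K (log n - log (h*(u:ℝ)+r)) with hF
  have e1 : ∑ m ∈ s, fj K (log n - log m) = ∑ u ∈ s.image ι, F u := by
    rw [Finset.sum_image hinj]
    refine sum_congr rfl fun m hm => ?_
    simp only [hF]
    rw [← hmr m hm]
  rw [e1]
  set q : ℝ := π * (exp π * N2)/((K+1)*h) with hq
  have hb := sum_spaced (s.image ι) F ((t - r)/h) (K+1) q (by positivity)
    (by have := pi_pos; positivity) (fun u _ => fj_le K _) (by
      intro u hu hne
      obtain ⟨m, hm, rfl⟩ := mem_image.1 hu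
      have hM := hs m hm
      have hm0 : (0:ℝ) < m := by exact_mod_cast hM.1
      simp only [hF]
      rw [← hmr m hm]
      have hmt : (ι m : ℝ) - (t - r)/h = (m - t)/h := by
        rw [hmr m hm]; field_simp; ring
      have hmtne : (m:ℝ) - t ≠ 0 := by
        intro h0
        apply hne
        rw [h0, zero_div] at hmt
        linarith
      have ey : fj K (log n - log m) = fj K (log m - log t) := by
        rw [← fj_neg, neg_sub, hlogt]
        rw [← fj_periodic K (log m - (log n+p*(2 * π))) p]
        congr 1; ring
      have hy : |log m - log t| ≤ π := by
        rw [hlogt, ← sub_sub]; exact hM.2.2.2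
      have hlow := abs_log_sub_ge hm0 htpos (hM.2.1.trans hNe) htN
      have hMpos : 0 < exp π * N2 := by positivity
      have hlow0 : 0 < |(m:ℝ) - t| / (exp π * N2) := by
        have := abs_pos.2 hmtne; positivity
      have hy0 : log m - log t ≠ 0 := by
        intro h0; rw [h0, abs_zero] at hlow; linarith
      rw [ey]
      refine (fj_le' K _ hy hy0).trans ?_
      rw [hmt, ← sq_abs (log (m:ℝ) - log t)]
      calc π ^ 2/((K+1) * |log (m:ℝ) - log t| ^ 2)
          ≤ π ^ 2/((K+1)*(|(m:ℝ) - t| / (exp π * N2)) ^ 2) := by gcongr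
        _ = (K+1)*q ^ 2/((m - t)/h) ^ 2 := by
          rw [hq, div_pow, sq_abs]
          field_simp)
  refine hb.trans ?_
  have hpi := Real.pi_le_four
  have e3 : (12+6*q)*((K:ℝ)+1) = 12*(K+1)+6 * π * exp π * (N2/h) := by
    rw [hq]; field_simp
  rw [e3]
  have h4 : π * exp π ≤ 3.15*55 :=
    mul_le_mul Real.pi_lt_d2.le exp_pi_le (exp_pos _).le (by norm_num)
  have h5 : 0 ≤ N2/h := by positivity
  have h6 : (0:ℝ) ≤ K := by positivity
  nlinarith

open Classical in
lemma row_bound (h K : ℕ) [NeZero h] (s : Finset ℕ) (N1 N2 : ℝ) (hN1 : 0 < N1)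
    (hs : ∀ m ∈ s, N1 ≤ m ∧ (m:ℝ) ≤ N2) (n : ℕ) (hn : n ∈ s) :
    ∑ m ∈ s, (if CRel h n m then fj K (log n - log m) else 0)
      ≤ 4000*(1+log (N2/N1))*(K+1+N2/h) := by
  set per : ℕ → ℤ := fun m => round ((log m - log n)/(2 * π)) with hper
  have hpi := pi_pos
  have hpi3 := pi_gt_three
  have h12 : N1 ≤ N2 := (hs n hn).1.trans (hs n hn).2
  set Lg := log (N2/N1) with hLg
  have hLg0 : 0 ≤ Lg := log_nonneg (by rw [le_div_iff₀ hN1]; linarith)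
  have hN2 : 0 < N2 := by linarith
  have hpos : ∀ m ∈ s, (0:ℝ) < m := fun m hm => lt_of_lt_of_le hN1 (hs m hm).1
  have hdist : ∀ m ∈ s, |log m - log n| ≤ Lg := by
    intro m hm
    have a1 := log_le_log hN1 (hs m hm).1
    have a2 := log_le_log (hpos m hm) (hs m hm).2
    have a3 := log_le_log hN1 (hs n hn).1
    have a4 := log_le_log (hpos n hn) (hs n hn).2
    rw [hLg, log_div hN2.ne' hN1.ne', abs_le]
    constructor <;> linarith
  set P : ℕ := ⌊Lg⌋₊+1 with hP
  have hmaps : ∀ m ∈ s, per m ∈ Icc (-(P:ℤ)) P := by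
    intro m hm
    have h1 := abs_sub_round ((log m - log n)/(2 * π))
    have h2 : |(log m - log n)/(2 * π)| ≤ Lg/6 := by
      rw [abs_div, abs_of_pos (by positivity : 0 < 2 * π)]
      exact div_le_div₀ hLg0 (hdist m hm) (by norm_num) (by linarith)
    have h3 : |((per m : ℤ) : ℝ)| < P+1 := by
      have h5 : Lg < ⌊Lg⌋₊+1 := Nat.lt_floor_add_one Lg
      have h6 : (P:ℝ) = ⌊Lg⌋₊+1 := by rw [hP]; push_cast; ring
      have h4 : |((per m : ℤ) : ℝ)| ≤ Lg/6+1/2 := by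
        rw [abs_le] at h1 h2 ⊢
        simp only [hper]
        constructor <;> linarith [h1.1, h1.2, h2.1, h2.2]
      rw [h6]
      linarith
    rw [abs_lt] at h3
    rw [mem_Icc]
    have h7 : -((P:ℤ)+1) < per m := by exact_mod_cast h3.1
    have h8 : per m < (P:ℤ)+1 := by exact_mod_cast h3.2
    omega
  rw [← sum_filter, ← Finset.sum_fiberwise_of_maps_to (t := Icc (-(P:ℤ)) P) (g := per)
    (fun m hm => hmaps m (mem_filter.1 hm).1)]
  have hb : ∀ p ∈ Icc (-(P:ℤ)) P,
      ∑ m ∈ (s.filter (fun m => CRel h n m)) with per m = p, fj K (log n - log m)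
        ≤ 1100*(K+1+N2/h) := by
    intro p _
    refine period_bound h K _ N2 n (by exact_mod_cast hpos n hn) p hN2.le ?_
    intro m hm
    rw [mem_filter, mem_filter] at hm
    refine ⟨by exact_mod_cast hpos m hm.1.1, (hs m hm.1.1).2, hm.1.2, ?_⟩
    have h1 := abs_sub_round ((log m - log n)/(2 * π))
    have h2 : ((log m - log n)/(2 * π) - (per m : ℝ))*(2 * π)
      = log m - log n - p*(2 * π) := by
      rw [hm.2]; field_simp
    rw [← h2, abs_mul, abs_of_pos (by positivity : 0 < 2 * π)]
    simp only [hper]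
    nlinarith
  refine (Finset.sum_le_card_nsmul _ _ _ hb).trans ?_
  rw [Int.card_Icc, nsmul_eq_mul]
  have hc : (((P:ℤ)+1 - -(P:ℤ)).toNat : ℝ) = 2*P+1 := by
    have : ((P:ℤ)+1 - -(P:ℤ)).toNat = 2*P+1 := by omega
    rw [this]; push_cast; ring
  rw [hc]
  have h6 : (P:ℝ) ≤ Lg+1 := by
    rw [hP]; push_cast; linarith [Nat.floor_le hLg0]
  have h7 : (0:ℝ) ≤ K+1+N2/h := by positivity
  rw [← mul_assoc]
  refine mul_le_mul_of_nonneg_right ?_ h7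
  nlinarith

/-- Mean value theorem. -/
lemma MVT (h K : ℕ) [NeZero h] (s : Finset ℕ) (a : ℕ → ℂ) (N1 N2 : ℝ) (hN1 : 0 < N1)
    (hs : ∀ m ∈ s, N1 ≤ m ∧ (m:ℝ) ≤ N2) :
    En h K s a ≤ h.totient*(4000*(1+log (N2/N1))*(K+1+N2/h) * ∑ n ∈ s, ‖a n‖^2) := by
  classical
  exact En_le_rows h K s a _ (row_bound h K s N1 N2 hN1 hs)

/-- number of `ℓ`-tuples from `I` whose product divides `n` -/
def rep (I : Finset ℕ) : ℕ → ℕ → ℕ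
  | 0, _ => 1
  | (l+1), n => ∑ p ∈ I, if p ∣ n then rep I l (n/p) else 0

lemma rep_mul_prime (I : Finset ℕ) (hI : ∀ p ∈ I, p.Prime) (l : ℕ) : ∀ p m : ℕ, p.Prime →
    rep I l (p*m) ≤ rep I l m+l*rep I (l - 1) m := by
  induction l with
  | zero => intro p m _; simp [rep]
  | succ l ih =>
    intro p m hp
    have key : ∀ q ∈ I, (if q ∣ p*m then rep I l (p*m/q) else 0) ≤
        (if q = p then rep I l m else 0)+(if q ∣ m then rep I l (m/q)+l*rep I (l-1) (m/q) else 0) := by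
      intro q hq
      by_cases hqp : q = p
      · subst hqp
        simp [hp.pos]
      · simp only [hqp, if_false, zero_add]
        split_ifs with h1 h2 h2
        · obtain ⟨k, rfl⟩ := h2
          have hq0 := (hI q hq).pos
          rw [Nat.mul_div_cancel_left _ hq0, show p*(q*k) = q*(p*k) by ring,
            Nat.mul_div_cancel_left _ hq0]
          exact ih p k hp
        · exfalso
          rcases (hI q hq).dvd_mul.1 h1 with h | h
          · exact hqp ((Nat.prime_dvd_prime_iff_eq (hI q hq) hp).1 h)
          · exact h2 h
        · positivity
        · exact le_refl _
    simp only [rep]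
    refine (sum_le_sum key).trans ?_
    rw [sum_add_distrib]
    have h1 : ∑ q ∈ I, (if q = p then rep I l m else 0) ≤ rep I l m := by
      rw [sum_ite_eq']; split_ifs <;> simp
    have h2 : ∑ q ∈ I, (if q ∣ m then rep I l (m/q)+l*rep I (l-1) (m/q) else 0)
        ≤ (∑ q ∈ I, if q ∣ m then rep I l (m/q) else 0)+l*rep I l m := by
      have : ∑ q ∈ I, (if q ∣ m then rep I l (m/q)+l*rep I (l-1) (m/q) else 0)
        = (∑ q ∈ I, if q ∣ m then rep I l (m/q) else 0)+l * ∑ q ∈ I, (if q ∣ m then rep I (l-1) (m/q) else 0) := by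
        rw [mul_sum, ← sum_add_distrib]
        refine sum_congr rfl fun q _ => ?_
        split_ifs <;> simp
      rw [this]
      cases l with
      | zero => simp
      | succ l => simp [rep]
    simp only [Nat.add_sub_cancel]
    nlinarith

lemma sum_dvd_eq {M : Type*} [AddCommMonoid M] (p N : ℕ) (hp : 0 < p) (f : ℕ → M) :
    ∑ n ∈ Icc 1 N, (if p ∣ n then f n else 0) = ∑ m ∈ Icc 1 (N/p), f (p*m) := by
  rw [← sum_filter]
  symm
  refine Finset.sum_nbij' (fun m => p*m) (fun n => n/p) ?_ ?_ ?_ ?_ ?_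
  · intro m hm
    rw [mem_Icc] at hm
    rw [mem_filter, mem_Icc]
    refine ⟨⟨Nat.mul_pos hp hm.1, ?_⟩, dvd_mul_right _ _⟩
    rw [mul_comm]; exact (Nat.le_div_iff_mul_le hp).1 hm.2
  · intro n hn
    rw [mem_filter, mem_Icc] at hn
    rw [mem_Icc]
    exact ⟨Nat.div_pos (Nat.le_of_dvd hn.1.1 hn.2) hp, Nat.div_le_div_right hn.1.2⟩
  · intro m _; simp [hp]
  · intro n hn
    rw [mem_filter] at hn
    exact Nat.mul_div_cancel' hn.2
  · intro m _; rfl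

lemma rep_sum_le (I : Finset ℕ) (hI : ∀ p ∈ I, p.Prime) (hS : ∑ p ∈ I, (1:ℝ)/p ≤ 1) (l : ℕ) : ∀ N : ℕ,
    ∑ n ∈ Icc 1 N, (rep I l n : ℝ) ≤ N := by
  induction l with
  | zero => intro N; simp [rep]
  | succ l ih =>
    intro N
    have h1 : ∑ n ∈ Icc 1 N, (rep I (l+1) n : ℝ)
        = ∑ p ∈ I, ∑ m ∈ Icc 1 (N/p), (rep I l m : ℝ) := by
      simp only [rep]
      push_cast
      rw [sum_comm]
      refine sum_congr rfl fun p hp => ?_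
      have hp0 := (hI p hp).pos
      rw [sum_dvd_eq p N hp0 (fun n => (rep I l (n/p) : ℝ))]
      refine sum_congr rfl fun m _ => ?_
      rw [Nat.mul_div_cancel_left _ hp0]
    rw [h1]
    calc _ ≤ ∑ p ∈ I, ((N/p : ℕ) : ℝ) := sum_le_sum fun p _ => ih _
      _ ≤ ∑ p ∈ I, (N:ℝ)*(1/p) := by
        refine sum_le_sum fun p _ => ?_
        have := @Nat.cast_div_le ℝ _ _ _ N p
        rw [mul_one_div]; exact this
      _ = N * ∑ p ∈ I, (1:ℝ)/p := by rw [mul_sum]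
      _ ≤ N*1 := by gcongr
      _ = N := mul_one _

lemma rep_sum_mul_le (I : Finset ℕ) (hI : ∀ p ∈ I, p.Prime) (hS : ∑ p ∈ I, (1:ℝ)/p ≤ 1) (l : ℕ) :
    ∀ k N : ℕ, ∑ n ∈ Icc 1 N, (rep I l n : ℝ)*rep I k n ≤ N*(1+(k:ℝ))^l := by
  induction l with
  | zero => intro k N; simpa [rep] using rep_sum_le I hI hS k N
  | succ l ih =>
    intro k N
    have h1 : ∑ n ∈ Icc 1 N, (rep I (l+1) n : ℝ)*rep I k n
        = ∑ p ∈ I, ∑ m ∈ Icc 1 (N/p), (rep I l m : ℝ)*rep I k (p*m) := by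
      have : ∀ n, (rep I (l+1) n : ℝ)*rep I k n = ∑ p ∈ I, if p ∣ n then (rep I l (n/p) : ℝ)*rep I k n else 0 := by
        intro n
        simp only [rep]
        push_cast
        rw [sum_mul]
        refine sum_congr rfl fun p _ => ?_
        split_ifs <;> simp
      simp_rw [this]
      rw [sum_comm]
      refine sum_congr rfl fun p hp => ?_
      have hp0 := (hI p hp).pos
      rw [sum_dvd_eq p N hp0 (fun n => (rep I l (n/p) : ℝ)*rep I k n)]
      refine sum_congr rfl fun m _ => ?_
      rw [Nat.mul_div_cancel_left _ hp0]
    rw [h1]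
    have h2 : ∀ p ∈ I, ∑ m ∈ Icc 1 (N/p), (rep I l m : ℝ)*rep I k (p*m)
        ≤ (N:ℝ)*(1/p)*(1+(k:ℝ))^(l+1) := by
      intro p hp
      have hb : ∀ m ∈ Icc 1 (N/p), (rep I l m : ℝ)*rep I k (p*m)
          ≤ (rep I l m : ℝ)*rep I k m+k*((rep I l m : ℝ)*rep I (k-1) m) := by
        intro m _
        have := rep_mul_prime I hI k p m (hI p hp)
        have h3 : (rep I k (p*m) : ℝ) ≤ rep I k m+k*rep I (k-1) m := by exact_mod_cast this
        have h4 : (0:ℝ) ≤ rep I l m := by positivity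
        nlinarith
      refine (sum_le_sum hb).trans ?_
      rw [sum_add_distrib, ← mul_sum]
      have i1 := ih k (N/p)
      have i2 := ih (k - 1) (N/p)
      have h5 : (k:ℝ) * ∑ m ∈ Icc 1 (N/p), (rep I l m : ℝ)*rep I (k-1) m
          ≤ k*(((N/p : ℕ) : ℝ)*(1+(k:ℝ))^l) := by
        gcongr
        refine i2.trans ?_
        gcongr
        omega
      have h6 := @Nat.cast_div_le ℝ _ _ _ N p
      have h7 : (N:ℝ)*(1/p) = (N:ℝ)/p := by ring
      rw [h7, pow_succ]
      have h8 : ((N/p : ℕ) : ℝ)*((1+(k:ℝ))^l*(1+k)) ≤ (N:ℝ)/p*((1+(k:ℝ))^l*(1+k)) := by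
        gcongr
      nlinarith
    refine (sum_le_sum h2).trans ?_
    rw [← sum_mul, ← mul_sum]
    gcongr
    nlinarith [(by positivity : (0:ℝ) ≤ N)]

lemma pol_mul_pol {h : ℕ} (I s : Finset ℕ) (b a : ℕ → ℂ) (hI : ∀ p ∈ I, p ≠ 0) (hs : ∀ m ∈ s, m ≠ 0) (T : Finset ℕ)
    (hT : ∀ p ∈ I, ∀ m ∈ s, p*m ∈ T) (ξ : Freq h) :
    pol I b ξ * pol s a ξ = pol T (fun n => ∑ p ∈ I, ∑ m ∈ s, if p*m = n then b p*a m else 0) ξ := by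
  unfold pol
  rw [sum_mul_sum]
  simp_rw [sum_mul]
  rw [sum_comm (s := T)]
  refine sum_congr rfl fun p hp => ?_
  rw [sum_comm (s := T)]
  refine sum_congr rfl fun m hm => ?_
  simp_rw [ite_mul, zero_mul]
  rw [sum_ite_eq, if_pos (hT p hp m hm), ch_mul ξ (hI p hp) (hs m hm)]
  ring

lemma coeff_le {I s : Finset ℕ} {b a : ℕ → ℂ} {g : ℕ → ℝ} (hI : ∀ p ∈ I, p ≠ 0)
    (hb : ∀ p ∈ I, ‖b p‖ ≤ 1) (ha : ∀ m, ‖a m‖ ≤ g m) (n : ℕ) :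
    ‖∑ p ∈ I, ∑ m ∈ s, (if p*m = n then b p*a m else 0)‖ ≤ ∑ p ∈ I, if p ∣ n then g (n/p) else 0 := by
  refine (norm_sum_le _ _).trans (sum_le_sum fun p hp => ?_)
  have hg : ∀ m, 0 ≤ g m := fun m => (norm_nonneg _).trans (ha m)
  have hp0 := Nat.pos_of_ne_zero (hI p hp)
  split_ifs with h
  · obtain ⟨k, rfl⟩ := h
    have : ∀ m, (if p*m = p*k then b p*a m else 0) = if m = k then b p*a m else 0 := by
      intro m
      by_cases hmk : m = k
      · simp [hmk]
      · rw [if_neg hmk, if_neg]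
        intro h'; exact hmk (Nat.eq_of_mul_eq_mul_left hp0 h')
    simp_rw [this]
    rw [sum_ite_eq', Nat.mul_div_cancel_left _ hp0]
    split_ifs
    · rw [norm_mul]
      have := hb p hp
      have h2 := ha k
      nlinarith [norm_nonneg (a k), norm_nonneg (b p)]
    · simpa using hg k
  · rw [sum_eq_zero, norm_zero]
    intro m _
    rw [if_neg]
    rintro rfl
    exact h (dvd_mul_right _ _)

lemma exists_prod_pol {h : ℕ} (I s : Finset ℕ) (a : ℕ → ℂ) (hI : ∀ p ∈ I, p.Prime) (A B N1 N2 : ℝ) (hA : 0 < A)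
    (hN1 : 0 < N1) (hIA : ∀ p ∈ I, A ≤ p ∧ (p:ℝ) ≤ B) (hs : ∀ m ∈ s, N1 ≤ m ∧ (m:ℝ) ≤ N2) (ha : ∀ m, ‖a m‖ ≤ 1) (l : ℕ) :
    ∃ (T : Finset ℕ) (c : ℕ → ℂ), (∀ n ∈ T, N1*A^l ≤ n ∧ (n:ℝ) ≤ N2*B^l) ∧ (∀ n, ‖c n‖ ≤ rep I l n) ∧
      ∀ ξ : Freq h, (pol I (fun _ => 1) ξ)^l*pol s a ξ = pol T c ξ := by
  induction l with
  | zero => exact ⟨s, a, by simpa using hs, by simpa [rep] using ha, by simp⟩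
  | succ l ih =>
    obtain ⟨T, c, h1, h2, h3⟩ := ih
    have hT0 : ∀ n ∈ T, n ≠ 0 := by
      intro n hn h0
      have := (h1 n hn).1
      rw [h0] at this
      have h' : 0 < N1*A^l := by positivity
      simp at this; linarith
    refine ⟨(I ×ˢ T).image (fun x => x.1*x.2), fun n => ∑ p ∈ I, ∑ m ∈ T, if p*m = n then (fun _ => (1:ℂ)) p*c m else 0, ?_, ?_, ?_⟩
    rotate_left 2
    · intro ξ
      rw [pow_succ', mul_assoc, h3]
      exact pol_mul_pol I T (fun _ => 1) c (fun p hp => (hI p hp).ne_zero) hT0 _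
        (fun p hp m hm => mem_image.2 ⟨(p, m), mem_product.2 ⟨hp, hm⟩, rfl⟩) ξ
    · intro n hn
      obtain ⟨⟨p, m⟩, hpm, rfl⟩ := mem_image.1 hn
      rw [mem_product] at hpm
      have hp := hIA p hpm.1
      have hm := h1 m hpm.2
      push_cast
      constructor
      · calc N1*A^(l+1) = A*(N1*A^l) := by ring
          _ ≤ p*m := mul_le_mul hp.1 hm.1 (by positivity) (by positivity)
      · calc (p:ℝ)*m ≤ B*(N2*B^l) := mul_le_mul hp.2 hm.2 (by positivity) (by linarith)
          _ = _ := by ring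
    · intro n
      refine (coeff_le (g := fun n => (rep I l n : ℝ)) (fun p hp => (hI p hp).ne_zero) (by simp) h2 n).trans ?_
      simp only [rep]
      push_cast
      exact le_refl _

/-- moments of prime polynomials times something -/
lemma moment_bound (h K : ℕ) [NeZero h] (I s : Finset ℕ) (a : ℕ → ℂ) (hI : ∀ p ∈ I, p.Prime)
    (hS : ∑ p ∈ I, (1:ℝ)/p ≤ 1) (A B N1 N2 : ℝ) (hA : 0 < A) (hAB : A ≤ B)
    (hN1 : 0 < N1) (hN12 : N1 ≤ N2) (hIA : ∀ p ∈ I, A ≤ p ∧ (p:ℝ) ≤ B) (hs : ∀ m ∈ s, N1 ≤ m ∧ (m:ℝ) ≤ N2)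
    (ha : ∀ m, ‖a m‖ ≤ 1) (l : ℕ) :
    ∑ ξ ∈ Xi h K, wt K ξ.2*(‖pol I (fun _ => 1) ξ‖^(2*l) * ‖pol s a ξ‖^2) ≤
      h.totient*(4000*(1+log (N2/N1)+l*log (B/A))*(K+1+N2*B^l/h)
        * (N2*B^l*(1+(l:ℝ))^l)) := by
  obtain ⟨T, c, h1, h2, h3⟩ := exists_prod_pol (h := h) I s a hI A B N1 N2 hA hN1 hIA hs ha l
  have hB : 0 < B := by linarith
  have hN2 : 0 < N2 := by linarith
  have e1 : ∑ ξ ∈ Xi h K, wt K ξ.2*(‖pol I (fun _ => 1) ξ‖^(2*l) * ‖pol s a ξ‖^2) = En h K T c := by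
    unfold En
    refine sum_congr rfl fun ξ _ => ?_
    rw [← h3 ξ, norm_mul, norm_pow]; ring
  rw [e1]
  have hm := MVT h K T c (N1*A^l) (N2*B^l) (by positivity) h1
  refine hm.trans ?_
  have e2 : log (N2*B^l/(N1*A^l)) = log (N2/N1)+l*log (B/A) := by
    rw [← log_pow, ← log_mul (by positivity) (by positivity)]
    congr 1
    rw [div_pow]; field_simp
  rw [e2, ← add_assoc]
  have hl1 : 0 ≤ log (N2/N1) := log_nonneg (by rw [le_div_iff₀ hN1]; linarith)
  have hl2 : 0 ≤ log (B/A) := log_nonneg (by rw [le_div_iff₀ hA]; linarith)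
  gcongr
  have hsub : T ⊆ Icc 1 ⌊N2*B^l⌋₊ := by
    intro n hn
    rw [mem_Icc]
    constructor
    · have := (h1 n hn).1
      have h' : 0 < N1*A^l := by positivity
      have : (0:ℝ) < n := by linarith
      exact_mod_cast this
    · exact Nat.le_floor (h1 n hn).2
  calc ∑ n ∈ T, ‖c n‖^2 ≤ ∑ n ∈ T, (rep I l n : ℝ)*rep I l n := by
        refine sum_le_sum fun n _ => ?_
        rw [← sq]
        exact pow_le_pow_left₀ (norm_nonneg _) (h2 n) 2
    _ ≤ ∑ n ∈ Icc 1 ⌊N2*B^l⌋₊, (rep I l n : ℝ)*rep I l n :=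
        sum_le_sum_of_subset_of_nonneg hsub fun _ _ _ => by positivity
    _ ≤ (⌊N2*B^l⌋₊ : ℝ)*(1+(l:ℝ))^l := rep_sum_mul_le I hI hS l l _
    _ ≤ _ := by
        gcongr
        exact Nat.floor_le (by positivity)

/-- integers in (x,y] -/
noncomputable def sg (x y : ℝ) : Finset ℕ := Ioc ⌊x⌋₊ ⌊y⌋₊

lemma mem_sg {x y : ℝ} (hx : 0 ≤ x) (hy : 0 ≤ y) {n : ℕ} : n ∈ sg x y ↔ x < n ∧ (n:ℝ) ≤ y := by
  unfold sg
  rw [mem_Ioc, Nat.floor_lt hx, Nat.le_floor_iff hy]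

lemma card_sg_le {x y : ℝ} (hx : 0 ≤ x) (hxy : x ≤ y) : ((sg x y).card : ℝ) ≤ y - x+1 := by
  unfold sg
  rw [Nat.card_Ioc, Nat.cast_sub (Nat.floor_mono hxy)]
  have := Nat.floor_le (hx.trans hxy)
  have := Nat.lt_floor_add_one x
  linarith

lemma one_sub_ge_rpow {x : ℝ} (h0 : 0 ≤ x) (h1 : x ≤ 1/2) : (4:ℝ)^(-x) ≤ 1 - x := by
  have hc : ConvexOn ℝ Set.univ (fun x : ℝ => (4:ℝ)^x) := convexOn_rpow_left (by norm_num)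
  have h := hc.2 (Set.mem_univ (0:ℝ)) (Set.mem_univ (-(1/2):ℝ))
    (show 0 ≤ 1 - 2*x by linarith) (show 0 ≤ 2*x by linarith) (by ring)
  have e : (4:ℝ)^(-(1/2):ℝ) = 1/2 := by
    rw [rpow_neg (by norm_num), ← Real.sqrt_eq_rpow, show (4:ℝ) = 2^2 by norm_num,
      sqrt_sq (by norm_num)]; norm_num
  simp only [smul_eq_mul] at h
  rw [e, rpow_zero] at h
  have e2 : (1 - 2*x)*0+2*x*(-(1/2)) = -x := by ring
  rw [e2] at h
  linarith

lemma totient_ratio {h : ℕ} (hh : 0 < h) : (4:ℝ)^(-(primeVol h)) ≤ (h.totient : ℝ)/h := by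
  have e : ((h.totient : ℝ))/h = ∏ p ∈ h.primeFactors, (1 - (1:ℝ)/p) := by
    have := Nat.totient_eq_mul_prod_factors h
    have h2 : ((h.totient : ℚ) : ℝ) = ((h * ∏ p ∈ h.primeFactors, (1 - (p:ℚ)⁻¹) : ℚ) : ℝ) := by rw [this]
    push_cast at h2
    rw [h2, mul_div_cancel_left₀ _ (by positivity)]
    simp
  rw [e, primeVol, ← sum_neg_distrib, Real.rpow_sum_of_pos (by norm_num)]
  refine Finset.prod_le_prod (fun _ _ => by positivity) fun p hp => ?_
  have hp2 : (2:ℝ) ≤ p := by exact_mod_cast (Nat.prime_of_mem_primeFactors hp).two_le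
  refine one_sub_ge_rpow (by positivity) ?_
  rw [div_le_div_iff₀ (by linarith) (by norm_num)]; linarith

lemma theta_diff : ∀ᶠ y : ℝ in atTop, y/2 ≤ Chebyshev.theta (3*y) - Chebyshev.theta y := by
  have hl : (fun y : ℝ => log 2+log (3*y+2)+2 * √(3*y)*log (3*y)) =o[atTop] (fun y : ℝ => y) := by
    have h3 : Tendsto (fun y : ℝ => 3*y) atTop atTop := tendsto_id.const_mul_atTop (by norm_num)
    have h32 : Tendsto (fun y : ℝ => 3*y+2) atTop atTop := tendsto_atTop_add_const_right _ _ h3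
    have a1 : (fun y : ℝ => log 2) =o[atTop] (fun y : ℝ => y) :=
      Asymptotics.isLittleO_const_id_atTop _
    have a2 : (fun y : ℝ => log (3*y+2)) =o[atTop] (fun y : ℝ => y) := by
      refine (Real.isLittleO_log_id_atTop.comp_tendsto h32).trans_isBigO ?_
      refine Asymptotics.IsBigO.of_bound 5 ?_
      filter_upwards [eventually_ge_atTop 1] with y hy
      simp only [Function.comp, id, norm_eq_abs]
      rw [abs_of_nonneg (by linarith), abs_of_nonneg (by linarith)]; linarith
    have a3 : (fun y : ℝ => 2 * √(3*y)*log (3*y)) =o[atTop] (fun y : ℝ => y) := by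
      have b := (isLittleO_log_rpow_atTop (r := 1/2) (by norm_num)).comp_tendsto h3
      have b2 : (fun y : ℝ => 2 * √(3*y)*log (3*y)) =o[atTop] (fun y => 2 * √(3*y)*(3*y)^(1/2:ℝ)) :=
        (Asymptotics.isBigO_refl (fun y : ℝ => 2 * √(3*y)) atTop).mul_isLittleO b
      refine b2.trans_isBigO (Asymptotics.IsBigO.of_bound 6 ?_)
      filter_upwards [eventually_ge_atTop 1] with y hy
      rw [← Real.sqrt_eq_rpow, mul_assoc, mul_self_sqrt (by linarith)]
      simp only [norm_eq_abs]
      rw [abs_of_nonneg (by linarith), abs_of_nonneg (by linarith)]; linarith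
    exact (a1.add a2).add a3
  filter_upwards [hl.bound (show (0:ℝ) < 1/10 by norm_num), eventually_ge_atTop 1] with y h1 hy
  have t1 := Chebyshev.theta_ge' (x := 3*y) (by linarith)
  have t2 := Chebyshev.theta_le_log4_mul_x (x := y) (by linarith)
  have e4 : log 4 = 2*log 2 := by
    rw [show (4:ℝ) = 2^2 by norm_num, log_pow]; norm_num
  rw [e4] at t2
  have h2 := le_trans (le_abs_self _) h1
  rw [norm_eq_abs, abs_of_nonneg (by linarith : (0:ℝ) ≤ y)] at h2
  have := Real.log_two_gt_d9
  nlinarith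

noncomputable def PR (x y : ℝ) : Finset ℕ := (sg x y).filter Nat.Prime

lemma mem_PR {x y : ℝ} (hx : 0 ≤ x) (hy : 0 ≤ y) {p : ℕ} : p ∈ PR x y ↔ (x < p ∧ (p:ℝ) ≤ y) ∧ p.Prime := by
  unfold PR
  rw [mem_filter, mem_sg hx hy]

lemma PR_log_sum {x y : ℝ} (hxy : x ≤ y) : ∑ p ∈ PR x y, log p = Chebyshev.theta y - Chebyshev.theta x := by
  unfold Chebyshev.theta PR sg
  have hf := Nat.floor_mono hxy
  rw [eq_sub_iff_add_eq, add_comm, ← sum_union]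
  · rw [← filter_union, Finset.Ioc_union_Ioc_eq_Ioc (Nat.zero_le _) hf]
  · refine Finset.disjoint_filter_filter ?_
    rw [disjoint_left]; intro a; simp only [mem_Ioc]; omega

lemma PR_inv_three : ∀ᶠ y : ℝ in atTop, 1/(6*log (3*y)) ≤ ∑ p ∈ PR y (3*y), (1:ℝ)/p := by
  filter_upwards [theta_diff, eventually_ge_atTop 1] with y h1 hy
  rw [← PR_log_sum (by linarith)] at h1
  have hl : 0 < log (3*y) := log_pos (by linarith)
  have : ∀ p ∈ PR y (3*y), log p ≤ (3*y*log (3*y))*((1:ℝ)/p) := by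
    intro p hp
    rw [mem_PR (by linarith) (by linarith)] at hp
    have hp0 : (0:ℝ) < p := by linarith [hp.1.1]
    rw [mul_one_div, le_div_iff₀ hp0, mul_comm (3*y)]
    have : log p ≤ log (3*y) := log_le_log hp0 hp.1.2
    have h0 : 0 ≤ log p := log_nonneg (by linarith [hp.1.1])
    exact mul_le_mul this hp.1.2 hp0.le hl.le
  have h2 := h1.trans (sum_le_sum this)
  rw [← mul_sum] at h2
  rw [div_le_iff₀ (by positivity)]
  nlinarith

lemma PR_union {M : Type*} [AddCommMonoid M] {x y z : ℝ} (hxy : x ≤ y) (hyz : y ≤ z) (f : ℕ → M) :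
    ∑ p ∈ PR x z, f p = ∑ p ∈ PR x y, f p + ∑ p ∈ PR y z, f p := by
  unfold PR sg
  rw [← sum_union]
  · rw [← filter_union, Finset.Ioc_union_Ioc_eq_Ioc (Nat.floor_mono hxy) (Nat.floor_mono hyz)]
  · refine Finset.disjoint_filter_filter ?_
    rw [disjoint_left]; intro a; simp only [mem_Ioc]; omega

/-- lower bound for sums of reciprocals of primes -/
lemma PR_inv_lower : ∃ t0 : ℝ, 1 ≤ t0 ∧ ∀ t u : ℝ, t0 ≤ t → t+2 ≤ u →
    (u - t)/(16*u) ≤ ∑ p ∈ PR (exp t) (exp u), (1:ℝ)/p := by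
  obtain ⟨y0, hy0⟩ := eventually_atTop.1 PR_inv_three
  refine ⟨max 1 (log (max y0 1)), le_max_left _ _, fun t u ht htu => ?_⟩
  have ht1 : 1 ≤ t := (le_max_left _ _).trans ht
  have hl3 : 0 < log 3 := log_pos (by norm_num)
  have hl3' : log 3 < 11/10 := by
    rw [Real.log_lt_iff_lt_exp (by norm_num)]
    have := Real.exp_one_gt_d9
    have h2 : exp (11/10) = exp 1*exp (1/10) := by rw [← exp_add]; norm_num
    have h3 := add_one_le_exp (1/10:ℝ)
    have h4 := Real.quadratic_le_exp_of_nonneg (show (0:ℝ) ≤ 1/10 by norm_num)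
    rw [h2]; nlinarith
  have key : ∀ n : ℕ, t+n*log 3 ≤ u →
      n/(6*u) ≤ ∑ p ∈ PR (exp t) (exp (t+n*log 3)), (1:ℝ)/p := by
    intro n
    induction n with
    | zero => intro _; simp; exact sum_nonneg fun _ _ => by positivity
    | succ n ih =>
      intro hn
      push_cast at hn ⊢
      have e : exp (t+(n+1)*log 3) = 3*exp (t+n*log 3) := by
        rw [show t+(n+1)*log 3 = log 3+(t+n*log 3) by ring, exp_add,
          exp_log (by norm_num)]
      have hn0 : (0:ℝ) ≤ n*log 3 := by positivity
      rw [PR_union (y := exp (t+n*log 3)) (exp_le_exp.2 (by linarith))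
        (exp_le_exp.2 (by nlinarith))]
      have i := ih (by linarith)
      have hy := hy0 (exp (t+n*log 3)) (by
        have : y0 ≤ exp t := by
          have h1 : log (max y0 1) ≤ t := (le_max_right _ _).trans ht
          rw [Real.log_le_iff_le_exp (by positivity)] at h1
          exact (le_max_left _ _).trans h1
        exact this.trans (exp_le_exp.2 (by linarith)))
      rw [e]
      refine le_trans ?_ (add_le_add i hy)
      rw [add_div]
      gcongr
      · rw [← e, log_exp]; nlinarith
      · rw [← e, log_exp]; linarith
  set n := ⌊(u - t)/log 3⌋₊ with hn
  have h1 : (n:ℝ) ≤ (u - t)/log 3 := Nat.floor_le (by apply div_nonneg <;> linarith)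
  have h2 : (u - t)/log 3 < n+1 := Nat.lt_floor_add_one _
  rw [le_div_iff₀ hl3] at h1
  rw [div_lt_iff₀ hl3] at h2
  have h3 := key n (by linarith)
  have hle : exp (t+n*log 3) ≤ exp u := exp_le_exp.2 (by linarith)
  rw [PR_union (y := exp (t+n*log 3)) (exp_le_exp.2 (by nlinarith [(by positivity : (0:ℝ) ≤ n)])) hle]
  have h4 : 0 ≤ ∑ p ∈ PR (exp (t+n*log 3)) (exp u), (1:ℝ)/p :=
    sum_nonneg fun _ _ => by positivity
  have h5 : (u - t)/(16*u) ≤ n/(6*u) := by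
    rw [div_le_div_iff₀ (by linarith) (by linarith)]
    have hn1 : 1 ≤ n := by
      rw [hn, Nat.one_le_floor_iff, le_div_iff₀ hl3]; linarith
    have hn1' : (1:ℝ) ≤ n := by exact_mod_cast hn1
    have : (u - t)*6 ≤ n*16 := by nlinarith
    nlinarith
  linarith

noncomputable def blk (h V v : ℕ) : Finset ℕ :=
  (PR (exp ((v:ℝ)/V)) (exp (((v:ℝ)+1)/V))).filter (fun p => ¬ p ∣ h)

noncomputable def PP (h V v0 v1 : ℕ) : Finset ℕ :=
  (PR (exp ((v0:ℝ)/V)) (exp ((v1:ℝ)/V))).filter (fun p => ¬ p ∣ h)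

lemma mem_blk {h V v p : ℕ} : p ∈ blk h V v ↔
    (exp ((v:ℝ)/V) < p ∧ (p:ℝ) ≤ exp (((v:ℝ)+1)/V)) ∧ p.Prime ∧ ¬ p ∣ h := by
  unfold blk
  rw [mem_filter, mem_PR (exp_pos _).le (exp_pos _).le]; tauto

lemma mem_PP {h V v0 v1 p : ℕ} : p ∈ PP h V v0 v1 ↔
    (exp ((v0:ℝ)/V) < p ∧ (p:ℝ) ≤ exp ((v1:ℝ)/V)) ∧ p.Prime ∧ ¬ p ∣ h := by
  unfold PP
  rw [mem_filter, mem_PR (exp_pos _).le (exp_pos _).le]; tauto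

lemma sum_blk {M : Type*} [AddCommMonoid M] (h V v0 v1 : ℕ) (hv : v0 ≤ v1) (f : ℕ → M) :
    ∑ v ∈ Ico v0 v1, ∑ p ∈ blk h V v, f p = ∑ p ∈ PP h V v0 v1, f p := by
  induction v1, hv using Nat.le_induction with
  | base => simp [PP, PR, sg]
  | succ n hn ih =>
    rw [Finset.sum_Ico_succ_top hn, ih]
    unfold PP blk
    simp_rw [sum_filter]
    rw [PR_union (y := exp ((n:ℝ)/V)) (z := exp (((n+1:ℕ):ℝ)/V))]
    · push_cast; rfl
    · gcongr
    · push_cast; gcongr; linarith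

/-- number of prime divisors in a set -/
noncomputable def om (P : Finset ℕ) (n : ℕ) : ℝ := ∑ p ∈ P, if p ∣ n then 1 else 0

lemma om_nonneg (P : Finset ℕ) (n : ℕ) : 0 ≤ om P n := by
  unfold om; exact sum_nonneg fun _ _ => by split_ifs <;> norm_num

noncomputable def cnt (h V v0 v1 : ℕ) (X κ : ℝ) (n : ℕ) : ℝ :=
  ∑ v ∈ Ico v0 v1, ∑ p ∈ blk h V v,
    if p ∣ n ∧ n/p ∈ sg (X/exp ((v:ℝ)/V)) ((1+κ)*(X/exp ((v:ℝ)/V))) then 1 else 0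

lemma cnt_nonneg (h V v0 v1 : ℕ) (X κ : ℝ) (n : ℕ) : 0 ≤ cnt h V v0 v1 X κ n := by
  unfold cnt
  exact sum_nonneg fun _ _ => sum_nonneg fun _ _ => by split_ifs <;> norm_num

lemma cnt_le (h V v0 v1 : ℕ) (hv : v0 ≤ v1) (X κ : ℝ) (n : ℕ) : cnt h V v0 v1 X κ n ≤ om (PP h V v0 v1) n := by
  unfold om
  rw [← sum_blk h V v0 v1 hv]
  refine sum_le_sum fun v _ => sum_le_sum fun p _ => ?_
  split_ifs <;> simp_all

lemma cnt_eq (h V v0 v1 : ℕ) (hV : 0 < V) (hv : v0 ≤ v1) (X κ : ℝ) (hX : 0 < X) (hκ : 0 < κ) (n : ℕ)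
    (h1 : X*exp (1/V) < n) (h2 : (n:ℝ) ≤ (1+κ)*X) :
    cnt h V v0 v1 X κ n = om (PP h V v0 v1) n := by
  unfold om
  rw [← sum_blk h V v0 v1 hv]
  refine sum_congr rfl fun v _ => sum_congr rfl fun p hp => ?_
  rw [mem_blk] at hp
  have hE := exp_pos ((v:ℝ)/V)
  have hp0 : (0:ℝ) < p := hE.trans hp.1.1
  by_cases hd : p ∣ n
  · rw [if_pos hd, if_pos]
    refine ⟨hd, ?_⟩
    obtain ⟨m, rfl⟩ := hd
    rw [Nat.mul_div_cancel_left _ (by exact_mod_cast hp0), mem_sg (by positivity) (by positivity)]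
    push_cast at h1 h2
    constructor
    · rw [div_lt_iff₀ hE]
      have e : exp (((v:ℝ)+1)/V) = exp ((v:ℝ)/V)*exp (1/V) := by
        rw [← exp_add]; congr 1; ring
      have h3 : (p:ℝ)*m ≤ (exp ((v:ℝ)/V)*exp (1/V))*m := by
        rw [← e]; gcongr; exact hp.1.2
      have h4 := exp_pos (1/(V:ℝ))
      have h5 : X*exp (1/V) < (m*exp ((v:ℝ)/V))*exp (1/V) := by nlinarith
      exact lt_of_mul_lt_mul_right h5 h4.le
    · rw [← mul_div_assoc, le_div_iff₀ hE]
      have : (m:ℝ)*exp ((v:ℝ)/V) ≤ m*p := by gcongr; exact hp.1.1.le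
      linarith [mul_comm (m:ℝ) p]
  · rw [if_neg hd, if_neg (fun h => hd h.1)]

lemma pol_cnt (h V v0 v1 : ℕ) (hV : 0 < V) (X κ : ℝ) (hX : 0 < X) (hκ : 0 < κ) (ξ : Freq h) :
    ∑ v ∈ Ico v0 v1, pol (blk h V v) (fun _ => 1) ξ *
      pol (sg (X/exp ((v:ℝ)/V)) ((1+κ)*(X/exp ((v:ℝ)/V)))) (fun m => (liouville m : ℂ)) ξ
    = - pol (sg X ((1+κ)*X*exp (1/V))) (fun n => ((liouville n*cnt h V v0 v1 X κ n : ℝ) : ℂ)) ξ := by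
  have hsg : ∀ v : ℕ, ∀ m ∈ sg (X/exp ((v:ℝ)/V)) ((1+κ)*(X/exp ((v:ℝ)/V))), m ≠ 0 := by
    intro v m hm h0
    rw [mem_sg (by positivity) (by positivity), h0] at hm
    have : 0 < X/exp ((v:ℝ)/V) := by positivity
    simp at hm; linarith [hm.1]
  have e1 : ∀ v ∈ Ico v0 v1, pol (blk h V v) (fun _ => 1) ξ *
      pol (sg (X/exp ((v:ℝ)/V)) ((1+κ)*(X/exp ((v:ℝ)/V)))) (fun m => (liouville m : ℂ)) ξ =
      pol (sg X ((1+κ)*X*exp (1/V))) (fun n => ∑ p ∈ blk h V v,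
        ∑ m ∈ sg (X/exp ((v:ℝ)/V)) ((1+κ)*(X/exp ((v:ℝ)/V))), if p*m = n then (fun _ => (1:ℂ)) p*(liouville m : ℂ) else 0) ξ := by
    intro v _
    refine pol_mul_pol _ _ _ _ (fun p hp => (mem_blk.1 hp).2.1.ne_zero) (hsg v) _ ?_ ξ
    intro p hp m hm
    rw [mem_blk] at hp
    rw [mem_sg (by positivity) (by positivity)] at hm ⊢
    have hE := exp_pos ((v:ℝ)/V)
    have e : exp (((v:ℝ)+1)/V) = exp ((v:ℝ)/V)*exp (1/V) := by
      rw [← exp_add]; congr 1; ring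
    have hp0 : (0:ℝ) < p := hE.trans hp.1.1
    push_cast
    have hd : X/exp ((v:ℝ)/V)*exp ((v:ℝ)/V) = X := by field_simp
    constructor
    · calc X = exp ((v:ℝ)/V)*(X/exp ((v:ℝ)/V)) := by rw [mul_comm, hd]
        _ < p*m := mul_lt_mul hp.1.1 hm.1.le (by positivity) hp0.le
    · calc (p:ℝ)*m ≤ (exp ((v:ℝ)/V)*exp (1/V))*((1+κ)*(X/exp ((v:ℝ)/V))) := by
            rw [← e]; exact mul_le_mul hp.1.2 hm.2 (by positivity) (by positivity)
        _ = (1+κ)*(X/exp ((v:ℝ)/V)*exp ((v:ℝ)/V))*exp (1/V) := by ring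
        _ = _ := by rw [hd]
  rw [sum_congr rfl e1]
  unfold pol
  rw [sum_comm, ← sum_neg_distrib]
  refine sum_congr rfl fun n _ => ?_
  rw [← sum_mul, ← neg_mul]
  congr 1
  unfold cnt
  push_cast
  rw [mul_sum, ← sum_neg_distrib]
  refine sum_congr rfl fun v _ => ?_
  rw [mul_sum, ← sum_neg_distrib]
  refine sum_congr rfl fun p hp => ?_
  have hpp := (mem_blk.1 hp).2.1
  by_cases hd : p ∣ n
  · obtain ⟨k, rfl⟩ := hd
    have : ∀ m, (if p*m = p*k then (1:ℂ)*(liouville m:ℂ) else 0) = if m = k then (liouville m : ℂ) else 0 := by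
      intro m
      by_cases hmk : m = k
      · simp [hmk]
      · rw [if_neg hmk, if_neg]
        intro h'; exact hmk (Nat.eq_of_mul_eq_mul_left hpp.pos h')
    simp_rw [this]
    rw [sum_ite_eq', Nat.mul_div_cancel_left _ hpp.pos]
    by_cases hk : k ∈ sg (X/exp ((v:ℝ)/V)) ((1+κ)*(X/exp ((v:ℝ)/V)))
    · rw [if_pos hk, if_pos ⟨dvd_mul_right _ _, hk⟩, lio_mul hpp.ne_zero (hsg v k hk), lio_prime hpp]
      push_cast; ring
    · rw [if_neg hk, if_neg (fun h => hk h.2)]; simp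
  · rw [if_neg (fun h => hd h.1), sum_eq_zero]
    · simp
    · intro m _
      rw [if_neg]
      rintro rfl
      exact hd (dvd_mul_right _ _)

/-- the coefficient of the difference between the interval and its factored approximation -/
noncomputable def gco (h V v0 v1 : ℕ) (X κ W : ℝ) (n : ℕ) : ℝ :=
  (if (n:ℝ) ≤ (1+κ)*X then 1 else 0) - cnt h V v0 v1 X κ n/W

lemma pol_approx (h V v0 v1 : ℕ) (hV : 0 < V) (X κ W : ℝ) (hX : 0 < X) (hκ : 0 < κ) (ξ : Freq h) :
    pol (sg X ((1+κ)*X)) (fun n => (liouville n : ℂ)) ξ =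
      -(1/W : ℝ) * ∑ v ∈ Ico v0 v1, pol (blk h V v) (fun _ => 1) ξ *
      pol (sg (X/exp ((v:ℝ)/V)) ((1+κ)*(X/exp ((v:ℝ)/V)))) (fun m => (liouville m : ℂ)) ξ
      + pol (sg X ((1+κ)*X*exp (1/V))) (fun n => ((liouville n*gco h V v0 v1 X κ W n : ℝ) : ℂ)) ξ := by
  rw [pol_cnt h V v0 v1 hV X κ hX hκ]
  have e1 : (1:ℝ) ≤ exp (1/V) := one_le_exp (by positivity)
  have hsub : sg X ((1+κ)*X) ⊆ sg X ((1+κ)*X*exp (1/V)) := by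
    intro n hn
    rw [mem_sg (by positivity) (by positivity)] at hn ⊢
    refine ⟨hn.1, hn.2.trans ?_⟩
    have : 0 < (1+κ)*X := by positivity
    nlinarith
  unfold pol
  rw [neg_mul_neg, mul_sum, ← sum_add_distrib]
  have e2 : ∑ n ∈ sg X ((1+κ)*X), (liouville n : ℂ)*ch ξ n =
      ∑ n ∈ sg X ((1+κ)*X*exp (1/V)), (if (n:ℝ) ≤ (1+κ)*X then (1:ℂ) else 0)*((liouville n : ℂ)*ch ξ n) := by
    rw [← sum_subset hsub]
    · refine sum_congr rfl fun n hn => ?_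
      rw [mem_sg (by positivity) (by positivity)] at hn
      rw [if_pos hn.2, one_mul]
    · intro n hn hn'
      rw [mem_sg (by positivity) (by positivity)] at hn hn'
      rw [if_neg, zero_mul]; tauto
  rw [e2]
  refine sum_congr rfl fun n _ => ?_
  unfold gco
  by_cases hn : (n:ℝ) ≤ (1+κ)*X
  · simp only [if_pos hn]; push_cast; ring
  · simp only [if_neg hn]; push_cast; ring

lemma gco_main (h V v0 v1 : ℕ) (hV : 0 < V) (hv : v0 ≤ v1) (X κ W : ℝ) (hX : 0 < X) (hκ : 0 < κ) (n : ℕ)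
    (h1 : X*exp (1/V) < n) (h2 : (n:ℝ) ≤ (1+κ)*X) :
    gco h V v0 v1 X κ W n = 1 - om (PP h V v0 v1) n/W := by
  unfold gco
  rw [if_pos h2, cnt_eq h V v0 v1 hV hv X κ hX hκ n h1 h2]

lemma gco_abs (h V v0 v1 : ℕ) (hv : v0 ≤ v1) (X κ W : ℝ) (hW : 0 < W) (n : ℕ) :
    |gco h V v0 v1 X κ W n| ≤ 1 + |1 - om (PP h V v0 v1) n/W| := by
  have h1 := cnt_le h V v0 v1 hv X κ n
  have h0 := cnt_nonneg h V v0 v1 X κ n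
  have h2 : cnt h V v0 v1 X κ n/W ≤ om (PP h V v0 v1) n/W := by gcongr
  have h3 : 0 ≤ cnt h V v0 v1 X κ n/W := by positivity
  have h4 := neg_abs_le (1 - om (PP h V v0 v1) n/W)
  have h5 := abs_nonneg (1 - om (PP h V v0 v1) n/W)
  unfold gco
  rw [abs_le]
  split_ifs <;> constructor <;> linarith

/-- edge set -/
noncomputable def edg (V : ℕ) (X κ : ℝ) : Finset ℕ :=
  sg X (X*exp (1/V)) ∪ sg ((1+κ)*X) ((1+κ)*X*exp (1/V))

lemma edg_card (V : ℕ) (hV : 0 < V) (X κ : ℝ) (hX : 0 < X) (hκ : 0 < κ) (hκ1 : κ ≤ 1) :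
    ((edg V X κ).card : ℝ) ≤ 6*X/V+2 := by
  have e1 : (1:ℝ) ≤ exp (1/V) := one_le_exp (by positivity)
  have hV1 : (1:ℝ) ≤ V := by exact_mod_cast hV
  have hv1 : (1:ℝ)/V ≤ 1 := by rw [div_le_one (by positivity)]; exact hV1
  have e2 : exp (1/V) ≤ 1+2*(1/V) := by
    have := Real.abs_exp_sub_one_le (x := 1/V) (by rw [abs_of_nonneg (by positivity)]; exact hv1)
    rw [abs_of_nonneg (by linarith), abs_of_nonneg (by positivity)] at this
    linarith
  have hX' : X ≤ X*exp (1/V) := by nlinarith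
  have hX2 : 0 < (1+κ)*X := by positivity
  have hX2' : (1+κ)*X ≤ (1+κ)*X*exp (1/V) := by nlinarith
  have c1 := card_sg_le hX.le hX'
  have c2 := card_sg_le hX2.le hX2'
  have c3 : ((edg V X κ).card : ℝ) ≤ (sg X (X*exp (1/V))).card+(sg ((1+κ)*X) ((1+κ)*X*exp (1/V))).card := by
    exact_mod_cast Finset.card_union_le _ _
  have h6 : 6*X/V = 6*X*(1/V) := by ring
  have h7 : X*(exp (1/V) - 1) ≤ X*(2*(1/V)) := by gcongr; linarith
  have h8 : κ * (X*(exp (1/V) - 1)) ≤ X*(2*(1/V)) := by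
    have : 0 ≤ X*(exp (1/V) - 1) := by apply mul_nonneg hX.le; linarith
    nlinarith
  rw [h6]; nlinarith

lemma not_edg {V : ℕ} {X κ : ℝ} (hX : 0 < X) (hκ : 0 < κ) {n : ℕ} (hn : n ∈ sg X ((1+κ)*X*exp (1/V)))
    (hn' : n ∉ edg V X κ) : X*exp (1/V) < n ∧ (n:ℝ) ≤ (1+κ)*X := by
  unfold edg at hn'
  rw [mem_union, mem_sg (by positivity) (by positivity), mem_sg (by positivity) (by positivity)] at hn'
  rw [mem_sg (by positivity) (by positivity)] at hn
  push Not at hn'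
  constructor
  · by_contra hc; push Not at hc; exact absurd hc (not_le.2 (hn'.1 hn.1))
  · by_contra hc; push Not at hc; exact absurd hn.2 (not_le.2 (hn'.2 hc))

lemma sg_dvd_count {A B : ℝ} (hA : 0 ≤ A) (hAB : A ≤ B) (d : ℕ) (hd : 0 < d) :
    |(((sg A B).filter (d ∣ ·)).card : ℝ) - (B - A)/d| ≤ 1 := by
  have hf := Nat.floor_mono hAB
  have e : ((sg A B).filter (d ∣ ·)).card = ⌊B⌋₊/d - ⌊A⌋₊/d := by
    have h1 := Nat.Ioc_filter_dvd_card_eq_div ⌊B⌋₊ d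
    have h2 := Nat.Ioc_filter_dvd_card_eq_div ⌊A⌋₊ d
    rw [← Finset.Ioc_union_Ioc_eq_Ioc (Nat.zero_le _) hf, filter_union, Finset.card_union_of_disjoint, h2] at h1
    · unfold sg; omega
    · refine Finset.disjoint_filter_filter ?_
      rw [disjoint_left]; intro a; simp only [mem_Ioc]; omega
  rw [e, ← Nat.floor_div_natCast, ← Nat.floor_div_natCast, Nat.cast_sub (Nat.floor_mono (by gcongr))]
  have a1 := Nat.floor_le (show 0 ≤ A/d by positivity)
  have a2 := Nat.lt_floor_add_one (A/d)
  have a3 := Nat.floor_le (show 0 ≤ B/d by have := hA.trans hAB; positivity)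
  have a4 := Nat.lt_floor_add_one (B/d)
  rw [sub_div, abs_le]
  constructor <;> linarith

/-- Turan-Kubilius -/
lemma turan_kubilius (P : Finset ℕ) (hP : ∀ p ∈ P, p.Prime) {A B : ℝ} (hA : 0 ≤ A) (hAB : A ≤ B) :
    ∑ n ∈ sg A B, (om P n - ∑ p ∈ P, (1:ℝ)/p)^2 ≤ (B - A) * ∑ p ∈ P, (1:ℝ)/p+4*(P.card:ℝ)^2 := by
  set W := ∑ p ∈ P, (1:ℝ)/p with hW
  have hW0 : 0 ≤ W := sum_nonneg fun _ _ => by positivity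
  have hWc : W ≤ P.card := by
    rw [hW, card_eq_sum_ones]; push_cast
    refine sum_le_sum fun p hp => ?_
    have : (1:ℝ) ≤ p := by exact_mod_cast (hP p hp).one_le
    rw [div_le_one (by linarith)]; exact this
  have s1 : (B - A)*W - P.card ≤ ∑ n ∈ sg A B, om P n := by
    unfold om
    rw [sum_comm, hW, mul_sum, card_eq_sum_ones]
    push_cast
    rw [← sum_sub_distrib]
    refine sum_le_sum fun p hp => ?_
    rw [← sum_filter, sum_const, nsmul_eq_mul, mul_one]
    have := (abs_le.1 (sg_dvd_count hA hAB p (hP p hp).pos)).1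
    rw [mul_one_div]; linarith
  have s2 : ∑ n ∈ sg A B, (om P n)^2 ≤ (B - A)*(W^2+W)+(P.card:ℝ)^2 := by
    have e : ∀ n, (om P n)^2 = ∑ p ∈ P, ∑ q ∈ P, if p ∣ n ∧ q ∣ n then (1:ℝ) else 0 := by
      intro n
      unfold om
      rw [sq, sum_mul_sum]
      refine sum_congr rfl fun p _ => sum_congr rfl fun q _ => ?_
      by_cases h1 : p ∣ n <;> by_cases h2 : q ∣ n <;> simp [h1, h2]
    simp_rw [e]
    rw [sum_comm]
    have b : ∀ p ∈ P, ∑ n ∈ sg A B, ∑ q ∈ P, (if p ∣ n ∧ q ∣ n then (1:ℝ) else 0) ≤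
        (B - A)*(1/p*W)+(B - A)*(1/p)+P.card := by
      intro p hp
      rw [sum_comm]
      have b2 : ∀ q ∈ P, ∑ n ∈ sg A B, (if p ∣ n ∧ q ∣ n then (1:ℝ) else 0) ≤
          (B - A)*(1/p*(1/q))+(if p = q then (B - A)*(1/p) else 0)+1 := by
        intro q hq
        rw [← sum_filter, sum_const, nsmul_eq_mul, mul_one]
        have hBA : 0 ≤ B - A := by linarith
        by_cases hpq : p = q
        · subst hpq
          simp only [and_self, if_true]
          have := (abs_le.1 (sg_dvd_count hA hAB p (hP p hp).pos)).2
          have h3 : 0 ≤ (B - A)*(1/p*(1/(p:ℝ))) := by positivity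
          rw [mul_one_div (B - A) (p:ℝ)]; linarith
        · have hc : Nat.Coprime p q := (Nat.coprime_primes (hP p hp) (hP q hq)).2 hpq
          have := (abs_le.1 (sg_dvd_count hA hAB (p*q) (Nat.mul_pos (hP p hp).pos (hP q hq).pos))).2
          have e2 : (sg A B).filter (fun n => p ∣ n ∧ q ∣ n) = (sg A B).filter (fun n => p*q ∣ n) := by
            refine Finset.filter_congr fun n _ => ?_
            exact ⟨fun h => hc.mul_dvd_of_dvd_of_dvd h.1 h.2, fun h => ⟨dvd_of_mul_right_dvd h, dvd_of_mul_left_dvd h⟩⟩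
          rw [e2, if_neg hpq]
          push_cast at this
          rw [one_div_mul_one_div, mul_one_div]; linarith
      refine (sum_le_sum b2).trans ?_
      rw [sum_add_distrib, sum_add_distrib, sum_ite_eq, if_pos hp, ← mul_sum, ← mul_sum, ← hW]
      simp
    refine (sum_le_sum b).trans ?_
    rw [sum_add_distrib, sum_add_distrib, ← mul_sum, ← mul_sum, ← sum_mul]
    simp only [sum_const, nsmul_eq_mul]
    rw [← hW]
    nlinarith
  have s3 := card_sg_le hA hAB
  have e3 : ∑ n ∈ sg A B, (om P n - W)^2 = ∑ n ∈ sg A B, (om P n)^2 - 2*W * ∑ n ∈ sg A B, om P n+(sg A B).card*W^2 := by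
    rw [mul_sum, ← sum_sub_distrib, ← nsmul_eq_mul, ← sum_const, ← sum_add_distrib]
    refine sum_congr rfl fun n _ => by ring
  rw [e3]
  have h4 : 2*W*((B - A)*W - P.card) ≤ 2*W * ∑ n ∈ sg A B, om P n := by gcongr
  have h5 : ((sg A B).card:ℝ)*W^2 ≤ (B - A+1)*W^2 := by gcongr
  have h6 : W^2 ≤ (P.card:ℝ)^2 := by gcongr
  have h7 : W*P.card ≤ (P.card:ℝ)^2 := by rw [sq]; gcongr
  nlinarith

lemma exp_inv_le (V : ℕ) (hV : 0 < V) : exp (1/V) ≤ 1+2*(1/V) := by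
  have e1 : (1:ℝ) ≤ exp (1/V) := one_le_exp (by positivity)
  have hV1 : (1:ℝ) ≤ V := by exact_mod_cast hV
  have hv1 : (1:ℝ)/V ≤ 1 := by rw [div_le_one (by positivity)]; exact hV1
  have := Real.abs_exp_sub_one_le (x := 1/V) (by rw [abs_of_nonneg (by positivity)]; exact hv1)
  rw [abs_of_nonneg (by linarith), abs_of_nonneg (by positivity)] at this
  linarith

lemma exp_add_one_div (V v : ℕ) : exp (((v:ℝ)+1)/V) = exp ((v:ℝ)/V)*exp (1/V) := by
  rw [← exp_add]; congr 1; ring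

lemma blk_inv_le (h V v : ℕ) (hV : 4 ≤ V) (hv : V^2 ≤ v) : ∑ p ∈ blk h V v, (1:ℝ)/p ≤ 1 := by
  have hV' : (4:ℝ) ≤ V := by exact_mod_cast hV
  have hE := exp_pos ((v:ℝ)/V)
  have h1 : ∀ p ∈ blk h V v, (1:ℝ)/p ≤ 1/exp ((v:ℝ)/V) := by
    intro p hp
    rw [mem_blk] at hp
    exact one_div_le_one_div_of_le hE hp.1.1.le
  refine (sum_le_sum h1).trans ?_
  rw [sum_const, nsmul_eq_mul, mul_one_div, div_le_one hE]
  have hc : (blk h V v).card ≤ (sg (exp ((v:ℝ)/V)) (exp (((v:ℝ)+1)/V))).card :=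
    card_le_card ((filter_subset _ _).trans (filter_subset _ _))
  have hc' : ((blk h V v).card : ℝ) ≤ (sg (exp ((v:ℝ)/V)) (exp (((v:ℝ)+1)/V))).card := by exact_mod_cast hc
  have h2 := card_sg_le hE.le (y := exp (((v:ℝ)+1)/V)) (exp_le_exp.2 (by gcongr; linarith))
  refine hc'.trans (h2.trans ?_)
  have h3 := exp_inv_le V (by omega)
  rw [exp_add_one_div]
  have h4 : (1:ℝ)/V ≤ 1/4 := by apply one_div_le_one_div_of_le <;> linarith
  have h5 : 2 ≤ exp ((v:ℝ)/V) := by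
    have : (4:ℝ) ≤ (v:ℝ)/V := by
      rw [le_div_iff₀ (by linarith)]
      have : ((V^2:ℕ):ℝ) ≤ v := by exact_mod_cast hv
      push_cast at this; nlinarith
    linarith [add_one_le_exp ((v:ℝ)/V)]
  nlinarith

/-- Rv -/
noncomputable def Rv {h : ℕ} (X κ : ℝ) (V v : ℕ) (ξ : Freq h) : ℂ :=
  pol (sg (X/exp ((v:ℝ)/V)) ((1+κ)*(X/exp ((v:ℝ)/V)))) (fun m => (liouville m : ℂ)) ξ

noncomputable def Pv {h : ℕ} (V v : ℕ) (ξ : Freq h) : ℂ := pol (blk h V v) (fun _ => 1) ξ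

noncomputable def rho (h : ℕ) : ℝ := (h.totient : ℝ)/h

lemma rho_nonneg (h : ℕ) : 0 ≤ rho h := by unfold rho; positivity

lemma log_two_pow (b : ℕ) : log ((2:ℝ)^b) ≤ b*(7/10) := by
  rw [log_pow]; gcongr; linarith [log_two_lt_d9]

/-- generic moment estimate -/
lemma gen_moment (h K b r : ℕ) [NeZero h] (s : Finset ℕ) (a : ℕ → ℂ) (α T M : ℝ) (hb : 2 ≤ b)
    (hr0 : (2^b)^2 ≤ r) (hr1 : r < (2^b)^3) (hα0 : 0 ≤ α) (hα1 : α ≤ 1) (hT0 : ((2:ℝ)^b)^3 ≤ T) (hT1 : T ≤ ((2:ℝ)^b)^9)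
    (hM : 0 < M) (hs : ∀ m ∈ s, M ≤ m ∧ (m:ℝ) ≤ 2*M) (ha : ∀ m, ‖a m‖ ≤ 1) (hK : (K:ℝ)+1 ≤ 2*M*exp T/h) :
    ∃ l : ℕ, ∑ ξ ∈ Xi h K, wt K ξ.2*((‖Pv (2^b) r ξ‖ / exp ((1-α)*((r:ℝ)/(2^b)))) ^ (2*l) * ‖pol s a ξ‖^2) ≤
      rho h*M^2*exp (2*α*T+20*b*T/2^b) := by
  set z : ℝ := (2:ℝ)^b with hz
  have hz4 : 4 ≤ z := by
    calc (4:ℝ) = 2^2 := by norm_num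
      _ ≤ 2^b := pow_le_pow_right₀ (by norm_num) hb
  have hr0' : z^2 ≤ r := by rw [hz]; exact_mod_cast hr0
  have hr1' : (r:ℝ) < z^3 := by rw [hz]; exact_mod_cast hr1
  have hrz0 : z ≤ r/z := by rw [le_div_iff₀ (by linarith)]; nlinarith
  have hrz1 : r/z ≤ z^2 := by rw [div_le_iff₀ (by linarith)]; nlinarith
  have hrz : 0 < (r:ℝ)/z := by linarith
  have hT : 0 < T := by have : 0 < z^3 := by positivity
                        linarith
  have hTz : z^2 ≤ T/z := by rw [le_div_iff₀ (by linarith)]; nlinarith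
  set l := ⌈T/(r/z)⌉₊ with hl
  have hl0 : T/(r/z) ≤ l := Nat.le_ceil _
  have hl1 : (l:ℝ) < T/(r/z)+1 := Nat.ceil_lt_add_one (by positivity)
  have hlr0 : T ≤ l*(r/z) := by rwa [div_le_iff₀ hrz] at hl0
  have hlr1 : l*(r/z) ≤ T+r/z := by
    have : (l - 1)*(r/z) ≤ T := by rw [← le_div_iff₀ hrz]; linarith
    linarith
  have hlT : (l:ℝ) ≤ T/z+1 := by
    have : T/(r/z) ≤ T/z := by gcongr
    linarith
  refine ⟨l, ?_⟩
  have hmb := moment_bound h K (blk h (2^b) r) s a (fun p hp => (mem_blk.1 hp).2.1)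
    (blk_inv_le h (2^b) r (by
      calc 4 = 2^2 := by norm_num
        _ ≤ 2^b := Nat.pow_le_pow_right (by norm_num) hb) hr0) (exp (r/z)) (exp ((r+1)/z)) M (2*M) (exp_pos _)
    (exp_le_exp.2 (by gcongr; linarith)) hM (by linarith)
    (fun p hp => by
      have := (mem_blk.1 hp).1
      push_cast at this
      exact ⟨this.1.le, this.2⟩) hs ha l
  have e1 : ∀ ξ : Freq h, wt K ξ.2*((‖Pv (2^b) r ξ‖ / exp ((1-α)*((r:ℝ)/z))) ^ (2*l) * ‖pol s a ξ‖^2)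
      = (1/exp ((1-α)*((r:ℝ)/z)) ^ (2*l))*(wt K ξ.2*(‖pol (blk h (2^b) r) (fun _ => 1) ξ‖^(2*l) * ‖pol s a ξ‖^2)) := by
    intro ξ
    rw [div_pow, Pv]; ring
  simp_rw [e1]
  rw [← mul_sum]
  refine (mul_le_mul_of_nonneg_left hmb (by positivity)).trans ?_
  have hh : (0:ℝ) < h := by exact_mod_cast Nat.pos_of_ne_zero (NeZero.ne h)
  have elog1 : log (2*M/M) ≤ 1 := by
    rw [mul_div_cancel_right₀ _ hM.ne']; linarith [log_two_lt_d9]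
  have elog2 : log (exp ((r+1)/z)/exp (r/z)) = 1/z := by
    rw [← exp_sub, log_exp]; ring
  rw [elog2]
  have hz1 : 1/z ≤ 1 := by rw [div_le_one (by linarith)]; linarith
  set B := exp ((r+1)/z) with hB
  have hBl : exp T ≤ B^l := by
    rw [hB, ← exp_nat_mul]
    apply exp_le_exp.2
    refine hlr0.trans ?_
    gcongr; linarith
  have hK2 : (K:ℝ)+1+2*M*B^l/h ≤ 4*M*B^l/h := by
    have : 2*M*exp T/h ≤ 2*M*B^l/h := by gcongr
    have e : 4*M*B^l/h = 2*M*B^l/h+2*M*B^l/h := by ring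
    linarith
  have hlz : (l:ℝ)*(1/z) ≤ l := by
    have : (0:ℝ) ≤ l := by positivity
    nlinarith
  calc 1/exp ((1-α)*(r/z)) ^ (2*l)*(h.totient*(4000*(1+log (2*M/M)+l*(1/z))*(K+1+2*M*B^l/h)*(2*M*B^l*(1+(l:ℝ))^l)))
      ≤ 1/exp ((1-α)*(r/z)) ^ (2*l)*(h.totient*(4000*(2+l)*(4*M*B^l/h)*(2*M*B^l*(2+(l:ℝ))^l))) := by
        have : (1:ℝ)+l ≤ 2+l := by linarith
        gcongr
        · linarith
    _ = rho h*M^2*(32000*(2+(l:ℝ))^(l+1)*(B^(2*l)/exp ((1-α)*(r/z)) ^ (2*l))) := by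
        unfold rho; rw [pow_succ]; ring
    _ ≤ rho h*M^2*exp (2*α*T+20*b*T/z) := by
        have hrho := rho_nonneg h
        gcongr
        have i1 : (32000:ℝ) ≤ exp 11 := by
          have e : exp 11 = (exp 1)^11 := by rw [← exp_nat_mul]; norm_num
          rw [e]
          calc (32000:ℝ) ≤ 2.7^11 := by norm_num
            _ ≤ _ := by gcongr; linarith [Real.exp_one_gt_d9]
        have hb2 : (2:ℝ) ≤ b := by exact_mod_cast hb
        have i2 : (2+(l:ℝ))^(l+1) ≤ exp (2*(T/z)*(7*b)) := by
          have l2 : 2+(l:ℝ) ≤ z^9 := by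
            have : T/z ≤ z^8 := by rw [div_le_iff₀ (by linarith)]; linarith [pow_succ z 8]
            have h8 : 1 ≤ z^8 := one_le_pow₀ (by linarith)
            have : z^9 = z^8*z := pow_succ z 8
            nlinarith
          have l3 : log (2+l) ≤ 7*b := by
            calc log (2+l) ≤ log (z^9) := log_le_log (by positivity) l2
              _ = 9*log z := by rw [log_pow]; norm_num
              _ ≤ 9*(b*(7/10)) := by gcongr; exact log_two_pow b
              _ ≤ 7*b := by linarith
          have l4 : ((l+1:ℕ):ℝ) ≤ 2*(T/z) := by push_cast; nlinarith
          calc (2+(l:ℝ))^(l+1) = exp ((l+1:ℕ)*log (2+l)) := by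
                rw [exp_nat_mul, exp_log (by positivity)]
            _ ≤ _ := by
                apply exp_le_exp.2
                have : 0 ≤ log (2+l) := log_nonneg (by linarith [(by positivity : (0:ℝ) ≤ l)])
                gcongr
        have i3 : B^(2*l)/exp ((1-α)*(r/z)) ^ (2*l) ≤ exp (2*α*T+2*(T/z)+T/z) := by
          rw [hB, ← exp_nat_mul, ← exp_nat_mul, ← exp_sub]
          apply exp_le_exp.2
          push_cast
          have e : 2*(l:ℝ)*((r+1)/z) - 2*l*((1-α)*(r/z)) = 2*α*(l*(r/z))+2*l/z := by ring
          rw [e]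
          have j1 : 2*α*(l*(r/z)) ≤ 2*α*(T+r/z) := by gcongr
          have j2 : α*(r/z) ≤ 1*(T/z) := by
            apply mul_le_mul hα1 (by linarith) hrz.le (by norm_num)
          have j3 : 2*(l:ℝ)/z ≤ T/z := by
            gcongr
            have : T/z ≤ T/4 := by gcongr
            have : (16:ℝ) ≤ T := by nlinarith
            linarith
          linarith
        calc 32000*(2+(l:ℝ))^(l+1)*(B^(2*l)/exp ((1-α)*(r/z)) ^ (2*l))
            ≤ exp 11*exp (2*(T/z)*(7*b))*exp (2*α*T+2*(T/z)+T/z) := by gcongr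
          _ = exp (11+2*(T/z)*(7*b)+(2*α*T+2*(T/z)+T/z)) := by
            rw [exp_add (11+2*(T/z)*(7*b)), exp_add 11]
          _ ≤ _ := by
            apply exp_le_exp.2
            have e : 20*b*T/z = 20*b*(T/z) := by ring
            rw [e]
            have : 16 ≤ T/z := by nlinarith
            nlinarith

lemma exp_sq_div (b : ℕ) : ((((2^b)^2 : ℕ) : ℝ))/((2^b : ℕ) : ℝ) = (2:ℝ)^b := by
  push_cast; field_simp

lemma exp_cube_div (b : ℕ) : ((((2^b)^3 : ℕ) : ℝ))/((2^b : ℕ) : ℝ) = ((2:ℝ)^b)^2 := by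
  push_cast; field_simp

noncomputable def Wb (h b : ℕ) : ℝ := ∑ p ∈ PP h (2^b) ((2^b)^2) ((2^b)^3), (1:ℝ)/p

lemma sum_not_dvd_ge (s : Finset ℕ) (hs : ∀ p ∈ s, p.Prime) (h : ℕ) (hh : 0 < h) :
    ∑ p ∈ s, (1:ℝ)/p - primeVol h ≤ ∑ p ∈ s.filter (fun p => ¬ p ∣ h), (1:ℝ)/p := by
  rw [← Finset.sum_filter_add_sum_filter_not s (fun p => p ∣ h)]
  have : ∑ p ∈ s.filter (fun p => p ∣ h), (1:ℝ)/p ≤ primeVol h := by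
    unfold primeVol
    refine sum_le_sum_of_subset_of_nonneg ?_ (fun _ _ _ => by positivity)
    intro p hp
    rw [mem_filter] at hp
    rw [Nat.mem_primeFactors]
    exact ⟨hs p hp.1, hp.2, hh.ne'⟩
  linarith

lemma Wb_lower : ∃ b1 : ℕ, ∀ b ≥ b1, ∀ h : ℕ, 0 < h → (b:ℝ)/32 - primeVol h ≤ Wb h b := by
  obtain ⟨t0, ht0, H⟩ := PR_inv_lower
  obtain ⟨b1, hb1⟩ := pow_unbounded_of_one_lt (t0+2) (show (1:ℝ) < 2 by norm_num)
  refine ⟨b1, fun b hb h hh => ?_⟩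
  have hz : t0+2 ≤ (2:ℝ)^b := hb1.le.trans (pow_le_pow_right₀ (by norm_num) hb)
  set z := (2:ℝ)^b with hzd
  have key : ∀ n : ℕ, (n:ℝ)/32 ≤ ∑ p ∈ PR (exp z) (exp (z*2^n)), (1:ℝ)/p := by
    intro n
    induction n with
    | zero => simp; exact sum_nonneg fun _ _ => by positivity
    | succ n ih =>
      have h1 : (1:ℝ) ≤ 2^n := one_le_pow₀ (by norm_num)
      have h2 : z ≤ z*2^n := by nlinarith
      have h3 : z*2^n ≤ z*2^(n+1) := by rw [pow_succ]; nlinarith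
      rw [PR_union (exp_le_exp.2 h2) (exp_le_exp.2 h3)]
      have := H (z*2^n) (z*2^(n+1)) (by linarith) (by rw [pow_succ]; nlinarith)
      have e : (z*2^(n+1) - z*2^n)/(16*(z*2^(n+1))) = 1/32 := by
        rw [pow_succ, ← mul_assoc]
        have : z*2^n ≠ 0 := by positivity
        generalize z*2^n = y at this
        field_simp; ring
      rw [e] at this
      push_cast; rw [add_div]; linarith
  have k := key b
  unfold Wb PP
  rw [exp_sq_div, exp_cube_div]
  have := sum_not_dvd_ge (PR (exp z) (exp (z^2))) (fun p hp => (mem_filter.1 hp).2) h hh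
  rw [← hzd, ← sq] at k
  linarith

lemma PP_card (h b : ℕ) : ((PP h (2^b) ((2^b)^2) ((2^b)^3)).card : ℝ) ≤ exp (((2:ℝ)^b)^2) := by
  have : PP h (2^b) ((2^b)^2) ((2^b)^3) ⊆ Ioc 0 ⌊exp (((2:ℝ)^b)^2)⌋₊ := by
    intro p hp
    rw [mem_PP, exp_cube_div] at hp
    rw [mem_Ioc]
    exact ⟨hp.2.1.pos, Nat.le_floor hp.1.2⟩
  have h2 := card_le_card this
  rw [Nat.card_Ioc, Nat.sub_zero] at h2
  exact (by exact_mod_cast h2 : ((PP h (2^b) ((2^b)^2) ((2^b)^3)).card : ℝ) ≤ ⌊exp (((2:ℝ)^b)^2)⌋₊).trans (Nat.floor_le (by positivity))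

lemma gco_sq_sum (h b : ℕ) (hb : 2 ≤ b) (X κ : ℝ) (hκ : 0 < κ) (hκ1 : κ ≤ 1) (hW : 1 ≤ Wb h b)
    (hX : (2:ℝ)^b*exp (2*((2:ℝ)^b)^2) ≤ X) :
    ∑ n ∈ sg X ((1+κ)*X*exp (1/((2^b:ℕ):ℝ))), (gco h (2^b) ((2^b)^2) ((2^b)^3) X κ (Wb h b) n)^2 ≤
      X*(4/Wb h b+24/2^b) := by
  have hV : 0 < 2^b := by positivity
  have hv : (2^b)^2 ≤ (2^b)^3 := Nat.pow_le_pow_right hV (by norm_num)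
  set z := (2:ℝ)^b with hz
  have hz4 : 4 ≤ z := by
    calc (4:ℝ) = 2^2 := by norm_num
      _ ≤ 2^b := pow_le_pow_right₀ (by norm_num) hb
  have hzn : ((2^b:ℕ):ℝ) = z := by push_cast; rfl
  have hX0 : 0 < X := lt_of_lt_of_le (by positivity) hX
  set W := Wb h b with hWd
  have hX4 : 4 ≤ X/z := by
    rw [le_div_iff₀ (by linarith)]
    have h4 : 4 ≤ exp (2*z^2) := by nlinarith [add_one_le_exp (2*z^2)]
    nlinarith
  set T := sg X ((1+κ)*X*exp (1/((2^b:ℕ):ℝ))) with hT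
  have hpt : ∀ n ∈ T, (gco h (2^b) ((2^b)^2) ((2^b)^3) X κ W n)^2 ≤
      (2/W^2)*(om (PP h (2^b) ((2^b)^2) ((2^b)^3)) n - W)^2+(if n ∈ edg (2^b) X κ then 2 else 0) := by
    intro n hn
    have e : (2/W^2)*(om (PP h (2^b) ((2^b)^2) ((2^b)^3)) n - W)^2 = 2*(1 - om (PP h (2^b) ((2^b)^2) ((2^b)^3)) n/W)^2 := by
      field_simp; ring
    rw [e]
    split_ifs with he
    · have := gco_abs h (2^b) ((2^b)^2) ((2^b)^3) hv X κ W (by linarith) n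
      set y := 1 - om (PP h (2^b) ((2^b)^2) ((2^b)^3)) n/W
      rw [← sq_abs, ← sq_abs y]
      have h1 := abs_nonneg (gco h (2^b) ((2^b)^2) ((2^b)^3) X κ W n)
      nlinarith [sq_nonneg (1 - |y|)]
    · have h1 := not_edg hX0 hκ hn he
      rw [gco_main h (2^b) ((2^b)^2) ((2^b)^3) hV hv X κ W hX0 hκ n h1.1 h1.2]
      nlinarith [sq_nonneg (1 - om (PP h (2^b) ((2^b)^2) ((2^b)^3)) n/W)]
  refine (sum_le_sum hpt).trans ?_
  rw [sum_add_distrib, ← mul_sum]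
  have h1 := exp_inv_le (2^b) hV
  have h1' : (1:ℝ) ≤ exp (1/((2^b:ℕ):ℝ)) := one_le_exp (by positivity)
  rw [hzn] at h1 h1'
  have hz1 : 1/z ≤ 1/4 := one_div_le_one_div_of_le (by norm_num) hz4
  have hY : (1+κ)*X*exp (1/z) ≤ 3*X := by
    calc (1+κ)*X*exp (1/z) ≤ (1+1)*X*(3/2) := by gcongr; linarith
      _ = 3*X := by ring
  have hXY : X ≤ (1+κ)*X*exp (1/z) := by
    calc X = (1+0)*X*1 := by ring
      _ ≤ _ := by gcongr
  have tk := turan_kubilius (PP h (2^b) ((2^b)^2) ((2^b)^3)) (fun p hp => (mem_PP.1 hp).2.1) hX0.le hXY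
  have hWW : ∑ p ∈ PP h (2^b) ((2^b)^2) ((2^b)^3), (1:ℝ)/p = W := rfl
  rw [hWW] at tk
  have hP2 : ((PP h (2^b) ((2^b)^2) ((2^b)^3)).card : ℝ)^2 ≤ X/z := by
    have := PP_card h b
    rw [le_div_iff₀ (by linarith)]
    calc _ ≤ (exp (z^2))^2*z := by gcongr
      _ = z*exp (2*z^2) := by rw [← exp_nat_mul]; push_cast; ring
      _ ≤ X := hX
  have hT' : T = sg X ((1+κ)*X*exp (1/z)) := by rw [hT, hzn]
  have t1 : ∑ n ∈ T, (om (PP h (2^b) ((2^b)^2) ((2^b)^3)) n - W)^2 ≤ 2*X*W+4*(X/z) := by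
    rw [hT']
    refine tk.trans ?_
    have : ((1+κ)*X*exp (1/z) - X)*W ≤ (2*X)*W := by gcongr; linarith
    linarith
  have t2 : ∑ n ∈ T, (if n ∈ edg (2^b) X κ then (2:ℝ) else 0) ≤ 2*(6*(X/z)+2) := by
    rw [← sum_filter, sum_const, nsmul_eq_mul]
    have := edg_card (2^b) hV X κ hX0 hκ hκ1
    have h3 : ((T.filter (fun n => n ∈ edg (2^b) X κ)).card : ℝ) ≤ (edg (2^b) X κ).card := by
      exact_mod_cast card_le_card (fun n hn => (mem_filter.1 hn).2)
    rw [hzn, mul_div_assoc] at this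
    linarith
  have t3 : 2/W^2 * ∑ n ∈ T, (om (PP h (2^b) ((2^b)^2) ((2^b)^3)) n - W)^2 ≤ 4*(X/W)+8*(X/z) := by
    calc _ ≤ 2/W^2*(2*X*W+4*(X/z)) := by gcongr
      _ = 4*(X/W)+(8/W^2)*(X/z) := by field_simp; ring
      _ ≤ 4*(X/W)+8*(X/z) := by
        gcongr
        rw [div_le_iff₀ (by positivity)]
        nlinarith
  have e : X*(4/W+24/z) = 4*(X/W)+24*(X/z) := by ring
  rw [e]
  linarith

lemma approx_energy (h b K : ℕ) [NeZero h] (hb : 2 ≤ b) (X κ : ℝ) (hκ : 0 < κ) (hκ1 : κ ≤ 1) (hW : 1 ≤ Wb h b)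
    (hX : (2:ℝ)^b*exp (2*((2:ℝ)^b)^2) ≤ X) (hK : (K:ℝ)+1 ≤ X/h) :
    En h K (sg X ((1+κ)*X*exp (1/((2^b:ℕ):ℝ))))
      (fun n => ((liouville n*gco h (2^b) ((2^b)^2) ((2^b)^3) X κ (Wb h b) n : ℝ) : ℂ)) ≤
      48000*rho h*X^2*(4/Wb h b+24/2^b) := by
  have hX0 : 0 < X := lt_of_lt_of_le (by positivity) hX
  have hh : (0:ℝ) < h := by exact_mod_cast Nat.pos_of_ne_zero (NeZero.ne h)
  have h1 := exp_inv_le (2^b) (by positivity)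
  have hz4 : 4 ≤ ((2^b:ℕ):ℝ) := by
    have : 4 ≤ 2^b := by
      calc 4 = 2^2 := by norm_num
        _ ≤ 2^b := Nat.pow_le_pow_right (by norm_num) hb
    exact_mod_cast this
  have hz1 : 1/((2^b:ℕ):ℝ) ≤ 1/4 := one_div_le_one_div_of_le (by norm_num) hz4
  have hY : (1+κ)*X*exp (1/((2^b:ℕ):ℝ)) ≤ 3*X := by
    calc (1+κ)*X*exp (1/((2^b:ℕ):ℝ)) ≤ (1+1)*X*(3/2) := by gcongr; linarith
      _ = 3*X := by ring
  have m := MVT h K (sg X ((1+κ)*X*exp (1/((2^b:ℕ):ℝ))))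
    (fun n => ((liouville n*gco h (2^b) ((2^b)^2) ((2^b)^3) X κ (Wb h b) n : ℝ) : ℂ)) X (3*X) hX0 (by
      intro n hn
      rw [mem_sg hX0.le (by positivity)] at hn
      exact ⟨hn.1.le, hn.2.trans hY⟩)
  refine m.trans ?_
  have e : ∀ n, ‖((liouville n*gco h (2^b) ((2^b)^2) ((2^b)^3) X κ (Wb h b) n : ℝ) : ℂ)‖^2 =
      (gco h (2^b) ((2^b)^2) ((2^b)^3) X κ (Wb h b) n)^2 := by
    intro n
    rw [norm_real, norm_eq_abs, sq_abs, mul_pow, sq (liouville n), lio_sq, one_mul]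
  simp_rw [e]
  have hg := gco_sq_sum h b hb X κ hκ hκ1 hW hX
  have hlog : log (3*X/X) ≤ 2 := by
    rw [mul_div_cancel_right₀ _ hX0.ne']
    linarith [log_le_sub_one_of_pos (show (0:ℝ) < 3 by norm_num)]
  have hlog0 : 0 ≤ log (3*X/X) := by
    rw [mul_div_cancel_right₀ _ hX0.ne']; exact log_nonneg (by norm_num)
  have hK2 : (K:ℝ)+1+3*X/h ≤ 4*X/h := by
    have : 4*X/h = X/h+3*X/h := by ring
    linarith
  calc _ ≤ h.totient*(4000*(1+2)*(4*X/h)*(X*(4/Wb h b+24/2^b))) := by gcongr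
    _ = _ := by unfold rho; ring

/-- reduce a piece to products -/
lemma piece_split (h b K : ℕ) [NeZero h] (hb : 2 ≤ b) (X κ : ℝ) (hκ : 0 < κ) (hκ1 : κ ≤ 1) (hW : 1 ≤ Wb h b)
    (hX : (2:ℝ)^b*exp (2*((2:ℝ)^b)^2) ≤ X) (hK : (K:ℝ)+1 ≤ X/h) (A : Finset (Freq h)) (hA : A ⊆ Xi h K) :
    ∑ ξ ∈ A, wt K ξ.2 * ‖pol (sg X ((1+κ)*X)) (fun n => (liouville n : ℂ)) ξ‖^2 ≤
      2*((2:ℝ)^b)^3 * ∑ v ∈ Ico ((2^b)^2) ((2^b)^3), ∑ ξ ∈ A, wt K ξ.2*(‖Pv (2^b) v ξ‖^2 * ‖Rv X κ (2^b) v ξ‖^2)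
      + 2*(48000*rho h*X^2*(4/Wb h b+24/2^b)) := by
  have hX0 : 0 < X := lt_of_lt_of_le (by positivity) hX
  have hae := approx_energy h b K hb X κ hκ hκ1 hW hX hK
  set d := (fun n => ((liouville n*gco h (2^b) ((2^b)^2) ((2^b)^3) X κ (Wb h b) n : ℝ) : ℂ)) with hd
  set T := sg X ((1+κ)*X*exp (1/((2^b:ℕ):ℝ))) with hT
  have hwt : ∀ ξ ∈ Xi h K, 0 ≤ wt K ξ.2 := fun ξ hξ => wt_nonneg K _ (mem_product.1 hξ).2
  have hpt : ∀ ξ ∈ A, wt K ξ.2 * ‖pol (sg X ((1+κ)*X)) (fun n => (liouville n : ℂ)) ξ‖^2 ≤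
      2*((2:ℝ)^b)^3 * ∑ v ∈ Ico ((2^b)^2) ((2^b)^3), wt K ξ.2*(‖Pv (2^b) v ξ‖^2 * ‖Rv X κ (2^b) v ξ‖^2)
      + 2*(wt K ξ.2 * ‖pol T d ξ‖^2) := by
    intro ξ hξ
    have hw := hwt ξ (hA hξ)
    have hap := pol_approx h (2^b) ((2^b)^2) ((2^b)^3) (by positivity) X κ (Wb h b) hX0 hκ ξ
    set S := ∑ v ∈ Ico ((2^b)^2) ((2^b)^3), Pv (2^b) v ξ * Rv X κ (2^b) v ξ with hS
    have hap' : pol (sg X ((1+κ)*X)) (fun n => (liouville n : ℂ)) ξ = -(1/(Wb h b) : ℝ)*S+pol T d ξ := hap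
    have hSn : ‖S‖^2 ≤ ((2:ℝ)^b)^3 * ∑ v ∈ Ico ((2^b)^2) ((2^b)^3), (‖Pv (2^b) v ξ‖^2 * ‖Rv X κ (2^b) v ξ‖^2) := by
      have h1 : ‖S‖ ≤ ∑ v ∈ Ico ((2^b)^2) ((2^b)^3), ‖Pv (2^b) v ξ‖ * ‖Rv X κ (2^b) v ξ‖ := by
        refine (norm_sum_le _ _).trans (sum_le_sum fun v _ => (norm_mul _ _).le)
      have h2 := sq_sum_le_card_mul_sum_sq (s := Ico ((2^b)^2) ((2^b)^3)) (f := fun v => ‖Pv (2^b) v ξ‖ * ‖Rv X κ (2^b) v ξ‖)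
      have h3 : ((Ico ((2^b)^2) ((2^b)^3)).card : ℝ) ≤ ((2:ℝ)^b)^3 := by
        rw [Nat.card_Ico]
        have : (2^b)^3 - (2^b)^2 ≤ (2^b)^3 := Nat.sub_le _ _
        exact_mod_cast this
      calc ‖S‖^2 ≤ (∑ v ∈ Ico ((2^b)^2) ((2^b)^3), ‖Pv (2^b) v ξ‖ * ‖Rv X κ (2^b) v ξ‖)^2 := by gcongr
        _ ≤ _ := h2
        _ ≤ _ := by
          simp_rw [mul_pow]
          gcongr
    have hB : ‖-((1/(Wb h b) : ℝ):ℂ)*S‖^2 ≤ ‖S‖^2 := by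
      rw [norm_mul, norm_neg, norm_real, norm_eq_abs, abs_of_nonneg (by positivity), mul_pow]
      have : (1/Wb h b)^2 ≤ 1 := by
        apply pow_le_one₀ (by positivity)
        rw [div_le_one (by linarith)]; exact hW
      nlinarith [sq_nonneg ‖S‖]
    have hsum : ‖pol (sg X ((1+κ)*X)) (fun n => (liouville n : ℂ)) ξ‖^2 ≤ 2 * ‖S‖^2+2 * ‖pol T d ξ‖^2 := by
      rw [hap']
      have := norm_add_le (-((1/(Wb h b) : ℝ):ℂ)*S) (pol T d ξ)
      have h0 := norm_nonneg (-((1/(Wb h b) : ℝ):ℂ)*S+pol T d ξ)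
      nlinarith [sq_nonneg (‖-((1/(Wb h b) : ℝ):ℂ)*S‖ - ‖pol T d ξ‖)]
    rw [← mul_sum]
    calc _ ≤ wt K ξ.2*(2*(((2:ℝ)^b)^3 * ∑ v ∈ Ico ((2^b)^2) ((2^b)^3), (‖Pv (2^b) v ξ‖^2 * ‖Rv X κ (2^b) v ξ‖^2))+2 * ‖pol T d ξ‖^2) := by
          gcongr
          linarith
      _ = _ := by ring
  refine (sum_le_sum hpt).trans ?_
  rw [sum_add_distrib, ← mul_sum, ← mul_sum, sum_comm]
  gcongr
  refine le_trans ?_ hae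
  unfold En
  exact sum_le_sum_of_subset_of_nonneg hA fun ξ hξ _ => mul_nonneg (hwt ξ hξ) (by positivity)

open Classical in
noncomputable def Sc (h K b : ℕ) [NeZero h] (α : ℝ) : Finset (Freq h) :=
  (Xi h K).filter (fun ξ => ∀ v ∈ Ico ((2^b)^2) ((2^b)^3), ‖Pv (2^b) v ξ‖ ≤ exp ((1-α)*((v:ℝ)/2^b)))

lemma mem_Sc {h K b : ℕ} [NeZero h] {α : ℝ} {ξ : Freq h} : ξ ∈ Sc h K b α ↔ ξ ∈ Xi h K ∧
    ∀ v ∈ Ico ((2^b)^2) ((2^b)^3), ‖Pv (2^b) v ξ‖ ≤ exp ((1-α)*((v:ℝ)/2^b)) := by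
  unfold Sc; simp only [mem_filter]

lemma Sc_sub (h K b : ℕ) [NeZero h] (α : ℝ) : Sc h K b α ⊆ Xi h K := fun ξ hξ => (mem_Sc.1 hξ).1

noncomputable def Fw (h K : ℕ) (X κ : ℝ) (ξ : Freq h) : ℝ :=
  wt K ξ.2 * ‖pol (sg X ((1+κ)*X)) (fun n => (liouville n : ℂ)) ξ‖^2

lemma wt_nonneg' {h K : ℕ} [NeZero h] {ξ : Freq h} (hξ : ξ ∈ Xi h K) : 0 ≤ wt K ξ.2 :=
  wt_nonneg K _ (mem_product.1 hξ).2

lemma Fw_nonneg {h K : ℕ} [NeZero h] {X κ : ℝ} {ξ : Freq h} (hξ : ξ ∈ Xi h K) : 0 ≤ Fw h K X κ ξ :=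
  mul_nonneg (wt_nonneg' hξ) (by positivity)

lemma four_le_z {b : ℕ} (hb : 2 ≤ b) : (4:ℝ) ≤ (2:ℝ)^b := by
  calc (4:ℝ) = 2^2 := by norm_num
    _ ≤ 2^b := pow_le_pow_right₀ (by norm_num) hb

lemma v_range {b v : ℕ} (hv : v ∈ Ico ((2^b)^2) ((2^b)^3)) :
    (2:ℝ)^b ≤ (v:ℝ)/2^b ∧ (v:ℝ)/2^b ≤ ((2:ℝ)^b)^2 := by
  rw [mem_Ico] at hv
  have h1 : ((2:ℝ)^b)^2 ≤ v := by exact_mod_cast hv.1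
  have h2 : (v:ℝ) < ((2:ℝ)^b)^3 := by exact_mod_cast hv.2
  have hz : (0:ℝ) < 2^b := by positivity
  rw [le_div_iff₀ hz, div_le_iff₀ hz]
  constructor <;> nlinarith

lemma Rv_energy (h b K v : ℕ) [NeZero h] (hb : 2 ≤ b) (hv : v ∈ Ico ((2^b)^2) ((2^b)^3)) (X κ : ℝ) (hκ : 0 < κ) (hκ1 : κ ≤ 1)
    (hX : exp (((2:ℝ)^b)^2) ≤ X) (hK : (K:ℝ)+1 ≤ X*exp (-((2:ℝ)^b)^2)/h) :
    ∑ ξ ∈ Xi h K, wt K ξ.2 * ‖Rv X κ (2^b) v ξ‖^2 ≤ 48000*rho h*(X/exp ((v:ℝ)/2^b))^2 := by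
  obtain ⟨h1, h2⟩ := v_range hv
  have hh : (0:ℝ) < h := by exact_mod_cast Nat.pos_of_ne_zero (NeZero.ne h)
  have hX0 : 0 < X := lt_of_lt_of_le (exp_pos _) hX
  have hzn : ((2^b:ℕ):ℝ) = (2:ℝ)^b := by push_cast; rfl
  unfold Rv
  rw [hzn]
  set M := X/exp ((v:ℝ)/2^b) with hM
  have hMX : X*exp (-((2:ℝ)^b)^2) ≤ M := by
    rw [hM, div_eq_mul_inv, ← exp_neg]
    gcongr
  have hM1 : 1 ≤ M := by
    refine le_trans ?_ hMX
    have : exp (((2:ℝ)^b)^2)*exp (-((2:ℝ)^b)^2) = 1 := by rw [← exp_add]; simp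
    rw [← this]; gcongr
  have m := MVT h K (sg M ((1+κ)*M)) (fun m => (liouville m : ℂ)) M (2*M) (by linarith) (by
      intro n hn
      rw [mem_sg (by linarith) (by positivity)] at hn
      refine ⟨hn.1.le, hn.2.trans (by nlinarith)⟩)
  refine m.trans ?_
  have e : ∀ n, ‖(liouville n : ℂ)‖^2 = 1 := by
    intro n; rw [norm_real, norm_eq_abs, lio_abs, one_pow]
  simp_rw [e]
  rw [sum_const, nsmul_eq_mul, mul_one]
  have hc := card_sg_le (x := M) (y := (1+κ)*M) (by linarith) (by nlinarith)
  have hc2 : ((sg M ((1+κ)*M)).card : ℝ) ≤ 2*M := by nlinarith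
  have hl : log (2*M/M) ≤ 1 := by
    rw [mul_div_cancel_right₀ _ (by linarith)]; linarith [log_two_lt_d9]
  have hl0 : 0 ≤ log (2*M/M) := by
    rw [mul_div_cancel_right₀ _ (by linarith)]; positivity
  have hK2 : (K:ℝ)+1+2*M/h ≤ 3*M/h := by
    have : X*exp (-((2:ℝ)^b)^2)/h ≤ M/h := by gcongr
    have e : 3*M/h = M/h+2*M/h := by ring
    linarith
  calc _ ≤ h.totient*(4000*(1+1)*(3*M/h)*(2*M)) := by gcongr
    _ = _ := by unfold rho; ring

lemma exp_pow_sq (x : ℝ) : (exp x)^2 = exp (2*x) := by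
  rw [← exp_nat_mul]; norm_num

lemma piece_first (h b K : ℕ) [NeZero h] (hb : 2 ≤ b) (X κ α : ℝ) (hκ : 0 < κ) (hκ1 : κ ≤ 1) (hα : 0 ≤ α) (hW : 1 ≤ Wb h b)
    (hX : (2:ℝ)^b*exp (2*((2:ℝ)^b)^2) ≤ X) (hK : (K:ℝ)+1 ≤ X*exp (-((2:ℝ)^b)^2)/h) :
    ∑ ξ ∈ Sc h K b α, Fw h K X κ ξ ≤ 96000*rho h*X^2*(((2:ℝ)^b)^6*exp (-(2*α*2^b))+4/Wb h b+24/2^b) := by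
  have hh : (0:ℝ) < h := by exact_mod_cast Nat.pos_of_ne_zero (NeZero.ne h)
  have hX0 : 0 < X := lt_of_lt_of_le (by positivity) hX
  have hz4 := four_le_z hb
  have hX1 : exp (((2:ℝ)^b)^2) ≤ X := by
    refine le_trans ?_ hX
    have : exp (((2:ℝ)^b)^2) ≤ exp (2*((2:ℝ)^b)^2) := exp_le_exp.2 (by nlinarith)
    nlinarith [exp_pos (2*((2:ℝ)^b)^2)]
  have hK1 : (K:ℝ)+1 ≤ X/h := by
    refine hK.trans ?_
    gcongr
    have : exp (-((2:ℝ)^b)^2) ≤ 1 := exp_le_one_iff.2 (by nlinarith)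
    nlinarith
  have ps := piece_split h b K hb X κ hκ hκ1 hW hX hK1 (Sc h K b α) (Sc_sub h K b α)
  unfold Fw
  refine ps.trans ?_
  have hr := rho_nonneg h
  have key : ∀ v ∈ Ico ((2^b)^2) ((2^b)^3), ∑ ξ ∈ Sc h K b α, wt K ξ.2*(‖Pv (2^b) v ξ‖^2 * ‖Rv X κ (2^b) v ξ‖^2) ≤
      48000*rho h*X^2*exp (-(2*α*2^b)) := by
    intro v hv
    have hvr := v_range hv
    calc _ ≤ ∑ ξ ∈ Sc h K b α, exp (2*((1-α)*((v:ℝ)/2^b)))*(wt K ξ.2 * ‖Rv X κ (2^b) v ξ‖^2) := by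
          apply sum_le_sum
          intro ξ hξ
          have hw := wt_nonneg' (mem_Sc.1 hξ).1
          have h1 := (mem_Sc.1 hξ).2 v hv
          have h2 : ‖Pv (2^b) v ξ‖^2 ≤ exp (2*((1-α)*((v:ℝ)/2^b))) := by
            rw [← exp_pow_sq]; gcongr
          calc _ = ‖Pv (2^b) v ξ‖^2*(wt K ξ.2 * ‖Rv X κ (2^b) v ξ‖^2) := by ring
            _ ≤ _ := by gcongr
      _ ≤ exp (2*((1-α)*((v:ℝ)/2^b))) * ∑ ξ ∈ Xi h K, (wt K ξ.2 * ‖Rv X κ (2^b) v ξ‖^2) := by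
          rw [← mul_sum]
          gcongr
          · intro ξ hξ _; exact mul_nonneg (wt_nonneg' hξ) (by positivity)
          · exact Sc_sub h K b α
      _ ≤ exp (2*((1-α)*((v:ℝ)/2^b)))*(48000*rho h*(X/exp ((v:ℝ)/2^b))^2) := by
          gcongr
          exact Rv_energy h b K v hb hv X κ hκ hκ1 hX1 hK
      _ = 48000*rho h*X^2*exp (-(2*α*((v:ℝ)/2^b))) := by
          rw [div_pow, exp_pow_sq, div_eq_mul_inv (X^2), ← exp_neg]
          have : exp (-(2*α*((v:ℝ)/2^b))) = exp (2*((1-α)*((v:ℝ)/2^b)))*exp (-(2*((v:ℝ)/2^b))) := by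
            rw [← exp_add]; congr 1; ring
          rw [this]; ring
      _ ≤ _ := by
          gcongr
          nlinarith [hvr.1]
  have h3 : ((Ico ((2^b)^2) ((2^b)^3)).card : ℝ) ≤ ((2:ℝ)^b)^3 := by
    rw [Nat.card_Ico]
    have : (2^b)^3 - (2^b)^2 ≤ (2^b)^3 := Nat.sub_le _ _
    exact_mod_cast this
  have k2 := sum_le_sum key
  rw [sum_const, nsmul_eq_mul] at k2
  have k3 : ∑ v ∈ Ico ((2^b)^2) ((2^b)^3), ∑ ξ ∈ Sc h K b α, wt K ξ.2*(‖Pv (2^b) v ξ‖^2 * ‖Rv X κ (2^b) v ξ‖^2) ≤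
      ((2:ℝ)^b)^3*(48000*rho h*X^2*exp (-(2*α*2^b))) := k2.trans (by gcongr)
  calc _ ≤ 2*((2:ℝ)^b)^3*(((2:ℝ)^b)^3*(48000*rho h*X^2*exp (-(2*α*2^b))))+2*(48000*rho h*X^2*(4/Wb h b+24/2^b)) := by gcongr
    _ = _ := by ring

lemma piece_step (h b K : ℕ) [NeZero h] (hb : 2 ≤ b) (X κ α δ : ℝ) (hκ : 0 < κ) (hκ1 : κ ≤ 1) (hα : 0 ≤ α) (hα1 : α ≤ 1)
    (hδ : 20*b/(2:ℝ)^b ≤ δ) (hW : 1 ≤ Wb h (3*b))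
    (hX : (2:ℝ)^(3*b)*exp (2*((2:ℝ)^(3*b))^2) ≤ X) (hK : (K:ℝ)+1 ≤ X/h) :
    ∑ ξ ∈ Sc h K (3*b) (α+δ) \ Sc h K b α, Fw h K X κ ξ ≤
      96000*rho h*X^2*(((2:ℝ)^b)^21*exp (-(δ*((2:ℝ)^b)^3))+4/Wb h (3*b)+24/2^(3*b)) := by
  have hh : (0:ℝ) < h := by exact_mod_cast Nat.pos_of_ne_zero (NeZero.ne h)
  have hX0 : 0 < X := lt_of_lt_of_le (by positivity) hX
  have hz4 := four_le_z hb
  have hδ0 : 0 ≤ δ := le_trans (by positivity) hδ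
  have hzz : (2:ℝ)^(3*b) = ((2:ℝ)^b)^3 := by rw [mul_comm, pow_mul]
  set A := Sc h K (3*b) (α+δ) \ Sc h K b α with hA
  have hAX : A ⊆ Xi h K := sdiff_subset.trans (Sc_sub h K _ _)
  have ps := piece_split h (3*b) K (by omega) X κ hκ hκ1 hW hX hK A hAX
  unfold Fw
  refine ps.trans ?_
  have hr := rho_nonneg h
  set z := (2:ℝ)^b with hz
  have key : ∀ v ∈ Ico ((2^(3*b))^2) ((2^(3*b))^3), ∑ ξ ∈ A, wt K ξ.2*(‖Pv (2^(3*b)) v ξ‖^2 * ‖Rv X κ (2^(3*b)) v ξ‖^2) ≤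
      z^3*(rho h*X^2*exp (-(δ*z^3))) := by
    intro v hv
    have hvr := v_range hv
    have hzn : ((2^(3*b):ℕ):ℝ) = (2:ℝ)^(3*b) := by push_cast; rfl
    set T := (v:ℝ)/2^(3*b) with hT
    set M := X/exp T with hM
    have hM0 : 0 < M := by positivity
    have hR : ∀ ξ : Freq h, Rv X κ (2^(3*b)) v ξ = pol (sg M ((1+κ)*M)) (fun m => (liouville m : ℂ)) ξ := by
      intro ξ; unfold Rv; rw [hzn]
    have hgm : ∀ r ∈ Ico ((2^b)^2) ((2^b)^3), ∃ l : ℕ, ∑ ξ ∈ Xi h K, wt K ξ.2*((‖Pv (2^b) r ξ‖ / exp ((1-α)*((r:ℝ)/(2^b)))) ^ (2*l) * ‖Rv X κ (2^(3*b)) v ξ‖^2) ≤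
      rho h*M^2*exp (2*α*T+20*b*T/2^b) := by
      intro r hr
      rw [mem_Ico] at hr
      have := gen_moment h K b r (sg M ((1+κ)*M)) (fun m => (liouville m : ℂ)) α T M hb hr.1 hr.2 hα hα1 (by rw [← hz, ← hzz]; exact hvr.1) (by
        refine hvr.2.trans ?_
        rw [hzz, ← hz, ← pow_mul]
        exact pow_le_pow_right₀ (by linarith) (by norm_num)) hM0 (by
          intro m hm
          rw [mem_sg hM0.le (by positivity)] at hm
          exact ⟨hm.1.le, hm.2.trans (by nlinarith)⟩) (by
          intro m; rw [norm_real, norm_eq_abs, lio_abs]) (by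
          refine hK.trans ?_
          gcongr
          rw [hM, mul_assoc, div_mul_cancel₀ _ (exp_pos T).ne']
          linarith)
      obtain ⟨l, hl⟩ := this
      refine ⟨l, ?_⟩
      simp_rw [hR]
      exact hl
    choose! l hl using hgm
    calc _ ≤ ∑ ξ ∈ A, exp (2*((1-(α+δ))*T)) * ∑ r ∈ Ico ((2^b)^2) ((2^b)^3), wt K ξ.2*((‖Pv (2^b) r ξ‖ / exp ((1-α)*((r:ℝ)/(2^b)))) ^ (2*l r) * ‖Rv X κ (2^(3*b)) v ξ‖^2) := by
          apply sum_le_sum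
          intro ξ hξ
          have hξ' := Finset.mem_sdiff.1 hξ
          have hw := wt_nonneg' (hAX hξ)
          have h1 := (mem_Sc.1 hξ'.1).2 v hv
          have h2 : ‖Pv (2^(3*b)) v ξ‖^2 ≤ exp (2*((1-(α+δ))*T)) := by
            rw [← exp_pow_sq]; gcongr
          have h3 : ∃ r : ℕ, r ∈ Ico ((2^b)^2) ((2^b)^3) ∧ exp ((1-α)*((r:ℝ)/2^b)) < ‖Pv (2^b) r ξ‖ := by
            by_contra hcon
            push Not at hcon
            exact hξ'.2 (mem_Sc.2 ⟨hAX hξ, hcon⟩)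
          obtain ⟨r, hr, hr'⟩ := h3
          have h4 : wt K ξ.2 * ‖Rv X κ (2^(3*b)) v ξ‖^2 ≤ ∑ r ∈ Ico ((2^b)^2) ((2^b)^3), wt K ξ.2*((‖Pv (2^b) r ξ‖ / exp ((1-α)*((r:ℝ)/(2^b)))) ^ (2*l r) * ‖Rv X κ (2^(3*b)) v ξ‖^2) := by
            refine le_trans ?_ (Finset.single_le_sum (fun i _ => mul_nonneg hw (by positivity)) hr)
            have : 1 ≤ (‖Pv (2^b) r ξ‖ / exp ((1-α)*((r:ℝ)/(2^b)))) ^ (2*l r) := by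
              apply one_le_pow₀
              rw [one_le_div (exp_pos _)]; exact hr'.le
            gcongr
            nlinarith [sq_nonneg ‖Rv X κ (2^(3*b)) v ξ‖]
          calc _ = ‖Pv (2^(3*b)) v ξ‖^2*(wt K ξ.2 * ‖Rv X κ (2^(3*b)) v ξ‖^2) := by ring
            _ ≤ _ := by gcongr
      _ ≤ exp (2*((1-(α+δ))*T)) * ∑ r ∈ Ico ((2^b)^2) ((2^b)^3), (rho h*M^2*exp (2*α*T+20*b*T/2^b)) := by
          rw [← mul_sum, sum_comm]
          gcongr with r hr
          refine le_trans ?_ (hl r hr)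
          apply sum_le_sum_of_subset_of_nonneg hAX
          intro ξ hξ _; exact mul_nonneg (wt_nonneg' hξ) (by positivity)
      _ ≤ exp (2*((1-(α+δ))*T))*(z^3*(rho h*M^2*exp (2*α*T+20*b*T/2^b))) := by
          rw [sum_const, nsmul_eq_mul]
          gcongr
          rw [Nat.card_Ico]
          have : (2^b)^3 - (2^b)^2 ≤ (2^b)^3 := Nat.sub_le _ _
          rw [hz]; exact_mod_cast this
      _ = z^3*(rho h*X^2*exp (-(2*δ*T)+20*b*T/2^b)) := by
          rw [hM, div_pow, exp_pow_sq, div_eq_mul_inv, ← exp_neg]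
          have : exp (-(2*δ*T)+20*b*T/2^b) = exp (2*((1-(α+δ))*T))*exp (-(2*T))*exp (2*α*T+20*b*T/2^b) := by
            rw [← exp_add, ← exp_add]; congr 1; ring
          rw [this]; ring
      _ ≤ _ := by
          gcongr
          have h5 : 20*b*T/2^b ≤ δ * T := by
            have : 20*b*T/(2:ℝ)^b = 20*b/(2:ℝ)^b*T := by ring
            rw [this]
            have : 0 ≤ T := by positivity
            gcongr
          have h6 : z^3 ≤ T := by rw [← hzz]; exact hvr.1
          nlinarith
  have h3 : ((Ico ((2^(3*b))^2) ((2^(3*b))^3)).card : ℝ) ≤ z^9 := by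
    rw [Nat.card_Ico]
    have : (2^(3*b))^3 - (2^(3*b))^2 ≤ (2^(3*b))^3 := Nat.sub_le _ _
    have e : z^9 = ((2:ℝ)^(3*b))^3 := by rw [hzz]; ring
    rw [e]
    exact_mod_cast this
  have k2 := sum_le_sum key
  rw [sum_const, nsmul_eq_mul] at k2
  have k3 := k2.trans (mul_le_mul_of_nonneg_right h3 (by positivity))
  have e9 : ((2:ℝ)^(3*b))^3 = z^9 := by rw [hzz]; ring
  rw [e9]
  calc _ ≤ 2*z^9*(z^9*(z^3*(rho h*X^2*exp (-(δ*z^3)))))+2*(48000*rho h*X^2*(4/Wb h (3*b)+24/2^(3*b))) := by gcongr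
    _ ≤ _ := by
      have : 0 ≤ rho h*X^2*(z^21*exp (-(δ*z^3))) := by positivity
      have e : 2*z^9*(z^9*(z^3*(rho h*X^2*exp (-(δ*z^3))))) = 2*(rho h*X^2*(z^21*exp (-(δ*z^3)))) := by ring
      rw [e]
      nlinarith

lemma one_add_le_two_pow (b : ℕ) : (b:ℝ)+1 ≤ (2:ℝ)^b := by
  have : b+1 ≤ 2^b := Nat.lt_two_pow_self
  exact_mod_cast this

lemma two_pow_tendsto : Tendsto (fun b : ℕ => (2:ℝ)^b) atTop atTop := tendsto_pow_atTop_atTop_of_one_lt (by norm_num)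

/-- numerical conditions on large scales -/
lemma scale_cond (a : ℝ) (ha : 0 < a) : ∃ b2 : ℕ, ∀ b ≥ b2,
    ((2:ℝ)^b)^6*exp (-(a*2^b)) ≤ 1/b ∧ ((2:ℝ)^b)^21*exp (-(2*a/(3*b)*((2:ℝ)^b)^3)) ≤ 1/(3*b) ∧
    20*b/(2:ℝ)^b ≤ 2*a/(3*b) := by
  have t1 : Tendsto (fun y : ℝ => y^7*exp (-a*y)) atTop (𝓝 0) := by
    have := (Real.tendsto_pow_mul_exp_neg_atTop_nhds_zero 7).comp (tendsto_id.const_mul_atTop ha)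
    have h2 := this.const_mul (1/a^7)
    rw [mul_zero] at h2
    refine h2.congr fun y => ?_
    simp only [Function.comp, id]
    rw [mul_pow, neg_mul]; field_simp
  have t2 : Tendsto (fun y : ℝ => y^22*exp (-(2*a/3)*y)) atTop (𝓝 0) := by
    have := (Real.tendsto_pow_mul_exp_neg_atTop_nhds_zero 22).comp (tendsto_id.const_mul_atTop (show 0 < 2*a/3 by positivity))
    have h2 := this.const_mul (1/(2*a/3)^22)
    rw [mul_zero] at h2
    refine h2.congr fun y => ?_
    simp only [Function.comp, id]
    rw [mul_pow, neg_mul]; field_simp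
  have t3 : Tendsto (fun b : ℕ => (b:ℝ)^2*(1/2:ℝ)^b) atTop (𝓝 0) :=
    tendsto_pow_const_mul_const_pow_of_abs_lt_one 2 (by rw [abs_of_pos] <;> norm_num)
  have e1 := (t1.comp two_pow_tendsto).eventually (ge_mem_nhds (show (0:ℝ) < 1 by norm_num))
  have e2 := (t2.comp two_pow_tendsto).eventually (ge_mem_nhds (show (0:ℝ) < 1/3 by norm_num))
  have e3 := t3.eventually (ge_mem_nhds (show (0:ℝ) < a/30 by positivity))
  obtain ⟨b2, h⟩ := eventually_atTop.1 (e1.and (e2.and e3))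
  refine ⟨b2+1, fun b hb => ?_⟩
  obtain ⟨h1, h2, h3⟩ := h b (by omega)
  simp only [Function.comp] at h1 h2
  have hb0 : (0:ℝ) < b := by exact_mod_cast (by omega : 0 < b)
  have hbz := one_add_le_two_pow b
  have h3' : (b:ℝ)^2/2^b ≤ a/30 := by
    rwa [one_div, inv_pow, ← div_eq_mul_inv] at h3
  set z := (2:ℝ)^b with hz
  have hz0 : 0 < z := by positivity
  refine ⟨?_, ?_, ?_⟩
  · rw [le_div_iff₀ hb0]
    calc z^6*exp (-(a*z))*b ≤ z^6*exp (-(a*z))*z := by gcongr; linarith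
      _ = z^7*exp (-a*z) := by rw [neg_mul]; ring
      _ ≤ 1 := h1
  · rw [le_div_iff₀ (by positivity)]
    have hz1 : 1 ≤ z := by linarith
    have : exp (-(2*a/(3*b)*z^3)) ≤ exp (-(2*a/3)*z) := by
      apply exp_le_exp.2
      have : 2*a/3*z ≤ 2*a/(3*b)*z^3 := by
        rw [div_mul_eq_mul_div, div_mul_eq_mul_div, div_le_div_iff₀ (by norm_num) (by positivity)]
        have : b*z ≤ z^3 := by nlinarith [mul_pos hz0 hz0]
        nlinarith
      linarith
    calc z^21*exp (-(2*a/(3*b)*z^3))*(3*b) ≤ z^21*exp (-(2*a/3)*z)*(3*z) := by gcongr; linarith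
      _ = 3*(z^22*exp (-(2*a/3)*z)) := by ring
      _ ≤ 1 := by linarith
  · rw [div_le_div_iff₀ hz0 (by positivity)]
    rw [div_le_iff₀ hz0] at h3'
    nlinarith

lemma log_scale {b : ℕ} (hb : 2 ≤ b) {X : ℝ} (hX : 0 < X) (h : ((2:ℝ)^b)^3 ≤ log X) :
    (2:ℝ)^b*exp (2*((2:ℝ)^b)^2) ≤ X := by
  have hz := four_le_z hb
  set z := (2:ℝ)^b
  calc z*exp (2*z^2) ≤ exp z*exp (2*z^2) := by gcongr; linarith [add_one_le_exp z]
    _ = exp (z+2*z^2) := by rw [exp_add]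
    _ ≤ exp (log X) := by
      apply exp_le_exp.2
      refine le_trans ?_ h
      nlinarith [mul_pos (show 0 < z by linarith) (show 0 < z by linarith)]
    _ = X := exp_log hX

lemma U_count (h K b : ℕ) [NeZero h] (hb : 2 ≤ b) (α X : ℝ) (hα : 0 ≤ α) (hα1 : α ≤ 1) (hX : 0 < X)
    (h0 : ((2:ℝ)^b)^3 ≤ log X) (h1 : log X ≤ ((2:ℝ)^b)^9) (hK : (K:ℝ)+1 ≤ X/h) :
    (((Xi h K) \ Sc h K b α).card : ℝ) ≤ 2*((2:ℝ)^b)^3*exp (2*α*log X+20*b*log X/2^b) := by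
  have hh : (0:ℝ) < h := by exact_mod_cast Nat.pos_of_ne_zero (NeZero.ne h)
  set T := log X with hT
  have hpol : ∀ ξ : Freq h, pol {1} (fun _ => (1:ℂ)) ξ = 1 := by
    intro ξ; unfold pol ch; simp
  have hgm : ∀ r ∈ Ico ((2^b)^2) ((2^b)^3), ∃ l : ℕ, ∑ ξ ∈ Xi h (2*K), wt (2*K) ξ.2*((‖Pv (2^b) r ξ‖ / exp ((1-α)*((r:ℝ)/(2^b)))) ^ (2*l)) ≤
      exp (2*α*T+20*b*T/2^b) := by
    intro r hr
    rw [mem_Ico] at hr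
    obtain ⟨l, hl⟩ := gen_moment h (2*K) b r {1} (fun _ => 1) α T 1 hb hr.1 hr.2 hα hα1 h0 h1 one_pos (by
      intro m hm; rw [Finset.mem_singleton] at hm; subst hm; norm_num) (by intro m; simp) (by
        rw [hT, exp_log hX]
        push_cast
        have : 2*1*X/h = 2*(X/h) := by ring
        rw [this]; linarith)
    refine ⟨l, ?_⟩
    simp_rw [hpol, norm_one, one_pow, mul_one] at hl
    refine hl.trans ?_
    have : rho h ≤ 1 := by
      unfold rho; rw [div_le_one hh]; exact_mod_cast Nat.totient_le h
    have := exp_pos (2*α*T+20*b*T/2^b)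
    nlinarith
  choose! l hl using hgm
  have hsub : Xi h K ⊆ Xi h (2*K) := by
    intro ξ hξ
    unfold Xi at *
    rw [mem_product] at *
    refine ⟨hξ.1, ?_⟩
    have := hξ.2
    rw [mem_Icc] at *
    push_cast
    constructor <;> omega
  have key : ∀ ξ ∈ (Xi h K) \ Sc h K b α, (1:ℝ) ≤ 2 * ∑ r ∈ Ico ((2^b)^2) ((2^b)^3), wt (2*K) ξ.2*((‖Pv (2^b) r ξ‖ / exp ((1-α)*((r:ℝ)/(2^b)))) ^ (2*l r)) := by
    intro ξ hξ
    have hξ' := Finset.mem_sdiff.1 hξ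
    have h3 : ∃ r : ℕ, r ∈ Ico ((2^b)^2) ((2^b)^3) ∧ exp ((1-α)*((r:ℝ)/2^b)) < ‖Pv (2^b) r ξ‖ := by
      by_contra hcon
      push Not at hcon
      exact hξ'.2 (mem_Sc.2 ⟨hξ'.1, hcon⟩)
    obtain ⟨r, hr, hr'⟩ := h3
    have hw : (1:ℝ)/2 ≤ wt (2*K) ξ.2 := by
      have h4 := mem_Icc.1 (mem_product.1 hξ'.1).2
      unfold wt
      have h5 : |((ξ.2:ℤ):ℝ)| ≤ K := by
        rw [abs_le]; constructor
        · exact_mod_cast h4.1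
        · exact_mod_cast h4.2
      have : |((ξ.2:ℤ):ℝ)| / (((2*K:ℕ):ℝ)+1) ≤ 1/2 := by
        rw [div_le_iff₀ (by positivity)]; push_cast; linarith
      linarith
    have hs := Finset.single_le_sum (f := fun r => wt (2*K) ξ.2*((‖Pv (2^b) r ξ‖ / exp ((1-α)*((r:ℝ)/(2^b)))) ^ (2*l r))) (fun i _ => mul_nonneg (by linarith) (by positivity)) hr
    have : 1 ≤ (‖Pv (2^b) r ξ‖ / exp ((1-α)*((r:ℝ)/(2^b)))) ^ (2*l r) := by
      apply one_le_pow₀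
      rw [one_le_div (exp_pos _)]; exact hr'.le
    have h6 : 1/2*1 ≤ wt (2*K) ξ.2*((‖Pv (2^b) r ξ‖ / exp ((1-α)*((r:ℝ)/(2^b)))) ^ (2*l r)) := by gcongr
    linarith
  have h7 : (((Xi h K) \ Sc h K b α).card : ℝ) ≤ ∑ ξ ∈ Xi h (2*K), 2 * ∑ r ∈ Ico ((2^b)^2) ((2^b)^3), wt (2*K) ξ.2*((‖Pv (2^b) r ξ‖ / exp ((1-α)*((r:ℝ)/(2^b)))) ^ (2*l r)) := by
    have := sum_le_sum key
    rw [sum_const, nsmul_eq_mul, mul_one] at this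
    refine this.trans ?_
    apply sum_le_sum_of_subset_of_nonneg (sdiff_subset.trans hsub)
    intro ξ hξ _
    have := wt_nonneg' hξ
    positivity
  refine h7.trans ?_
  rw [← mul_sum, sum_comm, mul_assoc]
  gcongr
  have h8 := sum_le_sum hl
  rw [sum_const, nsmul_eq_mul] at h8
  refine h8.trans ?_
  gcongr
  rw [Nat.card_Ico]
  have : (2^b)^3 - (2^b)^2 ≤ (2^b)^3 := Nat.sub_le _ _
  exact_mod_cast this

/-- conditions at one scale -/
def GoodScale (a : ℝ) (h b : ℕ) : Prop := 64 ≤ b ∧ (b:ℝ)/64 ≤ Wb h b ∧ ((2:ℝ)^b)^6*exp (-(a*2^b)) ≤ 1/b ∧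
  ((2:ℝ)^b)^21*exp (-(2*a/(3*b)*((2:ℝ)^b)^3)) ≤ 1/(3*b) ∧ 20*b/(2:ℝ)^b ≤ 2*a/(3*b)

lemma GoodScale.W1 {a : ℝ} {h b : ℕ} (hg : GoodScale a h b) : 1 ≤ Wb h b := by
  obtain ⟨h1, h2, _⟩ := hg
  have : (64:ℝ) ≤ b := by exact_mod_cast h1
  linarith

lemma GoodScale.tail {a : ℝ} {h b : ℕ} (hg : GoodScale a h b) : 4/Wb h b+24/2^b ≤ 280/b := by
  obtain ⟨h1, h2, _⟩ := hg
  have hb : (64:ℝ) ≤ b := by exact_mod_cast h1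
  have e1 : 4/Wb h b ≤ 4/((b:ℝ)/64) := by gcongr
  have e2 : 24/(2:ℝ)^b ≤ 24/b := by
    gcongr; linarith [one_add_le_two_pow b]
  have : 4/((b:ℝ)/64) = 256/b := by field_simp; norm_num
  have e3 : 280/(b:ℝ) = 256/b+24/b := by ring
  linarith

lemma chain_ind (a : ℝ) (ha : 0 < a) (ha1 : a ≤ 1) (h b K : ℕ) [NeZero h] (X κ : ℝ) (hκ : 0 < κ) (hκ1 : κ ≤ 1) (hX : 0 < X)
    (hg : ∀ i, GoodScale a h (b*3^i)) (hK : (K:ℝ)+1 ≤ X*exp (-((2:ℝ)^b)^2)/h) (J : ℕ) :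
    ((2:ℝ)^(b*3^J))^3 ≤ log X →
    ∑ ξ ∈ Sc h K (b*3^J) (a*(1-1/((b*3^J:ℕ):ℝ))), Fw h K X κ ξ ≤ 30000000*rho h*X^2/b*(3/2 - 1/(2*3^J)) := by
  have hh : (0:ℝ) < h := by exact_mod_cast Nat.pos_of_ne_zero (NeZero.ne h)
  have hb64 : 64 ≤ b := by have := (hg 0).1; simpa using this
  have hb0 : (64:ℝ) ≤ b := by exact_mod_cast hb64
  have hr := rho_nonneg h
  have hK1 : (K:ℝ)+1 ≤ X/h := by
    refine hK.trans ?_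
    gcongr
    have : exp (-((2:ℝ)^b)^2) ≤ 1 := exp_le_one_iff.2 (by nlinarith [sq_nonneg ((2:ℝ)^b)])
    nlinarith
  induction J with
  | zero =>
    intro hJ
    simp only [pow_zero, mul_one] at hJ ⊢
    have h0 := hg 0
    simp only [pow_zero, mul_one] at h0
    have hinv : 1/(b:ℝ) ≤ 1/2 := one_div_le_one_div_of_le (by norm_num) (by linarith)
    have pf := piece_first h b K (by omega) X κ (a*(1-1/(b:ℝ))) hκ hκ1 (mul_nonneg ha.le (by linarith)) h0.W1 (log_scale (by omega) hX hJ) hK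
    refine pf.trans ?_
    have e1 : ((2:ℝ)^b)^6*exp (-(2*(a*(1-1/(b:ℝ)))*2^b)) ≤ 1/b := by
      refine le_trans ?_ h0.2.2.1
      gcongr
      nlinarith
    have e2 := h0.tail
    calc _ ≤ 96000*rho h*X^2*(1/b+280/b) := by gcongr ?_ * ?_; linarith
      _ = (96000*281)*(rho h*X^2*(1/b)) := by ring
      _ ≤ 30000000*(rho h*X^2*(1/b)) := by gcongr; norm_num
      _ = _ := by ring
  | succ i ih =>
    intro hJ
    set B := b*3^i with hB
    have hB3 : b*3^(i+1) = 3*B := by rw [hB, pow_succ]; ring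
    have gB := hg i
    have gB3 := hg (i+1)
    rw [hB3] at hJ gB3 ⊢
    rw [← hB] at gB
    have hB64 : (64:ℝ) ≤ B := by exact_mod_cast gB.1
    have hJi : ((2:ℝ)^B)^3 ≤ log X := by
      refine le_trans ?_ hJ
      gcongr
      · norm_num
      · omega
    have hi := ih hJi
    have hinv : 1/(B:ℝ) ≤ 1/2 := one_div_le_one_div_of_le (by norm_num) (by linarith)
    have hinv0 : 0 ≤ 1/(B:ℝ) := by positivity
    have hst := piece_step h B K (by have := gB.1; omega) X κ (a*(1-1/(B:ℝ))) (2*a/(3*B)) hκ hκ1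
      (mul_nonneg ha.le (by linarith)) (by nlinarith) gB.2.2.2.2 gB3.W1 (log_scale (by have := gB.1; omega) hX hJ) hK1
    have eα : a*(1-1/(B:ℝ))+2*a/(3*B) = a*(1-1/((3*B:ℕ):ℝ)) := by
      push_cast; field_simp; ring
    rw [eα] at hst
    have hsplit : ∑ ξ ∈ Sc h K (3*B) (a*(1-1/((3*B:ℕ):ℝ))), Fw h K X κ ξ ≤
        ∑ ξ ∈ Sc h K (3*B) (a*(1-1/((3*B:ℕ):ℝ))) \ Sc h K B (a*(1-1/(B:ℝ))), Fw h K X κ ξ + ∑ ξ ∈ Sc h K B (a*(1-1/(B:ℝ))), Fw h K X κ ξ := by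
      rw [← sum_union Finset.sdiff_disjoint, Finset.sdiff_union_self_eq_union]
      apply sum_le_sum_of_subset_of_nonneg Finset.subset_union_left
      intro ξ hξ _
      refine Fw_nonneg ?_
      rcases mem_union.1 hξ with h1 | h1
      · exact Sc_sub _ _ _ _ h1
      · exact Sc_sub _ _ _ _ h1
    refine hsplit.trans ?_
    have e2 := gB3.tail
    have e3 := gB.2.2.2.1
    have hst2 : ∑ ξ ∈ Sc h K (3*B) (a*(1-1/((3*B:ℕ):ℝ))) \ Sc h K B (a*(1-1/(B:ℝ))), Fw h K X κ ξ ≤ 30000000*rho h*X^2/b*(1/(3*3^i)) := by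
      refine hst.trans ?_
      push_cast at e2
      calc _ ≤ 96000*rho h*X^2*(1/(3*B)+280/(3*B)) := by gcongr ?_ * ?_; linarith
        _ = (96000*281)*(rho h*X^2*(1/(3*B))) := by ring
        _ ≤ 30000000*(rho h*X^2*(1/(3*B))) := by gcongr; norm_num
        _ = _ := by rw [hB]; push_cast; field_simp
    refine (add_le_add hst2 hi).trans ?_
    rw [← mul_add]
    gcongr
    rw [pow_succ]
    have h3 : (0:ℝ) < 3^i := by positivity
    have : 1/(3*3^i)+(3/2 - 1/(2*3^i)) = (3/2 - 1/(2*(3^i*3)) : ℝ) := by field_simp; ring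
    rw [this]

/-- the result of the chain -/
lemma chain (a : ℝ) (ha : 0 < a) (ha1 : a ≤ 1) : ∃ b2 : ℕ, ∀ b ≥ b2, ∀ h : ℕ, ∀ _ : NeZero h, 64*primeVol h ≤ b →
    ∀ κ : ℝ, 0 < κ → κ ≤ 1 → ∀ᶠ X : ℝ in atTop, ∀ K : ℕ, (K:ℝ)+1 ≤ X*exp (-((2:ℝ)^b)^2)/h →
    ∃ A : Finset (Freq h), A ⊆ Xi h K ∧ ∑ ξ ∈ A, Fw h K X κ ξ ≤ 45000000/b*rho h*X^2 ∧ ((Xi h K \ A).card : ℝ) ≤ X^(3*a) := by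
  obtain ⟨b1, hb1⟩ := Wb_lower
  obtain ⟨b2, hb2⟩ := scale_cond a ha
  refine ⟨b1+b2+64, fun b hb h _ hpv κ hκ hκ1 => ?_⟩
  have hh : 0 < h := Nat.pos_of_ne_zero (NeZero.ne h)
  have hhR : (0:ℝ) < h := by exact_mod_cast hh
  have hg : ∀ i, GoodScale a h (b*3^i) := by
    intro i
    have h3 : 1 ≤ 3^i := Nat.one_le_pow _ _ (by norm_num)
    have hbi : b ≤ b*3^i := Nat.le_mul_of_pos_right _ h3
    have hbi' : (b:ℝ) ≤ ((b*3^i:ℕ):ℝ) := by exact_mod_cast hbi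
    refine ⟨by omega, ?_, hb2 _ (by omega)⟩
    have := hb1 (b*3^i) (by omega) h hh
    linarith
  have ev1 : ∀ᶠ X : ℝ in atTop, ((2:ℝ)^b)^3 ≤ log X := tendsto_log_atTop.eventually_ge_atTop _
  have ev2 : ∀ᶠ X : ℝ in atTop, 2*log X ≤ X^(a/3) := by
    have := isLittleO_log_rpow_atTop (show 0 < a/3 by positivity)
    filter_upwards [this.bound (show (0:ℝ) < 1/2 by norm_num), eventually_gt_atTop 1] with X hX h1
    rw [norm_eq_abs, norm_eq_abs, abs_of_nonneg (log_nonneg h1.le), abs_of_nonneg (by positivity)] at hX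
    linarith
  filter_upwards [ev1, ev2, eventually_gt_atTop 1] with X hX1 hX2 hX3 K hK
  have hX0 : 0 < X := by linarith
  have hL0 : 0 ≤ log X := log_nonneg hX3.le
  have hex : ∃ i, log X < ((2:ℝ)^(b*3^i))^3 := by
    obtain ⟨n, hn⟩ := pow_unbounded_of_one_lt (log X) (show (1:ℝ) < 2 by norm_num)
    refine ⟨n, hn.trans_le ?_⟩
    rw [← pow_mul]
    apply pow_le_pow_right₀ (by norm_num)
    have : n < 3^n := Nat.lt_pow_self (by norm_num)
    nlinarith
  classical
  obtain ⟨J, hJ0, hJ1⟩ : ∃ J, ((2:ℝ)^(b*3^J))^3 ≤ log X ∧ log X < ((2:ℝ)^(b*3^(J+1)))^3 := by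
    rcases hm : Nat.find hex with _ | J
    · have := Nat.find_spec hex
      rw [hm] at this
      simp at this
      linarith
    · refine ⟨J, ?_, ?_⟩
      · have := Nat.find_min hex (m := J) (by omega)
        linarith
      · have := Nat.find_spec hex
        rw [hm] at this; exact this
  have hch := chain_ind a ha ha1 h b K X κ hκ hκ1 hX0 hg hK J hJ0
  refine ⟨_, Sc_sub h K (b*3^J) (a*(1-1/((b*3^J:ℕ):ℝ))), hch.trans ?_, ?_⟩
  · have hb0 : (64:ℝ) ≤ b := by exact_mod_cast (by omega : 64 ≤ b)
    have hr := rho_nonneg h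
    calc _ ≤ 30000000*rho h*X^2/b*(3/2) := by
          gcongr
          have : (0:ℝ) < 1/(2*3^J) := by positivity
          linarith
      _ = _ := by ring
  · set B := b*3^J with hB
    have hgB := hg J
    rw [← hB] at hgB
    have hB64 : (64:ℝ) ≤ B := by exact_mod_cast hgB.1
    have hinv : 1/(B:ℝ) ≤ 1/2 := one_div_le_one_div_of_le (by norm_num) (by linarith)
    have hinv0 : 0 ≤ 1/(B:ℝ) := by positivity
    have hK1 : (K:ℝ)+1 ≤ X/h := by
      refine hK.trans ?_
      gcongr
      have : exp (-((2:ℝ)^b)^2) ≤ 1 := exp_le_one_iff.2 (by nlinarith [sq_nonneg ((2:ℝ)^b)])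
      nlinarith
    have hU := U_count h K B (by have := hgB.1; omega) (a*(1-1/(B:ℝ))) X (mul_nonneg ha.le (by linarith)) (by nlinarith) hX0 hJ0
      (by
        have : ((2:ℝ)^(b*3^(J+1)))^3 = ((2:ℝ)^B)^9 := by rw [hB, pow_succ, ← pow_mul, ← pow_mul]; ring_nf
        rw [← this]; exact hJ1.le) hK1
    refine hU.trans ?_
    have e1 : 2*(a*(1-1/(B:ℝ)))*log X+20*B*log X/2^B ≤ (3*a - a/3)*log X := by
      have h5 := hgB.2.2.2.2
      have h6 : 20*B*log X/2^B = 20*B/2^B*log X := by ring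
      have h7 : 2*a/(3*(B:ℝ)) = 2*a/3*(1/B) := by ring
      rw [h6, ← add_mul]
      gcongr
      rw [h7] at h5
      nlinarith
    calc 2*((2:ℝ)^B)^3*exp (2*(a*(1-1/(B:ℝ)))*log X+20*B*log X/2^B) ≤ X^(a/3)*exp ((3*a - a/3)*log X) := by
          gcongr
          linarith
      _ = X^(3*a) := by
          rw [rpow_def_of_pos hX0, rpow_def_of_pos hX0, ← exp_add]; congr 1; ring

noncomputable def ee (x : ℝ) : ℂ := Complex.exp (x*I)

lemma ee_norm (x : ℝ) : ‖ee x‖ = 1 := norm_exp_ofReal_mul_I x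

lemma ee_add (x y : ℝ) : ee (x+y) = ee x*ee y := by
  unfold ee; rw [← Complex.exp_add]; push_cast; ring_nf

lemma ee_conj (x : ℝ) : (starRingEnd ℂ) (ee x) = ee (-x) := by
  unfold ee; rw [← exp_conj]; simp

lemma half_cot (δ : ℝ) (h0 : 0 < δ) (h1 : δ ≤ π) :
    (1/2+((cos (δ/2)/sin (δ/2)/2 : ℝ) : ℂ)*I)*(1 - ee δ) = 1 := by
  have hs : 0 < sin (δ/2) := Real.sin_pos_of_pos_of_lt_pi (by linarith) (by linarith [pi_pos])
  have e : ee δ = ((cos (δ/2)^2 - sin (δ/2)^2 : ℝ) : ℂ)+((2*sin (δ/2)*cos (δ/2) : ℝ):ℂ)*I := by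
    unfold ee
    rw [Complex.exp_mul_I, ← Complex.ofReal_cos, ← Complex.ofReal_sin, ← Real.cos_two_mul', ← Real.sin_two_mul]
    congr 3 <;> ring_nf
  have hp := Real.sin_sq_add_cos_sq (δ/2)
  rw [e]
  set s := sin (δ/2)
  set c := cos (δ/2)
  have hs' : (s:ℂ) ≠ 0 := by exact_mod_cast hs.ne'
  have hp' : (s:ℂ)^2+(c:ℂ)^2 = 1 := by exact_mod_cast hp
  have hI := I_sq
  push_cast
  field_simp
  linear_combination (-((s:ℂ)+c*I)+2*s)*hp' - 2*s*c^2*hI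

lemma half_cot_le (δ θ : ℝ) (hθ : 0 < θ) (h0 : θ ≤ δ) (h1 : δ ≤ π) :
    0 ≤ cos (δ/2)/sin (δ/2)/2 ∧ cos (δ/2)/sin (δ/2)/2 ≤ 1/θ := by
  have hs : 0 < sin (δ/2) := Real.sin_pos_of_pos_of_lt_pi (by linarith) (by linarith [pi_pos])
  have hc : 0 ≤ cos (δ/2) := Real.cos_nonneg_of_neg_pi_div_two_le_of_le (by linarith [pi_pos]) (by linarith)
  refine ⟨by positivity, ?_⟩
  have h3 : δ/π ≤ sin (δ/2) := by
    have := Real.mul_le_sin (x := δ/2) (by linarith) (by linarith)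
    have e : 2/π*(δ/2) = δ/π := by ring
    linarith
  have h4 := Real.cos_le_one (δ/2)
  rw [div_div, div_le_div_iff₀ (by positivity) hθ]
  have h5 : δ ≤ sin (δ/2) * π := by rwa [div_le_iff₀ pi_pos] at h3
  -- tan bound
  rcases eq_or_lt_of_le (show δ/2 ≤ π/2 by linarith) with h6 | h6
  · rw [h6, Real.cos_pi_div_two]; simp
  · have := Real.lt_tan (x := δ/2) (by linarith) h6
    have hc' : 0 < cos (δ/2) := Real.cos_pos_of_mem_Ioo ⟨by linarith [pi_pos], h6⟩
    rw [Real.tan_eq_sin_div_cos, lt_div_iff₀ hc'] at this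
    nlinarith

lemma half_cot_mono (δ δ' : ℝ) (h0 : 0 < δ) (h01 : δ ≤ δ') (h1 : δ' ≤ π) :
    cos (δ'/2)/sin (δ'/2)/2 ≤ cos (δ/2)/sin (δ/2)/2 := by
  have hs : 0 < sin (δ/2) := Real.sin_pos_of_pos_of_lt_pi (by linarith) (by linarith [pi_pos])
  have hs' : 0 < sin (δ'/2) := Real.sin_pos_of_pos_of_lt_pi (by linarith) (by linarith [pi_pos])
  have : 0 ≤ sin (δ'/2 - δ/2) := Real.sin_nonneg_of_nonneg_of_le_pi (by linarith) (by linarith [pi_pos])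
  rw [Real.sin_sub] at this
  gcongr 1
  rw [div_le_div_iff₀ hs' hs]
  linarith

/-- Kusmin-Landau -/
lemma kusmin (φ : ℕ → ℝ) (n : ℕ) (θ : ℝ) (hθ : 0 < θ) (h0 : ∀ i < n, θ ≤ φ (i+1) - φ i)
    (h1 : ∀ i < n, φ (i+1) - φ i ≤ π) (h2 : ∀ i, i+1 < n → φ (i+2) - φ (i+1) ≤ φ (i+1) - φ i) :
    ‖∑ i ∈ range n, ee (φ i)‖ ≤ 1+3/θ := by
  set δ : ℕ → ℝ := fun i => φ (i+1) - φ i with hδ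
  set t : ℕ → ℝ := fun i => cos (δ i/2)/sin (δ i/2)/2 with ht
  set c : ℕ → ℂ := fun i => 1/2+(t i : ℂ)*I with hc
  have hcu : ∀ i < n, c i*(ee (φ i) - ee (φ (i+1))) = ee (φ i) := by
    intro i hi
    have e : ee (φ (i+1)) = ee (φ i)*ee (δ i) := by rw [← ee_add]; congr 1; simp only [hδ]; ring
    have := half_cot (δ i) (hθ.trans_le (h0 i hi)) (h1 i hi)
    rw [e]
    calc _ = (c i*(1 - ee (δ i)))*ee (φ i) := by ring
      _ = _ := by rw [hc, this, one_mul]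
  have key : ∀ m, m+1 ≤ n → ‖∑ i ∈ range (m+1), ee (φ i)+c m*ee (φ (m+1)) - c 0*ee (φ 0)‖ ≤ t m - t 0 := by
    intro m
    induction m with
    | zero =>
      intro hm
      have := hcu 0 (by omega)
      have e : ∑ i ∈ range (0+1), ee (φ i)+c 0*ee (φ (0+1)) - c 0*ee (φ 0) = 0 := by
        simp only [zero_add, Finset.sum_range_one] at *
        linear_combination -this
      rw [e]; simp
    | succ m ih =>
      intro hm
      have h3 := ih (by omega)
      have := hcu (m+1) (by omega)
      have e : ∑ i ∈ range (m+1+1), ee (φ i)+c (m+1)*ee (φ (m+1+1)) - c 0*ee (φ 0) =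
          (∑ i ∈ range (m+1), ee (φ i)+c m*ee (φ (m+1)) - c 0*ee (φ 0))+(c (m+1) - c m)*ee (φ (m+1)) := by
        rw [sum_range_succ]
        linear_combination -this
      rw [e]
      refine (norm_add_le _ _).trans ?_
      have h4 : ‖(c (m+1) - c m)*ee (φ (m+1))‖ = t (m+1) - t m := by
        rw [norm_mul, ee_norm, mul_one]
        have : c (m+1) - c m = ((t (m+1) - t m : ℝ) : ℂ)*I := by simp only [hc]; push_cast; ring
        rw [this, norm_mul, norm_I, mul_one, norm_real, norm_eq_abs, abs_of_nonneg]
        have := half_cot_mono (δ (m+1)) (δ m) (hθ.trans_le (h0 _ (by omega))) (h2 m (by omega)) (h1 m (by omega))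
        simp only [ht]; linarith
      rw [h4]; linarith
  rcases n with _ | m
  · simp; positivity
  · have hk := key m le_rfl
    have ht' : ∀ i < m+1, 0 ≤ t i ∧ t i ≤ 1/θ := fun i hi => half_cot_le (δ i) θ hθ (h0 i hi) (h1 i hi)
    have hcn : ∀ i < m+1, ‖c i*ee (φ (i+1))‖ ≤ 1/2+t i ∧ ‖c i*ee (φ i)‖ ≤ 1/2+t i := by
      intro i hi
      have : ‖c i‖ ≤ 1/2+t i := by
        refine (norm_add_le _ _).trans ?_
        rw [norm_mul, norm_I, mul_one, norm_real, norm_eq_abs, abs_of_nonneg (ht' i hi).1]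
        norm_num
      rw [norm_mul, norm_mul, ee_norm, ee_norm, mul_one]
      exact ⟨this, this⟩
    have e : ∑ i ∈ range (m+1), ee (φ i) = (∑ i ∈ range (m+1), ee (φ i)+c m*ee (φ (m+1)) - c 0*ee (φ 0)) - c m*ee (φ (m+1))+c 0*ee (φ 0) := by ring
    rw [e]
    refine (norm_add_le _ _).trans ((add_le_add_left (norm_sub_le _ _) _).trans ?_)
    have a1 := (hcn m (by omega)).1
    have a2 := (hcn 0 (by omega)).2
    have a3 := ht' m (by omega)
    have a4 := ht' 0 (by omega)
    have : 3/θ = 1/θ+1/θ+1/θ := by ring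
    linarith

/-- van der Corput inequality -/
lemma vdc (u : ℕ → ℂ) (n H : ℕ) (hu : ∀ i, ‖u i‖ ≤ 1) (B : ℕ → ℝ)
    (hB : ∀ r, 1 ≤ r → r < H → ‖∑ i ∈ range (n - r), u i*(starRingEnd ℂ) (u (i+r))‖ ≤ B r) :
    (H:ℝ)^2 * ‖∑ i ∈ range n, u i‖^2 ≤ (n+H)*(H*n+2*H * ∑ r ∈ Ico 1 H, B r) := by
  classical
  set U : ℤ → ℂ := fun i => if 0 ≤ i ∧ i < n then u i.toNat else 0 with hU
  have hU0 : ∀ i : ℤ, ¬ (0 ≤ i ∧ i < n) → U i = 0 := fun i hi => by simp only [hU]; rw [if_neg hi]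
  have hUn : ∀ i : ℕ, i < n → U i = u i := by
    intro i hi
    simp only [hU]
    rw [if_pos ⟨by positivity, by exact_mod_cast hi⟩]; simp
  set I := Ico (0:ℤ) (n+H) with hI
  have hshift : ∀ (g : ℤ → ℂ) (j : ℕ), j < H → (∀ i : ℤ, ¬ (0 ≤ i ∧ i < n) → g i = 0) →
      ∑ m ∈ I, g (m - j) = ∑ i ∈ range n, g i := by
    intro g j hj hg
    symm
    apply Finset.sum_of_injOn (fun i : ℕ => (i:ℤ)+j)
    · intro a _ b _ hab; simp at hab; exact hab
    · intro i hi
      simp [hI] at hi ⊢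
      omega
    · intro m hm hm'
      apply hg
      intro hc
      apply hm'
      refine ⟨(m - j).toNat, ?_, ?_⟩
      · simp; omega
      · simp; omega
    · intro i hi; simp
  set S := ∑ i ∈ range n, u i with hS
  have hS1 : ∀ j < H, ∑ m ∈ I, U (m - j) = S := by
    intro j hj
    rw [hshift U j hj hU0]
    exact sum_congr rfl fun i hi => hUn i (mem_range.1 hi)
  have hHS : (H:ℂ)*S = ∑ m ∈ I, ∑ j ∈ range H, U (m - j) := by
    rw [sum_comm, sum_congr rfl fun j hj => hS1 j (mem_range.1 hj)]
    simp
  have hcs : (H:ℝ)^2 * ‖S‖^2 ≤ (n+H) * ∑ m ∈ I, ‖∑ j ∈ range H, U (m - j)‖^2 := by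
    have h1 : (H:ℝ) * ‖S‖ ≤ ∑ m ∈ I, ‖∑ j ∈ range H, U (m - j)‖ := by
      calc (H:ℝ) * ‖S‖ = ‖(H:ℂ)*S‖ := by rw [norm_mul]; simp
        _ ≤ _ := by rw [hHS]; exact norm_sum_le _ _
    have h2 := sq_sum_le_card_mul_sum_sq (s := I) (f := fun m => ‖∑ j ∈ range H, U (m - j)‖)
    have h3 : (I.card : ℝ) = n+H := by
      rw [hI, Int.card_Ico];
      have : ((n:ℤ)+H - 0).toNat = n+H := by omega
      rw [this]; push_cast; rfl
    rw [h3] at h2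
    calc (H:ℝ)^2 * ‖S‖^2 = (H * ‖S‖)^2 := by ring
      _ ≤ (∑ m ∈ I, ‖∑ j ∈ range H, U (m - j)‖)^2 := by gcongr
      _ ≤ _ := h2
  refine hcs.trans ?_
  gcongr
  have hcor : ∀ j < H, ∀ r, j+r < H → ∑ m ∈ I, U (m - (j+r:ℕ))*(starRingEnd ℂ) (U (m - j)) = ∑ i ∈ range (n-r), u i*(starRingEnd ℂ) (u (i+r)) := by
    intro j hj r hr
    have := hshift (fun i => U i*(starRingEnd ℂ) (U (i+r))) (j+r) hr (by
      intro i hi; rw [hU0 i hi, zero_mul])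
    have e : ∀ m : ℤ, m - ((j+r:ℕ):ℤ)+r = m - j := by intro m; push_cast; ring
    simp only [e] at this
    rw [this]
    symm
    apply Finset.sum_subset_zero_on_sdiff
    · intro i hi; simp at *; omega
    · intro i hi
      simp at hi
      have : U ((i:ℤ)+r) = 0 := hU0 _ (by omega)
      rw [this]; simp
    · intro i hi
      simp at hi
      rw [hUn i (by omega)]
      have := hUn (i+r) (by omega)
      push_cast at this
      rw [this]
  set Bx : ℕ → ℝ := fun r => if r = 0 then n else B r with hBx
  have hc1 : ∀ j < H, ∀ r, j+r < H → ‖∑ m ∈ I, U (m - (j+r:ℕ))*(starRingEnd ℂ) (U (m - j))‖ ≤ Bx r := by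
    intro j hj r hr
    rw [hcor j hj r hr]
    simp only [hBx]
    split_ifs with h0
    · subst h0
      refine (norm_sum_le _ _).trans ?_
      calc _ ≤ ∑ i ∈ range (n-0), (1:ℝ) := by
            apply sum_le_sum
            intro i _
            rw [norm_mul, RCLike.norm_conj]
            have := hu i; have := hu (i+0)
            have := norm_nonneg (u i); have := norm_nonneg (u (i+0))
            nlinarith
        _ = n := by simp
    · exact hB r (by omega) (by omega)
  have hc2 : ∀ j < H, ∀ j' < H, ‖∑ m ∈ I, U (m - j)*(starRingEnd ℂ) (U (m - j'))‖ ≤ if j' ≤ j then Bx (j - j') else Bx (j' - j) := by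
    intro j hj j' hj'
    split_ifs with h0
    · have := hc1 j' hj' (j - j') (by omega)
      rwa [show j' + (j - j') = j by omega] at this
    · have := hc1 j hj (j' - j) (by omega)
      rw [show j+(j' - j) = j' by omega] at this
      rw [← RCLike.norm_conj, map_sum]
      refine le_trans (le_of_eq ?_) this
      congr 1
      apply sum_congr rfl
      intro m _
      rw [map_mul, Complex.conj_conj, mul_comm]
  have hexp : (((∑ m ∈ I, ‖∑ j ∈ range H, U (m - j)‖^2 : ℝ)) : ℂ) = ∑ j ∈ range H, ∑ j' ∈ range H, ∑ m ∈ I, U (m - j)*(starRingEnd ℂ) (U (m - j')) := by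
    push_cast
    have : ∀ m : ℤ, ((‖∑ j ∈ range H, U (m - j)‖ : ℂ))^2 = ∑ j ∈ range H, ∑ j' ∈ range H, U (m - j)*(starRingEnd ℂ) (U (m - j')) := by
      intro m
      rw [← mul_conj', map_sum, sum_mul_sum]
    rw [sum_congr rfl fun m _ => this m, sum_comm]
    apply sum_congr rfl
    intro j _
    rw [sum_comm]
  have hnn : 0 ≤ ∑ m ∈ I, ‖∑ j ∈ range H, U (m - j)‖^2 := sum_nonneg fun _ _ => by positivity
  have h9 : ∑ m ∈ I, ‖∑ j ∈ range H, U (m - j)‖^2 ≤ ∑ j ∈ range H, ∑ j' ∈ range H, (if j' ≤ j then Bx (j - j') else Bx (j' - j)) := by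
    have : ∑ m ∈ I, ‖∑ j ∈ range H, U (m - j)‖^2 = ‖(((∑ m ∈ I, ‖∑ j ∈ range H, U (m - j)‖^2 : ℝ)) : ℂ)‖ := by
      rw [norm_real, norm_eq_abs, abs_of_nonneg hnn]
    rw [this, hexp]
    refine (norm_sum_le _ _).trans (sum_le_sum fun j hj => ?_)
    refine (norm_sum_le _ _).trans (sum_le_sum fun j' hj' => ?_)
    exact hc2 j (mem_range.1 hj) j' (mem_range.1 hj')
  refine h9.trans ?_
  have hB0 : ∀ r ∈ Ico 1 H, 0 ≤ B r := by
    intro r hr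
    rw [mem_Ico] at hr
    exact (norm_nonneg _).trans (hB r hr.1 hr.2)
  have hrow : ∀ j ∈ range H, ∑ j' ∈ range H, (if j' ≤ j then Bx (j - j') else Bx (j' - j)) ≤ n+2 * ∑ r ∈ Ico 1 H, B r := by
    intro j hj
    have hj' := mem_range.1 hj
    have e : ∑ j' ∈ range H, (if j' ≤ j then Bx (j - j') else Bx (j' - j)) =
        ∑ r ∈ range (j+1), Bx r + ∑ r ∈ Ico 1 (H - j), Bx r := by
      rw [range_eq_Ico, ← Finset.sum_Ico_consecutive _ (Nat.zero_le (j+1)) (by omega : j+1 ≤ H)]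
      congr 1
      · rw [← range_eq_Ico, ← sum_range_reflect]
        apply sum_congr rfl
        intro r hr
        rw [mem_range] at hr
        rw [if_pos (by omega)]
        congr 1; omega
      · rw [Finset.sum_Ico_eq_sum_range, Finset.sum_Ico_eq_sum_range]
        rw [show H - j - 1 = H - (j+1) by omega]
        apply sum_congr rfl
        intro r hr
        rw [if_neg (by omega)]
        congr 1; omega
    rw [e, range_eq_Ico, ← Finset.sum_Ico_consecutive _ (Nat.zero_le 1) (by omega : 1 ≤ j+1)]
    have b1 : ∑ r ∈ Ico 0 1, Bx r = n := by simp [hBx]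
    have b2 : ∀ K ≤ H, ∑ r ∈ Ico 1 K, Bx r ≤ ∑ r ∈ Ico 1 H, B r := by
      intro K hK
      calc ∑ r ∈ Ico 1 K, Bx r = ∑ r ∈ Ico 1 K, B r := by
            apply sum_congr rfl
            intro r hr
            rw [mem_Ico] at hr
            simp only [hBx]; rw [if_neg (by omega)]
        _ ≤ _ := sum_le_sum_of_subset_of_nonneg (Finset.Ico_subset_Ico le_rfl hK) fun r hr _ => hB0 r hr
    rw [b1]
    linarith [b2 (j+1) (by omega), b2 (H-j) (by omega)]
  refine (sum_le_sum hrow).trans ?_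
  rw [sum_const, card_range, nsmul_eq_mul]
  linarith

lemma log1p_bounds {y : ℝ} (h0 : 0 ≤ y) (h1 : y ≤ 1) : y/2 ≤ log (1+y) ∧ log (1+y) ≤ y := by
  constructor
  · have := Real.one_sub_inv_le_log_of_pos (show 0 < 1+y by linarith)
    refine le_trans ?_ this
    rw [inv_eq_one_div, le_sub_iff_add_le, ← le_sub_iff_add_le', div_le_iff₀ (by linarith)]
    nlinarith
  · have := log_le_sub_one_of_pos (show 0 < 1+y by linarith)
    linarith

/-- phases whose increments are `k log(1+g)` -/
lemma kusmin_log (φ : ℕ → ℝ) (n : ℕ) (g : ℝ → ℝ) (x k lo hi : ℝ) (hk : 0 < k) (hlo : 0 < lo) (hhi : hi ≤ 1) (hkh : k*hi ≤ 3)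
    (hφ : ∀ i < n, φ (i+1) - φ i = k*log (1+g (x+i)))
    (hg : ∀ i < n, lo ≤ g (x+i) ∧ g (x+i) ≤ hi) (hanti : ∀ i, i+1 < n → g (x+((i+1:ℕ):ℝ)) ≤ g (x+i)) :
    ‖∑ i ∈ range n, ee (φ i)‖ ≤ 1+6/(k*lo) := by
  have hb : ∀ i < n, g (x+i)/2 ≤ log (1+g (x+i)) ∧ log (1+g (x+i)) ≤ g (x+i) := fun i hi' =>
    log1p_bounds (by linarith [(hg i hi').1]) (by linarith [(hg i hi').2])
  have := kusmin φ n (k*lo/2) (by positivity) (by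
    intro i hi'
    rw [hφ i hi']
    have := (hb i hi').1
    have := (hg i hi').1
    nlinarith) (by
    intro i hi'
    rw [hφ i hi']
    have h1 := (hb i hi').2
    have h2 := (hg i hi').2
    have : k*log (1+g (x+i)) ≤ k*hi := by gcongr; linarith
    linarith [pi_gt_three]) (by
    intro i hi'
    rw [hφ i (by omega), show i+2 = (i+1)+1 by ring, hφ (i+1) hi']
    have h1 := hg (i+1) hi'
    have h2 := hanti i hi'
    gcongr
    linarith)
  refine this.trans ?_
  have e : 3/(k*lo/2) = 6/(k*lo) := by field_simp; norm_num
  rw [e]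

noncomputable def LS (x k : ℝ) (n : ℕ) : ℂ := ∑ i ∈ range n, ee (k*log (x+i))

lemma range_y {x N : ℝ} {n i : ℕ} (hx : N ≤ x) (hn : x+n ≤ 600*N) (hi : i < n) : N ≤ x+i ∧ x+i+1 ≤ 600*N := by
  have : (i:ℝ)+1 ≤ n := by exact_mod_cast hi
  have h0 : (0:ℝ) ≤ i := by positivity
  constructor <;> linarith

lemma LS_small (N x k : ℝ) (n : ℕ) (hN : 2 ≤ N) (hx : N ≤ x) (hn : x+n ≤ 600*N) (hk : 0 < k) (hkN : k ≤ N) :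
    ‖LS x k n‖ ≤ 1+3600*N/k := by
  have := kusmin_log (fun i => k*log (x+i)) n (fun y => 1/y) x k (1/(600*N)) (1/N) hk (by positivity)
    (by rw [div_le_one (by linarith)]; linarith) (by rw [mul_one_div, div_le_iff₀ (by linarith)]; linarith) (by
      intro i hi
      have hy := range_y hx hn hi
      have hy0 : 0 < x+i := by linarith
      push_cast
      rw [← mul_sub, ← add_assoc, ← log_div (by linarith) (by linarith)]
      congr 2; field_simp) (by
      intro i hi
      have hy := range_y hx hn hi
      constructor
      · exact one_div_le_one_div_of_le (by linarith) (by linarith)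
      · exact one_div_le_one_div_of_le (by linarith) (by linarith)) (by
      intro i hi
      have hy := range_y hx hn (show i < n by omega)
      apply one_div_le_one_div_of_le (by linarith)
      push_cast; linarith)
  unfold LS
  refine this.trans (le_of_eq ?_)
  field_simp; ring

lemma LSr (N x k : ℝ) (m r : ℕ) (hN : 2 ≤ N) (hx : N ≤ x) (hn : x+m ≤ 600*N) (hk : 0 < k) (hr : 1 ≤ r) (hrN : (r:ℝ) ≤ N)
    (hkr : k*r ≤ N^2) :
    ‖∑ i ∈ range m, ee (k*(log (x+i) - log (x+i+r)))‖ ≤ 1+2400000*N^2/(k*r) := by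
  have hr' : (1:ℝ) ≤ r := by exact_mod_cast hr
  have := kusmin_log (fun i => k*(log (x+i) - log (x+i+r))) m (fun y => r/(y*(y+1+r))) x k (r/(400000*N^2)) (r/N^2) hk (by positivity)
    (by rw [div_le_one (by positivity)]; nlinarith) (by rw [← mul_div_assoc, div_le_iff₀ (by positivity)]; nlinarith) (by
      intro i hi
      have hy := range_y hx hn hi
      set y := x+i with hyd
      have hy0 : 0 < y := by linarith
      push_cast
      rw [← mul_sub, ← add_assoc, ← hyd, ← log_div (by linarith) (by linarith), ← log_div (by linarith) (by linarith), ← log_div (by positivity) (by positivity)]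
      congr 2; field_simp; ring) (by
      intro i hi
      have hy := range_y hx hn hi
      set y := x+i with hyd
      have hy0 : 0 < y := by linarith
      constructor
      · apply div_le_div_of_nonneg_left (by positivity) (by positivity)
        have : y*(y+1+r) ≤ (600*N)*(601*N) := by gcongr <;> linarith
        nlinarith
      · apply div_le_div_of_nonneg_left (by positivity) (by positivity)
        nlinarith) (by
      intro i hi
      have hy := range_y hx hn (show i < m by omega)
      have hy0 : 0 < x+i := by linarith
      push_cast
      gcongr <;> linarith)
  refine this.trans (le_of_eq ?_)
  field_simp; ring

lemma LSrs (N x k : ℝ) (m r s : ℕ) (hN : 2 ≤ N) (hx : N ≤ x) (hn : x+m ≤ 600*N) (hk : 0 < k) (hr : 1 ≤ r) (hrN : (r:ℝ) ≤ N)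
    (hs : 1 ≤ s) (hsN : (s:ℝ) ≤ N) (hkr : k*(r*s) ≤ N^3) :
    ‖∑ i ∈ range m, ee (k*(log (x+i) - log (x+i+r) - log (x+i+s)+log (x+i+s+r)))‖ ≤ 1+720000000*N^3/(k*(r*s)) := by
  have hr' : (1:ℝ) ≤ r := by exact_mod_cast hr
  have hs' : (1:ℝ) ≤ s := by exact_mod_cast hs
  have hrs : (r:ℝ)*s ≤ N*N := by gcongr
  have := kusmin_log (fun i => k*(log (x+i) - log (x+i+r) - log (x+i+s)+log (x+i+s+r))) m
    (fun y => (r*s)*(1/((y+s+r)*(y+1+r)*(y+1+s))+(1+1/(y+s+r))*(1/(y*(y+1+r)*(y+1+s))))) x k (r*s*(1/(120000000*N^3))) (r*s*(2/N^3)) hk (by positivity)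
    (by rw [← mul_div_assoc, div_le_one (by positivity)]; nlinarith [mul_pos (show 0 < N by linarith) (show 0 < N by linarith)])
    (by rw [← mul_div_assoc, ← mul_div_assoc, div_le_iff₀ (by positivity)]; nlinarith [pow_pos (show 0 < N by linarith) 3]) (by
      intro i hi
      have hy := range_y hx hn hi
      set y := x+i with hyd
      have hy0 : 0 < y := by linarith
      push_cast
      rw [← mul_sub, ← add_assoc, ← hyd]
      congr 1
      have e : (1+(r*s)*(1/((y+s+r)*(y+1+r)*(y+1+s))+(1+1/(y+s+r))*(1/(y*(y+1+r)*(y+1+s)))) : ℝ) =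
        ((y+1)*(y+1+s+r)*((y+r)*(y+s)))/((y+1+r)*(y+1+s)*(y*(y+s+r))) := by field_simp; ring
      rw [e, log_div (by positivity) (by positivity), log_mul (by positivity) (by positivity), log_mul (by positivity) (by positivity),
        log_mul (by positivity) (by positivity), log_mul (by positivity) (by positivity), log_mul (by positivity) (by positivity),
        log_mul (by positivity) (by positivity)]
      ring) (by
      intro i hi
      have hy := range_y hx hn hi
      set y := x+i with hyd
      have hy0 : 0 < y := by linarith
      constructor
      · gcongr
        have h1 : y*(y+1+r)*(y+1+s) ≤ (600*N)*(601*N)*(601*N) := by gcongr <;> linarith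
        have h2 : (y+s+r)*(y+1+r)*(y+1+s) ≤ (602*N)*(601*N)*(601*N) := by gcongr <;> linarith
        have h3 : 1/((602*N)*(601*N)*(601*N)) ≤ 1/((y+s+r)*(y+1+r)*(y+1+s)) := one_div_le_one_div_of_le (by positivity) h2
        have h4 : 1/((600*N)*(601*N)*(601*N)) ≤ 1/(y*(y+1+r)*(y+1+s)) := one_div_le_one_div_of_le (by positivity) h1
        have h5 : 1/(y*(y+1+r)*(y+1+s)) ≤ (1+1/(y+s+r))*(1/(y*(y+1+r)*(y+1+s))) := by
          have : 0 < 1/(y+s+r) := by positivity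
          have : 0 < 1/(y*(y+1+r)*(y+1+s)) := by positivity
          nlinarith
        have h6 : 1/(120000000*N^3) ≤ 1/((602*N)*(601*N)*(601*N))+1/((600*N)*(601*N)*(601*N)) := by
          have e1 : 1/((602*N)*(601*N)*(601*N)) = (1/(602*601*601))*(1/N^3) := by field_simp
          have e2 : 1/((600*N)*(601*N)*(601*N)) = (1/(600*601*601))*(1/N^3) := by field_simp
          have e3 : 1/(120000000*N^3) = (1/120000000)*(1/N^3) := by field_simp
          rw [e1, e2, e3, ← add_mul]
          gcongr
          norm_num
        linarith
      · gcongr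
        have h1 : N*N*N ≤ y*(y+1+r)*(y+1+s) := by gcongr <;> linarith
        have e : 1/((y+s+r)*(y+1+r)*(y+1+s))+(1+1/(y+s+r))*(1/(y*(y+1+r)*(y+1+s))) =
          ((2*y+1+s+r)/(y+s+r))*(1/(y*(y+1+r)*(y+1+s))) := by field_simp; ring
        rw [e]
        have h2 : (2*y+1+s+r)/(y+s+r) ≤ 2 := by rw [div_le_iff₀ (by positivity)]; linarith
        have h3 : 1/(y*(y+1+r)*(y+1+s)) ≤ 1/(N*N*N) := one_div_le_one_div_of_le (by positivity) h1
        calc _ ≤ 2*(1/(N*N*N)) := by gcongr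
          _ = 2/N^3 := by field_simp) (by
      intro i hi
      have hy := range_y hx hn (show i < m by omega)
      have hy0 : 0 < x+i := by linarith
      have hx0 : 0 < x := by linarith
      push_cast
      gcongr <;> first | positivity | linarith)
  refine this.trans (le_of_eq ?_)
  field_simp; ring

lemma sum_inv_sqrt (H : ℕ) : ∑ r ∈ Ico 1 H, (1:ℝ)/r ≤ 3*sqrt H := by
  induction H with
  | zero => simp
  | succ H ih =>
    rcases Nat.eq_zero_or_pos H with h | h
    · subst h; simp
    · rw [Finset.sum_Ico_succ_top h]
      have hH : (1:ℝ) ≤ H := by exact_mod_cast h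
      have hb := sq_sqrt (show (0:ℝ) ≤ H by linarith)
      have ha := sq_sqrt (show (0:ℝ) ≤ (H:ℝ)+1 by linarith)
      have hb0 := Real.sqrt_nonneg (H:ℝ)
      have ha0 := Real.sqrt_nonneg ((H:ℝ)+1)
      push_cast
      set a := sqrt ((H:ℝ)+1)
      set b := sqrt (H:ℝ)
      have h1 : a ≤ 2*H := by nlinarith
      have h2 : b ≤ H := by nlinarith
      have h3 : 1/(H:ℝ) ≤ 3*(a-b) := by
        rw [div_le_iff₀ (by linarith)]
        have h4 : (a-b)*(a+b) = 1 := by nlinarith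
        have h5 : 0 ≤ a - b := by nlinarith
        nlinarith
      linarith

lemma vdc' (N : ℝ) (u : ℕ → ℂ) (n H : ℕ) (hN : 2 ≤ N) (hu : ∀ i, ‖u i‖ ≤ 1) (hn : (n:ℝ) ≤ 600*N) (hH1 : 1 ≤ H) (hHN : (H:ℝ) ≤ N) (B : ℝ)
    (B' : ℕ → ℝ) (hB : ∀ r, 1 ≤ r → r < H → ‖∑ i ∈ range (n - r), u i*(starRingEnd ℂ) (u (i+r))‖ ≤ B' r)
    (hBB : ∑ r ∈ Ico 1 H, B' r ≤ B) :
    ‖∑ i ∈ range n, u i‖^2 ≤ 601*N/H*(600*N+2*B) := by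
  have h := vdc u n H hu B' hB
  have hH : (0:ℝ) < H := by exact_mod_cast hH1
  have hB0 : 0 ≤ ∑ r ∈ Ico 1 H, B' r := sum_nonneg fun r hr => by
    rw [mem_Ico] at hr
    exact (norm_nonneg _).trans (hB r hr.1 hr.2)
  rw [div_mul_eq_mul_div, le_div_iff₀ hH]
  have h2 : (H:ℝ)^2 * ‖∑ i ∈ range n, u i‖^2 ≤ (601*N)*(H*(600*N)+2*H*B) := by
    refine h.trans ?_
    gcongr
    linarith
  have h3 : H*(‖∑ i ∈ range n, u i‖^2*H) ≤ H*(601*N*(600*N+2*B)) := by linarith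
  exact le_of_mul_le_mul_left h3 hH

lemma LS_one (N x k : ℝ) (n H : ℕ) (hN : 2 ≤ N) (hx : N ≤ x) (hn : x+n ≤ 600*N) (hk : 0 < k) (hH1 : 1 ≤ H) (hHN : (H:ℝ) ≤ N)
    (hkH : k*H ≤ N^2) : ‖LS x k n‖^2 ≤ 400000*N^2/H+9000000000*N^3/(k*sqrt H) := by
  have hH : (1:ℝ) ≤ H := by exact_mod_cast hH1
  have h := vdc' N (fun i => ee (k*log (x+i))) n H hN (fun i => (ee_norm _).le) (by linarith) hH1 hHN
    (H+2400000*N^2/k*(3*sqrt H)) (fun r => 1+2400000*N^2/(k*r)) (by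
      intro r hr1 hrH
      have hrH' : (r:ℝ) ≤ H := by exact_mod_cast hrH.le
      have := LSr N x k (n-r) r hN hx (by
        have : ((n-r:ℕ):ℝ) ≤ n := by exact_mod_cast Nat.sub_le n r
        linarith) hk hr1 (hrH'.trans hHN) (le_trans (by gcongr) hkH)
      refine le_trans (le_of_eq ?_) this
      congr 1
      apply sum_congr rfl
      intro i _
      rw [ee_conj, ← ee_add]
      congr 1; push_cast; ring_nf) (by
      rw [sum_add_distrib, sum_const, Nat.card_Ico, nsmul_eq_mul, mul_one]
      have e : ∀ r : ℕ, 2400000*N^2/(k*r) = 2400000*N^2/k*(1/r) := by intro r; rw [div_mul_div_comm, mul_one]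
      simp_rw [e]
      rw [← mul_sum]
      have h1 : ((H-1:ℕ):ℝ) ≤ H := by exact_mod_cast Nat.sub_le H 1
      have h2 := sum_inv_sqrt H
      gcongr)
  refine h.trans ?_
  have hs := mul_self_sqrt (show (0:ℝ) ≤ H by linarith)
  have hs0 : 0 < sqrt H := sqrt_pos.2 (by linarith)
  have e : 601*N/H*(600*N+2*(H+2400000*N^2/k*(3*sqrt H))) = 360600*N^2/H+1202*N+8654400000*N^3/(k*sqrt H) := by
    have : sqrt H/H = 1/sqrt H := by
      rw [div_eq_div_iff (by linarith) hs0.ne']; linarith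
    calc _ = 360600*N^2/H+1202*N*(H/H)+8654400000*N^3/k*(sqrt H/H) := by ring
      _ = _ := by rw [this, div_self (by linarith), div_mul_div_comm]; ring
  rw [e]
  have h3 : N ≤ N^2/H := by rw [le_div_iff₀ (by linarith)]; nlinarith
  have h4 : 8654400000*N^3/(k*sqrt H) ≤ 9000000000*N^3/(k*sqrt H) := by gcongr; norm_num
  have e5 : 360600*N^2/H = 360600*(N^2/H) := by ring
  have e6 : 400000*N^2/H = 400000*(N^2/H) := by ring
  rw [e5, e6]
  nlinarith

lemma LS_two (N x k b : ℝ) (n H : ℕ) (hN : 2 ≤ N) (hx : N ≤ x) (hn : x+n ≤ 600*N) (hk : 0 < k) (hH1 : 1 ≤ H) (hHN : (H:ℝ) ≤ N)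
    (hkH : k*H^2 ≤ N^3) (hb : 0 ≤ b) (hb2 : 400000*N^2/H+3000000000000*N^4/(k*sqrt H) ≤ b^2) :
    ‖LS x k n‖^2 ≤ 400000*N^2/H+1202*N*b := by
  have hH : (1:ℝ) ≤ H := by exact_mod_cast hH1
  have hs := mul_self_sqrt (show (0:ℝ) ≤ H by linarith)
  have hs0 : 0 < sqrt H := sqrt_pos.2 (by linarith)
  have hr : ∀ r : ℕ, 1 ≤ r → r < H → ‖∑ i ∈ range (n - r), ee (k*(log (x+i) - log (x+i+r)))‖ ≤ b := by
    intro r hr1 hrH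
    have hrH' : (r:ℝ) ≤ H := by exact_mod_cast hrH.le
    have hr1' : (1:ℝ) ≤ r := by exact_mod_cast hr1
    have hnr : ((n-r:ℕ):ℝ) ≤ n := by exact_mod_cast Nat.sub_le n r
    have h := vdc' N (fun i => ee (k*(log (x+i) - log (x+i+r)))) (n-r) H hN (fun i => (ee_norm _).le) (by linarith) hH1 hHN
      (H+720000000*N^3/k*(3*sqrt H)) (fun s => 1+720000000*N^3/(k*(r*s))) (by
        intro s hs1 hsH
        have hsH' : (s:ℝ) ≤ H := by exact_mod_cast hsH.le
        have := LSrs N x k (n-r-s) r s hN hx (by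
          have : ((n-r-s:ℕ):ℝ) ≤ n := by exact_mod_cast (by omega : n - r - s ≤ n)
          linarith) hk hr1 (hrH'.trans hHN) hs1 (hsH'.trans hHN) (le_trans (by rw [sq]; gcongr) hkH)
        refine le_trans (le_of_eq ?_) this
        congr 1
        apply sum_congr rfl
        intro i _
        rw [ee_conj, ← ee_add]
        congr 1; push_cast; ring_nf) (by
        rw [sum_add_distrib, sum_const, Nat.card_Ico, nsmul_eq_mul, mul_one]
        have e : ∀ s ∈ Ico 1 H, 720000000*N^3/(k*(r*s)) ≤ 720000000*N^3/k*(1/s) := by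
          intro s hs
          have : (1:ℝ) ≤ s := by exact_mod_cast (mem_Ico.1 hs).1
          rw [div_mul_div_comm, mul_one]
          gcongr
          nlinarith
        have e2 := sum_le_sum e
        rw [← mul_sum] at e2
        have h1 : ((H-1:ℕ):ℝ) ≤ H := by exact_mod_cast Nat.sub_le H 1
        have h2 := sum_inv_sqrt H
        have h3 : 720000000*N^3/k * ∑ s ∈ Ico 1 H, (1:ℝ)/s ≤ 720000000*N^3/k*(3*sqrt H) := by gcongr
        linarith)
    refine (pow_le_pow_iff_left₀ (norm_nonneg _) hb two_ne_zero).1 ?_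
    refine h.trans (le_trans ?_ hb2)
    have e : 601*N/H*(600*N+2*(H+720000000*N^3/k*(3*sqrt H))) = 360600*N^2/H+1202*N+2596320000000*N^4/(k*sqrt H) := by
      have : sqrt H/H = 1/sqrt H := by
        rw [div_eq_div_iff (by linarith) hs0.ne']; linarith
      calc _ = 360600*N^2/H+1202*N*(H/H)+2596320000000*N^4/k*(sqrt H/H) := by ring
        _ = _ := by rw [this, div_self (by linarith), div_mul_div_comm]; ring
    rw [e]
    have h3 : N ≤ N^2/H := by rw [le_div_iff₀ (by linarith)]; nlinarith
    have h4 : 2596320000000*N^4/(k*sqrt H) ≤ 3000000000000*N^4/(k*sqrt H) := by gcongr; norm_num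
    have e5 : 360600*N^2/H = 360600*(N^2/H) := by ring
    have e6 : 400000*N^2/H = 400000*(N^2/H) := by ring
    rw [e5, e6]
    nlinarith
  have h := vdc' N (fun i => ee (k*log (x+i))) n H hN (fun i => (ee_norm _).le) (by linarith) hH1 hHN
    (H*b) (fun r => b) (by
      intro r hr1 hrH
      refine le_trans (le_of_eq ?_) (hr r hr1 hrH)
      congr 1
      apply sum_congr rfl
      intro i _
      rw [ee_conj, ← ee_add]
      congr 1; push_cast; ring_nf) (by
      rw [sum_const, Nat.card_Ico, nsmul_eq_mul]
      have h1 : ((H-1:ℕ):ℝ) ≤ H := by exact_mod_cast Nat.sub_le H 1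
      gcongr)
  refine h.trans ?_
  have e : 601*N/H*(600*N+2*(H*b)) = 360600*N^2/H+1202*N*b := by field_simp; ring
  rw [e]
  gcongr
  norm_num

lemma floor_half {y : ℝ} (hy : 1 ≤ y) : 1 ≤ ⌊y⌋₊ ∧ ((⌊y⌋₊:ℕ):ℝ) ≤ y ∧ y/2 ≤ (⌊y⌋₊:ℕ) := by
  have h1 : 1 ≤ ⌊y⌋₊ := Nat.one_le_floor_iff _ |>.2 hy
  have h2 := Nat.floor_le (show 0 ≤ y by linarith)
  have h3 := Nat.lt_floor_add_one y
  have h4 : (1:ℝ) ≤ (⌊y⌋₊:ℕ) := by exact_mod_cast h1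
  exact ⟨h1, h2, by linarith⟩

lemma LS_all (N x k : ℝ) (n : ℕ) (hN : 2 ≤ N) (hx : N ≤ x) (hn : x+n ≤ 600*N)
    (hk : N^(1/2:ℝ) ≤ k) (hk2 : k ≤ N^(2.6:ℝ)) : ‖LS x k n‖ ≤ 10000000*N^(0.99:ℝ) := by
  have hN0 : 0 < N := by linarith
  have hN1 : 1 ≤ N := by linarith
  have hp : ∀ a b : ℝ, N^a*N^b = N^(a+b) := fun a b => (rpow_add hN0 a b).symm
  have hm : ∀ {a b : ℝ}, a ≤ b → N^a ≤ N^b := fun h => Real.rpow_le_rpow_of_exponent_le hN1 h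
  have hpos : ∀ a : ℝ, 0 < N^a := fun a => rpow_pos_of_pos hN0 a
  have hn1 : N = N^(1:ℝ) := (rpow_one N).symm
  have hn2 : N^2 = N^(2:ℝ) := by norm_cast
  have hn3 : N^3 = N^(3:ℝ) := by norm_cast
  have hn4 : N^4 = N^(4:ℝ) := by norm_cast
  have hge1 : ∀ {a : ℝ}, 0 ≤ a → 1 ≤ N^a := fun h => one_le_rpow hN1 h
  have hk0 : 0 < k := lt_of_lt_of_le (hpos _) hk
  rcases le_total k N with h1 | h1
  · have h := LS_small N x k n hN hx hn hk0 h1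
    have e1 : N/k ≤ N^(1/2:ℝ) := by
      rw [div_le_iff₀ hk0]
      calc N = N^(1/2:ℝ)*N^(1/2:ℝ) := by rw [hp]; norm_num
        _ ≤ _ := by gcongr
    have e2 : N^(1/2:ℝ) ≤ N^(0.99:ℝ) := hm (by norm_num)
    have e3 : 1 ≤ N^(0.99:ℝ) := hge1 (by norm_num)
    have e4 : 3600*N/k = 3600*(N/k) := by ring
    nlinarith
  rcases le_total k (N^(1.9:ℝ)) with h2 | h2
  · set y := N^(1.93:ℝ)/k with hy
    have hy1 : 1 ≤ y := by
      rw [hy, one_le_div hk0]; exact h2.trans (hm (by norm_num))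
    have hyk : y*k = N^(1.93:ℝ) := by rw [hy]; field_simp
    have hy0 : 0 < y := by linarith
    obtain ⟨f1, f2, f3⟩ := floor_half hy1
    set H := ⌊y⌋₊
    have hyN : y ≤ N^(0.93:ℝ) := by
      rw [hy, div_le_iff₀ hk0]
      calc N^(1.93:ℝ) = N^(0.93:ℝ)*N := by nth_rewrite 3 [hn1]; rw [hp]; norm_num
        _ ≤ _ := by gcongr
    have hH0 : (0:ℝ) < H := by exact_mod_cast f1
    have h := LS_one N x k n H hN hx hn hk0 f1 (f2.trans (hyN.trans (by
      nth_rewrite 2 [hn1]; exact hm (by norm_num)))) (by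
        calc k*H ≤ k*y := by gcongr
          _ = N^(1.93:ℝ) := by linarith
          _ ≤ _ := by rw [hn2]; exact hm (by norm_num))
    have e1 : N^2/H ≤ 2*N^(1.97:ℝ) := by
      rw [div_le_iff₀ hH0]
      calc N^2 = N^(1.97:ℝ)*N^(0.03:ℝ) := by rw [hp, hn2]; norm_num
        _ ≤ N^(1.97:ℝ)*y := by
            gcongr
            rw [hy, le_div_iff₀ hk0]
            calc N^(0.03:ℝ)*k ≤ N^(0.03:ℝ)*N^(1.9:ℝ) := by gcongr
              _ = _ := by rw [hp]; norm_num
        _ ≤ _ := by nlinarith [hpos 1.97]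
    have hs : sqrt y/2 ≤ sqrt H := by
      apply le_sqrt_of_sq_le
      rw [div_pow, sq_sqrt hy0.le]; linarith
    have hsy : 0 < sqrt y := sqrt_pos.2 hy0
    have e2 : N^3/(k*sqrt H) ≤ 2*N^(1.97:ℝ) := by
      have hq : 0 < k*sqrt H := by positivity
      rw [div_le_iff₀ hq]
      have : N^(1.465:ℝ) ≤ k*sqrt y := by
        have : k*sqrt y = sqrt (k*N^(1.93:ℝ)) := by
          rw [← hyk, show k*(y*k) = y*k^2 by ring, Real.sqrt_mul hy0.le, sqrt_sq hk0.le]; ring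
        rw [this]
        apply le_sqrt_of_sq_le
        calc (N^(1.465:ℝ))^2 = N*N^(1.93:ℝ) := by nth_rewrite 2 [hn1]; rw [sq, hp, hp]; norm_num
          _ ≤ _ := by gcongr
      calc N^3 ≤ N^(1.97:ℝ)*N^(1.465:ℝ) := by rw [hp, hn3]; exact hm (by norm_num)
        _ ≤ N^(1.97:ℝ)*(k*sqrt y) := by gcongr
        _ = 2*N^(1.97:ℝ)*(k*(sqrt y/2)) := by ring
        _ ≤ _ := by gcongr
    refine (pow_le_pow_iff_left₀ (norm_nonneg _) (by positivity) two_ne_zero).1 (h.trans ?_)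
    have e3 : N^(1.97:ℝ) ≤ (N^(0.99:ℝ))^2 := by rw [sq, hp]; exact hm (by norm_num)
    have e4 : 400000*N^2/H = 400000*(N^2/H) := by ring
    have e5 : 9000000000*N^3/(k*sqrt H) = 9000000000*(N^3/(k*sqrt H)) := by ring
    rw [e4, e5]
    nlinarith
  · set y := sqrt (N^(2.95:ℝ)/k) with hy
    have hyk : y^2*k = N^(2.95:ℝ) := by
      rw [hy, sq_sqrt (by positivity)]; field_simp
    have hy1 : N^(0.175:ℝ) ≤ y := by
      apply le_sqrt_of_sq_le
      rw [le_div_iff₀ hk0]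
      calc (N^(0.175:ℝ))^2*k ≤ (N^(0.175:ℝ))^2*N^(2.6:ℝ) := by gcongr
        _ = _ := by rw [sq, hp, hp]; norm_num
    have hyN : y ≤ N^(0.525:ℝ) := by
      rw [hy]
      apply Real.sqrt_le_iff.2 ⟨(hpos _).le, ?_⟩
      rw [div_le_iff₀ hk0]
      calc N^(2.95:ℝ) = (N^(0.525:ℝ))^2*N^(1.9:ℝ) := by rw [sq, hp, hp]; norm_num
        _ ≤ _ := by gcongr
    have hy11 : 1 ≤ y := (hge1 (by norm_num)).trans hy1
    have hy0 : 0 < y := by linarith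
    obtain ⟨f1, f2, f3⟩ := floor_half hy11
    set H := ⌊y⌋₊
    have hH0 : (0:ℝ) < H := by exact_mod_cast f1
    have hs : sqrt y/2 ≤ sqrt H := by
      apply le_sqrt_of_sq_le
      rw [div_pow, sq_sqrt hy0.le]; linarith
    have hsy : 0 < sqrt y := sqrt_pos.2 hy0
    have e1 : N^2/H ≤ 2*N^(1.84:ℝ) := by
      rw [div_le_iff₀ hH0]
      calc N^2 ≤ N^(1.84:ℝ)*N^(0.175:ℝ) := by rw [hp, hn2]; exact hm (by norm_num)
        _ ≤ N^(1.84:ℝ)*y := by gcongr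
        _ ≤ _ := by nlinarith [hpos 1.84]
    have e2 : N^4/(k*sqrt H) ≤ 2*N^(1.84:ℝ) := by
      have hq : 0 < k*sqrt H := by positivity
      rw [div_le_iff₀ hq]
      have hys : sqrt y ≤ N^(0.2625:ℝ) := by
        apply Real.sqrt_le_iff.2 ⟨(hpos _).le, ?_⟩
        rw [sq, hp]; norm_num at hyN ⊢; exact hyN
      have hsq := mul_self_sqrt hy0.le
      have : N^(2.16:ℝ) ≤ k*sqrt y := by
        have e : k*sqrt y*(y*sqrt y) = N^(2.95:ℝ) := by
          rw [← hyk]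
          calc _ = k*y*(sqrt y*sqrt y) := by ring
            _ = _ := by rw [hsq]; ring
        have e' : y*sqrt y ≤ N^(0.79:ℝ) := by
          calc _ ≤ N^(0.525:ℝ)*N^(0.2625:ℝ) := by gcongr
            _ ≤ _ := by rw [hp]; exact hm (by norm_num)
        have e'' : N^(2.16:ℝ)*(y*sqrt y) ≤ k*sqrt y*(y*sqrt y) := by
          rw [e]
          calc _ ≤ N^(2.16:ℝ)*N^(0.79:ℝ) := by gcongr
            _ ≤ _ := by rw [hp]; exact hm (by norm_num)
        exact le_of_mul_le_mul_right e'' (by positivity)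
      calc N^4 ≤ N^(1.84:ℝ)*N^(2.16:ℝ) := by rw [hp, hn4]; exact hm (by norm_num)
        _ ≤ N^(1.84:ℝ)*(k*sqrt y) := by gcongr
        _ = 2*N^(1.84:ℝ)*(k*(sqrt y/2)) := by ring
        _ ≤ _ := by gcongr
    have e4 : 400000*N^2/H = 400000*(N^2/H) := by ring
    have e5 : 3000000000000*N^4/(k*sqrt H) = 3000000000000*(N^4/(k*sqrt H)) := by ring
    have e6 : (N^(0.92:ℝ))^2 = N^(1.84:ℝ) := by rw [sq, hp]; norm_num
    have h := LS_two N x k (3000000*N^(0.92:ℝ)) n H hN hx hn hk0 f1 (f2.trans (hyN.trans (by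
      nth_rewrite 2 [hn1]; exact hm (by norm_num)))) (by
        calc k*H^2 ≤ k*y^2 := by gcongr
          _ = N^(2.95:ℝ) := by linarith
          _ ≤ _ := by rw [hn3]; exact hm (by norm_num)) (by positivity) (by
        rw [mul_pow, e6, e4, e5]; nlinarith [hpos 1.84])
    refine (pow_le_pow_iff_left₀ (norm_nonneg _) (by positivity) two_ne_zero).1 (h.trans ?_)
    have e3 : N^(1.84:ℝ) ≤ (N^(0.99:ℝ))^2 := by rw [sq, hp]; exact hm (by norm_num)
    have e7 : N*N^(0.92:ℝ) ≤ (N^(0.99:ℝ))^2 := by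
      nth_rewrite 1 [hn1]; rw [sq, hp, hp]; exact hm (by norm_num)
    rw [e4]
    nlinarith

noncomputable def prim (k u : ℝ) : ℂ := u*ee (k*log u)/(1+k*I)

lemma one_add_ne (k : ℝ) : (1+k*I : ℂ) ≠ 0 := by
  intro h
  have := congrArg re h
  simp at this

lemma prim_deriv (k u : ℝ) (hu : 0 < u) : HasDerivAt (prim k) (ee (k*log u)) u := by
  have h1 : HasDerivAt (fun u : ℝ => ((k*log u : ℝ):ℂ)) ((k*u⁻¹ : ℝ):ℂ) u :=
    ((Real.hasDerivAt_log hu.ne').const_mul k).ofReal_comp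
  have h2 : HasDerivAt (fun u : ℝ => ee (k*log u)) (ee (k*log u)*((k*u⁻¹ : ℝ)*I)) u := by
    unfold ee
    exact (h1.mul_const I).cexp
  have h3 := ((ofRealCLM.hasDerivAt (x := u)).mul h2).div_const (1+k*I)
  refine h3.congr_deriv ?_
  have := one_add_ne k
  have hu' : (u:ℂ) ≠ 0 := by exact_mod_cast hu.ne'
  rw [div_eq_iff this]
  push_cast
  simp only [Complex.ofRealCLM_apply, ofReal_one]
  field_simp

lemma ee_sub_le (x y : ℝ) : ‖ee x - ee y‖ ≤ |x - y| := by
  unfold ee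
  have : Complex.exp (x*I) - Complex.exp (y*I) = Complex.exp (y*I)*(Complex.exp (I*((x-y:ℝ):ℂ)) - 1) := by
    rw [mul_sub, ← Complex.exp_add, mul_one]; congr 2; push_cast; ring
  rw [this, norm_mul, norm_exp_ofReal_mul_I, one_mul]
  exact Real.norm_exp_I_mul_ofReal_sub_one_le

lemma prim_lip (k x y : ℝ) (hx : 0 < x) (hxy : x ≤ y) : ‖prim k y - prim k x‖ ≤ y - x := by
  have := (convex_Icc x y).norm_image_sub_le_of_norm_hasDerivWithin_le (f := prim k) (C := 1)
    (fun u hu => (prim_deriv k u (by linarith [hu.1])).hasDerivWithinAt) (fun u hu => (ee_norm _).le)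
    (Set.left_mem_Icc.2 hxy) (Set.right_mem_Icc.2 hxy)
  rwa [one_mul, norm_of_nonneg (by linarith)] at this

lemma prim_step (k x : ℝ) (hx : 0 < x) : ‖ee (k*log x) - (prim k (x+1) - prim k x)‖ ≤ |k|/x := by
  have := (convex_Icc x (x+1)).norm_image_sub_le_of_norm_hasDerivWithin_le (f := fun u : ℝ => prim k u - u*ee (k*log x)) (C := |k|/x)
    (f' := fun u => ee (k*log u) - ee (k*log x))
    (fun u hu => by
      have h1 := (ofRealCLM.hasDerivAt (x := u)).mul_const (ee (k*log x))
      have := ((prim_deriv k u (by linarith [hu.1])).sub h1).hasDerivWithinAt (s := Set.Icc x (x+1))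
      simp only [Complex.ofRealCLM_apply, ofReal_one, one_mul] at this
      exact this) (fun u hu => by
        refine (ee_sub_le _ _).trans ?_
        rw [← mul_sub, abs_mul, ← log_div (by linarith [hu.1]) hx.ne', show |k|/x = |k| * (1/x) by ring]
        gcongr
        have h1 : 1 ≤ u/x := by rw [le_div_iff₀ hx]; linarith [hu.1]
        rw [abs_of_nonneg (log_nonneg h1)]
        have := log_le_sub_one_of_pos (show 0 < u/x by linarith)
        refine this.trans ?_
        rw [div_sub_one hx.ne']
        gcongr
        linarith [hu.2])
    (Set.left_mem_Icc.2 (by linarith)) (Set.right_mem_Icc.2 (by linarith))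
  have e : (x+1 - x : ℝ) = 1 := by ring
  rw [e, norm_one, mul_one] at this
  rw [← norm_neg]
  refine le_trans (le_of_eq ?_) this
  congr 1
  simp only [Complex.ofReal_add, ofReal_one]
  ring

lemma prim_norm (k u : ℝ) (hu : 0 < u) (hk : k ≠ 0) : ‖prim k u‖ ≤ u/|k| := by
  unfold prim
  rw [norm_div, norm_mul, ee_norm, mul_one, norm_real, norm_of_nonneg hu.le]
  have : 0 < |k| := abs_pos.2 hk
  gcongr
  have := Complex.abs_im_le_norm (1+k*I)
  simpa using this

lemma LS_neg (x k : ℝ) (n : ℕ) : ‖LS x (-k) n‖ = ‖LS x k n‖ := by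
  unfold LS
  rw [← norm_conj, map_sum]
  congr 1
  refine sum_congr rfl fun i _ => ?_
  rw [ee_conj]; congr 1; ring

lemma LSP (N x k : ℝ) (n : ℕ) (hN : 2 ≤ N) (hx : N ≤ x) (hn : x+n ≤ 600*N)
    (hk2 : |k| ≤ N^(2.6:ℝ)) : ‖LS x k n - (prim k (x+n) - prim k x)‖ ≤ 11000000*N^(0.99:ℝ) := by
  have hN0 : 0 < N := by linarith
  have hN1 : 1 ≤ N := by linarith
  have hs : N^(1/2:ℝ) ≤ N^(0.99:ℝ) := Real.rpow_le_rpow_of_exponent_le hN1 (by norm_num)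
  have hs0 : 0 < N^(1/2:ℝ) := rpow_pos_of_pos hN0 _
  have hss : N^(1/2:ℝ)*N^(1/2:ℝ) = N := by rw [← rpow_add hN0]; norm_num
  have hn' : (n:ℝ) ≤ 600*N := by linarith
  rcases le_total |k| (N^(1/2:ℝ)) with h1 | h1
  · have : prim k (x+n) - prim k x = ∑ i ∈ range n, (prim k (x+i+1) - prim k (x+i)) := by
      have := Finset.sum_range_sub (fun i : ℕ => prim k (x+i)) n
      simp only [Nat.cast_zero, add_zero, Nat.cast_add, Nat.cast_one, ← add_assoc] at this
      exact this.symm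
    rw [this, LS, ← sum_sub_distrib]
    calc _ ≤ ∑ i ∈ range n, N^(1/2:ℝ)/N := by
          refine norm_sum_le_of_le _ fun i _ => (prim_step k (x+i) (add_pos_of_pos_of_nonneg (by linarith) (Nat.cast_nonneg i))).trans ?_
          have : (0:ℝ) ≤ i := by positivity
          gcongr; linarith
      _ = n*N^(1/2:ℝ)/N := by simp; ring
      _ ≤ 600*N*N^(1/2:ℝ)/N := by gcongr
      _ = 600*N^(1/2:ℝ) := by field_simp
      _ ≤ _ := by nlinarith
  · have hk0 : 0 < |k| := lt_of_lt_of_le hs0 h1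
    have hkne : k ≠ 0 := abs_pos.1 hk0
    have h2 : ‖LS x k n‖ ≤ 10000000*N^(0.99:ℝ) := by
      rcases abs_choice k with h | h
      · rw [← h]; exact LS_all N x |k| n hN hx hn h1 hk2
      · have := LS_all N x |k| n hN hx hn h1 hk2
        rwa [h, LS_neg] at this
    have hb : ∀ u, 0 < u → u ≤ 600*N → ‖prim k u‖ ≤ 600*N^(1/2:ℝ) := by
      intro u hu hu2
      refine (prim_norm k u hu hkne).trans ?_
      rw [div_le_iff₀ hk0]
      calc u ≤ 600*N := hu2
        _ = 600*N^(1/2:ℝ)*N^(1/2:ℝ) := by rw [mul_assoc, hss]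
        _ ≤ _ := by gcongr
    have hn0 : (0:ℝ) ≤ n := by positivity
    have b1 := hb x (by linarith) (by linarith)
    have b2 := hb (x+n) (by linarith) hn
    have := norm_sub_le (LS x k n) (prim k (x+n) - prim k x)
    have := norm_sub_le (prim k (x+n)) (prim k x)
    linarith

lemma sum_range_blocks {M : Type*} [AddCommMonoid M] (f : ℕ → M) (h n : ℕ) :
    ∑ j ∈ range (h*n), f j = ∑ r ∈ range h, ∑ i ∈ range n, f (r+h*i) := by
  induction n with
  | zero => simp
  | succ n ih =>
    simp_rw [sum_range_succ]
    rw [sum_add_distrib, ← ih, Nat.mul_succ, Finset.sum_range_add]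
    congr 1
    refine sum_congr rfl fun r _ => by rw [add_comm]

lemma sum_char_range (h : ℕ) [NeZero h] (χ : DirichletCharacter ℂ h) (A : ℕ) :
    ∑ r ∈ range h, χ ((A+r : ℕ) : ZMod h) = if χ = 1 then (h.totient:ℂ) else 0 := by
  have : ∑ r ∈ range h, χ ((A+r : ℕ) : ZMod h) = ∑ a : ZMod h, χ a := by
    have e : ∑ a : ZMod h, χ a = ∑ a : ZMod h, χ (A+a) := (Equiv.sum_comp (Equiv.addLeft (A : ZMod h)) (fun a => χ a)).symm
    rw [e]
    refine sum_bij (fun r _ => (r : ZMod h)) (fun _ _ => mem_univ _) ?_ ?_ ?_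
    · intro a ha b hb hab
      rw [ZMod.natCast_eq_natCast_iff'] at hab
      rwa [Nat.mod_eq_of_lt (mem_range.1 ha), Nat.mod_eq_of_lt (mem_range.1 hb)] at hab
    · intro b _
      exact ⟨b.val, mem_range.2 (ZMod.val_lt b), ZMod.natCast_zmod_val b⟩
    · intro a _; push_cast; rfl
  rw [this]
  split_ifs with h1
  · rw [h1, MulChar.sum_one_eq_card_units, ZMod.card_units_eq_totient]
  · exact MulChar.sum_eq_zero_of_ne_one h1

lemma ch_blk {h : ℕ} [NeZero h] (ξ : Freq h) (A r i : ℕ) :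
    ch ξ (A+1+(r+h*i)) = ξ.1 ((A+1+r : ℕ) : ZMod h)*(ee (ξ.2*log h)*ee (ξ.2*log (((A+1+r:ℕ):ℝ)/h+i))) := by
  have hh : (0:ℝ) < h := by exact_mod_cast Nat.pos_of_neZero h
  unfold ch
  congr 1
  · congr 1; push_cast; simp
  · rw [← ee_add, ← mul_add, ← log_mul hh.ne' (by positivity)]
    unfold ee
    have : ((A+1+(r+h*i) : ℕ):ℝ) = h*(((A+1+r:ℕ):ℝ)/h+i) := by
      push_cast; field_simp; ring
    rw [this]

lemma prim_scale (k h u : ℝ) (hh : 0 < h) (hu : 0 < u) : ee (k*log h)*prim k u = prim k (h*u)/h := by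
  unfold prim
  rw [log_mul hh.ne' hu.ne', mul_add, ee_add]
  have : (h:ℂ) ≠ 0 := by exact_mod_cast hh.ne'
  have := one_add_ne k
  push_cast
  field_simp

lemma polP_blk {h : ℕ} [NeZero h] (ξ : Freq h) (A n : ℕ) (hA : 2*h ≤ A) (hn : A+h*n ≤ 590*A)
    (hk : |(ξ.2:ℝ)| ≤ ((A:ℝ)/h)^(2.6:ℝ)) :
    ‖∑ j ∈ range (h*n), ch ξ (A+1+j) - (if ξ.1 = 1 then ((rho h : ℝ):ℂ) else 0)*(prim ξ.2 ((A:ℝ)+h*n) - prim ξ.2 A)‖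
      ≤ 11000000*h*(A:ℝ)^(0.99:ℝ)+2*h := by
  have hh : (0:ℝ) < h := by exact_mod_cast Nat.pos_of_neZero h
  have hh1 : (1:ℝ) ≤ h := by exact_mod_cast Nat.pos_of_neZero h
  have hAr : 2*(h:ℝ) ≤ A := by exact_mod_cast hA
  have hA0 : (0:ℝ) < A := by linarith
  have hnr : (A:ℝ)+h*n ≤ 590*A := by exact_mod_cast hn
  rw [sum_range_blocks]
  have e1 : (if ξ.1 = 1 then ((rho h : ℝ):ℂ) else 0) = ∑ r ∈ range h, ξ.1 ((A+1+r : ℕ) : ZMod h)*(1/(h:ℂ)) := by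
    rw [← sum_mul, sum_char_range]
    unfold rho
    split_ifs <;> push_cast <;> ring
  rw [e1, sum_mul, ← sum_sub_distrib]
  have : ∀ r ∈ range h, ‖∑ i ∈ range n, ch ξ (A+1+(r+h*i)) - ξ.1 ((A+1+r : ℕ) : ZMod h)*(1/(h:ℂ))*(prim ξ.2 ((A:ℝ)+h*n) - prim ξ.2 A)‖
      ≤ 11000000*(A:ℝ)^(0.99:ℝ)+2 := by
    intro r hr
    have hrh : (r:ℝ)+1 ≤ h := by exact_mod_cast mem_range.1 hr
    have hr0 : (0:ℝ) ≤ r := by positivity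
    simp_rw [ch_blk, ← mul_sum]
    rw [mul_assoc, ← mul_sub, norm_mul]
    refine (mul_le_of_le_one_left (norm_nonneg _) (DirichletCharacter.norm_le_one _ _)).trans ?_
    set x : ℝ := ((A+1+r:ℕ):ℝ)/h with hx
    have hx' : h*x = A+1+r := by rw [hx]; push_cast; field_simp
    have hx0 : 0 < x := by rw [hx]; positivity
    have h1 := LSP ((A:ℝ)/h) x ξ.2 n (by rw [le_div_iff₀ hh]; exact hAr) (by rw [hx]; push_cast; gcongr; linarith) (by
      rw [← mul_div_assoc, le_div_iff₀ hh, add_mul, mul_comm x, hx']; nlinarith) hk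
    have e2 : ee (ξ.2*log h)*(prim ξ.2 (x+n) - prim ξ.2 x) = 1/(h:ℂ)*(prim ξ.2 (A+1+r+h*n) - prim ξ.2 (A+1+r)) := by
      rw [mul_sub, prim_scale _ _ _ hh (by positivity), prim_scale _ _ _ hh hx0, mul_add, hx']
      push_cast; ring
    have e3 : ee (ξ.2*log h)*(∑ i ∈ range n, ee (ξ.2*log (x+i))) - 1/(h:ℂ)*(prim ξ.2 (A+h*n) - prim ξ.2 A)
       = ee (ξ.2*log h)*(LS x ξ.2 n - (prim ξ.2 (x+n) - prim ξ.2 x))+1/(h:ℂ)*((prim ξ.2 (A+1+r+h*n) - prim ξ.2 (A+h*n)) - (prim ξ.2 (A+1+r) - prim ξ.2 A)) := by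
      rw [mul_sub (ee _), e2, LS]; ring
    rw [e3]
    have p1 := prim_lip ξ.2 (A+h*n) (A+1+r+h*n) (by positivity) (by linarith)
    have p2 := prim_lip ξ.2 A (A+1+r) (by positivity) (by linarith)
    refine (norm_add_le _ _).trans (add_le_add ?_ ?_)
    · rw [norm_mul, ee_norm, one_mul]
      refine h1.trans ?_
      gcongr
      exact div_le_self hA0.le hh1
    · rw [norm_mul, norm_div, norm_one, Complex.norm_natCast, div_mul_eq_mul_div, one_mul, div_le_iff₀ hh]
      refine (norm_sub_le _ _).trans ?_
      linarith
  refine (norm_sum_le_of_le _ this).trans ?_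
  rw [sum_const, card_range, nsmul_eq_mul]
  apply le_of_eq; ring

lemma rho_le_one (h : ℕ) : rho h ≤ 1 := by
  unfold rho
  exact div_le_one_of_le₀ (by exact_mod_cast Nat.totient_le h) (by positivity)

lemma polP {h : ℕ} [NeZero h] (ξ : Freq h) (A B : ℕ) (hA : 2*h ≤ A) (hAB : A ≤ B) (hB : B ≤ 590*A)
    (hk : |(ξ.2:ℝ)| ≤ ((A:ℝ)/h)^(2.6:ℝ)) :
    ‖∑ n ∈ Ioc A B, ch ξ n - (if ξ.1 = 1 then ((rho h : ℝ):ℂ) else 0)*(prim ξ.2 B - prim ξ.2 A)‖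
      ≤ 20000000*h*(A:ℝ)^(0.99:ℝ) := by
  have hh0 := Nat.pos_of_neZero h
  have hh : (0:ℝ) < h := by exact_mod_cast hh0
  have hh1 : (1:ℝ) ≤ h := by exact_mod_cast hh0
  have hAr : 2*(h:ℝ) ≤ A := by exact_mod_cast hA
  set n := (B-A)/h
  have hn1 : h*n ≤ B - A := Nat.mul_div_le _ _
  have hn2 : B - A < h*n+h := by
    have := Nat.lt_div_mul_add (a := B - A) hh0
    rw [mul_comm]; exact this
  have hd := polP_blk ξ A n hA (by omega) hk
  obtain ⟨t, ht⟩ : ∃ t, B = A+h*n+t := ⟨B - (A+h*n), by omega⟩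
  have hth : t ≤ h := by omega
  have e1 : ∑ n ∈ Ioc A B, ch ξ n = ∑ j ∈ range (h*n), ch ξ (A+1+j) + ∑ j ∈ range t, ch ξ (A+1+(h*n+j)) := by
    rw [← Finset.sum_range_add (fun j => ch ξ (A+1+j)), show Ioc A B = Ico (A+1) (B+1) by ext; simp, Finset.sum_Ico_eq_sum_range]
    congr 2
    simp; omega
  have hBr : (B:ℝ) = A+h*n+t := by rw [ht]; push_cast; ring
  have htr : (t:ℝ) ≤ h := by exact_mod_cast hth
  have ht0 : (0:ℝ) ≤ t := by positivity
  have hA0 : (0:ℝ) < A := by linarith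
  have hp := prim_lip ξ.2 (A+h*n) B (by positivity) (by linarith)
  have e2 : ∑ n ∈ Ioc A B, ch ξ n - (if ξ.1 = 1 then ((rho h : ℝ):ℂ) else 0)*(prim ξ.2 B - prim ξ.2 A)
    = (∑ j ∈ range (h*n), ch ξ (A+1+j) - (if ξ.1 = 1 then ((rho h : ℝ):ℂ) else 0)*(prim ξ.2 ((A:ℝ)+h*n) - prim ξ.2 A))
      + (∑ j ∈ range t, ch ξ (A+1+(h*n+j)) - (if ξ.1 = 1 then ((rho h : ℝ):ℂ) else 0)*(prim ξ.2 B - prim ξ.2 ((A:ℝ)+h*n))) := by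
    rw [e1]; ring
  rw [e2]
  have b1 : ‖∑ j ∈ range t, ch ξ (A+1+(h*n+j))‖ ≤ t := by
    refine (norm_sum_le_of_le _ (fun j _ => ch_norm_le ξ _)).trans ?_
    simp
  have b2 : ‖(if ξ.1 = 1 then ((rho h : ℝ):ℂ) else 0)*(prim ξ.2 B - prim ξ.2 ((A:ℝ)+h*n))‖ ≤ h := by
    rw [norm_mul]
    refine (mul_le_of_le_one_left (norm_nonneg _) ?_).trans (by linarith)
    split_ifs
    · rw [norm_real, norm_of_nonneg (rho_nonneg h)]; exact rho_le_one h
    · simp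
  have b3 := norm_sub_le (∑ j ∈ range t, ch ξ (A+1+(h*n+j))) ((if ξ.1 = 1 then ((rho h : ℝ):ℂ) else 0)*(prim ξ.2 B - prim ξ.2 ((A:ℝ)+h*n)))
  refine (norm_add_le _ _).trans ?_
  have : 1 ≤ (A:ℝ)^(0.99:ℝ) := one_le_rpow (by linarith) (by norm_num)
  nlinarith

lemma abel_bound (c : ℕ → ℂ) (w : ℕ → ℝ) (A B : ℕ) (hAB : A < B) (D : ℝ)
    (hw : ∀ m, A < m → w (m+1) ≤ w m) (hw0 : ∀ m, A < m → 0 ≤ w m)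
    (hD : ∀ m, A ≤ m → m ≤ B → ‖∑ n ∈ Ioc A m, c n‖ ≤ D) :
    ‖∑ n ∈ Ioc A B, (w n:ℂ)*c n‖ ≤ w (A+1)*D := by
  have key : ∀ m, A+1 ≤ m → m ≤ B →
      ‖∑ n ∈ Ioc A m, (w n:ℂ)*c n - w m * ∑ n ∈ Ioc A m, c n‖ ≤ (w (A+1) - w m)*D := by
    intro m hm
    induction m, hm using Nat.le_induction with
    | base => intro _; simp
    | succ m hm ih =>
      intro hmB
      rw [sum_Ioc_succ_top (by omega), sum_Ioc_succ_top (by omega)]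
      have e : ∑ n ∈ Ioc A m, (w n:ℂ)*c n+w (m+1)*c (m+1) - w (m+1)*(∑ n ∈ Ioc A m, c n+c (m+1))
        = (∑ n ∈ Ioc A m, (w n:ℂ)*c n - w m * ∑ n ∈ Ioc A m, c n)+((w m - w (m+1) : ℝ):ℂ) * ∑ n ∈ Ioc A m, c n := by
        push_cast; ring
      rw [e]
      refine (norm_add_le _ _).trans ?_
      have h1 := ih (by omega)
      have h2 : ‖((w m - w (m+1) : ℝ):ℂ) * ∑ n ∈ Ioc A m, c n‖ ≤ (w m - w (m+1))*D := by
        rw [norm_mul, norm_real, norm_of_nonneg (by linarith [hw m (by omega)])]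
        exact mul_le_mul_of_nonneg_left (hD m (by omega) (by omega)) (by linarith [hw m (by omega)])
      linarith
  have h1 := key B hAB le_rfl
  have h2 : ‖(w B:ℂ) * ∑ n ∈ Ioc A B, c n‖ ≤ w B*D := by
    rw [norm_mul, norm_real, norm_of_nonneg (hw0 B hAB)]
    exact mul_le_mul_of_nonneg_left (hD B hAB.le le_rfl) (hw0 B hAB)
  have := norm_add_le (∑ n ∈ Ioc A B, (w n:ℂ)*c n - w B * ∑ n ∈ Ioc A B, c n) ((w B:ℂ) * ∑ n ∈ Ioc A B, c n)
  rw [sub_add_cancel] at this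
  linarith

open Classical in
noncomputable def qr (k u : ℝ) : ℂ := if k = 0 then (log u : ℂ) else ee (k*log u)/(k*I)

lemma qr_deriv (k u : ℝ) (hu : 0 < u) : HasDerivAt (qr k) (ee (k*log u)/u) u := by
  have hu' : (u:ℂ) ≠ 0 := by exact_mod_cast hu.ne'
  by_cases hk : k = 0
  · have : qr k = fun u => ((log u:ℝ):ℂ) := by funext v; simp [qr, hk]
    rw [this]
    refine (Real.hasDerivAt_log hu.ne').ofReal_comp.congr_deriv ?_
    simp [hk, ee]
  · have : qr k = fun u => ee (k*log u)/(k*I) := by funext v; simp [qr, hk]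
    rw [this]
    have h1 : HasDerivAt (fun u : ℝ => ((k*log u : ℝ):ℂ)) ((k*u⁻¹ : ℝ):ℂ) u :=
      ((Real.hasDerivAt_log hu.ne').const_mul k).ofReal_comp
    have h2 : HasDerivAt (fun u : ℝ => ee (k*log u)) (ee (k*log u)*((k*u⁻¹ : ℝ)*I)) u := by
      unfold ee
      exact (h1.mul_const I).cexp
    refine (h2.div_const _).congr_deriv ?_
    have hk' : (k:ℂ) ≠ 0 := by exact_mod_cast hk
    push_cast
    field_simp

lemma qr_lip (k x y : ℝ) (hx : 0 < x) (hxy : x ≤ y) : ‖qr k y - qr k x‖ ≤ (y - x)/x := by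
  have := (convex_Icc x y).norm_image_sub_le_of_norm_hasDerivWithin_le (f := qr k) (C := 1/x)
    (fun u hu => (qr_deriv k u (by linarith [hu.1])).hasDerivWithinAt) (fun u hu => by
      have : 0 < u := by linarith [hu.1]
      rw [norm_div, ee_norm, norm_real, norm_of_nonneg this.le]
      exact one_div_le_one_div_of_le hx hu.1)
    (Set.left_mem_Icc.2 hxy) (Set.right_mem_Icc.2 hxy)
  rw [norm_of_nonneg (by linarith)] at this
  refine this.trans (le_of_eq (by ring))

lemma qr_step (k x : ℝ) (hx : 0 < x) :
    ‖((1/(x+1):ℝ):ℂ)*(prim k (x+1) - prim k x) - (qr k (x+1) - qr k x)‖ ≤ 1/x - 1/(x+1) := by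
  have := (convex_Icc x (x+1)).norm_image_sub_le_of_norm_hasDerivWithin_le
    (f := fun u : ℝ => ((1/(x+1):ℝ):ℂ)*prim k u - qr k u) (C := 1/x - 1/(x+1))
    (f' := fun u => ((1/(x+1):ℝ):ℂ)*ee (k*log u) - ee (k*log u)/u)
    (fun u hu => by
      have hu0 : 0 < u := by linarith [hu.1]
      exact (((prim_deriv k u hu0).const_mul _).sub (qr_deriv k u hu0)).hasDerivWithinAt) (fun u hu => by
        have hu0 : 0 < u := by linarith [hu.1]
        have e : ((1/(x+1):ℝ):ℂ)*ee (k*log u) - ee (k*log u)/u = ((1/(x+1) - 1/u : ℝ):ℂ)*ee (k*log u) := by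
          push_cast; ring
        rw [e, norm_mul, ee_norm, mul_one, norm_real, norm_eq_abs]
        have h1 : 1/(x+1) ≤ 1/u := one_div_le_one_div_of_le hu0 hu.2
        have h2 : 1/u ≤ 1/x := one_div_le_one_div_of_le hx hu.1
        rw [abs_of_nonpos (by linarith)]; linarith)
    (Set.left_mem_Icc.2 (by linarith)) (Set.right_mem_Icc.2 (by linarith))
  have e : (x+1 - x : ℝ) = 1 := by ring
  rw [e, norm_one, mul_one] at this
  refine le_trans (le_of_eq ?_) this
  congr 1; ring

lemma qr_sum (k : ℝ) (A B : ℕ) (hA : 1 ≤ A) (hAB : A ≤ B) :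
    ‖∑ n ∈ Ioc A B, (((1:ℝ)/n:ℝ):ℂ)*(prim k n - prim k (n-1)) - (qr k B - qr k A)‖ ≤ 1/A - 1/B := by
  induction B, hAB using Nat.le_induction with
  | base => simp
  | succ B hB ih =>
    rw [sum_Ioc_succ_top hB]
    have hB0 : (0:ℝ) < B := by exact_mod_cast (by omega : 0 < B)
    have h := qr_step k B hB0
    push_cast at h ih ⊢
    have e : ∀ (S : ℂ), S+1/((B:ℂ)+1)*(prim k (B+1) - prim k (B+1-1)) - (qr k (B+1) - qr k A)
       = (S - (qr k B - qr k A))+(1/((B:ℂ)+1)*(prim k (B+1) - prim k B) - (qr k (B+1) - qr k B)) := by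
      intro S; rw [show (B:ℝ)+1-1 = B by ring]; ring
    rw [e]
    refine (norm_add_le _ _).trans ?_
    linarith

lemma prim_tele (k : ℝ) (A B : ℕ) (hAB : A ≤ B) :
    ∑ n ∈ Ioc A B, (prim k n - prim k (n-1)) = prim k B - prim k A := by
  induction B, hAB using Nat.le_induction with
  | base => simp
  | succ B hB ih =>
    rw [sum_Ioc_succ_top hB, ih]; push_cast
    rw [show (B:ℝ)+1-1 = B by ring]; ring

lemma exp_two_pi_le : exp (2*π) ≤ 550 := by
  have h1 : 2*π ≤ 6.2832 := by linarith [Real.pi_lt_d4]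
  have h2 : exp 6.2832 = exp 1 ^ 6*exp 0.2832 := by
    rw [← exp_nat_mul, ← exp_add]; norm_num
  have h3 := Real.exp_one_lt_d9
  have h4 : exp 0.2832 ≤ 1.34 := by
    have := Real.exp_bound' (x := 0.2832) (by norm_num) (by norm_num) (n := 4) (by norm_num)
    refine this.trans ?_
    simp [sum_range_succ, Nat.factorial]; norm_num
  calc exp (2*π) ≤ exp 6.2832 := exp_le_exp.2 h1
    _ = _ := h2
    _ ≤ 2.7182818286^6*1.34 := by gcongr
    _ ≤ _ := by norm_num

lemma qr_period (k : ℤ) (M : ℝ) (hM : 0 < M) :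
    qr k (exp (2*π)*M) - qr k M = if k = 0 then ((2*π:ℝ):ℂ) else 0 := by
  unfold qr
  rw [log_mul (exp_pos _).ne' hM.ne', log_exp]
  by_cases hk : k = 0
  · simp [hk]
  · have hk' : (k:ℝ) ≠ 0 := by exact_mod_cast hk
    simp only [hk', hk, if_false]
    have : ee (k*(2*π + log M)) = ee (k*log M) := by
      rw [mul_add, ee_add]
      have : ee (k*(2*π)) = 1 := by
        unfold ee
        rw [Complex.exp_eq_one_iff]; exact ⟨k, by push_cast; ring⟩
      rw [this, one_mul]
    rw [this, sub_self]

lemma recipP {h : ℕ} [NeZero h] (ξ : Freq h) (M : ℝ) (hM : 40*h ≤ M)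
    (hk : |(ξ.2:ℝ)| ≤ (M/(2*h))^(2.6:ℝ)) :
    ‖∑ n ∈ sg M (exp (2*π)*M), (((1:ℝ)/n:ℝ):ℂ)*ch ξ n - (if ξ = (1,0) then ((2*π*rho h : ℝ):ℂ) else 0)‖
      ≤ 60000000*h*M^(-0.01:ℝ) := by
  have hh0 := Nat.pos_of_neZero h
  have hh1 : (1:ℝ) ≤ h := by exact_mod_cast hh0
  have hM0 : 0 < M := by linarith
  have he := exp_two_pi_le
  have he2 : 2 ≤ exp (2*π) := by
    have := add_one_le_exp (2*π); linarith [pi_gt_three]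
  set A := ⌊M⌋₊ with hAd
  set E := exp (2*π)
  set B := ⌊E*M⌋₊ with hBd
  have hA1 : (A:ℝ) ≤ M := Nat.floor_le hM0.le
  have hA2 : M < A+1 := Nat.lt_floor_add_one M
  have hB1 : (B:ℝ) ≤ E*M := Nat.floor_le (by positivity)
  have hB2 : E*M < B+1 := Nat.lt_floor_add_one _
  have hA3 : M/2 ≤ A := by linarith
  have hA0 : (0:ℝ) < A := by linarith
  have hAB : A < B := by
    have : (A:ℝ) < B := by nlinarith
    exact_mod_cast this
  have hA2h : 2*h ≤ A := by
    have : 2*(h:ℝ) ≤ A := by linarith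
    exact_mod_cast this
  have hBA : B ≤ 590*A := by
    have : (B:ℝ) ≤ 590*A := by nlinarith
    exact_mod_cast this
  have hkA : |(ξ.2:ℝ)| ≤ ((A:ℝ)/h)^(2.6:ℝ) := by
    refine hk.trans (rpow_le_rpow (by positivity) ?_ (by norm_num))
    rw [← div_div]; gcongr
  set δ : ℂ := if ξ.1 = 1 then ((rho h : ℝ):ℂ) else 0 with hδ
  have hδ1 : ‖δ‖ ≤ 1 := by
    rw [hδ]; split_ifs
    · rw [norm_real, norm_of_nonneg (rho_nonneg h)]; exact rho_le_one h
    · simp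
  have h1 := abel_bound (fun n => ch ξ n - δ*(prim ξ.2 n - prim ξ.2 (n-1))) (fun n => 1/(n:ℝ)) A B hAB (20000000*h*(A:ℝ)^(0.99:ℝ))
    (by intro m hm; have : (0:ℝ) < m := by exact_mod_cast (by omega : 0 < m)
        exact one_div_le_one_div_of_le this (by push_cast; linarith)) (by intros; positivity) (by
      intro m hm hmB
      have := polP ξ A m hA2h hm (hmB.trans hBA) hkA
      rw [sum_sub_distrib, ← mul_sum, prim_tele _ _ _ hm]
      exact this)
  have h2 := qr_sum ξ.2 A B (by omega) hAB.le
  have h3 := qr_lip ξ.2 A M hA0 hA1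
  have h4 := qr_lip ξ.2 B (E*M) (lt_trans hA0 (by exact_mod_cast hAB)) hB1
  have h5 := qr_period ξ.2 M hM0
  have e6 : (if ξ = (1,0) then ((2*π*rho h : ℝ):ℂ) else 0) = δ*(qr ξ.2 (E*M) - qr ξ.2 M) := by
    rw [h5, hδ]
    by_cases a : ξ.1 = 1 <;> by_cases b : ξ.2 = 0 <;> simp [Prod.ext_iff, a, b]
    ring
  have e7 : ∑ n ∈ sg M (E*M), (((1:ℝ)/n:ℝ):ℂ)*ch ξ n - δ*(qr ξ.2 (E*M) - qr ξ.2 M)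
     = ∑ n ∈ Ioc A B, (((1:ℝ)/n:ℝ):ℂ)*(ch ξ n - δ*(prim ξ.2 n - prim ξ.2 (n-1)))
      + δ * ((∑ n ∈ Ioc A B, (((1:ℝ)/n:ℝ):ℂ)*(prim ξ.2 n - prim ξ.2 (n-1)) - (qr ξ.2 B - qr ξ.2 A))
        + ((qr ξ.2 M - qr ξ.2 A) - (qr ξ.2 (E*M) - qr ξ.2 B))) := by
    have : ∑ n ∈ Ioc A B, (((1:ℝ)/n:ℝ):ℂ)*(ch ξ n - δ*(prim ξ.2 n - prim ξ.2 (n-1)))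
       = ∑ n ∈ Ioc A B, (((1:ℝ)/n:ℝ):ℂ)*ch ξ n - δ * ∑ n ∈ Ioc A B, (((1:ℝ)/n:ℝ):ℂ)*(prim ξ.2 n - prim ξ.2 (n-1)) := by
      rw [mul_sum, ← sum_sub_distrib]
      exact sum_congr rfl fun n _ => by ring
    rw [this]; unfold sg; ring
  rw [e6, e7]
  refine (norm_add_le _ _).trans ?_
  rw [norm_mul]
  have b1 : (M - A)/A ≤ 1/A := by gcongr; linarith
  have hBA' : (A:ℝ) ≤ B := by exact_mod_cast hAB.le
  have b2 : (E*M - B)/B ≤ 1/A := by gcongr; linarith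
  have b3 : 1/(A:ℝ) - 1/B ≤ 1/A := by
    have : (0:ℝ) ≤ 1/B := by positivity
    linarith
  have n1 := norm_add_le (∑ n ∈ Ioc A B, (((1:ℝ)/n:ℝ):ℂ)*(prim ξ.2 n - prim ξ.2 (n-1)) - (qr ξ.2 B - qr ξ.2 A)) ((qr ξ.2 M - qr ξ.2 A) - (qr ξ.2 (E*M) - qr ξ.2 B))
  have n2 := norm_sub_le (qr ξ.2 M - qr ξ.2 A) (qr ξ.2 (E*M) - qr ξ.2 B)
  set T := (∑ n ∈ Ioc A B, (((1:ℝ)/n:ℝ):ℂ)*(prim ξ.2 n - prim ξ.2 (n-1)) - (qr ξ.2 B - qr ξ.2 A))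
        + ((qr ξ.2 M - qr ξ.2 A) - (qr ξ.2 (E*M) - qr ξ.2 B)) with hT
  have hTle : ‖T‖ ≤ 3*(1/A) := by linarith
  have hprod : ‖δ‖*‖T‖ ≤ 3*(1/A) := by nlinarith [norm_nonneg T]
  have hp1 : 1/(A:ℝ)*(A:ℝ)^(0.99:ℝ) = (A:ℝ)^(-0.01:ℝ) := by
    rw [one_div, ← Real.rpow_neg_one, ← rpow_add hA0]; norm_num
  have hp2 : 1/(A:ℝ) ≤ (A:ℝ)^(-0.01:ℝ) := by
    rw [← hp1]
    have : 1 ≤ (A:ℝ)^(0.99:ℝ) := one_le_rpow (by linarith) (by norm_num)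
    exact le_mul_of_one_le_right (by positivity) this
  have hp3 : (A:ℝ)^(-0.01:ℝ) ≤ 2*M^(-0.01:ℝ) := by
    calc (A:ℝ)^(-0.01:ℝ) ≤ (M/2)^(-0.01:ℝ) := Real.rpow_le_rpow_of_nonpos (by positivity) hA3 (by norm_num)
      _ = (2:ℝ)^(0.01:ℝ)*M^(-0.01:ℝ) := by
          rw [div_rpow hM0.le (by norm_num), rpow_neg (by norm_num : (0:ℝ) ≤ 2)]; field_simp
      _ ≤ 2*M^(-0.01:ℝ) := by
          gcongr
          exact Real.rpow_le_self_of_one_le (by norm_num) (by norm_num)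
  have hw : 1/((A+1:ℕ):ℝ)*(20000000*h*(A:ℝ)^(0.99:ℝ)) ≤ 20000000*h*(A:ℝ)^(-0.01:ℝ) := by
    rw [← hp1]
    have : 1/((A+1:ℕ):ℝ) ≤ 1/A := one_div_le_one_div_of_le hA0 (by push_cast; linarith)
    calc _ ≤ 1/(A:ℝ)*(20000000*h*(A:ℝ)^(0.99:ℝ)) := by gcongr
      _ = _ := by ring
  have hq : 0 < (A:ℝ)^(-0.01:ℝ) := rpow_pos_of_pos hA0 _
  have hq2 : 0 < M^(-0.01:ℝ) := rpow_pos_of_pos hM0 _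
  have := h1.trans hw
  nlinarith

noncomputable def fdiff {h : ℕ} (ξ ξ' : Freq h) : Freq h := (ξ.1 * ξ'.1⁻¹, ξ.2 - ξ'.2)

lemma ch_mul_conj {h : ℕ} [NeZero h] (ξ ξ' : Freq h) (n : ℕ) : ch ξ n*(starRingEnd ℂ) (ch ξ' n) = ch (fdiff ξ ξ') n := by
  unfold ch fdiff
  have e : (starRingEnd ℂ) (ξ'.1 (n:ZMod h)) = ξ'.1⁻¹ (n:ZMod h) := by
    rw [← MulChar.star_eq_inv, MulChar.star_apply]; rfl
  rw [map_mul, e, ← exp_conj, MulChar.mul_apply, map_mul, conj_ofReal, conj_I]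
  have : Complex.exp (((((ξ.2 - ξ'.2:ℤ):ℝ))*log n : ℝ)*I) = Complex.exp (((ξ.2:ℝ)*log n : ℝ)*I)*Complex.exp (((ξ'.2:ℝ)*log n : ℝ)*(-I)) := by
    rw [← Complex.exp_add]; congr 1; push_cast; ring
  rw [this]; ring

lemma fdiff_eq {h : ℕ} (ξ ξ' : Freq h) : fdiff ξ ξ' = (1,0) ↔ ξ = ξ' := by
  unfold fdiff
  rw [Prod.ext_iff, Prod.ext_iff]
  simp only [mul_inv_eq_one, sub_eq_zero]

lemma dls_dual {h : ℕ} [NeZero h] (U : Finset (Freq h)) (M : ℝ) (hM : 40*h ≤ M)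
    (hU : ∀ ξ ∈ U, ∀ ξ' ∈ U, |((ξ.2 - ξ'.2 : ℤ):ℝ)| ≤ (M/(2*h))^(2.6:ℝ)) (b : Freq h → ℂ) :
    ∑ n ∈ sg M (exp (2*π)*M), (1:ℝ)/n * ‖∑ ξ ∈ U, b ξ * ch ξ n‖^2
      ≤ (2*π*rho h+U.card*(60000000*h*M^(-0.01:ℝ))) * ∑ ξ ∈ U, ‖b ξ‖^2 := by
  classical
  set ε := 60000000*h*M^(-0.01:ℝ) with hε
  have hh1 : (1:ℝ) ≤ h := by exact_mod_cast Nat.pos_of_neZero h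
  have hM0 : 0 < M := by linarith
  have hε0 : 0 ≤ ε := by positivity
  have e1 : ((∑ n ∈ sg M (exp (2*π)*M), (1:ℝ)/n * ‖∑ ξ ∈ U, b ξ * ch ξ n‖^2 : ℝ):ℂ)
    = ∑ ξ ∈ U, ∑ ξ' ∈ U, b ξ * (starRingEnd ℂ) (b ξ') * ∑ n ∈ sg M (exp (2*π)*M), (((1:ℝ)/n:ℝ):ℂ)*ch (fdiff ξ ξ') n := by
    push_cast
    simp_rw [mul_sum]
    rw [sum_congr rfl fun ξ _ => sum_comm, sum_comm]
    refine sum_congr rfl fun n _ => ?_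
    rw [← mul_conj', map_sum, sum_mul_sum, mul_sum]
    refine sum_congr rfl fun ξ _ => ?_
    rw [mul_sum]
    refine sum_congr rfl fun ξ' _ => ?_
    rw [← ch_mul_conj, map_mul]; ring
  have hn : ∑ n ∈ sg M (exp (2*π)*M), (1:ℝ)/n * ‖∑ ξ ∈ U, b ξ * ch ξ n‖^2
     = ‖((∑ n ∈ sg M (exp (2*π)*M), (1:ℝ)/n * ‖∑ ξ ∈ U, b ξ * ch ξ n‖^2 : ℝ):ℂ)‖ := by
    rw [norm_real, norm_of_nonneg]
    exact sum_nonneg fun n _ => by positivity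
  rw [hn, e1]
  have hb : ∀ ξ ∈ U, ∀ ξ' ∈ U, ‖b ξ * (starRingEnd ℂ) (b ξ') * ∑ n ∈ sg M (exp (2*π)*M), (((1:ℝ)/n:ℝ):ℂ)*ch (fdiff ξ ξ') n‖
      ≤ ‖b ξ‖*‖b ξ'‖*ε + (if ξ = ξ' then 2*π*rho h*‖b ξ‖^2 else 0) := by
    intro ξ hξ ξ' hξ'
    have h1 := recipP (fdiff ξ ξ') M hM (hU ξ hξ ξ' hξ')
    rw [norm_mul, norm_mul, norm_conj]
    set S := ∑ n ∈ sg M (exp (2*π)*M), (((1:ℝ)/n:ℝ):ℂ)*ch (fdiff ξ ξ') n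
    simp only [fdiff_eq] at h1
    have hrho := rho_nonneg h
    split_ifs at h1 ⊢ with hc
    · subst hc
      have h2 : ‖S‖ ≤ ε + 2*π*rho h := by
        have := norm_add_le (S - ((2*π*rho h : ℝ):ℂ)) ((2*π*rho h : ℝ):ℂ)
        rw [sub_add_cancel, norm_real, norm_of_nonneg (by positivity)] at this
        linarith
      calc _ ≤ ‖b ξ‖*‖b ξ‖*(ε + 2*π*rho h) := by gcongr
        _ = _ := by ring
    · rw [sub_zero] at h1
      rw [add_zero]; gcongr
  refine (norm_sum_le_of_le _ fun ξ hξ => norm_sum_le_of_le _ fun ξ' hξ' => hb ξ hξ ξ' hξ').trans ?_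
  simp_rw [sum_add_distrib]
  have e2 : ∑ ξ ∈ U, ∑ ξ' ∈ U, (if ξ = ξ' then 2*π*rho h*‖b ξ‖^2 else 0) = 2*π*rho h*∑ ξ ∈ U, ‖b ξ‖^2 := by
    rw [mul_sum]
    exact sum_congr rfl fun ξ hξ => by simp [hξ]
  have e3 : ∑ ξ ∈ U, ∑ ξ' ∈ U, ‖b ξ‖*‖b ξ'‖*ε = (∑ ξ ∈ U, ‖b ξ‖)^2*ε := by
    rw [sq, sum_mul_sum, sum_mul]
    exact sum_congr rfl fun ξ _ => by rw [sum_mul]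
  rw [e2, e3]
  have := sq_sum_le_card_mul_sum_sq (s := U) (f := fun ξ => ‖b ξ‖)
  nlinarith

lemma dls {h : ℕ} [NeZero h] (U : Finset (Freq h)) (M κ : ℝ) (hM : 40*h ≤ M) (hκ : 0 ≤ κ) (hκ2 : κ ≤ 1)
    (hU : ∀ ξ ∈ U, ∀ ξ' ∈ U, |((ξ.2 - ξ'.2 : ℤ):ℝ)| ≤ (M/(2*h))^(2.6:ℝ)) (a : ℕ → ℂ) :
    ∑ ξ ∈ U, ‖pol (sg M ((1+κ)*M)) a ξ‖^2
      ≤ (1+κ)*M*(2*π*rho h+U.card*(60000000*h*M^(-0.01:ℝ))) * ∑ n ∈ (sg M ((1+κ)*M)).filter (fun n => n.Coprime h), ‖a n‖^2 := by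
  classical
  have hh1 : (1:ℝ) ≤ h := by exact_mod_cast Nat.pos_of_neZero h
  have hM0 : 0 < M := by linarith
  have he2 : 2 ≤ exp (2*π) := by
    have := add_one_le_exp (2*π); linarith [pi_gt_three]
  have hrho := rho_nonneg h
  set Bd := 2*π*rho h+U.card*(60000000*h*M^(-0.01:ℝ)) with hBd
  have hBd0 : 0 ≤ Bd := by have := pi_pos; positivity
  set R : Freq h → ℂ := fun ξ => pol (sg M ((1+κ)*M)) a ξ with hR
  set S := ∑ ξ ∈ U, ‖R ξ‖^2 with hS
  have hS0 : 0 ≤ S := sum_nonneg fun _ _ => by positivity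
  set s := (sg M ((1+κ)*M)).filter (fun n => n.Coprime h)
  have hd := dls_dual U M hM hU (fun ξ => (starRingEnd ℂ) (R ξ))
  simp only [norm_conj] at hd
  have h1 : (S:ℂ) = ∑ n ∈ s, a n * ∑ ξ ∈ U, (starRingEnd ℂ) (R ξ)*ch ξ n := by
    have : ∑ n ∈ s, a n * ∑ ξ ∈ U, (starRingEnd ℂ) (R ξ)*ch ξ n = ∑ n ∈ sg M ((1+κ)*M), a n * ∑ ξ ∈ U, (starRingEnd ℂ) (R ξ)*ch ξ n := by
      rw [sum_filter]
      refine sum_congr rfl fun n _ => ?_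
      split_ifs with hc
      · rfl
      · simp [ch_eq_zero _ n hc]
    rw [this, hS]
    push_cast
    simp_rw [mul_sum]
    rw [sum_comm]
    refine sum_congr rfl fun ξ _ => ?_
    rw [← conj_mul']
    nth_rewrite 2 [hR]
    simp only [pol]
    rw [mul_sum]
    exact sum_congr rfl fun n _ => by ring
  have h2 : S ≤ ∑ n ∈ s, ‖a n‖ * ‖∑ ξ ∈ U, (starRingEnd ℂ) (R ξ)*ch ξ n‖ := by
    have : S = ‖(S:ℂ)‖ := by rw [norm_real, norm_of_nonneg hS0]
    rw [this, h1]
    exact norm_sum_le_of_le _ fun n _ => (norm_mul_le _ _)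
  have h3 := Finset.sum_mul_sq_le_sq_mul_sq s (fun n => ‖a n‖) (fun n => ‖∑ ξ ∈ U, (starRingEnd ℂ) (R ξ)*ch ξ n‖)
  have h4 : ∑ n ∈ s, ‖∑ ξ ∈ U, (starRingEnd ℂ) (R ξ)*ch ξ n‖^2 ≤ (1+κ)*M*(Bd*S) := by
    calc _ ≤ ∑ n ∈ s, (1+κ)*M*((1:ℝ)/n * ‖∑ ξ ∈ U, (starRingEnd ℂ) (R ξ)*ch ξ n‖^2) := by
          refine sum_le_sum fun n hn => ?_
          have hn := (mem_sg hM0.le (by positivity)).1 (mem_filter.1 hn).1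
          have hn0 : (0:ℝ) < n := by linarith
          have : 1 ≤ (1+κ)*M*((1:ℝ)/n) := by rw [mul_one_div, one_le_div hn0]; exact hn.2
          rw [← mul_assoc]
          exact le_mul_of_one_le_left (by positivity) this
      _ ≤ ∑ n ∈ sg M (exp (2*π)*M), (1+κ)*M*((1:ℝ)/n * ‖∑ ξ ∈ U, (starRingEnd ℂ) (R ξ)*ch ξ n‖^2) := by
          refine sum_le_sum_of_subset_of_nonneg ?_ fun _ _ _ => by positivity
          intro n hn
          have hn := (mem_sg hM0.le (by positivity)).1 (mem_filter.1 hn).1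
          rw [mem_sg hM0.le (by positivity)]
          exact ⟨hn.1, by nlinarith⟩
      _ ≤ _ := by rw [← mul_sum]; gcongr
  have h5 : S^2 ≤ (∑ n ∈ s, ‖a n‖^2)*((1+κ)*M*(Bd*S)) := by
    have hA : 0 ≤ ∑ n ∈ s, ‖a n‖^2 := sum_nonneg fun _ _ => by positivity
    calc S^2 ≤ _ := pow_le_pow_left₀ hS0 h2 2
      _ ≤ _ := h3
      _ ≤ _ := by gcongr
  rcases hS0.eq_or_lt with h0 | h0
  · rw [← h0]
    have : 0 ≤ ∑ n ∈ s, ‖a n‖^2 := sum_nonneg fun _ _ => by positivity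
    positivity
  · have : S*S ≤ ((1+κ)*M*Bd*∑ n ∈ s, ‖a n‖^2)*S := by nlinarith
    exact le_of_mul_le_mul_right this h0

open ArithmeticFunction in
lemma sum_mu_div (n : ℕ) (hn : n ≠ 0) : ∑ d ∈ n.divisors, ((moebius d : ℤ):ℝ) = if n = 1 then 1 else 0 := by
  have h := congrArg (fun f => f n) coe_zeta_mul_moebius
  simp only [coe_zeta_mul_apply, one_apply] at h
  have : ((∑ d ∈ n.divisors, moebius d : ℤ):ℝ) = ((if n = 1 then 1 else 0 : ℤ):ℝ) := by rw [h]
  push_cast at this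
  simpa using this

/-- sieve support -/
noncomputable def SS (h D : ℕ) : Finset ℕ := (Icc 1 D).filter (fun d => Squarefree d ∧ d.Coprime h)

lemma mem_SS {h D d : ℕ} : d ∈ SS h D ↔ (1 ≤ d ∧ d ≤ D) ∧ Squarefree d ∧ d.Coprime h := by
  unfold SS; rw [mem_filter, mem_Icc]

lemma SS_dvd {h D d e : ℕ} (he : e ∈ SS h D) (hd : d ∣ e) : d ∈ SS h D := by
  rw [mem_SS] at he ⊢
  have h0 : 0 < e := by omega
  exact ⟨⟨Nat.pos_of_dvd_of_pos hd h0, (Nat.le_of_dvd h0 hd).trans he.1.2⟩, he.2.1.squarefree_of_dvd hd, Nat.Coprime.of_dvd_left hd he.2.2⟩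

noncomputable def GG (h D : ℕ) : ℝ := ∑ e ∈ SS h D, 1/(e.totient:ℝ)

noncomputable def gg (h D e : ℕ) : ℝ := ((ArithmeticFunction.moebius e : ℤ):ℝ)/(e.totient*GG h D)

noncomputable def rr (h D d : ℕ) : ℝ := d * ∑ e ∈ (SS h D).filter (fun e => d ∣ e), ((ArithmeticFunction.moebius (e/d) : ℤ):ℝ)*gg h D e

lemma one_mem_SS {h D : ℕ} (hD : 1 ≤ D) : 1 ∈ SS h D := by
  rw [mem_SS]; simp [hD]

lemma GG_pos {h D : ℕ} (hD : 1 ≤ D) : 0 < GG h D := by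
  unfold GG
  refine Finset.sum_pos (fun e he => ?_) ⟨1, one_mem_SS hD⟩
  have : 0 < e.totient := Nat.totient_pos.2 (by have := (mem_SS.1 he).1; omega)
  positivity

lemma mu_sq {h D e : ℕ} (he : e ∈ SS h D) : ((ArithmeticFunction.moebius e : ℤ):ℝ)^2 = 1 := by
  have := (ArithmeticFunction.moebius_sq_eq_one_of_squarefree (mem_SS.1 he).2.1)
  exact_mod_cast this

lemma mu_abs (e : ℕ) : |((ArithmeticFunction.moebius e : ℤ):ℝ)| ≤ 1 := by
  have := ArithmeticFunction.abs_moebius_le_one (n := e)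
  exact_mod_cast this

lemma rr_one {h D : ℕ} (hD : 1 ≤ D) : rr h D 1 = 1 := by
  unfold rr gg
  have hG := GG_pos (h := h) hD
  simp only [Nat.cast_one, one_mul, one_dvd, Finset.filter_true, Nat.div_one]
  have : ∀ e ∈ SS h D, ((ArithmeticFunction.moebius e : ℤ):ℝ)*(((ArithmeticFunction.moebius e : ℤ):ℝ)/(e.totient*GG h D)) = (1/(e.totient:ℝ))*(1/GG h D) := by
    intro e he
    rw [← mul_div_assoc, ← sq, mu_sq he]
    rw [one_div_mul_one_div]
  rw [sum_congr rfl this, ← sum_mul]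
  change GG h D * _ = 1
  field_simp

lemma rr_abs {h D d : ℕ} (hD : 1 ≤ D) (hd : d ≤ D) : |rr h D d| ≤ D := by
  unfold rr gg
  have hG := GG_pos (h := h) hD
  rw [abs_mul, Nat.abs_cast]
  have : |∑ e ∈ (SS h D).filter (fun e => d ∣ e), ((ArithmeticFunction.moebius (e/d) : ℤ):ℝ)*(((ArithmeticFunction.moebius e : ℤ):ℝ)/(e.totient*GG h D))| ≤ 1 := by
    calc _ ≤ ∑ e ∈ (SS h D).filter (fun e => d ∣ e), (1/(e.totient:ℝ))*(1/GG h D) := by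
          refine (abs_sum_le_sum_abs _ _).trans (sum_le_sum fun e he => ?_)
          rw [abs_mul, abs_div, abs_of_nonneg (show 0 ≤ (e.totient:ℝ)*GG h D by positivity), one_div_mul_one_div]
          calc _ ≤ 1*(1/((e.totient:ℝ)*GG h D)) := by
                gcongr
                · exact mu_abs _
                · exact mu_abs _
            _ = _ := one_mul _
      _ ≤ ∑ e ∈ SS h D, (1/(e.totient:ℝ))*(1/GG h D) :=
          sum_le_sum_of_subset_of_nonneg (filter_subset _ _) fun _ _ _ => by positivity
      _ = 1 := by
          rw [← sum_mul]; change GG h D * _ = 1; field_simp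
  calc _ ≤ (D:ℝ)*1 := by gcongr
    _ = _ := mul_one _

lemma yy_eq {h D f : ℕ} (hf : f ∈ SS h D) :
    ∑ d ∈ (SS h D).filter (fun d => f ∣ d), rr h D d/d = gg h D f := by
  classical
  have e1 : ∀ d ∈ (SS h D).filter (fun d => f ∣ d), rr h D d/d = ∑ e ∈ SS h D, if d ∣ e then ((ArithmeticFunction.moebius (e/d) : ℤ):ℝ)*gg h D e else 0 := by
    intro d hd
    have hd0 : (d:ℝ) ≠ 0 := by
      have := (mem_SS.1 (mem_filter.1 hd).1).1
      exact_mod_cast (by omega : d ≠ 0)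
    unfold rr
    rw [mul_div_assoc, mul_div_cancel₀ _ hd0, sum_filter]
  rw [sum_congr rfl e1, sum_comm]
  have e2 : ∀ e ∈ SS h D, (∑ d ∈ (SS h D).filter (fun d => f ∣ d), if d ∣ e then ((ArithmeticFunction.moebius (e/d) : ℤ):ℝ)*gg h D e else 0)
      = if e = f then gg h D f else 0 := by
    intro e he
    have hf0 : 0 < f := by have := (mem_SS.1 hf).1; omega
    have he0 : 0 < e := by have := (mem_SS.1 he).1; omega
    rw [← sum_filter, ← sum_mul]
    by_cases hfe : f ∣ e
    · obtain ⟨q, rfl⟩ := hfe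
      have hq0 : 0 < q := Nat.pos_of_mul_pos_left he0
      have : ∑ d ∈ ((SS h D).filter (fun d => f ∣ d)).filter (fun d => d ∣ f*q), ((ArithmeticFunction.moebius (f*q/d) : ℤ):ℝ)
          = ∑ j ∈ q.divisors, ((ArithmeticFunction.moebius j : ℤ):ℝ) := by
        refine sum_bij (fun d _ => f*q/d) ?_ ?_ ?_ ?_
        · intro d hd
          simp only [mem_filter] at hd
          obtain ⟨⟨hd1, t, rfl⟩, s, hs⟩ := hd
          have ht0 : 0 < f*t := by have := (mem_SS.1 hd1).1; omega
          rw [hs, Nat.mul_div_cancel_left _ ht0, Nat.mem_divisors]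
          refine ⟨⟨t, ?_⟩, hq0.ne'⟩
          have : f*q = f*(s*t) := by rw [hs]; ring
          exact Nat.eq_of_mul_eq_mul_left hf0 this
        · intro d hd d' hd' heq
          simp only [mem_filter] at hd hd'
          exact Nat.div_eq_iff_eq_of_dvd_dvd he0.ne' hd.2 hd'.2 |>.1 heq
        · intro j hj
          obtain ⟨⟨t, rfl⟩, _⟩ := Nat.mem_divisors.1 hj
          have hj0 : 0 < j := Nat.pos_of_mul_pos_right hq0
          refine ⟨f*t, ?_, ?_⟩
          · simp only [mem_filter]
            have hd : f*t ∣ f*(j*t) := ⟨j, by ring⟩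
            exact ⟨⟨SS_dvd he hd, Dvd.intro _ rfl⟩, hd⟩
          · have ht0 : 0 < t := Nat.pos_of_mul_pos_left hq0
            exact Nat.div_eq_of_eq_mul_left (by positivity) (by ring)
        · intro d hd; rfl
      rw [this, sum_mu_div q hq0.ne']
      by_cases hq1 : q = 1
      · simp [hq1]
      · have : f*q ≠ f := by
          intro hh; exact hq1 (Nat.eq_of_mul_eq_mul_left hf0 (by rw [hh, mul_one]))
        simp [hq1, this]
    · have : ((SS h D).filter (fun d => f ∣ d)).filter (fun d => d ∣ e) = ∅ := by
        ext d; simp only [mem_filter, Finset.notMem_empty, iff_false]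
        rintro ⟨⟨_, h1⟩, h2⟩; exact hfe (h1.trans h2)
      rw [this]
      have : e ≠ f := by rintro rfl; exact hfe dvd_rfl
      simp [this]
  rw [sum_congr rfl e2]
  simp [hf]

lemma selberg_quad {h D : ℕ} (hD : 1 ≤ D) :
    ∑ d ∈ SS h D, ∑ d' ∈ SS h D, rr h D d*rr h D d' * (1/(d.lcm d' : ℕ):ℝ) = 1/GG h D := by
  classical
  have hG := GG_pos (h := h) hD
  have e1 : ∀ d ∈ SS h D, ∀ d' ∈ SS h D, rr h D d*rr h D d' * (1/(d.lcm d' : ℕ):ℝ)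
     = ∑ f ∈ SS h D, (f.totient:ℝ)*((if f ∣ d then rr h D d/d else 0)*(if f ∣ d' then rr h D d' / d' else 0)) := by
    intro d hd d' hd'
    have hd0 : 0 < d := by have := (mem_SS.1 hd).1; omega
    have hd0' : 0 < d' := by have := (mem_SS.1 hd').1; omega
    have hg0 : 0 < d.gcd d' := Nat.gcd_pos_of_pos_left _ hd0
    have h1 : ∑ f ∈ SS h D, (f.totient:ℝ)*((if f ∣ d then rr h D d/d else 0)*(if f ∣ d' then rr h D d' / d' else 0))
       = ∑ f ∈ (d.gcd d').divisors, (f.totient:ℝ)*(rr h D d/d*(rr h D d' / d')) := by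
      have hs : (d.gcd d').divisors ⊆ SS h D := fun f hf =>
        SS_dvd hd ((Nat.dvd_of_mem_divisors hf).trans (Nat.gcd_dvd_left _ _))
      rw [← sum_subset hs]
      · refine sum_congr rfl fun f hf => ?_
        have := Nat.dvd_of_mem_divisors hf
        rw [if_pos (this.trans (Nat.gcd_dvd_left _ _)), if_pos (this.trans (Nat.gcd_dvd_right _ _))]
      · intro f _ hf
        by_cases h1 : f ∣ d
        · by_cases h2 : f ∣ d'
          · exact absurd (Nat.mem_divisors.2 ⟨Nat.dvd_gcd h1 h2, hg0.ne'⟩) hf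
          · simp [h2]
        · simp [h1]
    rw [h1, ← sum_mul]
    have h2 : ∑ f ∈ (d.gcd d').divisors, (f.totient:ℝ) = (d.gcd d' : ℕ) := by
      exact_mod_cast Nat.sum_totient (d.gcd d')
    rw [h2]
    have h3 : ((d.gcd d' : ℕ):ℝ)*(d.lcm d' : ℕ) = d*d' := by exact_mod_cast Nat.gcd_mul_lcm d d'
    have hl0 : ((d.lcm d' : ℕ):ℝ) ≠ 0 := by exact_mod_cast (Nat.lcm_pos hd0 hd0').ne'
    have a0 : (d:ℝ) ≠ 0 := by exact_mod_cast hd0.ne'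
    have b0 : (d':ℝ) ≠ 0 := by exact_mod_cast hd0'.ne'
    field_simp
    linear_combination (-(rr h D d*rr h D d'))*h3
  rw [sum_congr rfl fun d hd => sum_congr rfl fun d' hd' => e1 d hd d' hd']
  rw [sum_congr rfl fun d hd => sum_comm, sum_comm]
  have e2 : ∀ f ∈ SS h D, (∑ d ∈ SS h D, ∑ d' ∈ SS h D, (f.totient:ℝ)*((if f ∣ d then rr h D d/d else 0)*(if f ∣ d' then rr h D d' / d' else 0)))
     = 1/(f.totient:ℝ)*(1/(GG h D)^2) := by
    intro f hf
    have hf0 : 0 < f := by have := (mem_SS.1 hf).1; omega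
    have ht : (0:ℝ) < f.totient := by exact_mod_cast Nat.totient_pos.2 hf0
    simp_rw [← mul_sum]
    rw [← sum_mul, ← sum_filter, yy_eq hf, gg]
    have := mu_sq hf
    field_simp
    linear_combination this
  rw [sum_congr rfl e2, ← sum_mul]
  change GG h D * _ = _
  field_simp

noncomputable def nu (h D n : ℕ) : ℝ := (∑ d ∈ (SS h D).filter (fun d => d ∣ n), rr h D d)^2

lemma nu_nonneg (h D n : ℕ) : 0 ≤ nu h D n := sq_nonneg _

lemma nu_prime {h D p : ℕ} (hD : 1 ≤ D) (hp : p.Prime) (hpD : D < p) : nu h D p = 1 := by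
  unfold nu
  have : (SS h D).filter (fun d => d ∣ p) = {1} := by
    ext d
    rw [mem_filter, Finset.mem_singleton]
    constructor
    · rintro ⟨h1, h2⟩
      rcases (Nat.dvd_prime hp).1 h2 with h | h
      · exact h
      · have := (mem_SS.1 h1).1.2; omega
    · rintro rfl; exact ⟨one_mem_SS hD, one_dvd _⟩
  rw [this, Finset.sum_singleton, rr_one hD, one_pow]

lemma coprime_block (h j : ℕ) (hh : 0 < h) : ((Ioc (h*j) (h*(j+1))).filter (fun n => n.Coprime h)).card = h.totient := by
  have := Nat.filter_coprime_Ico_eq_totient h (h*j+1)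
  rw [← this]
  congr 1
  ext n
  simp only [mem_filter, mem_Ioc, mem_Ico, Nat.coprime_comm]
  rw [Nat.mul_succ]
  constructor <;> rintro ⟨h1, h2⟩ <;> exact ⟨by omega, h2⟩

lemma sum_coprime_inv (h J : ℕ) (hh : 0 < h) :
    rho h*log (J+1) ≤ ∑ n ∈ (Icc 1 (h*J)).filter (fun n => n.Coprime h), 1/(n:ℝ) := by
  have key : rho h * ∑ j ∈ range J, 1/((j:ℝ)+1) ≤ ∑ n ∈ (Icc 1 (h*J)).filter (fun n => n.Coprime h), 1/(n:ℝ) := by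
    induction J with
    | zero => simp
    | succ J ih =>
      have : (Icc 1 (h*(J+1))).filter (fun n => n.Coprime h) = (Icc 1 (h*J)).filter (fun n => n.Coprime h) ∪ (Ioc (h*J) (h*(J+1))).filter (fun n => n.Coprime h) := by
        ext n
        simp only [mem_filter, mem_Icc, mem_union, mem_Ioc, Nat.mul_succ]
        constructor
        · rintro ⟨h1, h2⟩
          rcases le_or_gt n (h*J) with h3 | h3
          · left; exact ⟨⟨h1.1, h3⟩, h2⟩
          · right; exact ⟨⟨h3, h1.2⟩, h2⟩
        · rintro (⟨h1, h2⟩ | ⟨h1, h2⟩)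
          · exact ⟨by omega, h2⟩
          · exact ⟨by omega, h2⟩
      rw [this, sum_union, sum_range_succ, mul_add]
      · refine add_le_add ih ?_
        have hc := coprime_block h J hh
        calc rho h*(1/((J:ℝ)+1)) = ∑ n ∈ (Ioc (h*J) (h*(J+1))).filter (fun n => n.Coprime h), 1/((h:ℝ)*(J+1)) := by
              rw [sum_const, hc, nsmul_eq_mul, rho]
              have : (0:ℝ) < h := by exact_mod_cast hh
              field_simp
          _ ≤ _ := by
              refine sum_le_sum fun n hn => ?_
              have hn := mem_Ioc.1 (mem_filter.1 hn).1
              have h1 : (0:ℝ) < n := by exact_mod_cast (by omega : 0 < n)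
              apply one_div_le_one_div_of_le h1
              exact_mod_cast hn.2
      · rw [disjoint_left]
        intro n h1 h2
        have a := mem_Icc.1 (mem_filter.1 h1).1
        have b := mem_Ioc.1 (mem_filter.1 h2).1
        omega
  refine le_trans (mul_le_mul_of_nonneg_left ?_ (rho_nonneg h)) key
  have := log_add_one_le_harmonic J
  rw [harmonic] at this
  push_cast at this
  simpa using this

lemma GG_lower (h D : ℕ) (hh : 0 < h) (hD : h^2 ≤ D) : rho h*log D/6 ≤ GG h D := by
  classical
  have hD1 : 1 ≤ D := le_trans (Nat.one_le_pow _ _ hh) hD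
  set J := D/h
  have hJ : h*J ≤ D := Nat.mul_div_le D h
  have h1 := sum_coprime_inv h J hh
  have hDr : (0:ℝ) < D := by exact_mod_cast hD1
  have hhr : (0:ℝ) < h := by exact_mod_cast hh
  have h2 : log D/2 ≤ log (J+1) := by
    have a : (D:ℝ)/h ≤ J+1 := by
      rw [div_le_iff₀ hhr]
      have := Nat.lt_div_mul_add (a := D) hh
      have : (D:ℝ) ≤ (J:ℝ)*h+h := by exact_mod_cast this.le
      linarith
    have b : (D:ℝ) ≤ ((J:ℝ)+1)^2 := by
      have h3 : (h:ℝ)^2 ≤ D := by exact_mod_cast hD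
      have h4 : (D:ℝ) ≤ ((D:ℝ)/h)^2 := by
        rw [div_pow, le_div_iff₀ (by positivity)]; nlinarith
      refine h4.trans ?_
      gcongr
    have := log_le_log hDr b
    rw [log_pow] at this
    push_cast at this; linarith
  have h3 : ∑ n ∈ (Icc 1 (h*J)).filter (fun n => n.Coprime h), 1/(n:ℝ) ≤ 3 * ∑ e ∈ SS h D, 1/(e:ℝ) := by
    set g : ℕ × ℕ → ℕ := fun q => q.2^2*q.1
    have hsub : (Icc 1 (h*J)).filter (fun n => n.Coprime h) ⊆ (SS h D ×ˢ Icc 1 D).image g := by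
      intro n hn
      simp only [mem_filter, mem_Icc] at hn
      obtain ⟨a, b, hab, ha⟩ := Nat.sq_mul_squarefree n
      rw [mem_image]
      have hn0 : 0 < n := by omega
      have had : a ∣ n := ⟨b^2, by rw [← hab]; ring⟩
      have hbd : b ∣ n := ⟨b*a, by rw [← hab]; ring⟩
      refine ⟨(a,b), ?_, hab⟩
      rw [mem_product, mem_SS, mem_Icc]
      have := Nat.le_of_dvd hn0 had
      have := Nat.le_of_dvd hn0 hbd
      have := Nat.pos_of_dvd_of_pos had hn0
      have := Nat.pos_of_dvd_of_pos hbd hn0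
      exact ⟨⟨⟨by omega, by simp only; omega⟩, ha, Nat.Coprime.of_dvd_left had hn.2⟩, by simp only; omega, by simp only; omega⟩
    calc _ ≤ ∑ n ∈ (SS h D ×ˢ Icc 1 D).image g, 1/(n:ℝ) :=
          sum_le_sum_of_subset_of_nonneg hsub fun _ _ _ => by positivity
      _ ≤ ∑ q ∈ SS h D ×ˢ Icc 1 D, 1/((g q : ℕ):ℝ) := Finset.sum_image_le_of_nonneg (fun _ _ => by positivity)
      _ = (∑ b ∈ Icc 1 D, ((b:ℝ)^2)⁻¹) * ∑ e ∈ SS h D, 1/(e:ℝ) := by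
          rw [sum_product, sum_comm, sum_mul_sum]
          refine sum_congr rfl fun b _ => sum_congr rfl fun e _ => ?_
          simp only [g]; push_cast
          rw [one_div, mul_inv, one_div]
      _ ≤ _ := by
          refine mul_le_mul_of_nonneg_right ?_ (sum_nonneg fun _ _ => by positivity)
          have := sum_Ioo_inv_sq_le (α := ℝ) 0 (D+1)
          have e : Ioo 0 (D+1) = Icc 1 D := by ext; simp; omega
          rw [e] at this
          norm_num at this ⊢
          linarith
  have h4 : ∑ e ∈ SS h D, 1/(e:ℝ) ≤ GG h D := by
    refine sum_le_sum fun e he => ?_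
    have : 0 < e.totient := Nat.totient_pos.2 (by have := (mem_SS.1 he).1; omega)
    apply one_div_le_one_div_of_le (by exact_mod_cast this)
    exact_mod_cast Nat.totient_le e
  have h5 : rho h*(log D/2) ≤ rho h*log (J+1) := mul_le_mul_of_nonneg_left h2 (rho_nonneg h)
  linarith

lemma polPr {h : ℕ} [NeZero h] (ξ : Freq h) (x y : ℝ) (hx : 40*h ≤ x) (hxy : x ≤ y) (hy : y ≤ 500*x)
    (hk : |(ξ.2:ℝ)| ≤ (x/(2*h))^(2.6:ℝ)) :
    ‖∑ n ∈ sg x y, ch ξ n - (if ξ.1 = 1 then ((rho h : ℝ):ℂ) else 0)*(prim ξ.2 y - prim ξ.2 x)‖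
      ≤ 30000000*h*x^(0.99:ℝ) := by
  have hh1 : (1:ℝ) ≤ h := by exact_mod_cast Nat.pos_of_neZero h
  have hx0 : 0 < x := by linarith
  have hy0 : 0 < y := by linarith
  set A := ⌊x⌋₊ with hAd
  set B := ⌊y⌋₊ with hBd
  have hA1 : (A:ℝ) ≤ x := Nat.floor_le hx0.le
  have hA2 : x < A+1 := Nat.lt_floor_add_one x
  have hB1 : (B:ℝ) ≤ y := Nat.floor_le hy0.le
  have hB2 : y < B+1 := Nat.lt_floor_add_one _
  have hA3 : x/2 ≤ A := by linarith
  have hA0 : (0:ℝ) < A := by linarith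
  have hAB : A ≤ B := Nat.floor_mono hxy
  have hABr : (A:ℝ) ≤ B := by exact_mod_cast hAB
  have hA2h : 2*h ≤ A := by
    have : 2*(h:ℝ) ≤ A := by linarith
    exact_mod_cast this
  have hBA : B ≤ 590*A := by
    have : (B:ℝ) ≤ 590*A := by nlinarith
    exact_mod_cast this
  have hkA : |(ξ.2:ℝ)| ≤ ((A:ℝ)/h)^(2.6:ℝ) := by
    refine hk.trans (rpow_le_rpow (by positivity) ?_ (by norm_num))
    rw [← div_div]; gcongr
  have h1 := polP ξ A B hA2h hAB hBA hkA
  set δ : ℂ := if ξ.1 = 1 then ((rho h : ℝ):ℂ) else 0 with hδ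
  have hδ1 : ‖δ‖ ≤ 1 := by
    rw [hδ]; split_ifs
    · rw [norm_real, norm_of_nonneg (rho_nonneg h)]; exact rho_le_one h
    · simp
  have p1 := prim_lip ξ.2 A x hA0 hA1
  have p2 := prim_lip ξ.2 B y (by linarith) hB1
  have e : ∑ n ∈ sg x y, ch ξ n - δ*(prim ξ.2 y - prim ξ.2 x) = (∑ n ∈ Ioc A B, ch ξ n - δ*(prim ξ.2 B - prim ξ.2 A))
      + δ*((prim ξ.2 x - prim ξ.2 A) - (prim ξ.2 y - prim ξ.2 B)) := by unfold sg; ring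
  rw [e]
  refine (norm_add_le _ _).trans ?_
  rw [norm_mul]
  have n2 := norm_sub_le (prim ξ.2 x - prim ξ.2 A) (prim ξ.2 y - prim ξ.2 B)
  have h2 : ‖δ‖*‖(prim ξ.2 x - prim ξ.2 A) - (prim ξ.2 y - prim ξ.2 B)‖ ≤ 2 := by
    have := mul_le_mul hδ1 n2 (norm_nonneg _) zero_le_one
    linarith
  have h3 : (A:ℝ)^(0.99:ℝ) ≤ x^(0.99:ℝ) := rpow_le_rpow hA0.le hA1 (by norm_num)
  have h4 : 1 ≤ x^(0.99:ℝ) := one_le_rpow (by linarith) (by norm_num)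
  have h5 : 20000000*h*(A:ℝ)^(0.99:ℝ) ≤ 20000000*h*x^(0.99:ℝ) := by gcongr
  nlinarith

lemma sum_sg_dvd {h : ℕ} (ξ : Freq h) (x y : ℝ) (hx : 0 ≤ x) (hy : 0 ≤ y) (e : ℕ) (he : 0 < e) :
    ∑ n ∈ (sg x y).filter (fun n => e ∣ n), ch ξ n = ch ξ e * ∑ m ∈ sg (x/e) (y/e), ch ξ m := by
  have her : (0:ℝ) < e := by exact_mod_cast he
  rw [mul_sum]
  symm
  refine sum_bij (fun m _ => e*m) ?_ ?_ ?_ ?_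
  · intro m hm
    rw [mem_sg (by positivity) (by positivity), div_lt_iff₀ her, le_div_iff₀ her] at hm
    rw [mem_filter, mem_sg hx hy]
    push_cast
    exact ⟨⟨by linarith, by linarith⟩, Dvd.intro _ rfl⟩
  · intro a _ b _ hab; exact Nat.eq_of_mul_eq_mul_left he hab
  · intro n hn
    rw [mem_filter, mem_sg hx hy] at hn
    obtain ⟨⟨h1, h2⟩, m, rfl⟩ := hn
    refine ⟨m, ?_, rfl⟩
    push_cast at h1 h2
    rw [mem_sg (by positivity) (by positivity), div_lt_iff₀ her, le_div_iff₀ her]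
    exact ⟨by linarith, by linarith⟩
  · intro m hm
    rw [mem_sg (by positivity) (by positivity)] at hm
    have : m ≠ 0 := by
      rintro rfl
      have : 0 ≤ x/e := by positivity
      have := hm.1
      push_cast at this; linarith
    rw [ch_mul ξ he.ne' this]

lemma ch_one_eq {h : ℕ} (ξ : Freq h) (hχ : ξ.1 = 1) (n : ℕ) (hn : n.Coprime h) : ch ξ n = ee (ξ.2*log n) := by
  unfold ch ee
  rw [hχ, MulChar.one_apply ((ZMod.isUnit_iff_coprime n h).2 hn), one_mul]

lemma selb {h : ℕ} [NeZero h] (ξ : Freq h) (D : ℕ) (hD : 1 ≤ D) (x y : ℝ) (hx : 40*h*D^2 ≤ x) (hxy : x ≤ y) (hy : y ≤ 500*x)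
    (hk : |(ξ.2:ℝ)| ≤ (x/(2*h*D^2))^(2.6:ℝ)) :
    ‖∑ n ∈ sg x y, (nu h D n:ℂ)*ch ξ n - (if ξ.1 = 1 then ((rho h : ℝ):ℂ) else 0)*(prim ξ.2 y - prim ξ.2 x)*((1/GG h D : ℝ):ℂ)‖
      ≤ 30000000*h*D^4*x^(0.99:ℝ) := by
  classical
  have hh1 : (1:ℝ) ≤ h := by exact_mod_cast Nat.pos_of_neZero h
  have hDr : (1:ℝ) ≤ D := by exact_mod_cast hD
  have hD2 : (1:ℝ) ≤ (D:ℝ)^2 := one_le_pow₀ hDr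
  have hx0 : 0 < x := by nlinarith
  have hy0 : 0 < y := by linarith
  set δ : ℂ := if ξ.1 = 1 then ((rho h : ℝ):ℂ) else 0 with hδ
  have e1 : ∑ n ∈ sg x y, (nu h D n:ℂ)*ch ξ n = ∑ d ∈ SS h D, ∑ d' ∈ SS h D, (rr h D d*rr h D d' : ℂ) * ∑ n ∈ (sg x y).filter (fun n => d.lcm d' ∣ n), ch ξ n := by
    have : ∀ n ∈ sg x y, (nu h D n:ℂ)*ch ξ n = ∑ d ∈ SS h D, ∑ d' ∈ SS h D, (rr h D d*rr h D d' : ℂ)*(if d.lcm d' ∣ n then ch ξ n else 0) := by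
      intro n _
      unfold nu
      rw [sum_filter, sq, sum_mul_sum]
      push_cast
      rw [sum_mul]
      refine sum_congr rfl fun d _ => ?_
      rw [sum_mul]
      refine sum_congr rfl fun d' _ => ?_
      by_cases a : d ∣ n <;> by_cases b : d' ∣ n <;> simp [a, b, Nat.lcm_dvd_iff]
    rw [sum_congr rfl this, sum_comm]
    refine sum_congr rfl fun d _ => ?_
    rw [sum_comm]
    refine sum_congr rfl fun d' _ => ?_
    rw [sum_filter, mul_sum]
  have e2 : ((1/GG h D : ℝ):ℂ) = ∑ d ∈ SS h D, ∑ d' ∈ SS h D, (rr h D d*rr h D d' : ℂ)*(1/(d.lcm d' : ℕ):ℂ) := by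
    rw [← selberg_quad hD]; push_cast; rfl
  rw [e1, e2, mul_sum, ← sum_sub_distrib]
  have hb : ∀ d ∈ SS h D, ∀ d' ∈ SS h D, ‖(rr h D d*rr h D d' : ℂ) * ∑ n ∈ (sg x y).filter (fun n => d.lcm d' ∣ n), ch ξ n
      - δ*(prim ξ.2 y - prim ξ.2 x)*((rr h D d*rr h D d' : ℂ)*(1/(d.lcm d' : ℕ):ℂ))‖ ≤ D^2*(30000000*h*x^(0.99:ℝ)) := by
    intro d hd d' hd'
    obtain ⟨⟨d1, d2⟩, d3, d4⟩ := mem_SS.1 hd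
    obtain ⟨⟨d1', d2'⟩, d3', d4'⟩ := mem_SS.1 hd'
    set e := d.lcm d' with he
    have he0 : 0 < e := Nat.lcm_pos d1 d1'
    have her : (0:ℝ) < e := by exact_mod_cast he0
    have hecop : e.Coprime h := Nat.Coprime.of_dvd_left (Nat.lcm_dvd_mul d d') (d4.mul_left d4')
    have heD : (e:ℝ) ≤ D^2 := by
      have : e ≤ d*d' := Nat.le_of_dvd (by positivity) (Nat.lcm_dvd_mul d d')
      have : e ≤ D*D := this.trans (Nat.mul_le_mul d2 d2')
      rw [sq]; exact_mod_cast this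
    have he1 : (1:ℝ) ≤ e := by exact_mod_cast he0
    rw [sum_sg_dvd ξ x y hx0.le hy0.le e he0]
    have hp := polPr ξ (x/e) (y/e) (by rw [le_div_iff₀ her]; refine le_trans ?_ hx; gcongr) (by gcongr)
      (by rw [← mul_div_assoc]; gcongr) (hk.trans (rpow_le_rpow (by positivity) (by
        rw [div_div]; apply div_le_div_of_nonneg_left hx0.le (by positivity)
        calc (e:ℝ)*(2*h) ≤ D^2*(2*h) := by gcongr
          _ = _ := by ring) (by norm_num)))
    have e3 : δ*(prim ξ.2 y - prim ξ.2 x)*(1/(e:ℂ)) = ch ξ e*(δ*(prim ξ.2 (y/e) - prim ξ.2 (x/e))) := by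
      rw [hδ]
      split_ifs with hc
      · rw [ch_one_eq ξ hc e hecop]
        have p1 := prim_scale ξ.2 e (y/e) her (by positivity)
        have p2 := prim_scale ξ.2 e (x/e) her (by positivity)
        rw [mul_div_cancel₀ _ her.ne'] at p1 p2
        push_cast at p1 p2
        linear_combination (-((rho h:ℝ):ℂ))*p1+((rho h:ℝ):ℂ)*p2
      · simp
    have e4 : (rr h D d*rr h D d' : ℂ)*(ch ξ e * ∑ m ∈ sg (x/e) (y/e), ch ξ m)
      - δ*(prim ξ.2 y - prim ξ.2 x)*((rr h D d*rr h D d' : ℂ)*(1/(e:ℂ)))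
      = (rr h D d*rr h D d' : ℂ)*(ch ξ e*(∑ m ∈ sg (x/e) (y/e), ch ξ m - δ*(prim ξ.2 (y/e) - prim ξ.2 (x/e)))) := by
      linear_combination (-(rr h D d*rr h D d' : ℂ))*e3
    rw [e4, norm_mul, norm_mul, norm_mul, norm_real, norm_real, norm_eq_abs, norm_eq_abs]
    have b1 : |rr h D d| * |rr h D d'| ≤ D^2 := by
      rw [sq]; exact mul_le_mul (rr_abs hD d2) (rr_abs hD d2') (abs_nonneg _) (by positivity)
    have b2 : (x/e)^(0.99:ℝ) ≤ x^(0.99:ℝ) := rpow_le_rpow (by positivity) (div_le_self hx0.le he1) (by norm_num)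
    refine mul_le_mul b1 ?_ (by positivity) (by positivity)
    refine (mul_le_of_le_one_left (norm_nonneg _) (ch_norm_le _ _)).trans (hp.trans ?_)
    gcongr
  have hcard : ((SS h D).card:ℝ) ≤ D := by
    have : (SS h D).card ≤ D := by
      unfold SS; refine (card_filter_le _ _).trans ?_; simp
    exact_mod_cast this
  calc _ ≤ ∑ d ∈ SS h D, ∑ d' ∈ SS h D, D^2*(30000000*h*x^(0.99:ℝ)) := by
        refine norm_sum_le_of_le _ fun d hd => ?_
        rw [mul_sum, ← sum_sub_distrib]
        exact norm_sum_le_of_le _ fun d' hd' => hb d hd d' hd'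
    _ = ((SS h D).card:ℝ)*(((SS h D).card:ℝ)*(D^2*(30000000*h*x^(0.99:ℝ)))) := by
        simp only [sum_const, nsmul_eq_mul]
    _ ≤ D*(D*(D^2*(30000000*h*x^(0.99:ℝ)))) := by gcongr
    _ = _ := by ring

noncomputable def fpw {h : ℕ} (ξ : Freq h) (j : ℕ) : Freq h := (ξ.1^j, j*ξ.2)

lemma ch_fpw {h : ℕ} [NeZero h] (ξ : Freq h) (j n : ℕ) (hn : n.Coprime h) : ch (fpw ξ j) n = ch ξ n ^ j := by
  unfold ch fpw
  rw [mul_pow, ← Complex.exp_nat_mul]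
  have e : ((ξ.1^j) (n:ZMod h)) = (ξ.1 (n:ZMod h))^j := by
    obtain ⟨u, hu⟩ := (ZMod.isUnit_iff_coprime n h).2 hn
    rw [← hu, MulChar.pow_apply_coe]
  simp only [e]
  congr 2
  push_cast; ring

lemma pow_sub_one_norm (z : ℂ) (hz : ‖z‖ = 1) (j : ℕ) : ‖z^j - 1‖ ≤ j * ‖z - 1‖ := by
  induction j with
  | zero => simp
  | succ j ih =>
    have : z^(j+1) - 1 = z^j*(z-1)+(z^j - 1) := by ring
    rw [this]
    refine (norm_add_le _ _).trans ?_
    rw [norm_mul, norm_pow, hz, one_pow]; push_cast; linarith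

lemma fej_lower (z : ℂ) (hz : ‖z‖ = 1) (m : ℕ) :
    ((m:ℝ)+1)^2*(1/2 - m^2*‖z-1‖^2) ≤ ‖∑ j ∈ range (m+1), z^j‖^2 := by
  set S := ∑ j ∈ range (m+1), z^j with hS
  have h1 : ‖(((m:ℝ)+1 : ℝ):ℂ) - S‖ ≤ (m+1)*(m*‖z-1‖) := by
    have : (((m:ℝ)+1 : ℝ):ℂ) - S = - ∑ j ∈ range (m+1), (z^j - 1) := by
      rw [sum_sub_distrib]; simp [hS]
    rw [this, norm_neg]
    refine (norm_sum_le _ _).trans ?_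
    calc _ ≤ ∑ j ∈ range (m+1), (m*‖z-1‖ : ℝ) := by
          refine sum_le_sum fun j hj => (pow_sub_one_norm z hz j).trans ?_
          have : (j:ℝ) ≤ m := by exact_mod_cast Nat.lt_succ_iff.1 (mem_range.1 hj)
          gcongr
      _ = _ := by simp
  have h2 : (m:ℝ)+1 ≤ ‖S‖ + (m+1)*(m*‖z-1‖) := by
    have := norm_add_le S ((((m:ℝ)+1 : ℝ):ℂ) - S)
    rw [add_sub_cancel, norm_real, norm_of_nonneg (by positivity)] at this
    linarith
  have h3 : ((m:ℝ)+1)^2 ≤ 2*‖S‖^2+2*((m+1)*(m*‖z-1‖))^2 := by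
    have h4 : ((m:ℝ)+1)^2 ≤ (‖S‖ + (m+1)*(m*‖z-1‖))^2 := by gcongr
    nlinarith [sq_nonneg (‖S‖ - (m+1)*(m*‖z-1‖))]
  nlinarith

lemma dich {h : ℕ} [NeZero h] (ξ : Freq h) (Q s : Finset ℕ) (hQs : Q ⊆ s) (w : ℕ → ℝ) (hw : ∀ n, 0 ≤ w n)
    (hQ : ∀ p ∈ Q, p.Coprime h ∧ w p = 1) (m : ℕ) (hm : 1 ≤ m)
    (hP : (1 - 1/(8*(m:ℝ)^2))*Q.card < ‖pol Q (fun _ => 1) ξ‖) :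
    ((m:ℝ)+1)^2/4*Q.card ≤ ∑ j ∈ range (m+1), ∑ j' ∈ range (m+1),
      ‖∑ n ∈ s, (w n:ℂ)*ch (fdiff (fpw ξ j) (fpw ξ j')) n‖ := by
  have hm' : (1:ℝ) ≤ m := by exact_mod_cast hm
  set P := pol Q (fun _ => 1) ξ with hPd
  have hP0 : 0 < ‖P‖ := by
    refine lt_of_le_of_lt (mul_nonneg ?_ (by positivity)) hP
    rw [sub_nonneg, div_le_one (by positivity)]; nlinarith
  set u : ℂ := (starRingEnd ℂ) P/(‖P‖:ℂ) with hu
  have hPc : (‖P‖:ℂ) ≠ 0 := by exact_mod_cast hP0.ne'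
  have hun : ‖u‖ = 1 := by
    rw [hu, norm_div, RCLike.norm_conj, norm_real, norm_norm, div_self hP0.ne']
  have huP : u*P = ‖P‖ := by
    rw [hu, div_mul_eq_mul_div, mul_comm ((starRingEnd ℂ) P), Complex.mul_conj, normSq_eq_norm_sq]
    push_cast; field_simp
  have hz : ∀ p ∈ Q, ‖u*ch ξ p‖ = 1 := fun p hp => by rw [norm_mul, hun, ch_norm_one ξ p (hQ p hp).1, one_mul]
  -- lower bound
  have low : ((m:ℝ)+1)^2/4*Q.card ≤ ∑ n ∈ s, w n * ‖∑ j ∈ range (m+1), u^j*ch (fpw ξ j) n‖^2 := by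
    have l1 : ∑ p ∈ Q, ‖u*ch ξ p - 1‖^2 = 2*Q.card - 2*‖P‖ := by
      have : ∀ p ∈ Q, ‖u*ch ξ p - 1‖^2 = 2 - 2*(u*ch ξ p).re := by
        intro p hp
        have e := hz p hp
        rw [← normSq_eq_norm_sq, normSq_apply]
        have e2 : (u*ch ξ p).re*(u*ch ξ p).re+(u*ch ξ p).im*(u*ch ξ p).im = 1 := by
          rw [← normSq_apply, normSq_eq_norm_sq, e]; norm_num
        simp only [Complex.sub_re, Complex.sub_im, Complex.one_re, Complex.one_im]
        nlinarith
      rw [sum_congr rfl this, sum_sub_distrib, ← mul_sum, ← Complex.re_sum, ← mul_sum]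
      have : ∑ p ∈ Q, ch ξ p = P := by rw [hPd]; unfold pol; simp
      rw [this, huP]; simp; ring
    have l2 : ∑ p ∈ Q, ((m:ℝ)+1)^2*(1/2 - m^2*‖u*ch ξ p-1‖^2) ≤ ∑ p ∈ Q, w p * ‖∑ j ∈ range (m+1), u^j*ch (fpw ξ j) p‖^2 := by
      refine sum_le_sum fun p hp => ?_
      rw [(hQ p hp).2, one_mul]
      have e : ∑ j ∈ range (m+1), u^j*ch (fpw ξ j) p = ∑ j ∈ range (m+1), (u*ch ξ p)^j := by
        refine sum_congr rfl fun j _ => ?_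
        rw [ch_fpw ξ j p (hQ p hp).1, mul_pow]
      rw [e]
      exact fej_lower _ (hz p hp) m
    have l3 := sum_le_sum_of_subset_of_nonneg hQs (f := fun p => w p * ‖∑ j ∈ range (m+1), u^j*ch (fpw ξ j) p‖^2)
      (fun n _ _ => mul_nonneg (hw n) (by positivity))
    refine le_trans ?_ (l2.trans l3)
    rw [← mul_sum, sum_sub_distrib, ← mul_sum, l1]
    simp only [sum_const, nsmul_eq_mul]
    have l4 : (m:ℝ)^2*(2*Q.card - 2*‖P‖) ≤ Q.card/4 := by
      have : (m:ℝ)^2*(2*Q.card - 2*((1 - 1/(8*(m:ℝ)^2))*Q.card)) = Q.card/4 := by field_simp; ring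
      rw [← this]; gcongr
    have l5 : (0:ℝ) ≤ ((m:ℝ)+1)^2 := by positivity
    rw [div_mul_eq_mul_div, mul_div_assoc]
    refine mul_le_mul_of_nonneg_left ?_ l5
    linarith
  refine low.trans ?_
  have e : ((∑ n ∈ s, w n * ‖∑ j ∈ range (m+1), u^j*ch (fpw ξ j) n‖^2 : ℝ):ℂ) =
      ∑ j ∈ range (m+1), ∑ j' ∈ range (m+1), (u^j*(starRingEnd ℂ) (u^j')) * ∑ n ∈ s, (w n:ℂ)*ch (fdiff (fpw ξ j) (fpw ξ j')) n := by
    push_cast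
    have : ∀ n ∈ s, (w n:ℂ)*(‖∑ j ∈ range (m+1), u^j*ch (fpw ξ j) n‖:ℂ)^2 =
        ∑ j ∈ range (m+1), ∑ j' ∈ range (m+1), (u^j*(starRingEnd ℂ) (u^j'))*((w n:ℂ)*ch (fdiff (fpw ξ j) (fpw ξ j')) n) := by
      intro n _
      rw [← mul_conj', map_sum, sum_mul_sum, mul_sum]
      refine sum_congr rfl fun j _ => ?_
      rw [mul_sum]
      refine sum_congr rfl fun j' _ => ?_
      rw [← ch_mul_conj, map_mul]; ring
    rw [sum_congr rfl this, sum_comm]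
    refine sum_congr rfl fun j _ => ?_
    rw [sum_comm]
    refine sum_congr rfl fun j' _ => ?_
    rw [mul_sum]
  have e2 := congrArg norm e
  rw [norm_real] at e2
  refine (Real.le_norm_self _).trans ?_
  rw [e2]
  refine (norm_sum_le _ _).trans (sum_le_sum fun j _ => (norm_sum_le _ _).trans (sum_le_sum fun j' _ => ?_))
  rw [norm_mul, norm_mul, RCLike.norm_conj, norm_pow, norm_pow, hun]; simp

lemma blk_bound {h : ℕ} [NeZero h] (ξ : Freq h) (V v m D : ℕ) (hV : 1 ≤ V) (hm : 1 ≤ m) (hD : 1 ≤ D) (C : ℝ) (hC : 0 < C)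
    (hkC : C ≤ |(ξ.2:ℝ)|) (hx : 40*h*D^2 ≤ exp ((v:ℝ)/V))
    (hk : m * |(ξ.2:ℝ)| ≤ (exp ((v:ℝ)/V)/(2*h*D^2))^(2.6:ℝ))
    (hP : (1 - 1/(8*(m:ℝ)^2))*(blk h V v).card < ‖Pv V v ξ‖) :
    ((blk h V v).card:ℝ) ≤ 4*((rho h/GG h D)*(2*exp ((v:ℝ)/V)/(V*m))+(rho h/GG h D)*(6*exp ((v:ℝ)/V)/C)
      + 30000000*h*D^4*(exp ((v:ℝ)/V))^(0.99:ℝ)) := by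
  have hh1 : (1:ℝ) ≤ h := by exact_mod_cast Nat.pos_of_neZero h
  have hDr : (1:ℝ) ≤ D := by exact_mod_cast hD
  have hVr : (1:ℝ) ≤ V := by exact_mod_cast hV
  have hmr : (1:ℝ) ≤ m := by exact_mod_cast hm
  have hG := GG_pos (h := h) hD
  have hρ := rho_nonneg h
  set x := exp ((v:ℝ)/V) with hxd
  set y := exp (((v:ℝ)+1)/V) with hyd
  have hx0 : 0 < x := exp_pos _
  have hyx : y = x*exp (1/V) := by rw [hyd, hxd, ← exp_add]; congr 1; ring
  have e1 : (1:ℝ) ≤ exp (1/V) := one_le_exp (by positivity)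
  have e2 := exp_inv_le V hV
  have v1 : (1:ℝ)/V ≤ 1 := by rw [div_le_one (by positivity)]; exact hVr
  have hxy : x ≤ y := by rw [hyx]; nlinarith
  have hyx2 : y - x ≤ 2*x/V := by
    rw [hyx]
    have : 2*x/V = x*(2*(1/V)) := by ring
    rw [this]; nlinarith
  have hy3 : y ≤ 3*x := by rw [hyx]; nlinarith
  set err : ℝ := 30000000*h*D^4*x^(0.99:ℝ) with herr
  have herr0 : 0 ≤ err := by positivity
  have hDx : (D:ℝ) < x := by nlinarith [mul_le_mul hh1 (show (D:ℝ) ≤ D^2 by nlinarith) (by positivity) (by positivity)]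
  have hd := dich ξ (blk h V v) (sg x y) (by
      intro p hp
      rw [mem_blk] at hp
      rw [mem_sg hx0.le (by positivity)]; exact hp.1) (nu h D) (nu_nonneg h D) (by
      intro p hp
      rw [mem_blk] at hp
      refine ⟨(Nat.Prime.coprime_iff_not_dvd hp.2.1).2 hp.2.2, nu_prime hD hp.2.1 ?_⟩
      exact_mod_cast hDx.trans hp.1.1) m hm hP
  have hb : ∀ j ∈ range (m+1), ∀ j' ∈ range (m+1), ‖∑ n ∈ sg x y, (nu h D n:ℂ)*ch (fdiff (fpw ξ j) (fpw ξ j')) n‖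
      ≤ (if j = j' then (rho h/GG h D)*(2*x/V) else 0)+((rho h/GG h D)*(6*x/C)+err) := by
    intro j hj j' hj'
    rw [mem_range] at hj hj'
    set ζ := fdiff (fpw ξ j) (fpw ξ j') with hζ
    have hζ2 : (ζ.2:ℝ) = ((j:ℝ)-j')*ξ.2 := by
      rw [hζ]; unfold fdiff fpw; push_cast; ring
    have hjj : |(j:ℝ)-j'| ≤ m := by
      have a : (j:ℝ) ≤ m := by exact_mod_cast Nat.lt_succ_iff.1 hj
      have b : (j':ℝ) ≤ m := by exact_mod_cast Nat.lt_succ_iff.1 hj'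
      have a0 : (0:ℝ) ≤ j := by positivity
      have b0 : (0:ℝ) ≤ j' := by positivity
      rw [abs_le]; constructor <;> linarith
    have hs := selb ζ D hD x y hx hxy (by linarith) (by
      rw [hζ2, abs_mul]; exact le_trans (by gcongr) hk)
    set T := ∑ n ∈ sg x y, (nu h D n:ℂ)*ch ζ n with hT
    have hn : ‖(if ζ.1 = 1 then ((rho h : ℝ):ℂ) else 0)*(prim ζ.2 y - prim ζ.2 x)*((1/GG h D : ℝ):ℂ)‖ ≤ (rho h/GG h D)*‖prim ζ.2 y - prim ζ.2 x‖ := by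
      rw [norm_mul, norm_mul, norm_real, norm_of_nonneg (by positivity)]
      have : ‖(if ζ.1 = 1 then ((rho h : ℝ):ℂ) else 0)‖ ≤ rho h := by
        split_ifs
        · rw [norm_real, norm_of_nonneg hρ]
        · simpa using hρ
      calc _ ≤ rho h * ‖prim ζ.2 y - prim ζ.2 x‖ * (1/GG h D) := by gcongr
        _ = _ := by ring
    have hT1 : ‖T‖ ≤ err+(rho h/GG h D)*‖prim ζ.2 y - prim ζ.2 x‖ := by
      have := norm_add_le (T - (if ζ.1 = 1 then ((rho h : ℝ):ℂ) else 0)*(prim ζ.2 y - prim ζ.2 x)*((1/GG h D : ℝ):ℂ)) ((if ζ.1 = 1 then ((rho h : ℝ):ℂ) else 0)*(prim ζ.2 y - prim ζ.2 x)*((1/GG h D : ℝ):ℂ))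
      rw [sub_add_cancel] at this
      linarith
    refine hT1.trans ?_
    have hR : 0 ≤ rho h/GG h D := by positivity
    by_cases hjj' : j = j'
    · rw [if_pos hjj']
      have a := (prim_lip ζ.2 x y hx0 hxy).trans hyx2
      have b := mul_le_mul_of_nonneg_left a hR
      have c : 0 ≤ (rho h/GG h D)*(6*x/C) := by positivity
      linarith
    · rw [if_neg hjj']
      have hl : (1:ℝ) ≤ |(j:ℝ)-j'| := by
        have : (1:ℤ) ≤ |(j:ℤ)-j'| := Int.one_le_abs (by omega)
        exact_mod_cast this
      have hz : C ≤ |(ζ.2:ℝ)| := by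
        rw [hζ2, abs_mul]; nlinarith [abs_nonneg (ξ.2:ℝ)]
      have hz0 : (ζ.2:ℝ) ≠ 0 := by
        intro h0; rw [h0, abs_zero] at hz; linarith
      have a1 := prim_norm ζ.2 y (by linarith) hz0
      have a2 := prim_norm ζ.2 x hx0 hz0
      have a3 : y/|(ζ.2:ℝ)| ≤ 3*x/C := by gcongr
      have a4 : x/|(ζ.2:ℝ)| ≤ 3*x/C := by
        refine le_trans (b := x/C) (by gcongr) ?_
        gcongr; linarith
      have a : ‖prim ζ.2 y - prim ζ.2 x‖ ≤ 6*x/C := by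
        refine (norm_sub_le _ _).trans ?_
        have : 6*x/C = 3*x/C+3*x/C := by ring
        linarith
      have b := mul_le_mul_of_nonneg_left a hR
      linarith
  have hd2 := hd.trans (sum_le_sum fun j hj => sum_le_sum fun j' hj' => hb j hj j' hj')
  have e3 : ∑ j ∈ range (m+1), ∑ j' ∈ range (m+1), ((if j = j' then (rho h/GG h D)*(2*x/V) else 0)+((rho h/GG h D)*(6*x/C)+err))
      = ((m:ℝ)+1)*((rho h/GG h D)*(2*x/V))+((m:ℝ)+1)^2*((rho h/GG h D)*(6*x/C)+err) := by
    have : ∀ j ∈ range (m+1), ∑ j' ∈ range (m+1), ((if j = j' then (rho h/GG h D)*(2*x/V) else 0)+((rho h/GG h D)*(6*x/C)+err))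
        = (rho h/GG h D)*(2*x/V)+((m:ℝ)+1)*((rho h/GG h D)*(6*x/C)+err) := by
      intro j hj
      rw [sum_add_distrib, sum_ite_eq, if_pos hj]; simp; ring
    rw [sum_congr rfl this]; simp; ring
  rw [e3] at hd2
  set A := (rho h/GG h D)*(2*x/V) with hA
  have hA0 : 0 ≤ A := by positivity
  have h4 : (rho h/GG h D)*(2*x/(V*m)) = A/m := by rw [hA]; field_simp
  rw [h4]
  have h5 : ((m:ℝ)+1)*A ≤ ((m:ℝ)+1)^2*(A/m) := by
    have : ((m:ℝ)+1)^2*(A/m) = ((m:ℝ)+1)*A*(((m:ℝ)+1)/m) := by field_simp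
    rw [this]
    refine le_mul_of_one_le_right (by positivity) ?_
    rw [one_le_div (by positivity)]; linarith
  have h6 : (0:ℝ) < ((m:ℝ)+1)^2 := by positivity
  refine le_of_mul_le_mul_left ?_ h6
  linarith

lemma ev_pow (c a b : ℝ) (hab : a < b) : ∀ᶠ X : ℝ in atTop, c*X^a ≤ X^b := by
  have h1 := (tendsto_rpow_atTop (show 0 < b - a by linarith)).eventually_ge_atTop c
  filter_upwards [h1, eventually_gt_atTop 0] with X hX hX0
  calc c*X^a ≤ X^(b-a)*X^a := by gcongr
    _ = X^b := by rw [← rpow_add hX0]; congr 1; ring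

lemma ev_log (c a b : ℝ) (hab : a < b) : ∀ᶠ X : ℝ in atTop, c*(X^a*log X) ≤ X^b := by
  have h1 := isLittleO_log_rpow_atTop (show 0 < (b - a)/2 by linarith)
  have h2 := ev_pow (|c|) ((a+b)/2) b (by linarith)
  filter_upwards [h1.bound (show (0:ℝ) < 1 by norm_num), h2, eventually_gt_atTop 1] with X hX h2 hX1
  have hX0 : 0 < X := by linarith
  rw [norm_of_nonneg (log_nonneg hX1.le), norm_of_nonneg (by positivity), one_mul] at hX
  have hl := log_nonneg hX1.le
  calc c*(X^a*log X) ≤ |c| * (X^a*log X) := by gcongr; exact le_abs_self c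
    _ ≤ |c| * (X^a*X^((b-a)/2)) := by gcongr
    _ = |c| * X^((a+b)/2) := by rw [← rpow_add hX0]; congr 2; ring
    _ ≤ _ := h2

noncomputable def w0 (V : ℕ) (X : ℝ) : ℕ := ⌈0.40*V*log X⌉₊
noncomputable def w1 (V : ℕ) (X : ℝ) : ℕ := ⌊0.45*V*log X⌋₊
noncomputable def WW (h V : ℕ) (X : ℝ) : ℝ := ∑ p ∈ PP h V (w0 V X) (w1 V X), (1:ℝ)/p

lemma w_range {V : ℕ} (hV : 1 ≤ V) {X : ℝ} (hX : 1 < X) {v : ℕ} (h0 : w0 V X ≤ v) : X^(0.40:ℝ) ≤ exp ((v:ℝ)/V) := by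
  have hVr : (1:ℝ) ≤ V := by exact_mod_cast hV
  rw [rpow_def_of_pos (by linarith)]
  refine exp_le_exp.2 ?_
  rw [le_div_iff₀ (by positivity)]
  have := (Nat.le_ceil (0.40*V*log X)).trans (show ((w0 V X:ℕ):ℝ) ≤ v by exact_mod_cast h0)
  linarith

lemma w_range' {V : ℕ} (hV : 1 ≤ V) {X : ℝ} (hX : 1 < X) {v : ℕ} (h1 : v ≤ w1 V X) : exp ((v:ℝ)/V) ≤ X^(0.45:ℝ) := by
  have hVr : (1:ℝ) ≤ V := by exact_mod_cast hV
  rw [rpow_def_of_pos (by linarith)]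
  refine exp_le_exp.2 ?_
  rw [div_le_iff₀ (by positivity)]
  have hl := log_pos hX
  have := (show (v:ℝ) ≤ (w1 V X:ℕ) by exact_mod_cast h1).trans (Nat.floor_le (show 0 ≤ 0.45*V*log X by positivity))
  linarith

lemma w_diff {V : ℕ} (hV : 1 ≤ V) {X : ℝ} (hX : 1000 ≤ log X) :
    ((w1 V X:ℕ):ℝ) - w0 V X ≤ 0.05*V*log X ∧ 0.04*V*log X ≤ ((w1 V X:ℕ):ℝ) - w0 V X ∧ ((w1 V X:ℕ):ℝ) ≤ 0.45*V*log X := by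
  have hVr : (1:ℝ) ≤ V := by exact_mod_cast hV
  have h1 := Nat.le_ceil (0.40*V*log X)
  have h2 := Nat.ceil_lt_add_one (show 0 ≤ 0.40*V*log X by positivity)
  have h3 := Nat.floor_le (show 0 ≤ 0.45*V*log X by positivity)
  have h4 := Nat.lt_floor_add_one (0.45*V*log X)
  unfold w0 w1
  refine ⟨by linarith, ?_, h3⟩
  have : 1000 ≤ V*log X := by nlinarith
  nlinarith

lemma w_le {V : ℕ} (hV : 1 ≤ V) {X : ℝ} (hX : 1000 ≤ log X) : w0 V X ≤ w1 V X := by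
  have hVr : (1:ℝ) ≤ V := by exact_mod_cast hV
  have := (w_diff hV hX).2.1
  have h2 : 0 ≤ 0.04*V*log X := by positivity
  exact_mod_cast (by linarith : ((w0 V X:ℕ):ℝ) ≤ w1 V X)

lemma WW_lower (h V : ℕ) (hh : 0 < h) (hV : 1 ≤ V) : ∀ᶠ X : ℝ in atTop, 1/200 ≤ WW h V X := by
  obtain ⟨t0, ht0, H⟩ := PR_inv_lower
  have hVr : (1:ℝ) ≤ V := by exact_mod_cast hV
  filter_upwards [tendsto_log_atTop.eventually_ge_atTop 1000, tendsto_log_atTop.eventually_ge_atTop (t0/0.4),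
    ev_pow h 0 0.40 (by norm_num), eventually_gt_atTop 1] with X h1 h2 h3 hX1
  rw [rpow_zero, mul_one] at h3
  obtain ⟨d1, d2, d3⟩ := w_diff hV h1
  have e0 := Nat.le_ceil (0.40*V*log X)
  set t := ((w0 V X:ℕ):ℝ)/V with ht
  set u := ((w1 V X:ℕ):ℝ)/V with hu
  have hut : 0.04*log X ≤ u - t := by
    rw [hu, ht, ← sub_div, le_div_iff₀ (by positivity)]; linarith
  have htt : 0.4*log X ≤ t := by rw [ht, le_div_iff₀ (by positivity)]; unfold w0; linarith
  have hu' : u ≤ 0.45*log X := by rw [hu, div_le_iff₀ (by positivity)]; linarith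
  have hu0 : 0 < u := by linarith
  have hH := H t u (by rw [div_le_iff₀ (by norm_num)] at h2; linarith) (by linarith)
  have e : PP h V (w0 V X) (w1 V X) = PR (exp t) (exp u) := by
    unfold PP
    refine Finset.filter_true_of_mem fun p hp => ?_
    rw [mem_PR (exp_pos _).le (exp_pos _).le] at hp
    intro hd
    have a := Nat.le_of_dvd hh hd
    have b := w_range hV hX1 (le_refl (w0 V X))
    have c : (p:ℝ) ≤ h := by exact_mod_cast a
    have := hp.1.1
    linarith
  unfold WW
  rw [e]
  refine le_trans ?_ hH
  rw [div_le_div_iff₀ (by norm_num) (by positivity)]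
  nlinarith

noncomputable def m0 : ℕ := 10000000
noncomputable def c0 : ℝ := 1/(8*(m0:ℝ)^2)
lemma m0_eq : (m0:ℝ) = 10000000 := by unfold m0; norm_num
lemma c0_eq : c0 = 1/(8*10000000^2) := by unfold c0; rw [m0_eq]

lemma blk_sparse (h V : ℕ) [NeZero h] (hV : 1 ≤ V) : ∀ᶠ X : ℝ in atTop, ∀ v : ℕ, w0 V X ≤ v → ∀ ξ : Freq h,
    3*V*m0 ≤ |(ξ.2:ℝ)| → |(ξ.2:ℝ)| ≤ X → (1 - c0)*(blk h V v).card < ‖Pv V v ξ‖ →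
    ((blk h V v).card:ℝ) ≤ 0.025*exp ((v:ℝ)/V)/(V*log X) := by
  have hh1 : (1:ℝ) ≤ h := by exact_mod_cast Nat.pos_of_neZero h
  have hVr : (1:ℝ) ≤ V := by exact_mod_cast hV
  have hhpos : 0 < h := Nat.pos_of_neZero h
  filter_upwards [eventually_gt_atTop 1, tendsto_log_atTop.eventually_ge_atTop 1000,
    ev_pow ((h:ℝ)^2+2) 0 0.0005 (by norm_num), ev_pow 2 0.0004 0.0005 (by norm_num), ev_pow (40*h) 0.001 0.40 (by norm_num),
    ev_pow ((m0:ℝ)*(2*h)^(2.6:ℝ)) 1.0026 1.04 (by norm_num), ev_log (120000*h*(V*m0)) 0.002 0.004 (by norm_num)]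
    with X hX1 hL hp1 hp2 hp3 hp4 hp5 v hv ξ hk1 hk2 hP
  have hX0 : 0 < X := by linarith
  set l := log X with hl
  have hx := w_range hV hX1 hv
  set N := exp ((v:ℝ)/V) with hN
  have hN0 : 0 < N := exp_pos _
  set D := ⌊X^(0.0005:ℝ)⌋₊ with hDd
  rw [rpow_zero, mul_one] at hp1
  have hXp : 0 < X^(0.0005:ℝ) := by positivity
  have hDle : (D:ℝ) ≤ X^(0.0005:ℝ) := Nat.floor_le hXp.le
  have hDge : X^(0.0005:ℝ) - 1 < D := sub_lt_iff_lt_add.2 (Nat.lt_floor_add_one _)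
  have hDh : h^2 ≤ D := by
    have : (h:ℝ)^2 ≤ D := by linarith
    exact_mod_cast this
  have hD1 : 1 ≤ D := le_trans (Nat.one_le_pow _ _ hhpos) hDh
  have hD1r : (1:ℝ) ≤ D := by exact_mod_cast hD1
  have hDlog : 0.0004*l ≤ log D := by
    have h1 : X^(0.0004:ℝ) ≤ D := by nlinarith
    have h2 := log_le_log (by positivity) h1
    rw [Real.log_rpow hX0] at h2; exact h2
  have hGl := GG_lower h D hhpos hDh
  have hG := GG_pos (h := h) hD1
  have hρ0 := rho_nonneg h
  have hl0 : 0 < l := by linarith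
  have hratio : rho h/GG h D ≤ 15000/l := by
    rw [div_le_div_iff₀ hG hl0]
    have : rho h*(0.0004*l)/6 ≤ rho h*log D/6 := by gcongr
    nlinarith
  have hD2 : (D:ℝ)^2 ≤ X^(0.001:ℝ) := by
    calc (D:ℝ)^2 ≤ (X^(0.0005:ℝ))^2 := by gcongr
      _ = X^(0.001:ℝ) := by rw [← rpow_natCast, ← rpow_mul hX0.le]; norm_num
  have hD4 : (D:ℝ)^4 ≤ X^(0.002:ℝ) := by
    calc (D:ℝ)^4 ≤ (X^(0.0005:ℝ))^4 := by gcongr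
      _ = X^(0.002:ℝ) := by rw [← rpow_natCast, ← rpow_mul hX0.le]; norm_num
  have c1 : 40*h*(D:ℝ)^2 ≤ N := by
    refine le_trans ?_ (hp3.trans hx); gcongr
  have c2 : m0 * |(ξ.2:ℝ)| ≤ (N/(2*h*(D:ℝ)^2))^(2.6:ℝ) := by
    have a1 : X^(0.399:ℝ)/(2*h) ≤ N/(2*h*(D:ℝ)^2) := by
      rw [div_le_div_iff₀ (by positivity) (by positivity)]
      have : X^(0.399:ℝ)*(D:ℝ)^2 ≤ N := by
        calc _ ≤ X^(0.399:ℝ)*X^(0.001:ℝ) := by gcongr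
          _ = X^(0.40:ℝ) := by rw [← rpow_add hX0]; norm_num
          _ ≤ N := hx
      nlinarith [mul_le_mul_of_nonneg_left this (show (0:ℝ) ≤ 2*h by positivity)]
    have a2 : m0*X ≤ (X^(0.399:ℝ)/(2*h))^(2.6:ℝ) := by
      rw [div_rpow (by positivity) (by positivity), le_div_iff₀ (by positivity), ← rpow_mul hX0.le]
      have e1 : X^((0.399:ℝ)*2.6) = X^(1.04:ℝ)/X^(0.0026:ℝ) := by rw [← Real.rpow_sub hX0]; norm_num
      rw [e1, le_div_iff₀ (by positivity)]
      refine le_trans (le_of_eq ?_) hp4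
      have : X^(1.0026:ℝ) = X*X^(0.0026:ℝ) := by
        rw [← Real.rpow_one_add' hX0.le (by norm_num)]; norm_num
      rw [this]; ring
    calc m0 * |(ξ.2:ℝ)| ≤ m0*X := by gcongr
      _ ≤ _ := a2
      _ ≤ _ := rpow_le_rpow (by positivity) a1 (by norm_num)
  have hb := blk_bound ξ V v m0 D hV (by unfold m0; norm_num) hD1 (3*V*m0) (by rw [m0_eq]; positivity) hk1 c1 c2 hP
  rw [← hN] at hb
  have c3 : 30000000*h*(D:ℝ)^4*N^(0.99:ℝ) ≤ 250*N/(V*m0*l) := by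
    have a1 : X^(0.004:ℝ) ≤ N^(0.01:ℝ) := by
      calc X^(0.004:ℝ) = (X^(0.40:ℝ))^(0.01:ℝ) := by rw [← rpow_mul hX0.le]; norm_num
        _ ≤ _ := rpow_le_rpow (by positivity) hx (by norm_num)
    rw [le_div_iff₀ (by rw [m0_eq]; positivity)]
    have a2 : N = N^(0.01:ℝ)*N^(0.99:ℝ) := by
      rw [← rpow_add hN0]; norm_num
    calc 30000000*h*(D:ℝ)^4*N^(0.99:ℝ)*(V*m0*l) ≤ 30000000*h*X^(0.002:ℝ)*N^(0.99:ℝ)*(V*m0*l) := by gcongr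
      _ = 250*(120000*h*(V*m0)*(X^(0.002:ℝ)*l))*N^(0.99:ℝ) := by ring
      _ ≤ 250*N^(0.01:ℝ)*N^(0.99:ℝ) := by gcongr; exact hp5.trans a1
      _ = 250*N := by rw [mul_assoc, ← a2]
  have c4 : (rho h/GG h D)*(2*N/(V*m0)) ≤ 15000/l*(2*N/(V*m0)) := by gcongr
  have c5 : (rho h/GG h D)*(6*N/(3*V*m0)) ≤ 15000/l*(6*N/(3*V*m0)) := by gcongr
  have c6 : 0.025*N/(V*l) = 4*(15000/l*(2*N/(V*m0))+15000/l*(6*N/(3*V*m0))+2500*N/(V*m0*l)) := by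
    rw [m0_eq]; field_simp; norm_num
  have c7 : 250*N/(V*m0*l) ≤ 2500*N/(V*m0*l) := by gcongr; norm_num
  rw [c6]
  linarith

lemma q_exists (h V : ℕ) [NeZero h] (hV : 1 ≤ V) : ∀ᶠ X : ℝ in atTop, ∃ q : ℕ → ℝ, (∀ v, 0 ≤ q v) ∧
    (∀ v ∈ Ico (w0 V X) (w1 V X), ∀ ξ : Freq h, 3*V*m0 ≤ |(ξ.2:ℝ)| → |(ξ.2:ℝ)| ≤ X → ‖Pv V v ξ‖ ≤ q v) ∧
    ∑ v ∈ Ico (w0 V X) (w1 V X), q v/exp ((v:ℝ)/V) ≤ (1 - c0/2)*exp (1/V)*WW h V X := by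
  classical
  have hVr : (1:ℝ) ≤ V := by exact_mod_cast hV
  have hc0 : 0 < c0 := by rw [c0_eq]; norm_num
  have hc1 : c0 < 1 := by rw [c0_eq]; norm_num
  filter_upwards [blk_sparse h V hV, WW_lower h V (Nat.pos_of_neZero h) hV, tendsto_log_atTop.eventually_ge_atTop 1000] with X hs hW hL
  set l := log X with hl
  set sp : ℕ → Prop := fun v => ((blk h V v).card:ℝ) ≤ 0.025*exp ((v:ℝ)/V)/(V*l) with hsp
  refine ⟨fun v => if sp v then ((blk h V v).card:ℝ) else (1-c0)*(blk h V v).card, fun v => ?_, fun v hv ξ h1 h2 => ?_, ?_⟩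
  · dsimp only; split_ifs
    · positivity
    · exact mul_nonneg (by linarith) (by positivity)
  · dsimp only; split_ifs with hc
    · unfold Pv pol
      refine (norm_sum_le _ _).trans ?_
      calc _ ≤ ∑ p ∈ blk h V v, (1:ℝ) := sum_le_sum fun p _ => by rw [one_mul]; exact ch_norm_le ξ p
        _ = _ := by simp
    · by_contra hcon
      exact hc (hs v (mem_Ico.1 hv).1 ξ h1 h2 (not_le.1 hcon))
  · set I := Ico (w0 V X) (w1 V X) with hI
    have e1 : ∀ v ∈ I, (if sp v then ((blk h V v).card:ℝ) else (1-c0)*(blk h V v).card)/exp ((v:ℝ)/V)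
        ≤ (1-c0)*((blk h V v).card/exp ((v:ℝ)/V))+c0*(0.025/(V*l)) := by
      intro v _
      have hE := exp_pos ((v:ℝ)/V)
      split_ifs with hc
      · have a : ((blk h V v).card:ℝ)/exp ((v:ℝ)/V) ≤ 0.025/(V*l) := by
          rw [div_le_iff₀ hE]
          have : 0.025/(V*l)*exp ((v:ℝ)/V) = 0.025*exp ((v:ℝ)/V)/(V*l) := by ring
          rw [this]; exact hc
        have := mul_le_mul_of_nonneg_left a hc0.le
        linarith
      · have : 0 ≤ c0*(0.025/(V*l)) := by positivity
        rw [mul_div_assoc]; linarith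
    refine (sum_le_sum e1).trans ?_
    rw [sum_add_distrib, ← mul_sum, sum_const, nsmul_eq_mul]
    have e2 : ∑ v ∈ I, ((blk h V v).card:ℝ)/exp ((v:ℝ)/V) ≤ exp (1/V)*WW h V X := by
      unfold WW
      rw [← sum_blk h V _ _ (w_le hV hL), mul_sum]
      refine sum_le_sum fun v _ => ?_
      rw [card_eq_sum_ones, mul_sum]
      push_cast
      rw [sum_div]
      refine sum_le_sum fun p hp => ?_
      have := (mem_blk.1 hp).1
      rw [exp_add_one_div] at this
      have hE := exp_pos ((v:ℝ)/V)
      have hp0 : (0:ℝ) < p := hE.trans this.1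
      rw [mul_one_div, div_le_div_iff₀ hE hp0]; linarith [this.2]
    have e3 : (I.card:ℝ)*(c0*(0.025/(V*l))) ≤ c0*(1/800) := by
      rw [hI, Nat.card_Ico, Nat.cast_sub (w_le hV hL)]
      have := (w_diff hV hL).1
      have hp : 0 ≤ c0*(0.025/(V*l)) := by positivity
      calc _ ≤ (0.05*V*l)*(c0*(0.025/(V*l))) := mul_le_mul_of_nonneg_right this hp
        _ = c0*(1/800) := by field_simp; norm_num
    have e4 := mul_le_mul_of_nonneg_left e2 (show 0 ≤ 1 - c0 by linarith)
    have e5 : (1:ℝ) ≤ exp (1/V) := one_le_exp (by positivity)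
    have e6 : WW h V X ≤ exp (1/V)*WW h V X := by nlinarith
    nlinarith

lemma rho_pos (h : ℕ) [NeZero h] : 0 < rho h := by
  unfold rho
  have a : 0 < h := Nat.pos_of_neZero h
  have b := Nat.totient_pos.2 a
  positivity

lemma prim_zero (u : ℝ) : prim 0 u = u := by
  unfold prim ee; simp

lemma sum_ch_one {h : ℕ} [NeZero h] (s : Finset ℕ) : ∑ n ∈ s, ch ((1,0) : Freq h) n = ((s.filter (fun n => n.Coprime h)).card : ℂ) := by
  rw [Finset.card_filter]; push_cast
  refine sum_congr rfl fun n _ => ?_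
  split_ifs with hn
  · rw [ch_one_eq (1,0) rfl n hn]; unfold ee; simp
  · exact ch_eq_zero _ n hn

lemma cop_count {h : ℕ} [NeZero h] (x y : ℝ) (hx : 40*h ≤ x) (hxy : x ≤ y) (hy : y ≤ 500*x) :
    |(((sg x y).filter (fun n => n.Coprime h)).card:ℝ) - rho h*(y-x)| ≤ 30000000*h*x^(0.99:ℝ) := by
  have hh1 : (1:ℝ) ≤ h := by exact_mod_cast Nat.pos_of_neZero h
  have hx0 : 0 < x := by linarith
  have := polPr ((1,0) : Freq h) x y hx hxy hy (by simp; positivity)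
  rw [sum_ch_one] at this
  simp only [if_true, Int.cast_zero, prim_zero] at this
  have e : ((((sg x y).filter (fun n => n.Coprime h)).card:ℕ):ℂ) - ((rho h:ℝ):ℂ)*((y:ℂ)-x) = (((((sg x y).filter (fun n => n.Coprime h)).card:ℝ) - rho h*(y-x) : ℝ):ℂ) := by
    push_cast; ring
  rw [e, norm_real, norm_eq_abs] at this
  exact this

lemma cop_count_ev (h : ℕ) [NeZero h] (κ δ : ℝ) (hκ : 0 < κ) (hκ1 : κ ≤ 1) (hδ : 0 < δ) : ∀ᶠ M : ℝ in atTop,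
    (((sg M ((1+κ)*M)).filter (fun n => n.Coprime h)).card:ℝ) ≤ (1+δ)*(rho h*(κ*M)) := by
  have hρ := rho_pos h
  filter_upwards [eventually_ge_atTop (40*(h:ℝ)), ev_pow (30000000*h/(δ*(rho h*κ))) 0.99 1 (by norm_num), eventually_gt_atTop 0] with M h1 h2 h3
  have := (abs_le.1 (cop_count (h := h) M ((1+κ)*M) h1 (by nlinarith) (by nlinarith))).2
  rw [rpow_one, div_mul_eq_mul_div, div_le_iff₀ (by positivity)] at h2
  nlinarith

lemma mem_Xi {h K : ℕ} [NeZero h] {ξ : Freq h} : ξ ∈ Xi h K ↔ |(ξ.2:ℝ)| ≤ K := by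
  unfold Xi
  rw [mem_product, mem_Icc, abs_le]
  simp only [mem_univ, true_and]
  constructor
  · rintro ⟨a, b⟩; exact ⟨by exact_mod_cast a, by exact_mod_cast b⟩
  · rintro ⟨a, b⟩; exact ⟨by exact_mod_cast a, by exact_mod_cast b⟩

lemma sqrtX_M (κ : ℝ) {V : ℕ} (hV : 1 ≤ V) {X : ℝ} (hX : 1 < X) {v : ℕ} (h1 : v ≤ w1 V X) : X^(0.55:ℝ) ≤ X/exp ((v:ℝ)/V) := by
  have h2 := w_range' hV hX h1
  rw [le_div_iff₀ (exp_pos _)]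
  have hX0 : 0 < X := by linarith
  calc X^(0.55:ℝ)*exp ((v:ℝ)/V) ≤ X^(0.55:ℝ)*X^(0.45:ℝ) := by gcongr
    _ = X := by rw [← rpow_add hX0]; norm_num

lemma Rv_U (h V : ℕ) [NeZero h] (hV : 1 ≤ V) (κ δ : ℝ) (hκ : 0 < κ) (hκ1 : κ ≤ 1) (hδ : 0 < δ) : ∀ᶠ X : ℝ in atTop,
    ∀ U : Finset (Freq h), (∀ ξ ∈ U, |(ξ.2:ℝ)| ≤ X) → (U.card:ℝ) ≤ X^(0.003:ℝ) → ∀ v ≤ w1 V X,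
    ∑ ξ ∈ U, ‖Rv X κ V v ξ‖^2 ≤ (1+κ)*(1+δ)^2*(2*π*(rho h)^2*κ)*(X/exp ((v:ℝ)/V))^2 := by
  have hρ := rho_pos h
  have hh1 : (1:ℝ) ≤ h := by exact_mod_cast Nat.pos_of_neZero h
  have hpi := pi_gt_three
  obtain ⟨M0, hM0⟩ := eventually_atTop.1 (cop_count_ev h κ δ hκ hκ1 hδ)
  filter_upwards [eventually_gt_atTop 1, ev_pow M0 0 0.55 (by norm_num), ev_pow (40*h) 0 0.55 (by norm_num),
    ev_pow (60000000*h/(δ*(2*π*rho h))) 0.003 0.0055 (by norm_num), ev_pow (2*(2*h)^(2.6:ℝ)) 1 1.43 (by norm_num)]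
    with X hX1 h1 h2 h3 h4 U hU hUc v hv
  have hX0 : 0 < X := by linarith
  rw [rpow_zero, mul_one] at h1 h2
  rw [rpow_one] at h4
  have hM := sqrtX_M κ hV hX1 hv
  unfold Rv
  set M := X/exp ((v:ℝ)/V) with hMd
  have hMp : 0 < M := lt_of_lt_of_le (by positivity) hM
  have hc := hM0 M (h1.trans hM)
  have hd := dls U M κ (h2.trans hM) hκ.le hκ1 (by
    intro ξ hξ ξ' hξ'
    have a1 := hU ξ hξ
    have a2 := hU ξ' hξ'
    push_cast
    refine (abs_sub _ _).trans ?_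
    have a3 : 2*X ≤ (X^(0.55:ℝ)/(2*h))^(2.6:ℝ) := by
      rw [div_rpow (by positivity) (by positivity), le_div_iff₀ (by positivity), ← rpow_mul hX0.le]
      have : (0.55:ℝ)*2.6 = 1.43 := by norm_num
      rw [this]; linarith
    have a4 : (X^(0.55:ℝ)/(2*h))^(2.6:ℝ) ≤ (M/(2*h))^(2.6:ℝ) := rpow_le_rpow (by positivity) (by gcongr) (by norm_num)
    linarith) (fun m => (liouville m : ℂ))
  refine hd.trans ?_
  have e1 : ∑ n ∈ (sg M ((1+κ)*M)).filter (fun n => n.Coprime h), ‖(liouville n:ℂ)‖^2 = (((sg M ((1+κ)*M)).filter (fun n => n.Coprime h)).card:ℝ) := by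
    rw [card_eq_sum_ones]; push_cast
    refine sum_congr rfl fun n _ => ?_
    rw [norm_real, norm_eq_abs, lio_abs]; norm_num
  rw [e1]
  have e2 : (U.card:ℝ)*(60000000*h*M^(-0.01:ℝ)) ≤ δ*(2*π*rho h) := by
    have b1 : M^(-0.01:ℝ) ≤ (X^(0.0055:ℝ))⁻¹ := by
      rw [rpow_neg hMp.le]
      refine inv_anti₀ (by positivity) ?_
      calc X^(0.0055:ℝ) = (X^(0.55:ℝ))^(0.01:ℝ) := by rw [← rpow_mul hX0.le]; norm_num
        _ ≤ _ := rpow_le_rpow (by positivity) hM (by norm_num)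
    rw [div_mul_eq_mul_div, div_le_iff₀ (by positivity)] at h3
    calc (U.card:ℝ)*(60000000*h*M^(-0.01:ℝ)) ≤ X^(0.003:ℝ)*(60000000*h*(X^(0.0055:ℝ))⁻¹) := by gcongr
      _ = (60000000*h*X^(0.003:ℝ))/X^(0.0055:ℝ) := by ring
      _ ≤ _ := by rw [div_le_iff₀ (by positivity)]; linarith
  calc _ ≤ (1+κ)*M*(2*π*rho h + δ*(2*π*rho h))*((1+δ)*(rho h*(κ*M))) := by gcongr
    _ = _ := by ring

lemma U_bound (h V : ℕ) [NeZero h] (hV : 1 ≤ V) (κ δ : ℝ) (hκ : 0 < κ) (hκ1 : κ ≤ 1) (hδ : 0 < δ) : ∀ᶠ X : ℝ in atTop,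
    ∀ U : Finset (Freq h), (∀ ξ ∈ U, |(ξ.2:ℝ)| ≤ X) → (∀ ξ ∈ U, 3*V*m0 ≤ |(ξ.2:ℝ)|) → (U.card:ℝ) ≤ X^(0.003:ℝ) →
    ∑ ξ ∈ U, ‖(1/WW h V X:ℝ) * ∑ v ∈ Ico (w0 V X) (w1 V X), Pv V v ξ * Rv X κ V v ξ‖^2 ≤
      (1-c0/2)^2*(exp (1/V))^2*((1+κ)*(1+δ)^2)*(2*π*(rho h)^2*κ*X^2) := by
  filter_upwards [Rv_U h V hV κ δ hκ hκ1 hδ, q_exists h V hV, WW_lower h V (Nat.pos_of_neZero h) hV, eventually_gt_atTop 1]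
    with X hR hq hW hX1 U hU1 hU2 hUc
  obtain ⟨q, q0, q1, q2⟩ := hq
  have hX0 : 0 < X := by linarith
  have hρ := rho_pos h
  have hpi := pi_pos
  set W := WW h V X with hWd
  have hW0 : 0 < W := by linarith
  set I := Ico (w0 V X) (w1 V X) with hI
  set T : ℝ := (1+κ)*(1+δ)^2*(2*π*(rho h)^2*κ) with hT
  have hT0 : 0 ≤ T := by positivity
  set M : ℕ → ℝ := fun v => X/exp ((v:ℝ)/V) with hM
  have hM0 : ∀ v, 0 < M v := fun v => div_pos hX0 (exp_pos _)
  set S := ∑ v ∈ I, q v*M v with hS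
  have hS0 : 0 ≤ S := sum_nonneg fun v _ => mul_nonneg (q0 v) (hM0 v).le
  have hSle : S ≤ (1-c0/2)*exp (1/V)*W*X := by
    have : S = (∑ v ∈ I, q v/exp ((v:ℝ)/V))*X := by
      rw [hS, sum_mul]; refine sum_congr rfl fun v _ => ?_
      simp only [hM]; ring
    rw [this]; gcongr
  have hpt : ∀ ξ ∈ U, ‖(1/W:ℝ) * ∑ v ∈ I, Pv V v ξ * Rv X κ V v ξ‖^2 ≤ 1/W^2*(S*∑ v ∈ I, q v/M v*‖Rv X κ V v ξ‖^2) := by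
    intro ξ hξ
    have a1 : ‖∑ v ∈ I, Pv V v ξ * Rv X κ V v ξ‖ ≤ ∑ v ∈ I, q v * ‖Rv X κ V v ξ‖ := by
      refine (norm_sum_le _ _).trans (sum_le_sum fun v hv => ?_)
      rw [norm_mul]
      exact mul_le_mul_of_nonneg_right (q1 v hv ξ (hU2 ξ hξ) (hU1 ξ hξ)) (norm_nonneg _)
    have a2 : (∑ v ∈ I, q v * ‖Rv X κ V v ξ‖)^2 ≤ S*∑ v ∈ I, q v/M v*‖Rv X κ V v ξ‖^2 := by
      refine Finset.sum_sq_le_sum_mul_sum_of_sq_eq_mul _ (fun v _ => mul_nonneg (q0 v) (hM0 v).le)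
        (fun v _ => mul_nonneg (div_nonneg (q0 v) (hM0 v).le) (by positivity)) fun v _ => ?_
      have := (hM0 v).ne'
      field_simp
    rw [norm_mul, norm_real, norm_of_nonneg (by positivity), mul_pow, div_pow, one_pow]
    gcongr
    exact le_trans (by gcongr) a2
  refine (sum_le_sum hpt).trans ?_
  rw [← mul_sum, ← mul_sum, sum_comm]
  have hin : ∑ v ∈ I, ∑ ξ ∈ U, q v/M v*‖Rv X κ V v ξ‖^2 ≤ T*S := by
    rw [hS, mul_sum]
    refine sum_le_sum fun v hv => ?_
    rw [← mul_sum]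
    have b := hR U hU1 hUc v (mem_Ico.1 hv).2.le
    have b0 : 0 ≤ q v/M v := div_nonneg (q0 v) (hM0 v).le
    refine (mul_le_mul_of_nonneg_left b b0).trans (le_of_eq ?_)
    have := (hM0 v).ne'
    change q v/M v*(T*(M v)^2) = _
    field_simp
  calc _ ≤ 1/W^2*(S*(T*S)) := by gcongr
    _ = 1/W^2*T*S^2 := by ring
    _ ≤ 1/W^2*T*((1-c0/2)*exp (1/V)*W*X)^2 := by gcongr
    _ = _ := by rw [hT]; field_simp

lemma count_mod (A B m c : ℕ) (hAB : A ≤ B) (hm : 0 < m) :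
    |(((Ioc A B).filter (fun n => n ≡ c [MOD m])).card:ℝ) - ((B:ℝ)-A)/m| ≤ 1 := by
  have h1 := Nat.Ioc_filter_modEq_card A B hm c
  have hmq : (0:ℚ) < m := by exact_mod_cast hm
  have h2 : ⌊((A:ℚ) - c)/(m:ℚ)⌋ ≤ ⌊((B:ℚ) - c)/(m:ℚ)⌋ := by
    refine Int.floor_mono ?_
    have : (A:ℚ) ≤ B := by exact_mod_cast hAB
    gcongr
  rw [max_eq_left (by omega)] at h1
  have h3 : (((Ioc A B).filter (fun n => n ≡ c [MOD m])).card:ℚ) = (⌊((B:ℚ) - c)/(m:ℚ)⌋:ℚ) - (⌊((A:ℚ) - c)/(m:ℚ)⌋:ℚ) := by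
    exact_mod_cast congrArg (Int.cast : ℤ → ℚ) h1
  have a1 := Int.floor_le (((B:ℚ) - c)/(m:ℚ))
  have a2 := Int.lt_floor_add_one (((B:ℚ) - c)/(m:ℚ))
  have a3 := Int.floor_le (((A:ℚ) - c)/(m:ℚ))
  have a4 := Int.lt_floor_add_one (((A:ℚ) - c)/(m:ℚ))
  have a5 : ((B:ℚ)-A)/m = ((B:ℚ) - c)/(m:ℚ) - ((A:ℚ) - c)/(m:ℚ) := by ring
  have : |(((Ioc A B).filter (fun n => n ≡ c [MOD m])).card:ℚ) - ((B:ℚ)-A)/m| ≤ 1 := by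
    rw [h3, a5, abs_le]; constructor <;> linarith
  have h5 := (Rat.cast_le (K := ℝ)).2 this
  push_cast at h5
  exact h5

lemma cop_dvd_count (A B h d e r : ℕ) (hAB : A ≤ B) (hh : 0 < h) (hd : 0 < d) (he : 0 < e) (hhd : h.Coprime d) (hhe : h.Coprime e) (hde : d.Coprime e) :
    |(((Ioc A B).filter (fun n => n.Coprime h ∧ d ∣ n ∧ e ∣ n+r)).card:ℝ) - rho h*((B:ℝ)-A)/(d*e)| ≤ h := by
  classical
  set S := (range h).filter (fun a => h.Coprime a) with hS
  have hSc : S.card = h.totient := rfl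
  have hiff : ∀ n, e ∣ n+r ↔ n ≡ (e-1)*r [MOD e] := by
    intro n
    have e1 : (e-1)*r+r = e*r := by
      obtain ⟨e', rfl⟩ : ∃ e', e = e'+1 := ⟨e-1, by omega⟩
      simp; ring
    constructor
    · intro hn
      refine Nat.ModEq.add_right_cancel' r ?_
      rw [e1]
      exact ((Nat.modEq_zero_iff_dvd).2 hn).trans ((Nat.modEq_zero_iff_dvd).2 (dvd_mul_right e r)).symm
    · intro hn
      have := hn.add_right r
      rw [e1] at this
      exact (Nat.modEq_zero_iff_dvd).1 (this.trans ((Nat.modEq_zero_iff_dvd).2 (dvd_mul_right e r)))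
  have hco : h.Coprime (d*e) := Nat.Coprime.mul_right hhd hhe
  have hcard : ((Ioc A B).filter (fun n => n.Coprime h ∧ d ∣ n ∧ e ∣ n+r)).card =
      ∑ a ∈ S, ((Ioc A B).filter (fun n => n ≡ Nat.chineseRemainder hco a (Nat.chineseRemainder hde 0 ((e-1)*r)) [MOD h*(d*e)])).card := by
    rw [Finset.card_eq_sum_card_fiberwise (f := fun n => n % h) (t := S)]
    · refine sum_congr rfl fun a ha => ?_
      congr 1
      ext n
      simp only [mem_filter]
      have ha' := mem_filter.1 ha
      have hah : a % h = a := Nat.mod_eq_of_lt (mem_range.1 ha'.1)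
      set c2 := Nat.chineseRemainder hde 0 ((e-1)*r)
      set c1 := Nat.chineseRemainder hco a c2
      rw [← Nat.modEq_and_modEq_iff_modEq_mul hco, ← Nat.modEq_and_modEq_iff_modEq_mul hde, hiff, ← Nat.modEq_zero_iff_dvd]
      have p1 := c1.2.1
      have p2 := c1.2.2
      rw [← Nat.modEq_and_modEq_iff_modEq_mul hde] at p2
      have p3 := p2.1.trans c2.2.1
      have p4 := p2.2.trans c2.2.2
      constructor
      · rintro ⟨⟨q0, q1, q2, q3⟩, q4⟩
        refine ⟨q0, ?_, q2.trans p3.symm, q3.trans p4.symm⟩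
        refine Nat.ModEq.trans ?_ p1.symm
        unfold Nat.ModEq; rw [hah]; exact q4
      · rintro ⟨q0, q1, q2, q3⟩
        have q5 := q1.trans p1
        refine ⟨⟨q0, ?_, q2.trans p3, q3.trans p4⟩, ?_⟩
        · have := Nat.ModEq.gcd_eq q5
          unfold Nat.Coprime; rw [this]; exact ha'.2.symm
        · unfold Nat.ModEq at q5; rw [hah] at q5; exact q5
    · intro n hn
      simp only [coe_filter, Set.mem_ofPred_eq, mem_Ioc] at hn
      simp only [hS, coe_filter, Set.mem_ofPred_eq, mem_range]
      refine ⟨Nat.mod_lt _ hh, ?_⟩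
      have := hn.2.1
      unfold Nat.Coprime at *
      rw [Nat.gcd_comm, ← Nat.gcd_rec, Nat.gcd_comm]; exact this
  have hrho : rho h*((B:ℝ)-A)/(d*e) = ∑ a ∈ S, ((B:ℝ)-A)/((h*(d*e) : ℕ):ℝ) := by
    rw [sum_const, hSc, nsmul_eq_mul]; unfold rho; push_cast
    have : (h:ℝ) ≠ 0 := by positivity
    field_simp
  rw [hcard, hrho]
  push_cast
  rw [← sum_sub_distrib]
  refine (abs_sum_le_sum_abs _ _).trans ?_
  calc _ ≤ ∑ a ∈ S, (1:ℝ) := by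
        refine sum_le_sum fun a ha => ?_
        have := count_mod A B (h*(d*e)) (Nat.chineseRemainder hco a (Nat.chineseRemainder hde 0 ((e-1)*r))) hAB (by positivity)
        push_cast at this
        exact this
    _ ≤ h := by
        rw [sum_const, nsmul_eq_mul, mul_one, hSc]; exact_mod_cast Nat.totient_le h

lemma sum_sqrt_gam (P : Finset ℕ) (W : ℝ) (n : ℕ) (h1 : 1 ∉ P) :
    1 - om P n/W = ∑ d ∈ insert 1 P, (if d = 1 then 1 else -1/W)*(if d ∣ n then 1 else 0) := by
  rw [sum_insert h1]
  have : ∑ d ∈ P, (if d = 1 then (1:ℝ) else -1/W)*(if d ∣ n then 1 else 0) = -(om P n/W) := by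
    unfold om
    rw [sum_div, ← sum_neg_distrib]
    refine sum_congr rfl fun d hd => ?_
    rw [if_neg (by rintro rfl; exact h1 hd)]; ring
  rw [this]; simp; ring

lemma corr_bound (A B h r : ℕ) (P : Finset ℕ) (hAB : A ≤ B) (hh : 0 < h) (hr : 0 < r)
    (hP : ∀ p ∈ P, p.Prime ∧ ¬ p ∣ h ∧ r < p) (Y : ℝ) (hY : 0 < Y) (hPY : ∀ p ∈ P, Y ≤ p) (W : ℝ) (hW : W = ∑ p ∈ P, (1:ℝ)/p) (hW0 : 1/200 ≤ W) :
    |∑ n ∈ (Ioc A B).filter (fun n => n.Coprime h), (1 - om P n/W)*(1 - om P (n+r)/W)|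
      ≤ h*(1+200*(P.card:ℝ))^2+200*((B:ℝ)-A)/Y := by
  classical
  have h1 : 1 ∉ P := fun h => Nat.not_prime_one (hP 1 h).1
  have hWp : 0 < W := by linarith
  set γ : ℕ → ℝ := fun d => if d = 1 then 1 else -1/W with hγ
  have hABr : (0:ℝ) ≤ (B:ℝ)-A := by
    have : (A:ℝ) ≤ B := by exact_mod_cast hAB
    linarith
  set Q := insert 1 P with hQ
  set N : ℕ → ℕ → ℝ := fun d e => (((Ioc A B).filter (fun n => n.Coprime h ∧ d ∣ n ∧ e ∣ n+r)).card:ℝ) with hN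
  have e1 : ∑ n ∈ (Ioc A B).filter (fun n => n.Coprime h), (1 - om P n/W)*(1 - om P (n+r)/W)
      = ∑ d ∈ Q, ∑ e ∈ Q, γ d*γ e*N d e := by
    have : ∀ n ∈ (Ioc A B).filter (fun n => n.Coprime h), (1 - om P n/W)*(1 - om P (n+r)/W)
        = ∑ d ∈ Q, ∑ e ∈ Q, γ d*γ e*(if d ∣ n ∧ e ∣ n+r then 1 else 0) := by
      intro n _
      rw [sum_sqrt_gam P W n h1, sum_sqrt_gam P W (n+r) h1, sum_mul_sum]
      refine sum_congr rfl fun d _ => sum_congr rfl fun e _ => ?_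
      by_cases a : d ∣ n <;> by_cases b : e ∣ n+r <;> simp [a, b, hγ]
    rw [sum_congr rfl this, sum_comm]
    refine sum_congr rfl fun d _ => ?_
    rw [sum_comm]
    refine sum_congr rfl fun e _ => ?_
    rw [← mul_sum]
    congr 1
    rw [hN]
    simp only
    rw [card_eq_sum_ones, sum_filter, sum_filter]
    push_cast
    refine sum_congr rfl fun n _ => ?_
    by_cases a : n.Coprime h <;> by_cases b : d ∣ n ∧ e ∣ n+r <;> simp [a, b]
  have e2 : ∑ d ∈ Q, γ d/d = 0 := by
    rw [hQ, sum_insert h1]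
    have : ∑ d ∈ P, γ d/d = -1 := by
      have : ∀ d ∈ P, γ d/d = -1/W*(1/d) := by
        intro d hd
        rw [hγ]; simp only; rw [if_neg (by rintro rfl; exact h1 hd)]; ring
      rw [sum_congr rfl this, ← mul_sum, ← hW]; field_simp
    rw [this, hγ]; simp
  have e3 : ∑ d ∈ Q, ∑ e ∈ Q, γ d*γ e*(rho h*((B:ℝ)-A)/(d*e)) = 0 := by
    have : ∑ d ∈ Q, ∑ e ∈ Q, γ d*γ e*(rho h*((B:ℝ)-A)/(d*e)) = rho h*((B:ℝ)-A)*((∑ d ∈ Q, γ d/d)*(∑ e ∈ Q, γ e/e)) := by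
      rw [sum_mul_sum, mul_sum]
      refine sum_congr rfl fun d _ => ?_
      rw [mul_sum]
      refine sum_congr rfl fun e _ => ?_
      rw [div_mul_div_comm]; ring
    rw [this, e2]; ring
  rw [e1, ← sub_zero (∑ d ∈ Q, _), ← e3, ← sum_sub_distrib]
  have hγ0 : ∀ d, |γ d| ≤ if d = 1 then 1 else 200 := by
    intro d; rw [hγ]; simp only
    split_ifs
    · simp
    · rw [abs_div, abs_neg, abs_one, abs_of_pos hWp, div_le_iff₀ hWp]; linarith
  have hρ1 := rho_le_one h
  have hρ0 := rho_nonneg h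
  have hterm : ∀ d ∈ Q, ∀ e ∈ Q, |γ d*γ e*N d e - γ d*γ e*(rho h*((B:ℝ)-A)/(d*e))| ≤ h*|γ d| * |γ e|
      + (if d = e then (if d = 1 then 0 else ((B:ℝ)-A)/W^2/Y*(1/d)) else 0) := by
    intro d hd e he
    rw [← mul_sub, abs_mul, abs_mul]
    have hpos : ∀ x ∈ Q, 0 < x ∧ h.Coprime x := by
      intro x hx
      rcases mem_insert.1 hx with rfl | hx
      · exact ⟨one_pos, Nat.coprime_one_right _⟩
      · exact ⟨(hP x hx).1.pos, ((Nat.Prime.coprime_iff_not_dvd (hP x hx).1).2 (hP x hx).2.1).symm⟩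
    have extra : 0 ≤ (if d = e then (if d = 1 then 0 else ((B:ℝ)-A)/W^2/Y*(1/d)) else 0) := by
      split_ifs <;> positivity
    by_cases hco : d.Coprime e
    · have := cop_dvd_count A B h d e r hAB hh (hpos d hd).1 (hpos e he).1 (hpos d hd).2 (hpos e he).2 hco
      have h3 := mul_le_mul_of_nonneg_left this (show 0 ≤ |γ d| * |γ e| by positivity)
      have h4 : |γ d| * |γ e| * (h:ℝ) = h*|γ d| * |γ e| := by ring
      rw [h4] at h3
      exact h3.trans (le_add_of_nonneg_right extra)
    · have hdP : d ∈ P ∧ e ∈ P := by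
        constructor
        · rcases mem_insert.1 hd with rfl | hx
          · exact absurd (Nat.coprime_one_left e) hco
          · exact hx
        · rcases mem_insert.1 he with rfl | hx
          · exact absurd (Nat.coprime_one_right d) hco
          · exact hx
      have hdp := (hP d hdP.1)
      have hep := (hP e hdP.2)
      have hde : d = e := by
        by_contra hne
        exact hco ((Nat.coprime_primes hdp.1 hep.1).2 hne)
      subst hde
      have hN0 : N d d = 0 := by
        rw [hN]; simp only
        rw [Nat.cast_eq_zero, Finset.card_eq_zero, Finset.filter_eq_empty_iff]
        rintro n _ ⟨_, a, b⟩
        have : d ∣ r := (Nat.dvd_add_right a).1 b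
        have := Nat.le_of_dvd hr this
        omega
      have hd1 : d ≠ 1 := hdp.1.one_lt.ne'
      rw [hN0, if_pos rfl, if_neg hd1, zero_sub, abs_neg]
      have hdY := hPY d hdP.1
      have hd0 : (0:ℝ) < d := by exact_mod_cast hdp.1.pos
      have hg : |γ d| = 1/W := by
        rw [hγ]; simp only; rw [if_neg hd1, abs_div, abs_neg, abs_one, abs_of_pos hWp]
      have : |γ d| * |γ d| * |rho h*((B:ℝ)-A)/(d*d)| ≤ ((B:ℝ)-A)/W^2/Y*(1/d) := by
        rw [hg, abs_of_nonneg (by positivity)]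
        calc 1/W*(1/W)*(rho h*((B:ℝ)-A)/(d*d)) ≤ 1/W*(1/W)*(1*((B:ℝ)-A)/(Y*d)) := by gcongr
          _ = _ := by field_simp
      refine this.trans (le_add_of_nonneg_left (by positivity))
  refine (abs_sum_le_sum_abs _ _).trans ?_
  refine (sum_le_sum fun d hd => ?_).trans (?_ : ∑ d ∈ Q, ∑ e ∈ Q, (h*|γ d| * |γ e| + (if d = e then (if d = 1 then 0 else ((B:ℝ)-A)/W^2/Y*(1/d)) else 0)) ≤ _)
  · rw [← sum_sub_distrib]
    exact (abs_sum_le_sum_abs _ _).trans (sum_le_sum fun e he => hterm d hd e he)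
  · have f1 : ∑ d ∈ Q, ∑ e ∈ Q, (h*|γ d| * |γ e| : ℝ) = h*(∑ d ∈ Q, |γ d|)^2 := by
      rw [sq, sum_mul_sum, mul_sum]
      refine sum_congr rfl fun d _ => ?_
      rw [mul_sum]; refine sum_congr rfl fun e _ => by ring
    have f2 : ∑ d ∈ Q, |γ d| ≤ 1+200*(P.card:ℝ) := by
      rw [hQ, sum_insert h1]
      have a : |γ 1| = 1 := by rw [hγ]; simp
      have b : ∑ d ∈ P, |γ d| ≤ ∑ d ∈ P, (200:ℝ) := sum_le_sum fun d hd => (hγ0 d).trans (by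
        rw [if_neg (by rintro rfl; exact h1 hd)])
      rw [sum_const, nsmul_eq_mul] at b
      linarith
    have f3 : ∑ d ∈ Q, ∑ e ∈ Q, (if d = e then (if d = 1 then 0 else ((B:ℝ)-A)/W^2/Y*(1/d)) else 0) = ((B:ℝ)-A)/W^2/Y*W := by
      have : ∀ d ∈ Q, ∑ e ∈ Q, (if d = e then (if d = 1 then (0:ℝ) else ((B:ℝ)-A)/W^2/Y*(1/d)) else 0) = (if d = 1 then 0 else ((B:ℝ)-A)/W^2/Y*(1/d)) := by
        intro d hd; rw [sum_ite_eq, if_pos hd]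
      rw [sum_congr rfl this, hQ, sum_insert h1, if_pos rfl, zero_add, hW, mul_sum]
      refine sum_congr rfl fun d hd => ?_
      rw [if_neg (by rintro rfl; exact h1 hd)]
    simp only [sum_add_distrib]
    rw [f1, f3]
    have f4 : 0 ≤ ∑ d ∈ Q, |γ d| := sum_nonneg fun _ _ => abs_nonneg _
    have f5 : ((B:ℝ)-A)/W^2/Y*W ≤ 200*((B:ℝ)-A)/Y := by
      have : ((B:ℝ)-A)/W^2/Y*W = ((B:ℝ)-A)/Y*(1/W) := by field_simp
      rw [this]
      have : 1/W ≤ 200 := by rw [div_le_iff₀ hWp]; linarith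
      calc _ ≤ ((B:ℝ)-A)/Y*200 := by gcongr
        _ = _ := by ring
    gcongr

lemma rel_sum (h N : ℕ) (hh : 0 < h) (s : Finset ℕ) (hs : ∀ m ∈ s, m ≤ N) (f : ℕ → ℕ → ℝ) (hf : ∀ n m, f n m = f m n)
    [∀ n m, Decidable (CRel h n m)] :
    ∑ n ∈ s, ∑ m ∈ s, (if CRel h n m then f n m else 0) = ∑ n ∈ s.filter (fun n => n.Coprime h), f n n
      + 2 * ∑ j ∈ Icc 1 N, ∑ n ∈ s.filter (fun n => n.Coprime h ∧ n+j*h ∈ s), f n (n+j*h) := by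
  classical
  set F : ℕ → ℕ → ℝ := fun n m => if CRel h n m then f n m else 0 with hF
  have hFs : ∀ n m, F n m = F m n := by
    intro n m; rw [hF]; simp only [CRel_comm (n := n) (m := m), hf n m]
  have e1 : ∀ n ∈ s, ∑ m ∈ s, F n m = F n n + ∑ m ∈ s, (if n < m then F n m else 0) + ∑ m ∈ s, (if m < n then F n m else 0) := by
    intro n hn
    have : F n n = ∑ m ∈ s, if n = m then F n m else 0 := by rw [sum_ite_eq, if_pos hn]
    rw [this, ← sum_add_distrib, ← sum_add_distrib]
    refine sum_congr rfl fun m _ => ?_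
    rcases lt_trichotomy n m with h1 | h1 | h1
    · simp [h1, h1.ne, h1.not_gt]
    · simp [h1]
    · simp [h1, h1.ne', h1.not_gt]
  change ∑ n ∈ s, ∑ m ∈ s, F n m = _
  rw [sum_congr rfl e1, sum_add_distrib, sum_add_distrib]
  have e2 : ∑ n ∈ s, ∑ m ∈ s, (if m < n then F n m else 0) = ∑ n ∈ s, ∑ m ∈ s, (if n < m then F n m else 0) := by
    rw [sum_comm]
    refine sum_congr rfl fun m _ => sum_congr rfl fun n _ => ?_
    rw [hFs]
  have e3 : ∑ n ∈ s, F n n = ∑ n ∈ s.filter (fun n => n.Coprime h), f n n := by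
    rw [sum_filter]
    refine sum_congr rfl fun n _ => ?_
    rw [hF]; simp [CRel]
  have e4 : ∑ n ∈ s, ∑ m ∈ s, (if n < m then F n m else 0) = ∑ j ∈ Icc 1 N, ∑ n ∈ s.filter (fun n => n.Coprime h ∧ n+j*h ∈ s), f n (n+j*h) := by
    have : ∀ j ∈ Icc 1 N, ∑ n ∈ s.filter (fun n => n.Coprime h ∧ n+j*h ∈ s), f n (n+j*h) = ∑ n ∈ s, if n.Coprime h ∧ n+j*h ∈ s then f n (n+j*h) else 0 := by
      intro j _; rw [sum_filter]
    rw [sum_congr rfl this, sum_comm (s := Icc 1 N)]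
    refine sum_congr rfl fun n hn => ?_
    have e5 : ∑ m ∈ s, (if n < m then F n m else 0) = ∑ m ∈ s.filter (fun m => n < m ∧ CRel h n m), f n m := by
      rw [hF, sum_filter]
      refine sum_congr rfl fun m _ => ?_
      by_cases a : n < m <;> by_cases b : CRel h n m <;> simp [a, b]
    rw [e5, ← sum_filter]
    symm
    refine sum_bij (fun j _ => n+j*h) ?_ ?_ ?_ ?_
    · intro j hj
      simp only [mem_filter, mem_Icc] at hj ⊢
      refine ⟨hj.2.2, ?_, hj.2.1, by simp⟩
      have : 0 < j*h := Nat.mul_pos hj.1.1 hh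
      omega
    · intro j hj j' hj' hjj
      simp only [Nat.add_left_cancel_iff] at hjj
      exact Nat.eq_of_mul_eq_mul_right hh hjj
    · intro m hm
      simp only [mem_filter] at hm
      have hmod := hm.2.2.mod
      have hd : h ∣ m - n := (Nat.modEq_iff_dvd' hm.2.1.le).1 hmod
      obtain ⟨j, hj⟩ := hd
      have hj0 : 1 ≤ j := by
        rcases Nat.eq_zero_or_pos j with rfl | h0
        · simp at hj; omega
        · exact h0
      have e6 : n+j*h = m := by rw [mul_comm] at hj; omega
      refine ⟨j, ?_, e6⟩
      simp only [mem_filter, mem_Icc]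
      refine ⟨⟨hj0, ?_⟩, hm.2.2.1, by rw [e6]; exact hm.1⟩
      have := hs m hm.1
      have : j ≤ j*h := Nat.le_mul_of_pos_right j hh
      omega
    · intro j _; rfl
  rw [e2, e3, e4]; ring

open Classical in
lemma En_real (h K : ℕ) [NeZero h] (s : Finset ℕ) (a : ℕ → ℝ) :
    En h K s (fun n => (a n:ℂ)) = h.totient * ∑ n ∈ s, ∑ m ∈ s, if CRel h n m then
      a n*a m*fj K (log n - log m) else 0 := by
  have := En_eq h K s (fun n => (a n:ℂ))
  have e : (En h K s (fun n => (a n:ℂ)) : ℂ) = ((h.totient * ∑ n ∈ s, ∑ m ∈ s, if CRel h n m then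
      a n*a m*fj K (log n - log m) else 0 : ℝ):ℂ) := by
    rw [this]; push_cast
    congr 1
    refine sum_congr rfl fun n _ => sum_congr rfl fun m _ => ?_
    split_ifs
    · rw [conj_ofReal]; push_cast; ring
    · rfl
  exact_mod_cast e

lemma fj_lip (K : ℕ) (x y : ℝ) : |fj K x - fj K y| ≤ 2*((K:ℝ)+1)^2*|x-y| := by
  have : ‖(fj K x:ℂ) - fj K y‖ ≤ 2*((K:ℝ)+1)^2*|x-y| := by
    rw [← fj_eq, ← fj_eq, ← sum_sub_distrib]
    refine (norm_sum_le _ _).trans ?_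
    calc _ ≤ ∑ k ∈ Icc (-(K:ℤ)) K, ((K:ℝ)+1)*|x-y| := by
          refine sum_le_sum fun k hk => ?_
          rw [← mul_sub, norm_mul, norm_real, norm_of_nonneg (wt_nonneg K k hk)]
          have h1 : wt K k ≤ 1 := by unfold wt; have : 0 ≤ |(k:ℝ)|/((K:ℝ)+1) := by positivity
                                     linarith
          have h2 : ‖Complex.exp (((k : ℝ)*x : ℝ)*I) - Complex.exp (((k : ℝ)*y : ℝ)*I)‖ ≤ |(k:ℝ)*x - k*y| := ee_sub_le _ _
          have h3 : |(k:ℝ)| ≤ K := by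
            rw [mem_Icc] at hk
            rw [abs_le]; exact ⟨by exact_mod_cast hk.1, by exact_mod_cast hk.2⟩
          have h4 : |(k:ℝ)*x - k*y| ≤ ((K:ℝ)+1)*|x-y| := by
            rw [← mul_sub, abs_mul]; gcongr; linarith
          have h0 := wt_nonneg K k hk
          calc _ ≤ 1*(((K:ℝ)+1)*|x-y|) := mul_le_mul h1 (h2.trans h4) (norm_nonneg _) (by norm_num)
            _ = _ := one_mul _
      _ ≤ _ := by
          rw [sum_const, nsmul_eq_mul, Int.card_Icc]
          have : (((K:ℤ)+1-(-(K:ℤ))).toNat:ℝ) = 2*K+1 := by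
            have : ((K:ℤ)+1-(-(K:ℤ))).toNat = 2*K+1 := by omega
            rw [this]; push_cast; ring
          rw [this]
          have : 0 ≤ |x-y| := abs_nonneg _
          have hK : (0:ℝ) ≤ K := by positivity
          have a : (2*(K:ℝ)+1)*((K:ℝ)+1) ≤ 2*((K:ℝ)+1)^2 := by nlinarith
          calc _ = (2*(K:ℝ)+1)*((K:ℝ)+1)*|x-y| := by ring
            _ ≤ _ := by gcongr
  rw [← Complex.ofReal_sub, norm_real] at this
  exact this

lemma abel_tv (c w : ℕ → ℝ) (A B : ℕ) (hAB : A ≤ B) (D τ H : ℝ) (hτ : 0 ≤ τ)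
    (hw : ∀ m, A < m → |w (m+1) - w m| ≤ τ) (hH : ∀ m, A < m → |w m| ≤ H) (hH0 : 0 ≤ H)
    (hD : ∀ m, A ≤ m → m ≤ B → |∑ n ∈ Ioc A m, c n| ≤ D) :
    |∑ n ∈ Ioc A B, w n*c n| ≤ D*(H+(B-A)*τ) := by
  have hD0 : 0 ≤ D := (abs_nonneg _).trans (hD A le_rfl hAB)
  rcases hAB.eq_or_lt with rfl | hlt
  · simp; positivity
  have key : ∀ m, A+1 ≤ m → m ≤ B →
      |∑ n ∈ Ioc A m, w n*c n - w m * ∑ n ∈ Ioc A m, c n| ≤ D*((m-A)*τ) := by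
    intro m hm
    induction m, hm using Nat.le_induction with
    | base => intro _; simp; positivity
    | succ m hm ih =>
      intro hmB
      have i1 := ih (by omega)
      rw [sum_Ioc_succ_top (by omega), sum_Ioc_succ_top (by omega)]
      set S := ∑ n ∈ Ioc A m, w n*c n
      set C := ∑ n ∈ Ioc A m, c n with hC
      have e : S+w (m+1)*c (m+1) - w (m+1)*(C+c (m+1)) = (S - w m*C) - (w (m+1) - w m)*C := by ring
      rw [e]
      refine (abs_sub _ _).trans ?_
      rw [abs_mul]
      have i2 := hD m (by omega) (by omega)
      have i3 := mul_le_mul (hw m (by omega)) i2 (abs_nonneg _) hτ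
      push_cast
      nlinarith
  have k := key B hlt le_rfl
  have a := hH B hlt
  have b := hD B hAB le_rfl
  have c' := mul_le_mul a b (abs_nonneg _) hH0
  rw [← abs_mul] at c'
  have := abs_add_le (∑ n ∈ Ioc A B, w n*c n - w B * ∑ n ∈ Ioc A B, c n) (w B * ∑ n ∈ Ioc A B, c n)
  rw [sub_add_cancel] at this
  nlinarith

lemma log_step (n r : ℕ) (hn : 0 < n) :
    |(log ((n+1+r:ℕ):ℝ) - log ((n+1:ℕ):ℝ)) - (log ((n+r:ℕ):ℝ) - log (n:ℝ))| ≤ (r+1)/(n:ℝ)^2 := by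
  have hn0 : (0:ℝ) < n := by exact_mod_cast hn
  have gen : ∀ t : ℝ, 0 < t → 1/(t+1) ≤ log (t+1) - log t ∧ log (t+1) - log t ≤ 1/t := by
    intro t ht
    rw [← log_div (by positivity) ht.ne']
    constructor
    · have := Real.one_sub_inv_le_log_of_pos (show 0 < (t+1)/t by positivity)
      have e : 1 - ((t+1)/t)⁻¹ = 1/(t+1) := by field_simp; ring
      rw [e] at this; exact this
    · have := log_le_sub_one_of_pos (show 0 < (t+1)/t by positivity)
      have e : (t+1)/t - 1 = 1/t := by field_simp; ring
      rw [e] at this; exact this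
  have g1 := gen n hn0
  have g2 := gen ((n:ℝ)+r) (by positivity)
  have e1 : ((n+1+r:ℕ):ℝ) = (n:ℝ)+r+1 := by push_cast; ring
  have e2 : ((n+r:ℕ):ℝ) = (n:ℝ)+r := by push_cast; ring
  rw [e1, e2]; push_cast
  have k1 : 1/(n:ℝ) - 1/((n:ℝ)+r+1) ≤ (r+1)/(n:ℝ)^2 := by
    rw [div_sub_div _ _ (by positivity) (by positivity), div_le_div_iff₀ (by positivity) (by positivity)]
    have hr : (0:ℝ) ≤ r := by positivity
    have a : 1*((n:ℝ)+r+1) - n*1 = r+1 := by ring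
    rw [a]
    have : (n:ℝ)^2 ≤ n*((n:ℝ)+r+1) := by nlinarith
    gcongr
  have k2 : 1/((n:ℝ)+r) ≤ 1/n := by gcongr; linarith [show (0:ℝ) ≤ r by positivity]
  have k3 : 1/((n:ℝ)+r) - 1/((n:ℝ)+1) ≤ (r+1)/(n:ℝ)^2 := by
    have : 1/(n:ℝ) - 1/((n:ℝ)+1) ≤ 1/(n:ℝ) - 1/((n:ℝ)+r+1) := by
      have : 1/((n:ℝ)+r+1) ≤ 1/((n:ℝ)+1) := by gcongr; linarith [show (0:ℝ) ≤ r by positivity]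
      linarith
    linarith
  rw [abs_le]; constructor <;> linarith [g1.1, g1.2, g2.1, g2.2]

lemma fj_dist (K n r : ℕ) (X : ℝ) (hX : 0 < X) (hn : X < n) (hn2 : ((n+r:ℕ):ℝ) ≤ 2*X) (hr : 0 < r) :
    fj K (log n - log (n+r:ℕ)) ≤ 40*X^2/((K+1)*(r:ℝ)^2) := by
  have hn0 : (0:ℝ) < n := by linarith
  have hr0 : (0:ℝ) < r := by exact_mod_cast hr
  push_cast at hn2 ⊢
  set x := log n - log ((n:ℝ)+r) with hx
  have h1 : x ≤ -((r:ℝ)/(2*X)) := by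
    have := log_le_sub_one_of_pos (show 0 < (n:ℝ)/(n+r) by positivity)
    rw [log_div (by positivity) (by positivity), ← hx] at this
    have e : (n:ℝ)/(n+r) - 1 = -(r/(n+r)) := by field_simp; ring
    rw [e] at this
    have : (r:ℝ)/(2*X) ≤ r/(n+r) := by gcongr
    linarith
  have h2 : -1 ≤ x := by
    have := Real.one_sub_inv_le_log_of_pos (show 0 < (n:ℝ)/(n+r) by positivity)
    rw [log_div (by positivity) (by positivity), ← hx] at this
    have e : ((n:ℝ)/(n+r))⁻¹ ≤ 2 := by rw [inv_div, div_le_iff₀ hn0]; linarith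
    linarith
  have h3 : 0 < (r:ℝ)/(2*X) := by positivity
  have hpi := pi_gt_three
  have h4 := fj_le' K x (by rw [abs_le]; constructor <;> linarith) (by linarith)
  refine h4.trans ?_
  have h5 : ((r:ℝ)/(2*X))^2 ≤ x^2 := by nlinarith
  have h6 : π^2 ≤ 10 := by nlinarith [Real.pi_lt_d2]
  calc π^2/((K+1)*x^2) ≤ 10/((K+1)*((r:ℝ)/(2*X))^2) := by gcongr
    _ = _ := by field_simp; ring

open Classical in
noncomputable def badS (h : ℕ) (X : ℝ) : Finset ℕ := (Icc 1 ⌊2*X⌋₊).filter (fun n => liouville n ≠ liouville (n+h))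

open Classical in
lemma bad_j (h j : ℕ) (X Y : ℝ) (hX : 0 ≤ X) (hXY : X ≤ Y) (hY : Y ≤ 2*X) :
    (((sg X Y).filter (fun n => n+j*h ∈ sg X Y ∧ liouville n ≠ liouville (n+j*h))).card : ℝ) ≤ j*(badS h X).card := by
  have hsub : (sg X Y).filter (fun n => n+j*h ∈ sg X Y ∧ liouville n ≠ liouville (n+j*h)) ⊆
      (range j).biUnion (fun i => (badS h X).image (fun m => m - i*h)) := by
    intro n hn
    simp only [mem_filter] at hn
    obtain ⟨h1, h2, h3⟩ := hn
    rw [mem_sg hX (hX.trans hXY)] at h1 h2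
    have : ∃ i < j, liouville (n+i*h) ≠ liouville (n+(i+1)*h) := by
      by_contra hc
      push Not at hc
      have : ∀ i ≤ j, liouville n = liouville (n+i*h) := by
        intro i
        induction i with
        | zero => intro _; simp
        | succ i ih => intro hi; rw [ih (by omega), hc i (by omega)]
      exact h3 (this j le_rfl)
    obtain ⟨i, hi, hne⟩ := this
    simp only [Finset.mem_biUnion, mem_range, mem_image]
    refine ⟨i, hi, n+i*h, ?_, by omega⟩
    unfold badS
    simp only [mem_filter, mem_Icc]
    have hn0 : 0 < n := by
      have : (0:ℝ) < n := by linarith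
      exact_mod_cast this
    refine ⟨⟨by omega, Nat.le_floor ?_⟩, by rw [add_mul, one_mul, ← add_assoc] at hne; exact hne⟩
    have : n+i*h ≤ n+j*h := by gcongr
    have : ((n+i*h:ℕ):ℝ) ≤ ((n+j*h:ℕ):ℝ) := by exact_mod_cast this
    linarith
  have := (card_le_card hsub).trans Finset.card_biUnion_le
  have h2 : ∑ i ∈ range j, ((badS h X).image (fun m => m - i*h)).card ≤ ∑ i ∈ range j, (badS h X).card :=
    sum_le_sum fun i _ => Finset.card_image_le
  rw [sum_const, card_range, smul_eq_mul] at h2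
  exact_mod_cast this.trans h2

open Classical in
lemma quad_bound (h K J : ℕ) [NeZero h] (hJ : 1 ≤ J) (X Y : ℝ) (hX : 1 ≤ X) (hXY : X ≤ Y) (hY : Y ≤ 2*X)
    (g : ℕ → ℕ → ℝ) (hg : ∀ n m, g n m = g m n) (G : ℝ) (hG : ∀ n ∈ sg X Y, ∀ m ∈ sg X Y, |g n m| ≤ G) (hG0 : 0 ≤ G) :
    |∑ n ∈ sg X Y, ∑ m ∈ sg X Y, if CRel h n m then g n m*fj K (log n - log m) else 0| ≤
      (K+1) * ∑ n ∈ sg X Y, |g n n|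
      + 2 * ∑ j ∈ Icc 1 J, |∑ n ∈ (sg X Y).filter (fun n => n.Coprime h ∧ n+j*h ∈ sg X Y),
          g n (n+j*h)*fj K (log n - log (n+j*h:ℕ))|
      + 160*G*X^3/((K+1)*(h:ℝ)^2*J) := by
  set s := sg X Y with hs
  have hX0 : 0 < X := by linarith
  have hh := Nat.pos_of_neZero h
  have hh0 : (0:ℝ) < h := by exact_mod_cast hh
  have hms : ∀ n ∈ s, X < n ∧ (n:ℝ) ≤ Y := fun n hn => (mem_sg hX0.le (hX0.le.trans hXY)).1 hn
  rw [rel_sum h (⌊Y⌋₊) hh s (fun m hm => Nat.le_floor (hms m hm).2) (fun n m => g n m*fj K (log n - log m))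
    (by intro n m; rw [hg n m, ← fj_neg, neg_sub])]
  set T : ℕ → ℝ := fun j => ∑ n ∈ s.filter (fun n => n.Coprime h ∧ n+j*h ∈ s), g n (n+j*h)*fj K (log n - log (n+j*h:ℕ)) with hT
  have hd : |∑ n ∈ s.filter (fun n => n.Coprime h), g n n*fj K (log n - log n)| ≤ (K+1) * ∑ n ∈ s, |g n n| := by
    rw [mul_sum]
    refine (abs_sum_le_sum_abs _ _).trans ((sum_le_sum_of_subset_of_nonneg (filter_subset _ _) (fun _ _ _ => abs_nonneg _)).trans
      (sum_le_sum fun n _ => ?_))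
    rw [abs_mul, mul_comm]
    gcongr
    rw [abs_of_nonneg (fj_nonneg _ _)]; exact fj_le _ _
  have hcard : (s.card:ℝ) ≤ 2*X := by have := card_sg_le hX0.le hXY; rw [← hs] at this; linarith
  have hTj : ∀ j, 1 ≤ j → |T j| ≤ 80*G*X^3/((K+1)*(h:ℝ)^2)*((j:ℝ)^2)⁻¹ := by
    intro j hj
    have hj0 : (0:ℝ) < j := by exact_mod_cast hj
    refine (abs_sum_le_sum_abs _ _).trans ?_
    calc _ ≤ ∑ n ∈ s.filter (fun n => n.Coprime h ∧ n+j*h ∈ s), G*(40*X^2/((K+1)*((j*h:ℕ):ℝ)^2)) := by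
          refine sum_le_sum fun n hn => ?_
          simp only [mem_filter] at hn
          rw [abs_mul, abs_of_nonneg (fj_nonneg _ _)]
          have := fj_dist K n (j*h) X hX0 (hms n hn.1).1 ((hms _ hn.2.2).2.trans hY) (Nat.mul_pos hj hh)
          exact mul_le_mul (hG n hn.1 _ hn.2.2) this (fj_nonneg _ _) hG0
      _ ≤ 2*X*(G*(40*X^2/((K+1)*((j*h:ℕ):ℝ)^2))) := by
          rw [sum_const, nsmul_eq_mul]
          have : ((s.filter (fun n => n.Coprime h ∧ n+j*h ∈ s)).card:ℝ) ≤ s.card := by exact_mod_cast card_filter_le _ _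
          gcongr; linarith
      _ = _ := by push_cast; field_simp; ring
  have htail : ∀ M, ∑ j ∈ Icc 1 M, |T j| ≤ ∑ j ∈ Icc 1 J, |T j| + 80*G*X^3/((K+1)*(h:ℝ)^2*J) := by
    intro M
    have hJ0 : (0:ℝ) < J := by exact_mod_cast hJ
    rcases le_total M J with hMJ | hMJ
    · have := sum_le_sum_of_subset_of_nonneg (Finset.Icc_subset_Icc_right hMJ) (f := fun j => |T j|) (s := Icc 1 M) (fun _ _ _ => abs_nonneg _)
      have h0 : 0 ≤ 80*G*X^3/((K+1)*(h:ℝ)^2*J) := by positivity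
      linarith
    · have e : Icc 1 M = Icc 1 J ∪ Ioc J M := by ext x; simp; omega
      rw [e, sum_union (by rw [disjoint_left]; intro x; simp; omega)]
      gcongr
      calc _ ≤ ∑ j ∈ Ioc J M, 80*G*X^3/((K+1)*(h:ℝ)^2)*((j:ℝ)^2)⁻¹ :=
            sum_le_sum fun j hj => hTj j (by rw [mem_Ioc] at hj; omega)
        _ ≤ 80*G*X^3/((K+1)*(h:ℝ)^2)*(J:ℝ)⁻¹ := by
            rw [← mul_sum]
            have := sum_Ioc_inv_sq_le_sub (α := ℝ) (show J ≠ 0 by omega) hMJ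
            have h0 : (0:ℝ) ≤ (M:ℝ)⁻¹ := by positivity
            gcongr; linarith
        _ = _ := by field_simp
  have ht := htail ⌊Y⌋₊
  have h2 := abs_sum_le_sum_abs T (Icc 1 ⌊Y⌋₊)
  refine (abs_add_le _ _).trans ?_
  rw [abs_mul, abs_of_pos (show (0:ℝ) < 2 by norm_num)]
  have e : 160*G*X^3/((K+1)*(h:ℝ)^2*J) = 2*(80*G*X^3/((K+1)*(h:ℝ)^2*J)) := by ring
  rw [e]
  linarith

lemma En_add_le (h K : ℕ) [NeZero h] (s : Finset ℕ) (a b c : ℕ → ℂ) (habc : ∀ n ∈ s, a n = b n+c n) :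
    En h K s a ≤ 2*En h K s b+2*En h K s c := by
  unfold En
  rw [mul_sum, mul_sum, ← sum_add_distrib]
  refine sum_le_sum fun ξ hξ => ?_
  have hw : 0 ≤ wt K ξ.2 := wt_nonneg K ξ.2 (by unfold Xi at hξ; exact (mem_product.1 hξ).2)
  have e : pol s a ξ = pol s b ξ + pol s c ξ := by
    unfold pol; rw [← sum_add_distrib]
    exact sum_congr rfl fun n hn => by rw [habc n hn, add_mul]
  rw [e]
  have h1 := norm_add_le (pol s b ξ) (pol s c ξ)
  have h2 : ‖pol s b ξ + pol s c ξ‖^2 ≤ 2*‖pol s b ξ‖^2+2*‖pol s c ξ‖^2 := by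
    nlinarith [sq_nonneg (‖pol s b ξ‖ - ‖pol s c ξ‖), norm_nonneg (pol s b ξ + pol s c ξ)]
  nlinarith

open Classical in
lemma lam_diff (h K j : ℕ) (X Y G : ℝ) (hX : 0 ≤ X) (hXY : X ≤ Y) (hY : Y ≤ 2*X) (u : ℕ → ℝ) (hu : ∀ n ∈ sg X Y, |u n| ≤ G) (hG : 0 ≤ G) :
    |∑ n ∈ (sg X Y).filter (fun n => n.Coprime h ∧ n+j*h ∈ sg X Y),
      (liouville n*liouville (n+j*h) - 1)*(u n*u (n+j*h))*fj K (log n - log (n+j*h:ℕ))| ≤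
      2*G^2*(K+1)*(j*(badS h X).card) := by
  have hb := bad_j h j X Y hX hXY hY
  set s := sg X Y with hs
  set b := s.filter (fun n => n+j*h ∈ s ∧ liouville n ≠ liouville (n+j*h)) with hbd
  calc _ ≤ ∑ n ∈ b, 2*G^2*((K:ℝ)+1) := by
        refine (abs_sum_le_sum_abs _ _).trans ?_
        rw [hbd, sum_filter, sum_filter]
        refine sum_le_sum fun n hn => ?_
        by_cases hl : liouville n = liouville (n+j*h)
        · rw [hl, lio_sq]; simp
        by_cases hm : n+j*h ∈ s
        · rw [if_pos (c := n+j*h ∈ s ∧ _) ⟨hm, hl⟩]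
          split_ifs
          · rw [abs_mul, abs_mul, abs_mul, abs_of_nonneg (fj_nonneg _ _)]
            have h1 : |liouville n*liouville (n+j*h) - 1| ≤ 2 := by
              have := abs_sub (liouville n*liouville (n+j*h)) 1
              rw [abs_mul, lio_abs, lio_abs] at this; norm_num at this; linarith
            have h2 := mul_le_mul (hu n hn) (hu _ hm) (abs_nonneg _) hG
            calc _ ≤ 2*(G*G)*((K:ℝ)+1) := by gcongr; exacts [fj_nonneg _ _, fj_le _ _]
              _ = _ := by ring
          · positivity
        · simp [hm]
    _ = 2*G^2*(K+1)*b.card := by rw [sum_const, nsmul_eq_mul]; ring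
    _ ≤ _ := by gcongr

lemma om_le_two (P : Finset ℕ) (X : ℝ) (hX : 1 < X) (hX2 : 2*X^(1:ℝ) < X^(1.2:ℝ)) (hP : ∀ p ∈ P, p.Prime ∧ X^(0.4:ℝ) ≤ p) (n : ℕ) (hn : 0 < n)
    (hn2 : (n:ℝ) ≤ 2*X) : om P n ≤ 2 := by
  have e : om P n = ((P.filter (fun p => p ∣ n)).card:ℝ) := by unfold om; simp
  rw [e]
  by_contra hc
  push Not at hc
  have hc' : 3 ≤ (P.filter (fun p => p ∣ n)).card := by
    have : 2 < (P.filter (fun p => p ∣ n)).card := by exact_mod_cast hc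
    omega
  obtain ⟨t, ht, htc⟩ := Finset.exists_subset_card_eq hc'
  have hmem : ∀ p ∈ t, p ∈ P ∧ p ∣ n := fun p hp => by have := ht hp; simpa using this
  have hd : ∏ p ∈ t, p ∣ n := Finset.prod_primes_dvd n (fun p hp => (hP p (hmem p hp).1).1.prime) (fun p hp => (hmem p hp).2)
  have h1 : ((∏ p ∈ t, p : ℕ):ℝ) ≤ n := by exact_mod_cast Nat.le_of_dvd hn hd
  have h2 : (X^(0.4:ℝ))^3 ≤ ((∏ p ∈ t, p : ℕ):ℝ) := by
    push_cast
    rw [← htc, ← Finset.prod_const]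
    exact Finset.prod_le_prod (fun _ _ => by positivity) fun p hp => (hP p (hmem p hp).1).2
  rw [← rpow_natCast, ← rpow_mul (by linarith)] at h2
  push_cast at h1
  norm_num at h2 hX2
  linarith

lemma PP_ge {h V : ℕ} (hV : 1 ≤ V) {X : ℝ} (hX : 1 < X) {p : ℕ} (hp : p ∈ PP h V (w0 V X) (w1 V X)) :
    p.Prime ∧ ¬ p ∣ h ∧ X^(0.4:ℝ) ≤ p ∧ (p:ℝ) ≤ X^(0.45:ℝ) := by
  rw [mem_PP] at hp
  have := w_range hV hX (le_refl (w0 V X))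
  exact ⟨hp.2.1, hp.2.2, by norm_num at this ⊢; linarith [hp.1.1], hp.1.2.trans (w_range' hV hX le_rfl)⟩

open Classical in
lemma corr_sum (h V J : ℕ) [NeZero h] (hV : 1 ≤ V) : ∀ᶠ X : ℝ in atTop, ∀ K : ℕ, ∀ Y : ℝ, X ≤ Y → Y ≤ 2*X → (K:ℝ)+1 ≤ 2*X →
    ∀ j ∈ Icc 1 J, |∑ n ∈ (sg X Y).filter (fun n => n.Coprime h ∧ n+j*h ∈ sg X Y),
      ((1 - om (PP h V (w0 V X) (w1 V X)) n/WW h V X)*(1 - om (PP h V (w0 V X) (w1 V X)) (n+j*h)/WW h V X))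
        * fj K (log n - log (n+j*h:ℕ))| ≤ X^(1.99:ℝ) := by
  have hh := Nat.pos_of_neZero h
  filter_upwards [eventually_gt_atTop 1, ev_pow (J*h+1) 0 0.4 (by norm_num), WW_lower h V hh hV,
    ev_pow ((40601*h)*(10+8*J*h)) 1.9 1.99 (by norm_num)] with X hX1 hX2 hW hX3 K Y hXY hY hK j hj
  rw [mem_Icc] at hj
  have hX0 : 0 < X := by linarith
  set P := PP h V (w0 V X) (w1 V X) with hP
  have hPm : ∀ p ∈ P, _ := fun p hp => PP_ge hV hX1 hp
  set W := WW h V X with hWd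
  set r := j*h with hr
  have hr0 : 0 < r := Nat.mul_pos hj.1 hh
  have hrJ : (r:ℝ) ≤ J*h := by rw [hr]; push_cast; gcongr; exact hj.2
  have hr1 : (1:ℝ) ≤ r := by exact_mod_cast hr0
  rw [rpow_zero, mul_one] at hX2
  have hh1 : (1:ℝ) ≤ h := by exact_mod_cast hh
  have hX9 : 1 ≤ X^(0.9:ℝ) := one_le_rpow hX1.le (by norm_num)
  rcases lt_or_ge ⌊Y⌋₊ (⌊X⌋₊+r) with hlt | hge
  · rw [sum_eq_zero]
    · rw [abs_zero]; positivity
    · intro n hn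
      unfold sg at hn
      simp only [mem_filter, mem_Ioc] at hn
      omega
  set A := ⌊X⌋₊ with hA
  set B := ⌊Y⌋₊ - r with hB
  have hAB : A ≤ B := by omega
  set c : ℕ → ℝ := fun n => if n.Coprime h then (1 - om P n/W)*(1 - om P (n+r)/W) else 0 with hc
  set w : ℕ → ℝ := fun n => fj K (log n - log (n+r:ℕ)) with hw
  have e : ∑ n ∈ (sg X Y).filter (fun n => n.Coprime h ∧ n+r ∈ sg X Y),
      ((1 - om P n/W)*(1 - om P (n+r)/W))*fj K (log n - log (n+r:ℕ)) = ∑ n ∈ Ioc A B, w n*c n := by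
    have : (sg X Y).filter (fun n => n.Coprime h ∧ n+r ∈ sg X Y) = (Ioc A B).filter (fun n => n.Coprime h) := by
      ext n; unfold sg; simp only [mem_filter, mem_Ioc]
      constructor
      · rintro ⟨a, b, c⟩; exact ⟨by omega, b⟩
      · rintro ⟨a, b⟩; exact ⟨by omega, b, by omega⟩
    rw [this, sum_filter]
    refine sum_congr rfl fun n _ => ?_
    rw [hw, hc]; dsimp only
    split_ifs
    · ring
    · simp
  rw [e]
  have hBA : (B:ℝ) - A ≤ X := by
    have h1 := Nat.floor_le (hX0.le.trans hXY)
    have h2 := Nat.lt_floor_add_one X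
    have h3 : (B:ℝ)+r = ⌊Y⌋₊ := by exact_mod_cast (by omega : B+r = ⌊Y⌋₊)
    linarith
  have hPc : (P.card:ℝ) ≤ X^(0.45:ℝ) := by
    have : P ⊆ Icc 1 ⌊X^(0.45:ℝ)⌋₊ := by
      intro p hp
      rw [mem_Icc]
      exact ⟨(hPm p hp).1.pos, Nat.le_floor (hPm p hp).2.2.2⟩
    have := card_le_card this
    rw [Nat.card_Icc, Nat.add_sub_cancel] at this
    exact (Nat.cast_le.2 this).trans (Nat.floor_le (by positivity))
  have habel := abel_tv c w A B hAB (40601*h*X^(0.9:ℝ)) (8*(r+1)) (2*X) (by positivity) ?_ ?_ (by linarith) ?_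
  · refine habel.trans ?_
    calc 40601*h*X^(0.9:ℝ)*(2*X+(B-A)*(8*(r+1))) ≤ 40601*h*X^(0.9:ℝ)*(2*X+X*(8*(J*h+1))) := by gcongr
      _ = (40601*h)*(10+8*J*h)*(X^(0.9:ℝ)*X) := by ring
      _ = (40601*h)*(10+8*J*h)*X^(1.9:ℝ) := by
          rw [← Real.rpow_add_one hX0.ne']; norm_num
      _ ≤ _ := hX3
  · intro m hm
    have hm1 : X < m := by rw [hA] at hm; exact (Nat.floor_lt hX0.le).1 hm
    have hm0 : 0 < m := by omega
    have h1 := fj_lip K (log ((m+1:ℕ):ℝ) - log ((m+1+r:ℕ):ℝ)) (log m - log (m+r:ℕ))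
    have h2 := log_step m r hm0
    rw [show (log ((m+1:ℕ):ℝ) - log ((m+1+r:ℕ):ℝ)) - (log m - log (m+r:ℕ)) =
      -((log ((m+1+r:ℕ):ℝ) - log ((m+1:ℕ):ℝ)) - (log ((m+r:ℕ):ℝ) - log (m:ℝ))) by ring, abs_neg] at h1
    refine h1.trans ?_
    calc 2*((K:ℝ)+1)^2*_ ≤ 2*(2*X)^2*((r+1)/X^2) := by
          refine mul_le_mul (by gcongr) (h2.trans ?_) (abs_nonneg _) (by positivity)
          gcongr
      _ = _ := by field_simp; ring
  · intro m _
    rw [hw]; dsimp only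
    rw [abs_of_nonneg (fj_nonneg _ _)]
    exact (fj_le _ _).trans hK
  · intro m hm1 hm2
    rw [hc, ← sum_filter]
    refine (corr_bound A m h r P hm1 hh hr0 (fun p hp => ⟨(hPm p hp).1, (hPm p hp).2.1, ?_⟩) (X^(0.4:ℝ)) (by positivity)
      (fun p hp => (hPm p hp).2.2.1) W rfl hW).trans ?_
    · have := (hPm p hp).2.2.1
      exact_mod_cast (by linarith : (r:ℝ) < p)
    · have hmA : (m:ℝ) - A ≤ X := by have : (m:ℝ) ≤ B := by exact_mod_cast hm2
                                     linarith
      have h1 : 1 ≤ X^(0.45:ℝ) := one_le_rpow hX1.le (by norm_num)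
      have e1 : X^(0.45:ℝ)*X^(0.45:ℝ) = X^(0.9:ℝ) := by rw [← rpow_add hX0]; norm_num
      have e2 : X/X^(0.4:ℝ) ≤ X^(0.9:ℝ) := by
        rw [div_le_iff₀ (by positivity), ← rpow_add hX0]
        calc X = X^(1:ℝ) := (rpow_one X).symm
          _ ≤ _ := Real.rpow_le_rpow_of_exponent_le hX1.le (by norm_num)
      calc _ ≤ h*(X^(0.45:ℝ)+200*X^(0.45:ℝ))^2+200*X/X^(0.4:ℝ) := by gcongr
        _ = 40401*h*X^(0.9:ℝ)+200*(X/X^(0.4:ℝ)) := by rw [← e1]; ring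
        _ ≤ 40401*h*X^(0.9:ℝ)+200*(h*X^(0.9:ℝ)) := by gcongr; nlinarith
        _ = _ := by ring

lemma D1a (ε : ℝ) (hε : 0 < ε) : ∃ L0 : ℝ, 2 ≤ L0 ∧ ∀ L ≥ L0, ∃ η : ℝ, 0 < η ∧ ∀ (h : ℕ) (_ : NeZero h) (V : ℕ), 1 ≤ V → ∀ᶠ X : ℝ in atTop,
    ∀ K : ℕ, ∀ Y : ℝ, X ≤ Y → Y ≤ 2*X → X/(L*h) ≤ (K:ℝ)+1 → (K:ℝ)+1 ≤ 2*X/(L*h) → ((badS h X).card:ℝ) ≤ η*X →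
    (∀ n ∈ sg X Y, |1 - om (PP h V (w0 V X) (w1 V X)) n/WW h V X| ≤ 401) ∧
    En h K (sg X Y) (fun n => ((liouville n*(1 - om (PP h V (w0 V X) (w1 V X)) n/WW h V X) : ℝ):ℂ)) ≤ ε*rho h*X^2 := by
  classical
  set Q : ℝ := 401^2 with hQ
  have hQ0 : 0 < Q := by rw [hQ]; norm_num
  refine ⟨max 2 (16*Q/ε), le_max_left _ _, fun L hL => ?_⟩
  have hL2 : 2 ≤ L := (le_max_left _ _).trans hL
  have hL0 : 0 < L := by linarith
  have hL1 : 4*Q/L ≤ ε/4 := by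
    have := (le_max_right _ _).trans hL
    rw [div_le_iff₀ hε] at this
    rw [div_le_iff₀ hL0]; linarith
  set J := ⌈640*Q*L/ε⌉₊+1 with hJ
  have hJ0 : (0:ℝ) < J := by rw [hJ]; positivity
  have hJ1 : 160*Q*L/J ≤ ε/4 := by
    have : 640*Q*L/ε ≤ J := by rw [hJ]; push_cast; linarith [Nat.le_ceil (640*Q*L/ε)]
    rw [div_le_iff₀ hε] at this
    rw [div_le_iff₀ hJ0]; linarith
  refine ⟨ε/(32*Q*J^2), by positivity, fun h _ V hV => ?_⟩
  set η := ε/(32*Q*(J:ℝ)^2) with hη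
  have hη0 : 0 < η := by rw [hη]; positivity
  have hη1 : 8*J^2*Q*η/L ≤ ε/4 := by
    have : 8*J^2*Q*η = ε/4 := by rw [hη]; field_simp; norm_num
    rw [this]; exact div_le_self (by positivity) (by linarith)
  have hh := Nat.pos_of_neZero h
  have hh1 : (1:ℝ) ≤ h := by exact_mod_cast hh
  have hρ := rho_pos h
  filter_upwards [eventually_gt_atTop 1, corr_sum h V J hV, WW_lower h V hh hV, ev_pow 3 1 1.2 (by norm_num),
    ev_pow (2*J*h*4/ε) 1.99 2 (by norm_num)] with X hX1 hcs hW hX2 hX3 K Y hXY hY hK1 hK2 hbad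
  have hX0 : 0 < X := by linarith
  set P := PP h V (w0 V X) (w1 V X) with hP
  set W := WW h V X with hWd
  have hW0 : 0 < W := by linarith
  have hK0 : (0:ℝ) < (K:ℝ)+1 := by positivity
  have hu : ∀ n ∈ sg X Y, |1 - om P n/W| ≤ 401 := by
    intro n hn
    rw [mem_sg hX0.le (hX0.le.trans hXY)] at hn
    have hn0 : 0 < n := by
      have : (0:ℝ) < n := by linarith
      exact_mod_cast this
    have h1 := om_le_two P X hX1 (by rw [rpow_one] at *; linarith) (fun p hp => ⟨(PP_ge hV hX1 hp).1, (PP_ge hV hX1 hp).2.2.1⟩) n hn0 (hn.2.trans hY)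
    have h0 := om_nonneg P n
    have h2 : om P n/W ≤ 400 := by rw [div_le_iff₀ hW0]; linarith
    have h3 : 0 ≤ om P n/W := by positivity
    rw [abs_le]; constructor <;> linarith
  refine ⟨hu, ?_⟩
  set u : ℕ → ℝ := fun n => 1 - om P n/W with hud
  rw [En_real]
  have hg : ∀ n ∈ sg X Y, ∀ m ∈ sg X Y, |(liouville n*u n)*(liouville m*u m)| ≤ Q := by
    intro n hn m hm
    rw [abs_mul, abs_mul, abs_mul, lio_abs, lio_abs, one_mul, one_mul, hQ, sq]
    exact mul_le_mul (hu n hn) (hu m hm) (abs_nonneg _) (by norm_num)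
  have hq := quad_bound h K J (by omega) X Y hX1.le hXY hY (fun n m => (liouville n*u n)*(liouville m*u m)) (fun n m => mul_comm _ _) Q hg hQ0.le
  have hK2' : (K:ℝ)+1 ≤ 2*X := hK2.trans (div_le_self (by positivity) (by nlinarith))
  have hj : ∀ j ∈ Icc 1 J, |∑ n ∈ (sg X Y).filter (fun n => n.Coprime h ∧ n+j*h ∈ sg X Y),
      (liouville n*u n)*(liouville (n+j*h)*u (n+j*h))*fj K (log n - log (n+j*h:ℕ))| ≤ 2*Q*(K+1)*(J*(η*X))+X^(1.99:ℝ) := by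
    intro j hj
    have a := lam_diff h K j X Y 401 hX0.le hXY hY u hu (by norm_num)
    have b := hcs K Y hXY hY hK2' j hj
    have c := abs_add_le (∑ n ∈ (sg X Y).filter (fun n => n.Coprime h ∧ n+j*h ∈ sg X Y),
      (liouville n*liouville (n+j*h) - 1)*(u n*u (n+j*h))*fj K (log n - log (n+j*h:ℕ)))
      (∑ n ∈ (sg X Y).filter (fun n => n.Coprime h ∧ n+j*h ∈ sg X Y), (u n*u (n+j*h))*fj K (log n - log (n+j*h:ℕ)))
    rw [← sum_add_distrib] at c
    have e : ∀ n, (liouville n*u n)*(liouville (n+j*h)*u (n+j*h))*fj K (log n - log (n+j*h:ℕ)) =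
      (liouville n*liouville (n+j*h) - 1)*(u n*u (n+j*h))*fj K (log n - log (n+j*h:ℕ))+(u n*u (n+j*h))*fj K (log n - log (n+j*h:ℕ)) := by
      intro n; ring
    simp only [e]
    have d : 2*401^2*((K:ℝ)+1)*(j*(badS h X).card) ≤ 2*Q*(K+1)*(J*(η*X)) := by
      rw [mem_Icc] at hj
      rw [hQ]; gcongr; exact hj.2
    linarith
  have hs1 := sum_le_sum hj
  rw [sum_const, Nat.card_Icc, Nat.add_sub_cancel, nsmul_eq_mul] at hs1
  have hs2 : ∑ n ∈ sg X Y, |(liouville n*u n)*(liouville n*u n)| ≤ 2*X*Q := by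
    refine (sum_le_sum fun n hn => hg n hn n hn).trans ?_
    rw [sum_const, nsmul_eq_mul]
    gcongr
    linarith [card_sg_le hX0.le hXY]
  have hinv : 160*Q*X^3/((K+1)*(h:ℝ)^2*J) ≤ 160*Q*L/J*(X^2/h) := by
    calc _ ≤ 160*Q*X^3/(X/(L*h)*(h:ℝ)^2*J) := by
          refine div_le_div_of_nonneg_left (by positivity) (by positivity) (by gcongr)
      _ = _ := by field_simp
  set S := ∑ n ∈ sg X Y, ∑ m ∈ sg X Y, if CRel h n m then (liouville n*u n)*(liouville m*u m)*fj K (log n - log m) else 0 with hS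
  have hSb : S ≤ ε*X^2/h := by
    refine (le_abs_self _).trans (hq.trans ?_)
    have t1 : ((K:ℝ)+1)*∑ n ∈ sg X Y, |(liouville n*u n)*(liouville n*u n)| ≤ 4*Q/L*(X^2/h) := by
      calc _ ≤ 2*X/(L*h)*(2*X*Q) := by gcongr
        _ = _ := by field_simp; ring
    have t2 : 2*(J*(2*Q*((K:ℝ)+1)*(J*(η*X))+X^(1.99:ℝ))) ≤ 8*J^2*Q*η/L*(X^2/h) + ε/4*(X^2/h) := by
      have a : 2*(J*(2*Q*((K:ℝ)+1)*(J*(η*X)))) ≤ 8*J^2*Q*η/L*(X^2/h) := by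
        calc _ ≤ 2*(J*(2*Q*(2*X/(L*h))*(J*(η*X)))) := by gcongr
          _ = _ := by field_simp; ring
      have b : 2*(J*X^(1.99:ℝ)) ≤ ε/4*(X^2/h) := by
        have : X^(2:ℝ) = X^2 := by norm_cast
        rw [this] at hX3
        rw [mul_div_assoc', le_div_iff₀ (by positivity)]
        calc _ = ε/4*(2*J*h*4/ε*X^(1.99:ℝ)) := by field_simp
          _ ≤ _ := by gcongr
      linarith
    have hXh : 0 ≤ X^2/h := by positivity
    have m1 := mul_le_mul_of_nonneg_right hL1 hXh
    have m2 := mul_le_mul_of_nonneg_right hη1 hXh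
    have m3 := mul_le_mul_of_nonneg_right hJ1 hXh
    calc _ ≤ 4*Q/L*(X^2/h)+(8*J^2*Q*η/L*(X^2/h) + ε/4*(X^2/h))+160*Q*L/J*(X^2/h) := by
          refine add_le_add (add_le_add t1 ?_) hinv
          exact (mul_le_mul_of_nonneg_left hs1 (by norm_num)).trans t2
      _ ≤ ε*(X^2/h) := by linarith
      _ = _ := by ring
  calc (h.totient:ℝ)*S ≤ h.totient*(ε*X^2/h) := by gcongr
    _ = _ := by unfold rho; ring

lemma D1 (ε : ℝ) (hε : 0 < ε) : ∃ L0 : ℝ, 2 ≤ L0 ∧ ∀ L ≥ L0, ∃ η : ℝ, 0 < η ∧ ∀ (h : ℕ) (_ : NeZero h) (V : ℕ), 4 ≤ V →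
    ∀ κ : ℝ, 0 < κ → κ ≤ 1/4 → ∀ᶠ X : ℝ in atTop,
    ∀ K : ℕ, X/(L*h) ≤ (K:ℝ)+1 → (K:ℝ)+1 ≤ 2*X/(L*h) → ((badS h X).card:ℝ) ≤ η*X →
    En h K (sg X ((1+κ)*X*exp (1/V))) (fun n => ((liouville n*gco h V (w0 V X) (w1 V X) X κ (WW h V X) n : ℝ):ℂ))
      ≤ (2*ε + 10^12/V)*(rho h*X^2) := by
  obtain ⟨L0, hL0, H⟩ := D1a ε hε
  refine ⟨L0, hL0, fun L hL => ?_⟩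
  obtain ⟨η, hη, H⟩ := H L hL
  refine ⟨η, hη, fun h _ V hV κ hκ hκ1 => ?_⟩
  have hV0 : (4:ℝ) ≤ V := by exact_mod_cast hV
  have hh := Nat.pos_of_neZero h
  have hh1 : (1:ℝ) ≤ h := by exact_mod_cast hh
  have hρ := rho_pos h
  filter_upwards [H h inferInstance V (by omega), eventually_gt_atTop 1, WW_lower h V hh (by omega), eventually_ge_atTop (V:ℝ),
    tendsto_log_atTop.eventually_ge_atTop 1000] with X H hX1 hW hXV hlog K hK1 hK2 hbad
  have hX0 : 0 < X := by linarith
  have e1 : (1:ℝ) ≤ exp (1/V) := one_le_exp (by positivity)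
  have e2 := exp_inv_le V (by omega)
  have e3 : 2*((1:ℝ)/V) ≤ 1/2 := by rw [mul_one_div, div_le_iff₀ (by linarith)]; linarith
  set Y := (1+κ)*X*exp (1/V) with hY
  have hXY : X ≤ Y := by
    rw [hY]; nlinarith [mul_le_mul (show X ≤ (1+κ)*X by nlinarith) e1 (by norm_num) (by positivity)]
  have hYX : Y ≤ 2*X := by
    rw [hY]
    calc (1+κ)*X*exp (1/V) ≤ (1+1/4)*X*(3/2) := by gcongr; linarith
      _ ≤ _ := by linarith
  obtain ⟨hu, hEn⟩ := H K Y hXY hYX hK1 hK2 hbad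
  set P := PP h V (w0 V X) (w1 V X) with hP
  set W := WW h V X with hWd
  set gg := gco h V (w0 V X) (w1 V X) X κ W with hgg
  have hw := w_le (show 1 ≤ V by omega) hlog
  have hY0 : 0 ≤ Y := by linarith
  refine (En_add_le h K (sg X Y) _ (fun n => ((liouville n*(1 - om P n/W) : ℝ):ℂ)) (fun n => ((liouville n*(gg n - (1 - om P n/W)) : ℝ):ℂ))
    (fun n _ => by push_cast; ring)).trans ?_
  have hM := MVT h K (sg X Y) (fun n => ((liouville n*(gg n - (1 - om P n/W)) : ℝ):ℂ)) X (2*X) hX0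
    (fun m hm => by rw [mem_sg hX0.le hY0] at hm; exact ⟨hm.1.le, hm.2.trans hYX⟩)
  have hs : ∑ n ∈ sg X Y, ‖((liouville n*(gg n - (1 - om P n/W)) : ℝ):ℂ)‖^2 ≤ 803^2*(6*X/V+2) := by
    calc _ ≤ ∑ n ∈ sg X Y, if n ∈ edg V X κ then (803:ℝ)^2 else 0 := by
          refine sum_le_sum fun n hn => ?_
          rw [norm_real, norm_eq_abs, abs_mul, lio_abs, one_mul]
          have h1 := gco_abs h V (w0 V X) (w1 V X) hw X κ W (by linarith) n
          have h2 := hu n hn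
          split_ifs with he
          · have := abs_sub (gg n) (1 - om P n/W)
            gcongr; linarith
          · have h3 := not_edg hX0 hκ hn he
            have : gg n = 1 - om P n/W := gco_main h V (w0 V X) (w1 V X) (by omega) hw X κ W hX0 hκ n h3.1 h3.2
            rw [this, sub_self]; norm_num
      _ = 803^2*(((sg X Y).filter (fun n => n ∈ edg V X κ)).card:ℝ) := by
          rw [← sum_filter, sum_const, nsmul_eq_mul, mul_comm]
      _ ≤ 803^2*((edg V X κ).card:ℝ) := by
          gcongr; intro n hn; exact (mem_filter.1 hn).2
      _ ≤ _ := by gcongr; exact edg_card V (by omega) X κ hX0 hκ (by linarith)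
  have hl : log (2*X/X) ≤ 1 := by
    rw [mul_div_assoc, div_self hX0.ne', mul_one]
    have := log_two_lt_d9; linarith
  have hl0 : 0 ≤ log (2*X/X) := log_nonneg (by rw [le_div_iff₀ hX0]; linarith)
  have hK3 : (K:ℝ)+1+2*X/h ≤ 4*X/h := by
    have : 2*X/(L*h) ≤ 2*X/h := div_le_div_of_nonneg_left (by positivity) (by positivity) (by nlinarith)
    have e : 4*X/h = 2*X/h+2*X/h := by ring
    rw [e]; linarith
  have hV6 : 6*X/V+2 ≤ 8*X/V := by
    have : 2 ≤ 2*X/V := by rw [le_div_iff₀ (by linarith)]; linarith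
    have e : 8*X/V = 6*X/V+2*X/V := by ring
    rw [e]; linarith
  have hE2 : En h K (sg X Y) (fun n => ((liouville n*(gg n - (1 - om P n/W)) : ℝ):ℂ)) ≤ 2*10^11/V*(rho h*X^2) := by
    refine hM.trans ?_
    calc _ ≤ (h.totient:ℝ)*(4000*(1+1)*(4*X/h)*(803^2*(8*X/V))) := by
          have := hs.trans (mul_le_mul_of_nonneg_left hV6 (by norm_num : (0:ℝ) ≤ 803^2))
          gcongr
      _ = (4000*2*4*803^2*8)/V*(rho h*X^2) := by unfold rho; ring
      _ ≤ _ := mul_le_mul_of_nonneg_right (div_le_div_of_nonneg_right (by norm_num) (by linarith)) (by positivity)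
  calc _ ≤ 2*(ε*rho h*X^2)+2*(2*10^11/V*(rho h*X^2)) := by gcongr
    _ = (2*ε + 4*10^11/V)*(rho h*X^2) := by ring
    _ ≤ _ := mul_le_mul_of_nonneg_right (add_le_add_right (div_le_div_of_nonneg_right (by norm_num) (by linarith)) _) (by positivity)

lemma num_ineq (x y : ℝ) (hx : 0 ≤ x) (hx1 : x ≤ 1/1000) (hy : 0 ≤ y) (hy1 : y ≤ 1+x) :
    (1+x)*((1-16*x)^2*y^2*((1+4*x)*(1+x)^2)) ≤ 1-8*x := by
  have h1 : y^2 ≤ (1+x)^2 := by gcongr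
  have a1 : (1+x)^2 ≤ 1+2.01*x := by nlinarith
  have a2 : (1+x)^3 ≤ 1+3.02*x := by nlinarith [mul_nonneg hx hx]
  have a3 : (1+x)^5 ≤ 1+5.2*x := by
    calc (1+x)^5 = (1+x)^2*(1+x)^3 := by ring
      _ ≤ (1+2.01*x)*(1+3.02*x) := by gcongr
      _ ≤ _ := by nlinarith
  have a4 : (1+x)^5*(1+4*x) ≤ 1+16*x := by
    calc _ ≤ (1+5.2*x)*(1+4*x) := by gcongr
      _ ≤ _ := by nlinarith
  calc _ ≤ (1+x)*((1-16*x)^2*(1+x)^2*((1+4*x)*(1+x)^2)) := by gcongr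
    _ = (1-16*x)^2*((1+x)^5*(1+4*x)) := by ring
    _ ≤ (1-16*x)^2*(1+16*x) := by gcongr
    _ ≤ _ := by nlinarith [mul_nonneg hx hx, mul_nonneg (mul_nonneg hx hx) hx]

lemma D2 (c : ℝ) (hc : 0 < c) : ∃ V : ℕ, ∃ L0 : ℝ, 2 ≤ L0 ∧ ∀ L ≥ L0, ∃ η : ℝ, 0 < η ∧ ∀ (h : ℕ) (_ : NeZero h), c ≤ rho h →
    ∀ᶠ X : ℝ in atTop, ∀ K : ℕ, X/(L*h) ≤ (K:ℝ)+1 → (K:ℝ)+1 ≤ 2*X/(L*h) → ((badS h X).card:ℝ) ≤ η*X →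
    ∀ U ⊆ Xi h K, (∀ ξ ∈ U, 3*V*m0 ≤ |(ξ.2:ℝ)|) → (U.card:ℝ) ≤ X^(0.003:ℝ) →
      ∑ ξ ∈ U, Fw h K X (c0/8) ξ ≤ (1-c0/8)*(2*π*(rho h)^2*(c0/8)*X^2) := by
  set x : ℝ := c0/32 with hx
  have hx0 : 0 < x := by rw [hx, c0_eq]; norm_num
  have hx1 : x ≤ 1/1000 := by rw [hx, c0_eq]; norm_num
  have hpi := pi_gt_three
  set t : ℝ := 4*x*(2*π*c*(4*x))/(1+1/x) with ht
  have ht0 : 0 < t := by rw [ht]; positivity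
  obtain ⟨V, hV⟩ : ∃ V : ℕ, max 4 (max (2/x) (2*10^12/t)) ≤ V := exists_nat_ge _
  have hV4 : (4:ℝ) ≤ V := (le_max_left _ _).trans hV
  have hV1 : 2*(1/(V:ℝ)) ≤ x := by
    have := ((le_max_left _ _).trans (le_max_right _ _)).trans hV
    rw [div_le_iff₀ hx0] at this
    rw [mul_one_div, div_le_iff₀ (by linarith)]; linarith
  have hV2 : 10^12/(V:ℝ) ≤ t/2 := by
    have := ((le_max_right _ _).trans (le_max_right _ _)).trans hV
    rw [div_le_iff₀ ht0] at this
    rw [div_le_iff₀ (by linarith)]; linarith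
  have hV4' : 4 ≤ V := by exact_mod_cast hV4
  obtain ⟨L0, hL0, H⟩ := D1 (t/4) (by positivity)
  refine ⟨V, L0, hL0, fun L hL => ?_⟩
  obtain ⟨η, hη, H⟩ := H L hL
  refine ⟨η, hη, fun h _ hρc => ?_⟩
  have e4 : c0/8 = 4*x := by rw [hx]; ring
  have hκ0 : 0 < c0/8 := by rw [e4]; linarith
  have hκ1 : c0/8 ≤ 1/4 := by rw [e4]; linarith
  have hh1 : (1:ℝ) ≤ h := by exact_mod_cast Nat.pos_of_neZero h
  have hρ := rho_pos h
  filter_upwards [H h inferInstance V hV4' (c0/8) hκ0 hκ1, U_bound h V (by omega) (c0/8) x hκ0 (by linarith) hx0,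
    eventually_gt_atTop 1] with X H HU hX1 K hK1 hK2 hbad U hU hU1 hU2
  have hX0 : 0 < X := by linarith
  have H := H K hK1 hK2 hbad
  have hL00 : 0 < L := by linarith
  have hKX : (K:ℝ) ≤ X := by
    have : 2*X/(L*h) ≤ X := by
      rw [div_le_iff₀ (by positivity)]
      have : 2*1 ≤ L*h := mul_le_mul (by linarith) hh1 (by norm_num) (by linarith)
      nlinarith
    linarith
  have HU := HU U (fun ξ hξ => (mem_Xi.1 (hU hξ)).trans hKX) hU1 hU2
  set B : Freq h → ℂ := fun ξ => (1/WW h V X:ℝ) * ∑ v ∈ Ico (w0 V X) (w1 V X), Pv V v ξ * Rv X (c0/8) V v ξ with hB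
  set d : Freq h → ℂ := fun ξ => pol (sg X ((1+c0/8)*X*exp (1/V))) (fun n => ((liouville n*gco h V (w0 V X) (w1 V X) X (c0/8) (WW h V X) n : ℝ):ℂ)) ξ with hd
  have hF : ∀ ξ ∈ U, Fw h K X (c0/8) ξ ≤ (1+x)*‖B ξ‖^2+(1+1/x)*(wt K ξ.2 * ‖d ξ‖^2) := by
    intro ξ hξ
    have hw0 := wt_nonneg' (hU hξ)
    have hw1 : wt K ξ.2 ≤ 1 := by unfold wt; have : 0 ≤ |(ξ.2:ℝ)|/((K:ℝ)+1) := by positivity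
                                  linarith
    have e : pol (sg X ((1+c0/8)*X)) (fun n => (liouville n : ℂ)) ξ = -B ξ + d ξ := by
      rw [pol_approx h V (w0 V X) (w1 V X) (by omega) X (c0/8) (WW h V X) hX0 hκ0 ξ, hB, hd]
      unfold Pv Rv
      push_cast; ring
    unfold Fw
    rw [e]
    have n1 := norm_add_le (-B ξ) (d ξ)
    rw [norm_neg] at n1
    set b := ‖B ξ‖
    set q := ‖d ξ‖
    have n2 : ‖-B ξ + d ξ‖^2 ≤ (1+x)*b^2+(1+1/x)*q^2 := by
      have : ‖-B ξ + d ξ‖^2 ≤ (b+q)^2 := by gcongr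
      have k : 0 ≤ (x*b-q)^2/x := by positivity
      have k2 : (x*b-q)^2/x = x*b^2 - 2*b*q+1/x*q^2 := by field_simp; ring
      rw [k2] at k; nlinarith
    have hb : 0 ≤ (1+x)*b^2 := by positivity
    calc _ ≤ wt K ξ.2*((1+x)*b^2+(1+1/x)*q^2) := by gcongr
      _ = wt K ξ.2*((1+x)*b^2)+(1+1/x)*(wt K ξ.2*q^2) := by ring
      _ ≤ _ := by nlinarith
  have hEd : ∑ ξ ∈ U, wt K ξ.2 * ‖d ξ‖^2 ≤ t*(rho h*X^2) := by
    calc _ ≤ ∑ ξ ∈ Xi h K, wt K ξ.2 * ‖d ξ‖^2 := sum_le_sum_of_subset_of_nonneg hU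
          fun ξ hξ _ => mul_nonneg (wt_nonneg' hξ) (by positivity)
      _ ≤ (2*(t/4)+10^12/V)*(rho h*X^2) := H
      _ ≤ _ := by gcongr; linarith
  have ee2 := exp_inv_le V (by omega)
  have hnum := num_ineq x (exp (1/V)) hx0.le hx1 (exp_pos _).le (by linarith)
  set Z := 2*π*(rho h)^2*(c0/8)*X^2 with hZ
  have hZ0 : 0 ≤ Z := by rw [hZ]; positivity
  calc _ ≤ ∑ ξ ∈ U, ((1+x)*‖B ξ‖^2+(1+1/x)*(wt K ξ.2 * ‖d ξ‖^2)) := sum_le_sum hF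
    _ = (1+x)*∑ ξ ∈ U, ‖B ξ‖^2+(1+1/x)*∑ ξ ∈ U, (wt K ξ.2 * ‖d ξ‖^2) := by
        rw [sum_add_distrib, mul_sum, mul_sum]
    _ ≤ (1+x)*((1-c0/2)^2*(exp (1/V))^2*((1+c0/8)*(1+x)^2)*Z)+(1+1/x)*(t*(rho h*X^2)) := by gcongr
    _ = ((1+x)*((1-16*x)^2*(exp (1/V))^2*((1+4*x)*(1+x)^2)))*Z+4*x*(2*π*c*(4*x)*rho h*X^2) := by
        rw [ht]
        have : c0 = 32*x := by rw [hx]; ring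
        rw [this]; field_simp; ring
    _ ≤ (1-8*x)*Z+4*x*(2*π*rho h*(4*x)*rho h*X^2) := by gcongr
    _ = _ := by rw [hZ, e4]; ring

open FourierTransform MeasureTheory in
lemma ker_exists : ∃ φ : ℝ → ℂ, Continuous φ ∧ HasCompactSupport φ ∧ Continuous (𝓕 φ) ∧
    Integrable (𝓕 φ) ∧ ∫ z, (𝓕 φ) z = 1 ∧ Integrable (fun z => |z| * ‖(𝓕 φ) z‖) := by
  let b : ContDiffBump (0:ℝ) := ⟨1, 2, by norm_num, by norm_num⟩
  have h1 : HasCompactSupport (fun x => ((b x:ℝ):ℂ)) := b.hasCompactSupport.comp_left (g := fun x:ℝ => (x:ℂ)) (by simp)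
  have h2 : ContDiff ℝ (⊤:ℕ∞) (fun x => ((b x:ℝ):ℂ)) := ofRealCLM.contDiff.comp b.contDiff
  let f : SchwartzMap ℝ ℂ := h1.toSchwartzMap h2
  have hi : Integrable (𝓕 (f : ℝ → ℂ)) := (𝓕 f).integrable
  refine ⟨f, f.continuous, h1, (𝓕 f).continuous, hi, ?_, ?_⟩
  · have := congrFun (f.continuous.fourierInv_fourier_eq f.integrable hi) 0
    rw [Real.fourierInv_eq] at this
    simp only [inner_zero_right, AddChar.map_zero_eq_one, one_smul] at this
    rw [this]
    change ((b 0:ℝ):ℂ) = 1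
    rw [b.one_of_mem_closedBall (by simp [b])]; simp
  · have := (𝓕 f).integrable_pow_mul volume 1
    simp only [pow_one, norm_eq_abs] at this; exact this

/-- normalised summatory function -/
noncomputable def Mf (f : ℕ → ℂ) (u : ℝ) : ℂ :=
  exp (-u) * ∑ k ∈ Icc 1 ⌊exp u⌋₊, f k

lemma Mf_meas (f : ℕ → ℂ) : Measurable (Mf f) := by
  have : Measurable (fun n : ℕ => ∑ k ∈ Icc 1 n, f k) := measurable_from_top
  exact (Complex.measurable_ofReal.comp (Real.measurable_exp.comp measurable_neg)).mul
    (this.comp (Nat.measurable_floor.comp Real.measurable_exp))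

lemma Mf_neg (f : ℕ → ℂ) (u : ℝ) (hu : u < 0) : Mf f u = 0 := by
  have : ⌊exp u⌋₊ = 0 := Nat.floor_eq_zero.2 (Real.exp_lt_one_iff.2 hu)
  simp [Mf, this]

lemma Mf_slow (f : ℕ → ℂ) (hf : ∀ n, ‖f n‖ ≤ 1) (u w : ℝ) (hw : u ≤ w) :
    ‖Mf f w - Mf f u‖ ≤ 2*(w-u)+exp (-w) ∧ ‖Mf f u‖ ≤ 1 := by
  have hA : ∀ n : ℕ, ‖∑ k ∈ Icc 1 n, f k‖ ≤ n := fun n =>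
    (norm_sum_le _ _).trans ((sum_le_sum fun i _ => hf i).trans (by simp))
  have hM : ‖Mf f u‖ ≤ 1 := by
    rw [Mf, norm_mul, norm_real, norm_eq_abs, abs_of_pos (exp_pos _)]
    calc _ ≤ exp (-u)*exp u := by
          gcongr; exact (hA _).trans (Nat.floor_le (exp_pos _).le)
      _ = 1 := by rw [← exp_add]; simp
  refine ⟨?_, hM⟩
  have hfl : ⌊exp u⌋₊ ≤ ⌊exp w⌋₊ := Nat.floor_mono (exp_le_exp.2 hw)
  have e1 : ‖∑ k ∈ Icc 1 ⌊exp w⌋₊, f k - ∑ k ∈ Icc 1 ⌊exp u⌋₊, f k‖ ≤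
      exp w - exp u+1 := by
    have hs : Icc 1 ⌊exp u⌋₊ ⊆ Icc 1 ⌊exp w⌋₊ := Finset.Icc_subset_Icc_right hfl
    rw [← sum_sdiff hs, add_sub_cancel_right]
    refine ((norm_sum_le _ _).trans (sum_le_sum fun i _ => hf i)).trans ?_
    rw [sum_const, Finset.card_sdiff_of_subset hs, Nat.card_Icc, Nat.card_Icc]
    have a1 := Nat.lt_floor_add_one (exp u)
    have a2 := Nat.floor_le (exp_pos w).le
    simp only [Nat.add_sub_cancel, nsmul_eq_mul, mul_one]
    rw [Nat.cast_sub hfl]; linarith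
  have e2 : Mf f w - Mf f u = exp (-w)*(∑ k ∈ Icc 1 ⌊exp w⌋₊, f k -
      ∑ k ∈ Icc 1 ⌊exp u⌋₊, f k) - (1-exp (u-w):ℝ)*Mf f u := by
    have : exp (-w) = exp (u-w)*exp (-u) := by rw [← exp_add]; ring_nf
    simp only [Mf]; rw [this]; push_cast; ring
  have e3 := add_one_le_exp (u-w)
  have e4 : exp (u-w) ≤ 1 := exp_le_one_iff.2 (by linarith)
  rw [e2]
  refine (norm_sub_le _ _).trans ?_
  rw [norm_mul, norm_mul, norm_real, norm_real, norm_eq_abs, norm_eq_abs,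
    abs_of_pos (exp_pos _), abs_of_nonneg (by linarith)]
  have e5 : exp (-w)*(exp w - exp u+1) = 1 - exp (u-w)+exp (-w) := by
    have h1 : exp (-w)*exp w = 1 := by rw [← exp_add]; simp
    have h2 : exp (-w)*exp u = exp (u-w) := by rw [← exp_add]; ring_nf
    linear_combination h1 - h2
  have e6 := mul_le_mul_of_nonneg_left e1 (exp_pos (-w)).le
  have e7 := mul_le_mul_of_nonneg_left hM (by linarith : 0 ≤ 1-exp (u-w))
  linarith

open MeasureTheory in
lemma Mf_int (f : ℕ → ℂ) (hf : ∀ n, ‖f n‖ ≤ 1) (B σ : ℝ) (hB : 0 < B) (hσ : 0 < σ) :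
    Integrable (fun z:ℝ => Mf f (z/B)*exp (-(σ*(z/B)))) := by
  have h1 : IntegrableOn (fun z:ℝ => Mf f (z/B)*exp (-(σ*(z/B)))) (Set.Ici 0) := by
    rw [integrableOn_Ici_iff_integrableOn_Ioi]
    refine (exp_neg_integrableOn_Ioi 0 (div_pos hσ hB)).mono' ?_ ?_
    · refine Measurable.aestronglyMeasurable ?_
      exact ((Mf_meas f).comp (measurable_id.div_const B)).mul (by fun_prop)
    · refine Filter.Eventually.of_forall fun z => ?_
      rw [norm_mul, norm_real, norm_eq_abs, abs_of_pos (exp_pos _)]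
      have := (Mf_slow f hf (z/B) _ le_rfl).2
      calc _ ≤ 1*exp (-(σ*(z/B))) := by gcongr
        _ = _ := by rw [one_mul]; congr 1; ring
  refine (integrableOn_iff_integrable_of_support_subset fun z hz => ?_).1 h1
  by_contra h
  exact hz (by simp only [Set.mem_Ici, not_le] at h; simp [Mf_neg f (z/B) (div_neg_of_neg_of_pos h hB)])

open FourierTransform MeasureTheory in
lemma Mf_fourier (f : ℕ → ℂ) (hf : ∀ n, ‖f n‖ ≤ 1) (B σ : ℝ) (hB : 0 < B) (hσ : 0 < σ) (v : ℝ) :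
    (𝓕 (fun z:ℝ => Mf f (z/B)*exp (-(σ*(z/B))))) v =
      B*(LSeries f (1+σ+(2*π*B*v:ℝ)*I)/(1+σ+(2*π*B*v:ℝ)*I)) := by
  set s : ℂ := 1+σ+(2*π*B*v:ℝ)*I with hs
  have hre : s.re = 1+σ := by simp [hs]
  have hs0 : s ≠ 0 := fun h => by rw [h] at hre; simp at hre; linarith
  rw [LSeries_eq_mul_integral' f zero_le_one (s := s) (by linarith), mul_div_cancel_left₀ _ hs0]
  swap
  · refine Asymptotics.isBigO_of_le _ fun n => ?_
    simp only [rpow_one]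
    rw [norm_of_nonneg (sum_nonneg fun i _ => norm_nonneg _), norm_of_nonneg (Nat.cast_nonneg _)]
    exact (sum_le_sum fun i _ => hf i).trans (by simp)
  have him : Set.Ioi (1:ℝ) = Set.image (fun z => exp (z/B)) (Set.Ioi 0) := by
    ext t; constructor
    · intro ht
      exact ⟨B*log t, mul_pos hB (log_pos ht), by
        simp only; rw [mul_div_cancel_left₀ _ hB.ne', exp_log (zero_lt_one.trans ht)]⟩
    · rintro ⟨z, hz, rfl⟩
      exact Real.one_lt_exp_iff.2 (div_pos hz hB)
  rw [him, integral_image_eq_integral_abs_deriv_smul measurableSet_Ioi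
    (f := fun z => exp (z/B)) (f' := fun z => exp (z/B)*(1/B)) (fun z _ => ((hasDerivAt_id z).div_const B).exp.hasDerivWithinAt)
    (fun x _ y _ h => by
      have := Real.exp_injective h
      field_simp at this; exact this)]
  rw [Real.fourier_real_eq_integral_exp_smul, ← integral_const_mul,
    ← setIntegral_eq_integral_of_forall_compl_eq_zero (s := Set.Ici 0), integral_Ici_eq_integral_Ioi]
  · refine setIntegral_congr_fun measurableSet_Ioi fun z hz => ?_
    have hp := exp_pos (z/B)
    simp only [smul_eq_mul, Complex.real_smul, Mf]
    rw [abs_of_pos (by positivity), cpow_def_of_ne_zero (by exact_mod_cast hp.ne'),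
      ← Complex.ofReal_log hp.le, log_exp]
    have hBc : (B:ℂ) ≠ 0 := by exact_mod_cast hB.ne'
    have e : Complex.exp ((-2*π*z*v:ℝ)*I)*(exp (-(z/B))*exp (-(σ*(z/B)))) =
        B*((exp (z/B)*(1/B):ℝ)*Complex.exp ((z/B:ℝ) * -(s+1))) := by
      push_cast
      rw [mul_comm (Complex.exp _) (1/(B:ℂ)), ← mul_assoc, ← mul_assoc, ← mul_assoc (B:ℂ), mul_one_div_cancel hBc, one_mul,
        ← Complex.exp_add, ← Complex.exp_add, ← Complex.exp_add, hs]
      congr 1; push_cast; field_simp; ring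
    linear_combination (∑ k ∈ Icc 1 ⌊exp (z/B)⌋₊, f k)*e
  · intro z hz
    simp only [Set.mem_Ici, not_le] at hz
    simp [Mf_neg f (z/B) (div_neg_of_neg_of_pos hz hB)]

open FourierTransform MeasureTheory in
lemma conv_zero (f : ℕ → ℂ) (hf : ∀ n, ‖f n‖ ≤ 1) (H : ℂ → ℂ) (hH : ContinuousOn H {s | 1 ≤ s.re})
    (hL : ∀ s : ℂ, 1 < s.re → LSeries f s = H s) (φ : ℝ → ℂ) (hφ : Continuous φ)
    (hc : HasCompactSupport φ) (hψc : Continuous (𝓕 φ)) (hψ : Integrable (𝓕 φ)) (B : ℝ) (hB : 0 < B) :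
    Tendsto (fun x : ℝ => ∫ z, Mf f ((z+x)/B)*(𝓕 φ) z) atTop (𝓝 0) := by
  let S : ℝ → ℝ → ℂ := fun σ v => 1+σ+(2*π*B*v:ℝ)*I
  let G : ℝ → ℝ → ℂ := fun σ v => B*(H (S σ v)/S σ v)
  have hre : ∀ σ v, (S σ v).re = 1+σ := fun σ v => by simp [S]
  have hGc : ContinuousOn (fun p : ℝ × ℝ => G p.1 p.2) (Set.Ici 0 ×ˢ Set.univ) := by
    have hSc : Continuous (fun p : ℝ × ℝ => S p.1 p.2) := by simp only [S]; fun_prop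
    refine continuousOn_const.mul (ContinuousOn.div ?_ hSc.continuousOn ?_)
    · refine hH.comp hSc.continuousOn fun p hp => ?_
      have := hp.1
      simp only [Set.mem_Ici] at this
      change 1 ≤ (S p.1 p.2).re
      rw [hre]; linarith
    · intro p hp h0
      have h1 := hre p.1 p.2
      have := hp.1
      simp only [Set.mem_Ici] at this
      rw [h0] at h1; simp at h1; linarith
  obtain ⟨C, hC⟩ := ((isCompact_Icc (a := (0:ℝ)) (b := 1)).prod hc.isCompact).exists_bound_of_continuousOn
    (hGc.mono fun p hp => ⟨hp.1.1, trivial⟩)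
  have hGL : ∀ σ, 0 < σ → ∀ v, G σ v = B*(LSeries f (1+σ+(2*π*B*v:ℝ)*I)/(1+σ+(2*π*B*v:ℝ)*I)) := by
    intro σ hσ v
    rw [hL (1+σ+(2*π*B*v:ℝ)*I) (lt_of_lt_of_eq (by linarith) (hre σ v).symm)]
  clear_value G
  have hst : Tendsto (fun n:ℕ => 1/((n:ℝ)+1)) atTop (𝓝 0) := tendsto_one_div_add_atTop_nhds_zero_nat
  have hs0 : ∀ n:ℕ, (0:ℝ) < 1/((n:ℝ)+1) := fun n => by positivity
  have hGt : ∀ v, Tendsto (fun n:ℕ => G (1/((n:ℝ)+1)) v) atTop (𝓝 (G 0 v)) := by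
    intro v
    have hq : Tendsto (fun p : ℝ × ℝ => G p.1 p.2) (𝓝[Set.Ici 0 ×ˢ Set.univ] ((0:ℝ), v)) (𝓝 (G 0 v)) :=
      hGc (0,v) ⟨le_refl (0:ℝ), trivial⟩
    exact hq.comp (tendsto_nhdsWithin_iff.2
          ⟨hst.prodMk_nhds tendsto_const_nhds, Eventually.of_forall fun n => ⟨(hs0 n).le, trivial⟩⟩)
  have key : ∀ x : ℝ, ∫ z, Mf f ((z+x)/B)*(𝓕 φ) z = (𝓕 (fun v => G 0 v * φ v)) (-x) := by
    intro x
    let P : ℝ → ℝ → ℂ := fun σ z => Mf f (z/B)*exp (-(σ*(z/B)))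
    have hs1 : ∀ n:ℕ, 1/((n:ℝ)+1) ≤ 1 := fun n => by
      rw [div_le_one (by positivity)]; have := n.cast_nonneg (α := ℝ); linarith
    have hPle : ∀ n z, ‖P (1/((n:ℕ)+1:ℝ)) z‖ ≤ 1 := by
      intro n z
      rcases lt_or_ge z 0 with h | h
      · simp [P, Mf_neg f (z/B) (div_neg_of_neg_of_pos h hB)]
      · simp only [P]
        rw [norm_mul, norm_real, norm_eq_abs, abs_of_pos (exp_pos _)]
        refine mul_le_one₀ (Mf_slow f hf _ _ le_rfl).2 (exp_pos _).le (exp_le_one_iff.2 ?_)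
        have := hs0 n
        have : 0 ≤ 1/((n:ℝ)+1)*(z/B) := by positivity
        linarith
    have heq : ∀ n:ℕ, ∫ z, P (1/((n:ℝ)+1)) (z+x)*(𝓕 φ) z =
        ∫ v, (fourierChar (-(v*(-x))) : ℂ)*(G (1/((n:ℝ)+1)) v * φ v) := by
      intro n
      have hi := Mf_int f hf B _ hB (hs0 n)
      have h1 := VectorFourier.integral_fourierIntegral_smul_eq_flip (L := innerₗ ℝ) (f := fun z => P (1/((n:ℝ)+1)) (z+x))
        (g := φ) (μ := volume) (ν := volume) Real.continuous_fourierChar continuous_inner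
        (hi.comp_add_right x) (hφ.integrable_of_hasCompactSupport hc)
      have h2 := VectorFourier.fourierIntegral_comp_add_right fourierChar volume (innerₗ ℝ) (P (1/((n:ℝ)+1))) x
      have h3 : ∀ v, VectorFourier.fourierIntegral fourierChar volume (innerₗ ℝ) (P (1/((n:ℝ)+1))) v =
          G (1/((n:ℝ)+1)) v := by
        intro v
        rw [hGL _ (hs0 n)]
        exact Mf_fourier f hf B _ hB (hs0 n) v
      calc _ = _ := by
            refine Eq.trans ?_ h1.symm
            simp only [smul_eq_mul]
            rw [flip_innerₗ]; rfl
        _ = _ := by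
            congr 1; funext v
            have h2' : VectorFourier.fourierIntegral fourierChar volume (innerₗ ℝ)
              (fun z => P (1/((n:ℝ)+1)) (z+x)) v = _ := congrFun h2 v
            rw [h2', h3]
            simp [Circle.smul_def, mul_assoc]
    have l1 : Tendsto (fun n:ℕ => ∫ z, P (1/((n:ℝ)+1)) (z+x)*(𝓕 φ) z) atTop
        (𝓝 (∫ z, Mf f ((z+x)/B)*(𝓕 φ) z)) := by
      refine tendsto_integral_of_dominated_convergence (fun z => ‖(𝓕 φ) z‖) (fun n => ?_) hψ.norm
        (fun n => Eventually.of_forall fun z => ?_) (Eventually.of_forall fun z => ?_)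
      · refine Measurable.aestronglyMeasurable (Measurable.mul ?_ hψc.measurable)
        exact ((Mf_meas f).comp ((measurable_id.add_const x).div_const B)).mul (by fun_prop)
      · rw [norm_mul]; exact mul_le_of_le_one_left (norm_nonneg _) (hPle n _)
      · refine Tendsto.mul_const _ ?_
        have : Tendsto (fun n:ℕ => ((exp (-(1/((n:ℝ)+1)*((z+x)/B))):ℝ):ℂ)) atTop (𝓝 1) := by
          have h5 : Continuous (fun σ:ℝ => ((exp (-(σ*((z+x)/B))):ℝ):ℂ)) := by fun_prop
          have := (h5.tendsto 0).comp hst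
          simp only [zero_mul, neg_zero, Real.exp_zero, ofReal_one] at this
          exact this
        have := this.const_mul (Mf f ((z+x)/B))
        rw [mul_one] at this
        exact this
    have l2 : Tendsto (fun n:ℕ => ∫ v, (fourierChar (-(v*(-x))) : ℂ)*(G (1/((n:ℝ)+1)) v * φ v)) atTop
        (𝓝 (∫ v, (fourierChar (-(v*(-x))) : ℂ)*(G 0 v * φ v))) := by
      have hv : ∀ σ, 0 ≤ σ → Continuous (G σ) := fun σ h =>
        hGc.comp_continuous (f := fun v => (σ, v)) (by fun_prop) (fun v => ⟨h, trivial⟩)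
      refine tendsto_integral_of_dominated_convergence (fun v => C*‖φ v‖) (fun n => ?_)
        ((hφ.integrable_of_hasCompactSupport hc).norm.const_mul C)
        (fun n => Eventually.of_forall fun v => ?_) (Eventually.of_forall fun v => ?_)
      · refine Continuous.aestronglyMeasurable (Continuous.mul ?_ ((hv _ (hs0 n).le).mul hφ))
        exact continuous_subtype_val.comp (Real.continuous_fourierChar.comp (by fun_prop))
      · rw [norm_mul, Circle.norm_coe, one_mul, norm_mul]
        by_cases h0 : φ v = 0
        · simp [h0]
        · exact mul_le_mul_of_nonneg_right (hC (1/((n:ℝ)+1), v) ⟨⟨(hs0 n).le, hs1 n⟩, subset_tsupport _ h0⟩) (norm_nonneg _)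
      · exact ((hGt v).mul_const _).const_mul _
    rw [tendsto_nhds_unique l1 (l2.congr fun n => (heq n).symm), Real.fourier_real_eq]
    rfl
  simp only [key]
  exact (Real.zero_at_infty_fourier _).comp (tendsto_neg_atTop_atBot.mono_right atBot_le_cocompact)

open FourierTransform MeasureTheory in
lemma tauber (f : ℕ → ℂ) (hf : ∀ n, ‖f n‖ ≤ 1) (H : ℂ → ℂ) (hH : ContinuousOn H {s | 1 ≤ s.re})
    (hL : ∀ s : ℂ, 1 < s.re → LSeries f s = H s) (ε : ℝ) (hε : 0 < ε) :
    ∀ᶠ X : ℝ in atTop, ‖∑ k ∈ Icc 1 ⌊X⌋₊, f k‖ ≤ ε*X := by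
  obtain ⟨φ, hφ, hc, hψc, hψ, hone, hmom⟩ := ker_exists
  set m := ∫ z, |z| * ‖(𝓕 φ) z‖ with hm
  set m' := ∫ z, ‖(𝓕 φ) z‖ with hm'
  have hm0 : 0 ≤ m := integral_nonneg fun z => by positivity
  have hm0' : 0 ≤ m' := integral_nonneg fun z => norm_nonneg _
  set B := 8*(m+1)/ε with hBd
  have hB : 0 < B := by positivity
  have h1 := (conv_zero f hf H hH hL φ hφ hc hψc hψ B hB).norm
  rw [norm_zero] at h1
  have h2 : Tendsto (fun y:ℝ => B*y) atTop atTop := tendsto_id.const_mul_atTop hB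
  have h3 : ∀ᶠ y:ℝ in atTop, ‖∫ z, Mf f ((z+B*y)/B)*(𝓕 φ) z‖ < ε/4 :=
    h2.eventually (h1.eventually (gt_mem_nhds (by positivity)))
  have h4 : ∀ᶠ y:ℝ in atTop, exp (-(y/2))*m' < ε/4 := by
    have : Tendsto (fun y:ℝ => exp (-(y/2))*m') atTop (𝓝 (0*m')) :=
      (Real.tendsto_exp_neg_atTop_nhds_zero.comp (tendsto_id.atTop_div_const two_pos)).mul_const _
    rw [zero_mul] at this
    exact this.eventually (gt_mem_nhds (by positivity))
  have main : ∀ᶠ y:ℝ in atTop, ‖Mf f y‖ ≤ ε := by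
    filter_upwards [h3, h4, eventually_ge_atTop 2] with y h3 h4 hy
    have hd : ∀ z, ‖Mf f y - Mf f ((z+B*y)/B)‖ ≤ 2/B*|z| + exp (-(y/2)) := by
      intro z
      have e1 : (z+B*y)/B = y+z/B := by field_simp; ring
      rw [e1]
      have e2 : 2/B*|z| = 2*|z/B| := by rw [abs_div, abs_of_pos hB]; ring
      rw [e2]
      set w := z/B
      rcases le_or_gt 0 w with hw | hw
      · have := (Mf_slow f hf y (y+w) (by linarith)).1
        rw [norm_sub_rev, abs_of_nonneg hw]
        have e3 : exp (-(y+w)) ≤ exp (-(y/2)) := exp_le_exp.2 (by linarith)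
        linarith
      · rw [abs_of_neg hw]
        have a1 := Mf_slow f hf (y+w) y (by linarith)
        have e3 : exp (-y) ≤ exp (-(y/2)) := exp_le_exp.2 (by linarith)
        linarith [a1.1]
    have hMi : Integrable (fun z => Mf f ((z+B*y)/B)*(𝓕 φ) z) := by
      refine hψ.norm.mono' ?_ (Eventually.of_forall fun z => ?_)
      · exact (((Mf_meas f).comp ((measurable_id.add_const (B*y)).div_const B)).mul hψc.measurable).aestronglyMeasurable
      · rw [norm_mul]; exact mul_le_of_le_one_left (norm_nonneg _) (Mf_slow f hf _ _ le_rfl).2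
    have e4 : Mf f y = (∫ z, Mf f ((z+B*y)/B)*(𝓕 φ) z) + ∫ z, (Mf f y - Mf f ((z+B*y)/B))*(𝓕 φ) z := by
      simp only [sub_mul]
      rw [integral_sub (hψ.const_mul _) hMi, integral_const_mul, hone]; ring
    have e5 : ‖∫ z, (Mf f y - Mf f ((z+B*y)/B))*(𝓕 φ) z‖ ≤ 2/B*m+exp (-(y/2))*m' := by
      rw [hm, hm', ← integral_const_mul, ← integral_const_mul, ← integral_add (hmom.const_mul _) (hψ.norm.const_mul _)]
      refine norm_integral_le_of_norm_le ((hmom.const_mul _).add (hψ.norm.const_mul _)) (Eventually.of_forall fun z => ?_)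
      simp only [norm_mul, Pi.add_apply]
      have := mul_le_mul_of_nonneg_right (hd z) (norm_nonneg ((𝓕 φ) z))
      linarith
    have e6 : 2/B*m ≤ ε/4 := by
      rw [hBd]; field_simp; linarith
    rw [e4]
    exact (norm_add_le _ _).trans (by linarith)
  filter_upwards [tendsto_log_atTop.eventually main, eventually_gt_atTop 0] with X hX hX0
  rw [Mf, exp_neg, exp_log hX0, norm_mul, norm_real, norm_eq_abs,
    abs_of_pos (by positivity), inv_mul_le_iff₀ hX0] at hX
  linarith

lemma recip_L {h : ℕ} [NeZero h] (χ : DirichletCharacter ℂ h) : ∃ R : ℂ → ℂ,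
    ContinuousOn R {s | 1 ≤ s.re} ∧ ∀ s : ℂ, 1 < s.re → R s*DirichletCharacter.LFunction χ s = 1 := by
  by_cases hχ : χ = 1
  · subst hχ
    have hne : ∀ s : ℂ, 1 ≤ s.re → DirichletCharacter.LFunctionTrivChar₁ h s ≠ 0 := by
      intro s hs
      by_cases h1 : s = 1
      · rw [h1]; exact DirichletCharacter.LFunctionTrivChar₁_apply_one_ne_zero h
      · simp only [DirichletCharacter.LFunctionTrivChar₁, Function.update_of_ne h1]
        exact mul_ne_zero (sub_ne_zero.2 h1) (DirichletCharacter.LFunction_ne_zero_of_one_le_re _ (Or.inr h1) hs)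
    refine ⟨fun s => (s-1)/DirichletCharacter.LFunctionTrivChar₁ h s, ?_, ?_⟩
    · exact ContinuousOn.div (by fun_prop)
        (DirichletCharacter.differentiable_LFunctionTrivChar₁ h).continuous.continuousOn hne
    · intro s hs
      have h1 : s ≠ 1 := fun h => by rw [h] at hs; simp at hs
      have h2 := hne s hs.le
      rw [div_mul_eq_mul_div, div_eq_one_iff_eq h2]
      simp only [DirichletCharacter.LFunctionTrivChar₁, Function.update_of_ne h1]
  · refine ⟨fun s => (DirichletCharacter.LFunction χ s)⁻¹, ?_, fun s hs => ?_⟩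
    · exact (DirichletCharacter.differentiable_LFunction hχ).continuous.continuousOn.inv₀
        fun s hs => DirichletCharacter.LFunction_ne_zero_of_one_le_re _ (Or.inl hχ) hs
    · exact inv_mul_cancel₀ (DirichletCharacter.LFunction_ne_zero_of_one_le_re _ (Or.inl hχ) hs.le)

lemma lio_L {h : ℕ} [NeZero h] (ξ : Freq h) (s : ℂ) (hs : 1 < s.re) :
    LSeries (fun n => (liouville n:ℂ)*ch ξ n) s*DirichletCharacter.LFunction ξ.1 (s-ξ.2*I) =
      DirichletCharacter.LFunction (ξ.1^2) (2*(s-ξ.2*I)) := by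
  set w : ℂ := s-ξ.2*I with hw
  have hwr : 1 < w.re := by simpa [hw] using hs
  have hw2 : 1 < (2*w).re := by simp; linarith
  have hw0 := Complex.ne_zero_of_one_lt_re hwr
  let g := dirichletSummandHom ξ.1 hw0
  let f : ℕ →*₀ ℂ :=
    { toFun := fun n => (liouville n:ℂ)*g n
      map_zero' := by simp
      map_one' := by simp [liouville]
      map_mul' := by
        intro m n
        rcases eq_or_ne m 0 with rfl | hm
        · simp
        rcases eq_or_ne n 0 with rfl | hn
        · simp
        rw [lio_mul hm hn, map_mul]; push_cast; ring }
  have hfs : Summable (fun n => ‖f n‖) := by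
    refine (summable_dirichletSummand ξ.1 hwr).congr fun n => ?_
    change _ = ‖(liouville n:ℂ)*g n‖
    rw [norm_mul, norm_real, norm_eq_abs, lio_abs, one_mul]
  have e1 := EulerProduct.eulerProduct_completely_multiplicative_hasProd hfs
  have e2 := DirichletCharacter.LSeries_eulerProduct_hasProd ξ.1 hwr
  have e3 := DirichletCharacter.LSeries_eulerProduct_hasProd (ξ.1^2) hw2
  have e4 : LSeries (fun n => (liouville n:ℂ)*ch ξ n) s = ∑' n, f n := by
    refine tsum_congr fun n => ?_
    rcases eq_or_ne n 0 with rfl | hn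
    · simp
    · have hn' : (n:ℂ) ≠ 0 := by exact_mod_cast hn
      rw [LSeries.term_of_ne_zero hn]
      change _ = (liouville n:ℂ)*(ξ.1 n*(n:ℂ)^(-w))
      rw [ch, div_eq_mul_inv, ← Complex.cpow_neg, cpow_def_of_ne_zero hn', cpow_def_of_ne_zero hn',
        mul_assoc, mul_assoc, ← Complex.exp_add, hw]
      congr 3
      push_cast
      ring
  rw [DirichletCharacter.LFunction_eq_LSeries _ hwr, DirichletCharacter.LFunction_eq_LSeries _ hw2, e4]
  have e5 : (fun p : Nat.Primes => (1 - (ξ.1^2) p*(p:ℂ)^(-(2*w)))⁻¹) =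
      fun p : Nat.Primes => (1 - f p)⁻¹ * (1 - ξ.1 p*(p:ℂ)^(-w))⁻¹ := by
    funext p
    have h1 : f p = -(ξ.1 p*(p:ℂ)^(-w)) := by
      change (liouville p:ℂ)*(ξ.1 p*(p:ℂ)^(-w)) = _
      rw [lio_prime p.2]; push_cast; ring
    have h2 : (p:ℂ)^(-(2*w)) = ((p:ℂ)^(-w))^2 := by
      rw [← Complex.cpow_nat_mul]; congr 1; push_cast; ring
    rw [h1, h2, ← mul_inv, MulChar.pow_apply' _ two_ne_zero]
    congr 1; ring
  rw [e5] at e3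
  exact (e1.mul e2).unique e3

lemma low_one {h : ℕ} [NeZero h] (ξ : Freq h) (ε : ℝ) (hε : 0 < ε) :
    ∀ᶠ X : ℝ in atTop, ‖∑ k ∈ Icc 1 ⌊X⌋₊, (liouville k:ℂ)*ch ξ k‖ ≤ ε*X := by
  obtain ⟨R, hR, hR1⟩ := recip_L ξ.1
  refine tauber (fun k => (liouville k:ℂ)*ch ξ k) (fun n => ?_)
    (fun s => R (s-ξ.2*I)*DirichletCharacter.LFunction (ξ.1^2) (2*(s-ξ.2*I))) ?_ ?_ ε hε
  · rw [norm_mul, norm_real, norm_eq_abs, lio_abs, one_mul]; exact ch_norm_le ξ n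
  · refine ContinuousOn.mul (hR.comp (by fun_prop) fun s hs => ?_) ?_
    · simpa using hs
    · intro s hs
      refine ContinuousAt.continuousWithinAt ?_
      refine ContinuousAt.comp (f := fun s : ℂ => 2*(s-ξ.2*I)) (g := DirichletCharacter.LFunction (ξ.1^2)) ?_ (by fun_prop)
      refine (DirichletCharacter.differentiableAt_LFunction _ _ (Or.inl fun h1 => ?_)).continuousAt
      have := congrArg re h1
      simp at this
      have hs' : 1 ≤ s.re := hs
      linarith
  · intro s hs
    rw [← lio_L ξ s hs]
    have := hR1 (s-ξ.2*I) (by simpa using hs)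
    linear_combination -(LSeries (fun n => (liouville n:ℂ)*ch ξ n) s)*this

lemma lowB (h : ℕ) [NeZero h] (C : ℕ) (κ : ℝ) (hκ : 0 < κ) (hκ1 : κ ≤ 1) (ε : ℝ) (hε : 0 < ε) :
    ∀ᶠ X : ℝ in atTop, ∀ K : ℕ, ∀ S ⊆ Xi h K, (∀ ξ ∈ S, |(ξ.2:ℝ)| < C) → ∑ ξ ∈ S, Fw h K X κ ξ ≤ ε*X^2 := by
  set c := ((Xi h C).card:ℝ)+1 with hc
  have hc0 : 0 < c := by positivity
  set δ := sqrt (ε/c)/3 with hδ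
  have hδ0 : 0 < δ := by positivity
  have h1 : ∀ᶠ X : ℝ in atTop, ∀ ξ ∈ Xi h C, ‖∑ k ∈ Icc 1 ⌊X⌋₊, (liouville k:ℂ)*ch ξ k‖ ≤ δ*X :=
    (Finset.eventually_all _).2 fun ξ _ => low_one ξ δ hδ0
  have h2 : Tendsto (fun X : ℝ => (1+κ)*X) atTop atTop := tendsto_id.const_mul_atTop (by linarith)
  filter_upwards [h1, h2.eventually h1, eventually_gt_atTop 0] with X hX hX' hX0 K S hS hSC
  have hSX : S ⊆ Xi h C := fun ξ hξ => mem_Xi.2 (hSC ξ hξ).le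
  have hF : ∀ ξ ∈ S, Fw h K X κ ξ ≤ ε/c*X^2 := by
    intro ξ hξ
    have hp : ‖pol (sg X ((1+κ)*X)) (fun n => (liouville n:ℂ)) ξ‖ ≤ 3*δ*X := by
      have e : pol (sg X ((1+κ)*X)) (fun n => (liouville n:ℂ)) ξ =
          ∑ k ∈ Icc 1 ⌊(1+κ)*X⌋₊, (liouville k:ℂ)*ch ξ k - ∑ k ∈ Icc 1 ⌊X⌋₊, (liouville k:ℂ)*ch ξ k := by
        have hle : ⌊X⌋₊ ≤ ⌊(1+κ)*X⌋₊ := Nat.floor_mono (by nlinarith)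
        rw [pol, sg, eq_sub_iff_add_eq', ← Finset.Ico_add_one_right_eq_Icc, ← Finset.Ico_add_one_right_eq_Icc, ← Finset.Ico_add_one_add_one_eq_Ioc]
        exact Finset.sum_Ico_consecutive _ (by simp) (by simpa using hle)
      rw [e]
      refine (norm_sub_le _ _).trans ?_
      have := hX ξ (hSX hξ)
      have := hX' ξ (hSX hξ)
      nlinarith [mul_pos hδ0 hX0]
    have hwt : wt K ξ.2 ≤ 1 := by
      rw [wt]; have : 0 ≤ |(ξ.2:ℝ)|/((K:ℝ)+1) := by positivity
      linarith
    calc _ ≤ 1*(3*δ*X)^2 := by rw [Fw]; gcongr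
      _ = ε/c*X^2 := by
        rw [hδ, one_mul, mul_pow, show 3*(sqrt (ε/c)/3) = sqrt (ε/c) by ring, sq_sqrt (by positivity)]
  calc _ ≤ ∑ ξ ∈ S, ε/c*X^2 := sum_le_sum hF
    _ = (S.card:ℝ)*(ε/c*X^2) := by simp
    _ ≤ c*(ε/c*X^2) := by
        gcongr
        have : (S.card:ℝ) ≤ (Xi h C).card := by exact_mod_cast card_le_card hSX
        linarith
    _ = _ := by field_simp

open MeasureTheory in
lemma parseval (κ δ : ℝ) (hκ : 0 < κ) (hκ1 : κ ≤ 1) (hδ : 0 < δ) : ∃ T : Finset ℤ,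
    2*π*κ - δ ≤ ∑ k ∈ T, ‖prim k (1+κ) - prim k 1‖^2 := by
  set l := log (1+κ) with hl
  have hl0 : 0 ≤ l := log_nonneg (by linarith)
  have hel : exp l = 1+κ := exp_log (by linarith)
  have hl1 : l ≤ 2*π := by
    have := log_le_sub_one_of_pos (by linarith : 0 < 1+κ)
    linarith [pi_gt_three]
  have hab : (0:ℝ) < 2*π := by positivity
  set f : ℝ → ℂ := (Set.Ioc 0 l).indicator (fun x => ((exp x:ℝ):ℂ)) with hf
  have hsub : Set.Ioc 0 (2*π) ∩ Set.Ioc 0 l = Set.Ioc 0 l :=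
    Set.inter_eq_right.2 (Set.Ioc_subset_Ioc_right hl1)
  have hm : MemLp f 2 (volume.restrict (Set.Ioc 0 (2*π))) := by
    refine MemLp.of_bound (Measurable.aestronglyMeasurable ?_) (1+κ) (Eventually.of_forall fun x => ?_)
    · exact Measurable.indicator (by fun_prop) measurableSet_Ioc
    · rw [hf]
      by_cases hx : x ∈ Set.Ioc 0 l
      · rw [Set.indicator_of_mem hx, norm_real, norm_of_nonneg (exp_pos _).le, ← hel]
        exact exp_le_exp.2 hx.2
      · rw [Set.indicator_of_notMem hx, norm_zero]; linarith
  have hs := (Equiv.neg ℤ).hasSum_iff.2 (hasSum_sq_fourierCoeffOn hab hm)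
  have e1 : ∀ k : ℤ, ‖fourierCoeffOn hab f (-k)‖^2 = (1/(2*π))^2*‖prim k (1+κ) - prim k 1‖^2 := by
    intro k
    have hc : (1+(k:ℝ)*I : ℂ) ≠ 0 := one_add_ne k
    have e : ∫ x in (0:ℝ)..(2*π), fourier (- -k) (x : AddCircle (2*π-0)) • f x = prim k (1+κ) - prim k 1 := by
      rw [intervalIntegral.integral_of_le hab.le]
      have e2 : ∀ x : ℝ, fourier (- -k) (x : AddCircle (2*π-0)) • f x =
          (Set.Ioc 0 l).indicator (fun x : ℝ => Complex.exp ((1+(k:ℝ)*I)*x)) x := by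
        intro x
        rw [hf]
        by_cases hx : x ∈ Set.Ioc 0 l
        · rw [Set.indicator_of_mem hx, Set.indicator_of_mem hx, fourier_coe_apply, smul_eq_mul, ofReal_exp,
            ← Complex.exp_add]
          have : (π:ℂ) ≠ 0 := by exact_mod_cast Real.pi_ne_zero
          congr 1; push_cast; field_simp; ring
        · rw [Set.indicator_of_notMem hx, Set.indicator_of_notMem hx, smul_zero]
      simp only [e2]
      rw [setIntegral_indicator measurableSet_Ioc, hsub, ← intervalIntegral.integral_of_le hl0, integral_exp_mul_complex hc,
        prim, prim, ← hl, ← hel, ee, ee, log_one, ← sub_div, ofReal_exp, ← Complex.exp_add]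
      congr 2
      · congr 1; push_cast; ring
      · simp
    rw [fourierCoeffOn_eq_integral, e, norm_smul, mul_pow, sub_zero, norm_of_nonneg (by positivity)]
  have e3 : ∫ x in (0:ℝ)..(2*π), ‖f x‖^2 = ((1+κ)^2-1)/2 := by
    rw [intervalIntegral.integral_of_le hab.le]
    have e2 : ∀ x : ℝ, ‖f x‖^2 = (Set.Ioc 0 l).indicator (fun x : ℝ => exp (2*x)) x := by
      intro x
      rw [hf]
      by_cases hx : x ∈ Set.Ioc 0 l
      · rw [Set.indicator_of_mem hx, Set.indicator_of_mem hx, norm_real, norm_of_nonneg (exp_pos _).le,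
          ← exp_nat_mul]; norm_num
      · rw [Set.indicator_of_notMem hx, Set.indicator_of_notMem hx]; simp
    simp only [e2]
    rw [setIntegral_indicator measurableSet_Ioc, hsub, ← intervalIntegral.integral_of_le hl0,
      intervalIntegral.integral_comp_mul_left (fun x => exp x) two_ne_zero, integral_exp, mul_comm 2 l, mul_zero, Real.exp_zero,
      ← hel, ← exp_nat_mul, smul_eq_mul]
    push_cast; ring_nf
  have hs' := hs.mul_left ((2*π)^2)
  have e4 : ∀ k : ℤ, (2*π)^2*(((fun i => ‖fourierCoeffOn hab f i‖^2) ∘ (Equiv.neg ℤ)) k) = ‖prim k (1+κ) - prim k 1‖^2 := by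
    intro k
    change (2*π)^2*‖fourierCoeffOn hab f (-k)‖^2 = _
    rw [e1]; field_simp
  simp only [e4] at hs'
  obtain ⟨T, hT⟩ := (hs'.eventually (lt_mem_nhds (sub_lt_self _ hδ))).exists
  refine ⟨T, le_trans (sub_le_sub_right ?_ δ) hT.le⟩
  rw [e3, smul_eq_mul, sub_zero]
  have e5 : (2*π)^2*((2*π)⁻¹*(((1+κ)^2-1)/2)) = 2*π*κ + π*κ^2 := by field_simp; ring
  rw [e5]
  linarith [mul_pos pi_pos (pow_pos hκ 2)]

open Classical in
lemma lowA1 (h : ℕ) [NeZero h] (κ ε : ℝ) (hκ : 0 < κ) (hκ1 : κ ≤ 1) (hε : 0 < ε) (L : ℝ) (hL : 0 < L) : ∀ᶠ X : ℝ in atTop,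
    ∀ K : ℕ, X/(L*h) ≤ (K:ℝ)+1 →
    (1-ε)*(2*π*(rho h)^2*κ*X^2) ≤ En h K (sg X ((1+κ)*X)) (fun n => ((1:ℝ):ℂ)) := by
  obtain ⟨T, hT⟩ := parseval κ (ε*κ) hκ hκ1 (by positivity)
  have hh1 : (1:ℝ) ≤ h := by exact_mod_cast Nat.pos_of_neZero h
  have hρ := rho_pos h
  set c : ℤ → ℝ := fun k => ‖prim k (1+κ) - prim k 1‖ with hc
  have hlim : Tendsto (fun X : ℝ => ∑ k ∈ T, (1-(|(k:ℝ)| * (L*h))*X⁻¹)*(max 0 (rho h*c k - 30000000*h*X^(-(0.01:ℝ))))^2) atTop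
      (𝓝 (∑ k ∈ T, (1-(|(k:ℝ)| * (L*h))*0)*(max 0 (rho h*c k - 30000000*h*0))^2)) := by
    refine tendsto_finsetSum _ fun k _ => ?_
    refine (tendsto_const_nhds.sub (tendsto_inv_atTop_zero.const_mul _)).mul (Tendsto.pow (tendsto_const_nhds.max
      (tendsto_const_nhds.sub ((tendsto_rpow_neg_atTop (by norm_num)).const_mul _))) 2)
  have hlt : (1-ε)*(2*π*(rho h)^2*κ) < ∑ k ∈ T, (1-(|(k:ℝ)| * (L*h))*0)*(max 0 (rho h*c k - 30000000*h*0))^2 := by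
    have : ∀ k, (1-(|((k:ℤ):ℝ)| * (L*h))*0)*(max 0 (rho h*c k - 30000000*h*0))^2 = (rho h)^2*(c k)^2 := by
      intro k
      have : 0 ≤ rho h*c k := by positivity
      rw [mul_zero, mul_zero, sub_zero, sub_zero, one_mul, max_eq_right this, mul_pow]
    simp only [this]
    rw [← mul_sum]
    have := mul_le_mul_of_nonneg_left hT (by positivity : 0 ≤ (rho h)^2)
    have h2 : 0 < (rho h)^2*(ε*κ) := by positivity
    nlinarith [pi_gt_three]
  filter_upwards [hlim.eventually (lt_mem_nhds hlt), eventually_gt_atTop 0, eventually_ge_atTop (40*h:ℝ),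
    (Finset.eventually_all T).2 fun k _ => eventually_ge_atTop ((|(k:ℝ)|+1)*(L*h)),
    (Finset.eventually_all T).2 fun k _ => ((tendsto_rpow_atTop (by norm_num : (0:ℝ) < 2.6)).comp
      (tendsto_id.atTop_div_const (by positivity : (0:ℝ) < 2*h))).eventually (eventually_ge_atTop |(k:ℝ)|)] with X hX hX0 hX40 hXk hXk' K hK
  have hKk : ∀ k ∈ T, |(k:ℝ)|+1 ≤ (K:ℝ)+1 := fun k hk => le_trans (by rw [le_div_iff₀ (by positivity)]; exact hXk k hk) hK
  have hterm : ∀ k ∈ T, X^2*((1-(|(k:ℝ)| * (L*h))*X⁻¹)*(max 0 (rho h*c k - 30000000*h*X^(-(0.01:ℝ))))^2) ≤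
      wt K k * ‖pol (sg X ((1+κ)*X)) (fun n => ((1:ℝ):ℂ)) ((1, k) : Freq h)‖^2 := by
    intro k hk
    have p := polPr ((1, k) : Freq h) X ((1+κ)*X) hX40 (by nlinarith) (by nlinarith) (hXk' k hk)
    have e1 : prim k ((1+κ)*X) - prim k X = X*ee (k*log X)*(prim k (1+κ) - prim k 1) := by
      simp only [prim]
      rw [log_mul (by positivity) hX0.ne', mul_add, log_one, ee, ee, ee, ee]
      have : ∀ a b : ℝ, Complex.exp ((a+b:ℝ)*I) = Complex.exp (a*I)*Complex.exp (b*I) := by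
        intro a b; rw [← Complex.exp_add]; push_cast; ring_nf
      rw [this]; simp; ring
    have e2 : ‖((rho h:ℝ):ℂ)*(prim k ((1+κ)*X) - prim k X)‖ = rho h*(X*c k) := by
      rw [e1, norm_mul, norm_mul, norm_mul, ee_norm, norm_real, norm_real, norm_of_nonneg hρ.le, norm_of_nonneg hX0.le, mul_one]
    have e3 : pol (sg X ((1+κ)*X)) (fun n => ((1:ℝ):ℂ)) ((1, k) : Freq h) = ∑ n ∈ sg X ((1+κ)*X), ch ((1, k) : Freq h) n := by
      simp [pol]
    have e4 : X^(0.99:ℝ) = X*X^(-(0.01:ℝ)) := by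
      rw [← Real.rpow_one_add' hX0.le (by norm_num)]; norm_num
    simp only [if_true] at p
    have p2 := norm_sub_norm_le (((rho h:ℝ):ℂ)*(prim k ((1+κ)*X) - prim k X)) (∑ n ∈ sg X ((1+κ)*X), ch ((1, k) : Freq h) n)
    rw [norm_sub_rev, e2] at p2
    rw [e3]
    set P := ‖∑ n ∈ sg X ((1+κ)*X), ch ((1, k) : Freq h) n‖
    have p3 : X*max 0 (rho h*c k - 30000000*h*X^(-(0.01:ℝ))) ≤ P := by
      rw [mul_max_of_nonneg _ _ hX0.le, mul_zero]
      refine max_le (norm_nonneg _) ?_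
      have := p2.trans p
      rw [e4] at this
      linarith
    have hw : 1-(|(k:ℝ)| * (L*h))*X⁻¹ ≤ wt K k := by
      rw [wt]
      refine sub_le_sub_left ?_ _
      rw [div_le_iff₀ (by positivity)]
      calc |(k:ℝ)| = |(k:ℝ)| * (L*h)*X⁻¹*(X/(L*h)) := by field_simp
        _ ≤ _ := by gcongr
    have hw0 : 0 ≤ wt K k := by
      rw [wt, sub_nonneg, div_le_one (by positivity)]; linarith [hKk k hk]
    calc _ = (1-(|(k:ℝ)| * (L*h))*X⁻¹)*(X*max 0 (rho h*c k - 30000000*h*X^(-(0.01:ℝ))))^2 := by ring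
      _ ≤ wt K k*(X*max 0 (rho h*c k - 30000000*h*X^(-(0.01:ℝ))))^2 := by gcongr
      _ ≤ _ := by gcongr
  let emb : ℤ ↪ Freq h := ⟨fun k => (1, k), fun a b hab => congrArg Prod.snd hab⟩
  have hsub : T.map emb ⊆ Xi h K := by
    intro ξ hξ
    obtain ⟨k, hk, rfl⟩ := Finset.mem_map.1 hξ
    exact mem_Xi.2 (by linarith [hKk k hk] : |(k:ℝ)| ≤ K)
  calc (1-ε)*(2*π*(rho h)^2*κ*X^2) = X^2*((1-ε)*(2*π*(rho h)^2*κ)) := by ring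
    _ ≤ X^2*∑ k ∈ T, (1-(|(k:ℝ)| * (L*h))*X⁻¹)*(max 0 (rho h*c k - 30000000*h*X^(-(0.01:ℝ))))^2 := by gcongr
    _ ≤ ∑ k ∈ T, wt K k * ‖pol (sg X ((1+κ)*X)) (fun n => ((1:ℝ):ℂ)) ((1, k) : Freq h)‖^2 := by
        rw [mul_sum]; exact sum_le_sum hterm
    _ = ∑ ξ ∈ T.map emb, wt K ξ.2 * ‖pol (sg X ((1+κ)*X)) (fun n => ((1:ℝ):ℂ)) ξ‖^2 := by
        rw [Finset.sum_map]; rfl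
    _ ≤ _ := sum_le_sum_of_subset_of_nonneg hsub fun ξ hξ _ => mul_nonneg (wt_nonneg' hξ) (sq_nonneg _)

lemma lowA2 (ε L : ℝ) (hε : 0 < ε) (hL2 : 2 ≤ L) : ∃ η : ℝ, 0 < η ∧ ∀ (h : ℕ) (_ : NeZero h), ∀ X : ℝ, 1 ≤ X →
    ∀ K : ℕ, ∀ Y : ℝ, X ≤ Y → Y ≤ 2*X → X/(L*h) ≤ (K:ℝ)+1 → (K:ℝ)+1 ≤ 2*X/(L*h) → ((badS h X).card:ℝ) ≤ η*X →
    En h K (sg X Y) (fun n => ((1:ℝ):ℂ)) ≤ En h K (sg X Y) (fun n => (liouville n:ℂ)) + ε*rho h*X^2 := by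
  classical
  have hL0 : 0 < L := by linarith
  set J := ⌈640*L/ε⌉₊+1 with hJ
  have hJ0 : (0:ℝ) < J := by rw [hJ]; positivity
  have hJ1 : 160*2*L/J ≤ ε/2 := by
    have : 640*L/ε ≤ J := by rw [hJ]; push_cast; linarith [Nat.le_ceil (640*L/ε)]
    rw [div_le_iff₀ hε] at this
    rw [div_le_iff₀ hJ0]; linarith
  refine ⟨ε/(16*J^2), by positivity, fun h _ X hX1 K Y hXY hY hK1 hK2 hbad => ?_⟩
  set η := ε/(16*(J:ℝ)^2) with hη
  have hη0 : 0 < η := by rw [hη]; positivity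
  have hη1 : 8*J^2*η/L ≤ ε/2 := by
    have : 8*J^2*η = ε/2 := by rw [hη]; field_simp; norm_num
    rw [this]; exact div_le_self (by positivity) (by linarith)
  have hh1 : (1:ℝ) ≤ h := by exact_mod_cast Nat.pos_of_neZero h
  have hX0 : 0 < X := by linarith
  have hK0 : (0:ℝ) < (K:ℝ)+1 := by positivity
  rw [En_real, En_real]
  have hg : ∀ n ∈ sg X Y, ∀ m ∈ sg X Y, |1 - liouville n*liouville m| ≤ 2 := by
    intro n hn m hm
    refine (abs_sub _ _).trans ?_
    rw [abs_mul, lio_abs, lio_abs]; norm_num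
  have hq := quad_bound h K J (by omega) X Y hX1 hXY hY (fun n m => 1 - liouville n*liouville m) (fun n m => by ring) 2 hg (by norm_num)
  have hj : ∀ j ∈ Icc 1 J, |∑ n ∈ (sg X Y).filter (fun n => n.Coprime h ∧ n+j*h ∈ sg X Y),
      (1 - liouville n*liouville (n+j*h))*fj K (log n - log (n+j*h:ℕ))| ≤ 2*(K+1)*(J*(η*X)) := by
    intro j hj
    have a := lam_diff h K j X Y 1 hX0.le hXY hY (fun _ => 1) (fun n _ => by norm_num) (by norm_num)
    rw [← abs_neg, ← sum_neg_distrib] at a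
    have e : ∀ n, (1 - liouville n*liouville (n+j*h))*fj K (log n - log (n+j*h:ℕ)) =
      -((liouville n*liouville (n+j*h) - 1)*(1*1)*fj K (log n - log (n+j*h:ℕ))) := by
      intro n; ring
    simp only [e]
    refine a.trans ?_
    rw [mem_Icc] at hj
    rw [one_pow, mul_one]; gcongr; exact hj.2
  have hs1 := sum_le_sum hj
  rw [sum_const, Nat.card_Icc, Nat.add_sub_cancel, nsmul_eq_mul] at hs1
  have hs2 : ∑ n ∈ sg X Y, |1 - liouville n*liouville n| = 0 :=
    sum_eq_zero fun n _ => by rw [lio_sq]; norm_num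
  have hinv : 160*2*X^3/((K+1)*(h:ℝ)^2*J) ≤ 160*2*L/J*(X^2/h) := by
    calc _ ≤ 160*2*X^3/(X/(L*h)*(h:ℝ)^2*J) := by
          refine div_le_div_of_nonneg_left (by positivity) (by positivity) (by gcongr)
      _ = _ := by field_simp
  have t2 : 2*(J*(2*((K:ℝ)+1)*(J*(η*X)))) ≤ 8*J^2*η/L*(X^2/h) := by
    calc _ ≤ 2*(J*(2*(2*X/(L*h))*(J*(η*X)))) := by gcongr
      _ = _ := by field_simp; ring
  have hXh : 0 ≤ X^2/h := by positivity
  have m2 := mul_le_mul_of_nonneg_right hη1 hXh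
  have m3 := mul_le_mul_of_nonneg_right hJ1 hXh
  simp only [hs2, mul_zero, zero_add] at hq
  have hS := (le_abs_self _).trans (hq.trans (add_le_add (mul_le_mul_of_nonneg_left hs1 (by norm_num)) hinv))
  have eS : ∀ n m, (if CRel h n m then (1 - liouville n*liouville m)*fj K (log n - log m) else 0) =
      (if CRel h n m then (1:ℝ)*1*fj K (log n - log m) else 0) -
      (if CRel h n m then liouville n*liouville m*fj K (log n - log m) else 0) := by
    intro n m; split_ifs <;> ring
  simp only [eS, sum_sub_distrib] at hS
  rw [← sub_le_iff_le_add', ← mul_sub]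
  calc _ ≤ (h.totient:ℝ)*(ε*(X^2/h)) := by gcongr; linarith
    _ = _ := by unfold rho; ring

open Classical in
lemma bad_lower (j : ℕ) : ∃ η : ℝ, 0 < η ∧ ∀ h : ℕ, 0 < h → primeVol h < j → ∀ᶠ X : ℝ in atTop, η*X < (badS h X).card := by
  obtain ⟨κ, hκd⟩ : ∃ κ, κ = c0/8 := ⟨_, rfl⟩
  have hκ : 0 < κ := by rw [hκd, c0_eq]; norm_num
  have hκ1 : κ ≤ 1 := by rw [hκd, c0_eq]; norm_num
  obtain ⟨ε, hεd⟩ : ∃ ε, ε = κ/8 := ⟨_, rfl⟩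
  have hε : 0 < ε := by rw [hεd]; positivity
  obtain ⟨c, hcd⟩ : ∃ c : ℝ, c = (4:ℝ)^(-(j:ℝ)) := ⟨_, rfl⟩
  have hc : 0 < c := by rw [hcd]; positivity
  obtain ⟨V, L0, hL02, hD2⟩ := D2 c hc
  obtain ⟨b2, hb2⟩ := chain 0.001 (by norm_num) (by norm_num)
  set ε2 := ε*(2*π*c*κ) with hε2
  have hε20 : 0 < ε2 := by positivity
  obtain ⟨b, hb⟩ := (eventually_ge_atTop b2 |>.and ((tendsto_natCast_atTop_atTop (R := ℝ)).eventually
    ((eventually_ge_atTop (64*j:ℝ)).and (eventually_ge_atTop (45000000/ε2+1))))).exists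
  obtain ⟨hbb, hb64, hbε⟩ := hb
  have hb0 : (0:ℝ) < b := by
    have : 0 < 45000000/ε2 := by positivity
    linarith
  have hbε' : 45000000/b ≤ ε2 := by
    rw [div_le_iff₀ hb0]
    have := (div_le_iff₀ hε20).1 (by linarith : 45000000/ε2 ≤ b)
    linarith
  set E := exp (((2:ℝ)^b)^2) with hE
  set L := max L0 (2*E) with hL
  have hL2 : 2 ≤ L := hL02.trans (le_max_left _ _)
  have hL0 : 0 < L := by linarith
  obtain ⟨η1, hη1, H1⟩ := hD2 L (le_max_left _ _)
  obtain ⟨η2, hη2, H2⟩ := lowA2 ε2 L hε20 hL2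
  refine ⟨min η1 η2, lt_min hη1 hη2, fun h hh hvol => ?_⟩
  have : NeZero h := ⟨hh.ne'⟩
  have hρ := rho_pos h
  have hh1 : (1:ℝ) ≤ h := by exact_mod_cast hh
  have hcρ : c ≤ rho h := by
    refine le_trans ?_ (totient_ratio hh)
    rw [hcd]
    exact Real.rpow_le_rpow_of_exponent_le (by norm_num) (by linarith)
  filter_upwards [H1 h this hcρ, hb2 b hbb h this (by linarith) κ hκ hκ1, lowB h (3*V*10^7) κ hκ hκ1 (ε*(2*π*rho h^2*κ)) (by positivity),
    lowA1 h κ ε hκ hκ1 hε L hL0, eventually_ge_atTop (L*h), eventually_ge_atTop 1] with X h1 h2 h3 h4 hXL hX1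
  by_contra hbad
  push Not at hbad
  have hX0 : 0 < X := by linarith
  have hq1 : 1 ≤ X/(L*h) := by rw [le_div_iff₀ (by positivity), one_mul]; exact hXL
  obtain ⟨K, hKd⟩ : ∃ K, K = ⌊X/(L*h)⌋₊ := ⟨_, rfl⟩
  have hK1 : X/(L*h) ≤ (K:ℝ)+1 := by rw [hKd]; exact (Nat.lt_floor_add_one _).le
  have hK2 : (K:ℝ)+1 ≤ 2*X/(L*h) := by
    have := Nat.floor_le (by positivity : 0 ≤ X/(L*h))
    rw [← hKd] at this
    rw [mul_div_assoc]; linarith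
  have hK3 : (K:ℝ)+1 ≤ X*exp (-((2:ℝ)^b)^2)/h := by
    refine hK2.trans ?_
    rw [exp_neg, ← hE]
    calc 2*X/(L*h) ≤ 2*X/(2*E*h) := by gcongr; exact le_max_right _ _
      _ = _ := by field_simp
  obtain ⟨A, hA, hA1, hA2⟩ := h2 K hK3
  have b1 := h1 K hK1 hK2 (hbad.trans (by gcongr; exact min_le_left _ _))
  have b2 := H2 h this X hX1 K ((1+κ)*X) (by nlinarith) (by nlinarith) hK1 hK2 (hbad.trans (by gcongr; exact min_le_right _ _))
  have b4 := h4 K hK1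
  set S := (Xi h K \ A).filter (fun ξ => |(ξ.2:ℝ)| < (3*V*10^7:ℕ)) with hS
  set U := (Xi h K \ A).filter (fun ξ => ¬ |(ξ.2:ℝ)| < (3*V*10^7:ℕ)) with hU
  have b3 := h3 K S ((filter_subset _ _).trans sdiff_subset) (fun ξ hξ => (mem_filter.1 hξ).2)
  have b5 := b1 U ((filter_subset _ _).trans sdiff_subset) (fun ξ hξ => by
      have := not_lt.1 (mem_filter.1 hξ).2
      rw [m0_eq]; push_cast at this ⊢; linarith)
    ((Nat.cast_le.2 (card_filter_le _ _)).trans (hA2.trans (by norm_num)))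
  have hsum : En h K (sg X ((1+κ)*X)) (fun n => (liouville n:ℂ)) =
      (∑ ξ ∈ S, Fw h K X κ ξ + ∑ ξ ∈ U, Fw h K X κ ξ) + ∑ ξ ∈ A, Fw h K X κ ξ := by
    rw [hS, hU, Finset.sum_filter_add_sum_filter_not, sum_sdiff hA]; rfl
  rw [← hκd] at b5
  set Z := 2*π*(rho h)^2*κ*X^2 with hZ
  have hZ0 : 0 < Z := by positivity
  have hε2Z : ε2*rho h*X^2 ≤ ε*Z := by
    rw [hε2, hZ]
    calc _ = ε*(2*π*(c*rho h)*κ*X^2) := by ring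
      _ ≤ ε*(2*π*(rho h*rho h)*κ*X^2) := by gcongr
      _ = _ := by ring
  have hA3 : 45000000/b*rho h*X^2 ≤ ε2*rho h*X^2 := by gcongr
  have hκε : κ = 8*ε := by rw [hεd]; ring
  have hB : ε*(2*π*rho h^2*κ)*X^2 = ε*Z := by rw [hZ]; ring
  have : 0 < ε*Z := by positivity
  have e5 : (1-κ)*Z = Z - 8*(ε*Z) := by rw [hκε]; ring
  rw [e5] at b5
  rw [hB] at b3
  rw [hsum] at b2
  nlinarith

lemma avg_bound (h : ℕ) (η : ℝ) (M : ℕ) (hM : 0 < M) (hb : η*((M:ℝ)/2) < (badS h ((M:ℝ)/2)).card) :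
    (1/(M:ℝ))*∑ n ∈ Icc 1 M, liouville n*liouville (n+h) ≤ 1 - η := by
  classical
  have hM0 : (0:ℝ) < M := by exact_mod_cast hM
  have e : ⌊2*((M:ℝ)/2)⌋₊ = M := by rw [mul_div_cancel₀ _ two_ne_zero, Nat.floor_natCast]
  have hs : ∑ n ∈ Icc 1 M, liouville n*liouville (n+h) ≤ ∑ n ∈ Icc 1 M, (1 - if liouville n ≠ liouville (n+h) then (2:ℝ) else 0) := by
    refine sum_le_sum fun n _ => ?_
    have a : ∀ m, liouville m = 1 ∨ liouville m = -1 := fun m => neg_one_pow_eq_or ℝ _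
    rcases a n with h1 | h1 <;> rcases a (n+h) with h2 | h2 <;> rw [h1, h2] <;> norm_num
  rw [sum_sub_distrib, ← sum_filter, sum_const, sum_const, Nat.card_Icc, nsmul_eq_mul, nsmul_eq_mul] at hs
  rw [badS, e] at hb
  rw [one_div, inv_mul_le_iff₀ hM0]
  have : ((M+1-1:ℕ):ℝ) = M := by simp
  rw [this] at hs
  linarith

lemma lio_avg_mem (h M : ℕ) : (1/(M:ℝ))*∑ n ∈ Icc 1 M, liouville n*liouville (n+h) ∈ Set.Icc (-1:ℝ) 1 := by
  refine abs_le.1 ?_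
  rw [abs_mul, abs_of_nonneg (by positivity)]
  have : |∑ n ∈ Icc 1 M, liouville n*liouville (n+h)| ≤ M := by
    refine (abs_sum_le_sum_abs _ _).trans ?_
    simp [abs_mul, lio_abs]
  calc _ ≤ 1/(M:ℝ)*M := by gcongr
    _ ≤ 1 := by rw [one_div]; exact inv_mul_le_one

/-- along a subsequence of any given sequence, the autocorrelations of the
Liouville function at shifts of bounded prime volume stay bounded away from `1`. -/
theorem liouville_correlations_along_subsequence
    (N : ℕ → ℕ) (hN : StrictMono N) (hpos : ∀ n, 0 < N n) :
    ∃ φ : ℕ → ℕ, StrictMono φ ∧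
      ∀ j : ℕ, 1 ≤ j → ∃ η : ℝ, 0 < η ∧
        ∀ h : ℕ, 0 < h → primeVol h < j →
          ∃ ℓ : ℝ,
            Tendsto (fun k => (1 / (N (φ k) : ℝ)) *
                ∑ n ∈ Finset.Icc 1 (N (φ k)), liouville n * liouville (n + h))
              atTop (𝓝 ℓ) ∧ ℓ < 1 - η := by
  obtain ⟨a, -, φ, hφ, ha⟩ := (isCompact_univ_pi fun _ : ℕ => isCompact_Icc (a := (-1:ℝ)) (b := 1)).tendsto_subseq
    (x := fun k h => (1/(N k:ℝ))*∑ n ∈ Icc 1 (N k), liouville n * liouville (n+h)) (fun k h _ => lio_avg_mem h (N k))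
  refine ⟨φ, hφ, fun j hj => ?_⟩
  obtain ⟨η, hη, H⟩ := bad_lower j
  refine ⟨η/2, by positivity, fun h hh hv => ⟨a h, tendsto_pi_nhds.1 ha h, ?_⟩⟩
  have ht : Tendsto (fun k => (N (φ k):ℝ)/2) atTop atTop :=
    (tendsto_natCast_atTop_atTop.comp (hN.comp hφ).tendsto_atTop).atTop_div_const two_pos
  have := le_of_tendsto (tendsto_pi_nhds.1 ha h) ((ht.eventually (H h hh hv)).mono fun k hk => avg_bound h η _ (hpos _) hk)
  linarith
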